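/- Let G be a field of characteristic 0 and Γ a finitely generated subgroup of G*. Then there is a finite subset S of Γ with 1 ∈ S such that for every solution (x1, x2, x3, y1, y2, y3) ∈ Γ⁶ of the equation (x1 − 1)(x2 − 1)(x3 − 1) = (y1 − 1)(y2 − 1)(y3 − 1), at least one of the following holds: (i) at least one of x1, x2, x3, y1, y2, y3 belongs to S; (ii) there are η1, η2, η3 ∈ {1, −1} such that (y1, y2, y3) is a permutation of (x1^{η1}, x2^{η2}, x3^{η3}); (iii) one of the numbers x_i·x_j, x_i/x_j, y_i·y_j, y_i/y_j (1 ≤ i < j ≤ 3) is equal to −1 or to a primitive cube root of unity. -/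

import Mathlib

set_option linter.all false
namespace UE
open MvPolynomial Finset

/-- weighted l1-norm of a polynomial -/
noncomputable def wnorm {R σ : Type*} [CommRing R] (v : AbsoluteValue R ℝ) (β : σ → ℝ)
    (q : MvPolynomial σ R) : ℝ :=
  ∑ a ∈ q.support, v (q.coeff a) * a.prod fun i k => β i ^ k

section wn
variable {R σ τ : Type*} [CommRing R] (v : AbsoluteValue R ℝ) {β : σ → ℝ}

lemma mprod_nonneg (hβ : ∀ i, 0 ≤ β i) (a : σ →₀ ℕ) : 0 ≤ a.prod fun i k => β i ^ k :=
  Finset.prod_nonneg fun i _ => pow_nonneg (hβ i) _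

lemma wnorm_eq_of_subset (q : MvPolynomial σ R) (s : Finset (σ →₀ ℕ)) (h : q.support ⊆ s) :
    wnorm v β q = ∑ a ∈ s, v (q.coeff a) * a.prod fun i k => β i ^ k := by
  refine Finset.sum_subset h ?_
  intro a _ ha
  rw [MvPolynomial.notMem_support_iff.mp ha]; simp

lemma wnorm_nonneg (hβ : ∀ i, 0 ≤ β i) (q : MvPolynomial σ R) : 0 ≤ wnorm v β q :=
  Finset.sum_nonneg fun a _ => mul_nonneg (v.nonneg _) (mprod_nonneg hβ a)

lemma wnorm_zero : wnorm v β (0 : MvPolynomial σ R) = 0 := by simp [wnorm]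

lemma wnorm_monomial (a : σ →₀ ℕ) (c : R) :
    wnorm v β (monomial a c) = v c * a.prod fun i k => β i ^ k := by
  classical
  rw [wnorm_eq_of_subset v _ {a} MvPolynomial.support_monomial_subset]
  simp

lemma wnorm_C (c : R) : wnorm v β (C c : MvPolynomial σ R) = v c := by
  have := wnorm_monomial (β := β) v 0 c
  simpa using this

lemma wnorm_X [Nontrivial R] [IsDomain R] (i : σ) : wnorm v β (X i : MvPolynomial σ R) = β i := by
  have := wnorm_monomial (β := β) v (Finsupp.single i 1) (1 : R)
  rw [X, this]; simp

lemma wnorm_add_le (hβ : ∀ i, 0 ≤ β i) (p q : MvPolynomial σ R) :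
    wnorm v β (p + q) ≤ wnorm v β p + wnorm v β q := by
  classical
  rw [wnorm_eq_of_subset v (p + q) (p.support ∪ q.support) MvPolynomial.support_add,
    wnorm_eq_of_subset v p (p.support ∪ q.support) subset_union_left,
    wnorm_eq_of_subset v q (p.support ∪ q.support) subset_union_right, ← Finset.sum_add_distrib]
  refine Finset.sum_le_sum fun a _ => ?_
  rw [← add_mul, coeff_add]
  exact mul_le_mul_of_nonneg_right (v.add_le _ _) (mprod_nonneg hβ a)

lemma wnorm_sum_le (hβ : ∀ i, 0 ≤ β i) {κ : Type*} (s : Finset κ) (f : κ → MvPolynomial σ R) :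
    wnorm v β (∑ k ∈ s, f k) ≤ ∑ k ∈ s, wnorm v β (f k) := by
  classical
  induction s using Finset.induction_on with
  | empty => simp [wnorm_zero]
  | insert a s ha ih =>
    rw [sum_insert ha, sum_insert ha]
    exact (wnorm_add_le v hβ _ _).trans (by gcongr)

lemma wnorm_mul_le (hβ : ∀ i, 0 ≤ β i) (p q : MvPolynomial σ R) :
    wnorm v β (p * q) ≤ wnorm v β p * wnorm v β q := by
  classical
  have h1 : p * q = ∑ a ∈ p.support, ∑ b ∈ q.support,
      monomial (a + b) (p.coeff a * q.coeff b) := by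
    conv_lhs => rw [← p.support_sum_monomial_coeff, ← q.support_sum_monomial_coeff]
    rw [Finset.sum_mul_sum]
    simp [monomial_mul]
  rw [h1]
  refine (wnorm_sum_le v hβ _ _).trans ?_
  have h2 : wnorm v β p * wnorm v β q = ∑ a ∈ p.support, ∑ b ∈ q.support,
      wnorm v β (monomial (a + b) (p.coeff a * q.coeff b)) := by
    conv_lhs => rw [wnorm, wnorm, Finset.sum_mul_sum]
    refine sum_congr rfl fun a _ => sum_congr rfl fun b _ => ?_
    rw [wnorm_monomial, map_mul, Finsupp.prod_add_index' (by simp) (by intros; rw [pow_add])]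
    ring
  rw [h2]
  exact sum_le_sum fun a _ => wnorm_sum_le v hβ _ _

lemma wnorm_one_le [Nontrivial R] [IsDomain R] : wnorm v β (1 : MvPolynomial σ R) ≤ 1 := by
  have := wnorm_C (β := β) v (1 : R)
  rw [map_one] at this
  rw [this]; simp

lemma wnorm_pow_le [Nontrivial R] [IsDomain R] (hβ : ∀ i, 0 ≤ β i) (p : MvPolynomial σ R) (n : ℕ) :
    wnorm v β (p ^ n) ≤ wnorm v β p ^ n := by
  induction n with
  | zero => simpa using wnorm_one_le v
  | succ n ih =>
    rw [pow_succ, pow_succ]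
    exact (wnorm_mul_le v hβ _ _).trans
      (mul_le_mul_of_nonneg_right ih (wnorm_nonneg v hβ p))

lemma wnorm_prod_le [Nontrivial R] [IsDomain R] (hβ : ∀ i, 0 ≤ β i) {κ : Type*} (s : Finset κ)
    (f : κ → MvPolynomial σ R) :
    wnorm v β (∏ k ∈ s, f k) ≤ ∏ k ∈ s, wnorm v β (f k) := by
  classical
  induction s using Finset.induction_on with
  | empty => simpa using wnorm_one_le v
  | insert a s ha ih =>
    rw [prod_insert ha, prod_insert ha]
    exact (wnorm_mul_le v hβ _ _).trans
      (mul_le_mul_of_nonneg_left ih (wnorm_nonneg v hβ _))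

lemma wnorm_C_mul_le (hβ : ∀ i, 0 ≤ β i) (c : R) (p : MvPolynomial σ R) :
    wnorm v β (C c * p) ≤ v c * wnorm v β p := by
  have := wnorm_mul_le v hβ (C c) p
  rwa [wnorm_C] at this

lemma wnorm_aeval_le [Nontrivial R] [IsDomain R] {β : τ → ℝ} (hβ : ∀ i, 0 ≤ β i)
    (f : σ → MvPolynomial τ R) (P : MvPolynomial σ R) :
    wnorm v β (aeval f P) ≤ wnorm v (fun i => wnorm v β (f i)) P := by
  classical
  rw [aeval_def, eval₂_eq]
  refine (wnorm_sum_le v hβ _ _).trans (sum_le_sum fun a _ => ?_)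
  refine (wnorm_C_mul_le v hβ _ _).trans (mul_le_mul_of_nonneg_left ?_ (v.nonneg _))
  refine (wnorm_prod_le v hβ _ _).trans ?_
  exact Finset.prod_le_prod (fun i _ => wnorm_nonneg v hβ _) fun i _ => wnorm_pow_le v hβ _ _

lemma coeff_le_wnorm (hβ : ∀ i, 0 ≤ β i) (q : MvPolynomial σ R) (a : σ →₀ ℕ) :
    v (q.coeff a) * (a.prod fun i k => β i ^ k) ≤ wnorm v β q := by
  by_cases ha : a ∈ q.support
  · exact Finset.single_le_sum (f := fun a => v (q.coeff a) * a.prod fun i k => β i ^ k)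
      (fun a _ => mul_nonneg (v.nonneg _) (mprod_nonneg hβ a)) ha
  · rw [MvPolynomial.notMem_support_iff.mp ha]; simpa using wnorm_nonneg v hβ q

lemma wnorm_mono {β γ : σ → ℝ} (hβ : ∀ i, 0 ≤ β i) (h : ∀ i, β i ≤ γ i) (q : MvPolynomial σ R) :
    wnorm v β q ≤ wnorm v γ q := by
  refine sum_le_sum fun a _ => mul_le_mul_of_nonneg_left ?_ (v.nonneg _)
  exact Finset.prod_le_prod (fun i _ => pow_nonneg (hβ i) _)
    fun i _ => pow_le_pow_left₀ (hβ i) (h i) _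

end wn

/-- the usual absolute value on the integers, with real values -/
noncomputable def zabs : AbsoluteValue ℤ ℝ :=
  (AbsoluteValue.abs (S := ℝ)).comp (f := Int.castRingHom ℝ) Int.cast_injective

@[simp] lemma zabs_apply (n : ℤ) : zabs n = |(n : ℝ)| := rfl

/-- l1 norm of an integer polynomial -/
noncomputable def l1 {σ : Type*} (q : MvPolynomial σ ℤ) : ℝ := wnorm zabs (fun _ => 1) q

lemma l1_def {σ : Type*} (q : MvPolynomial σ ℤ) : l1 q = ∑ a ∈ q.support, |((q.coeff a : ℤ) : ℝ)| := by
  simp [l1, wnorm, Finsupp.prod]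

lemma one_le_l1 {σ : Type*} {q : MvPolynomial σ ℤ} (h : q ≠ 0) : 1 ≤ l1 q := by
  rw [l1_def]
  obtain ⟨a, ha⟩ := MvPolynomial.support_nonempty.mpr h
  refine le_trans ?_ (Finset.single_le_sum (f := fun a => |((q.coeff a : ℤ) : ℝ)|)
    (fun a _ => abs_nonneg _) ha)
  have := MvPolynomial.mem_support_iff.mp ha
  exact_mod_cast Int.one_le_abs this

end UE

set_option linter.all false
namespace UE
open MvPolynomial Finset

section hasse
variable {R σ : Type*} [CommRing R] [Fintype σ]

/-- multi-binomial coefficient -/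
def mb (a μ : σ →₀ ℕ) : ℕ := ∏ h, (a h).choose (μ h)

lemma mb_eq_zero {a μ : σ →₀ ℕ} (h : ¬ μ ≤ a) : mb a μ = 0 := by
  classical
  rw [Finsupp.le_def] at h; push Not at h
  obtain ⟨i, hi⟩ := h
  exact Finset.prod_eq_zero (mem_univ i) (Nat.choose_eq_zero_of_lt hi)

lemma mb_mul (a μ c : σ →₀ ℕ) : mb a μ * mb (a - μ) c = mb (c + μ) μ * mb a (c + μ) := by
  unfold mb
  rw [← prod_mul_distrib, ← prod_mul_distrib]
  refine prod_congr rfl fun h _ => ?_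
  simp only [Finsupp.coe_add, Pi.add_apply, Finsupp.coe_tsub, Pi.sub_apply]
  by_cases hle : c h + μ h ≤ a h
  · have := Nat.choose_mul (n := a h) (k := c h + μ h) (s := μ h) 
    simp at this
    rw [← this]; ring
  · rw [Nat.choose_eq_zero_of_lt (show a h < c h + μ h by omega)]
    by_cases h2 : a h < μ h
    · rw [Nat.choose_eq_zero_of_lt h2]; simp
    · rw [Nat.choose_eq_zero_of_lt (show a h - μ h < c h by omega)]; simp

lemma mb_le (a μ : σ →₀ ℕ) : (mb a μ : ℝ) ≤ ∏ h, (2:ℝ) ^ (a h) := by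
  unfold mb
  push_cast
  refine prod_le_prod (fun _ _ => by positivity) fun h _ => ?_
  exact_mod_cast Nat.choose_le_two_pow (a h) (μ h)

/-- Hasse derivative -/
noncomputable def D (μ : σ →₀ ℕ) : MvPolynomial σ R →ₗ[R] MvPolynomial σ R :=
  (basisMonomials σ R).constr R fun a => monomial (a - μ) (mb a μ : R)

lemma D_monomial (μ a : σ →₀ ℕ) (c : R) :
    D μ (monomial a c) = monomial (a - μ) (c * (mb a μ : R)) := by
  have h : (monomial a c : MvPolynomial σ R) = c • basisMonomials σ R a := by
    simp [smul_monomial]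
  rw [h, map_smul, D, Module.Basis.constr_basis, smul_monomial, smul_eq_mul]

lemma coeff_D (μ c : σ →₀ ℕ) (q : MvPolynomial σ R) :
    coeff c (D μ q) = (mb (c + μ) μ : R) * coeff (c + μ) q := by
  classical
  induction q using MvPolynomial.induction_on' with
  | monomial a x =>
    rw [D_monomial, coeff_monomial, coeff_monomial]
    by_cases h : a = c + μ
    · subst h; simp [mul_comm]
    · rw [if_neg h]
      split_ifs with h2
      · have : ¬ μ ≤ a := fun hle => h (by rw [← h2, tsub_add_cancel_of_le hle])
        rw [mb_eq_zero this]; simp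
      · simp
  | add p q hp hq => rw [map_add, coeff_add, coeff_add, hp, hq]; ring

lemma coeff_prod_univ (q : σ → Polynomial R) (c : σ →₀ ℕ) :
    coeff c (∏ h, Polynomial.aeval (X h : MvPolynomial σ R) (q h)) = ∏ h, (q h).coeff (c h) := by
  classical
  have h1 : ∀ h, Polynomial.aeval (X h : MvPolynomial σ R) (q h) =
      ∑ k ∈ range ((q h).natDegree + 1 + c h), C ((q h).coeff k) * X h ^ k := by
    intro h
    rw [Polynomial.aeval_eq_sum_range' (n := (q h).natDegree + 1 + c h) (by omega)]
    simp [MvPolynomial.smul_eq_C_mul]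
  simp_rw [h1]
  rw [Finset.prod_univ_sum, coeff_sum]
  rw [Finset.sum_eq_single (c : σ → ℕ)]
  · rw [prod_mul_distrib, ← map_prod, coeff_C_mul]
    have : (∏ h, (X h : MvPolynomial σ R) ^ c h) = monomial c 1 := by
      rw [monomial_eq, Finsupp.prod_fintype _ _ (by simp)]; simp
    rw [this]; simp
  · intro b _ hb
    rw [prod_mul_distrib, ← map_prod, coeff_C_mul]
    have : (∏ h, (X h : MvPolynomial σ R) ^ b h) = monomial (Finsupp.equivFunOnFinite.symm b) 1 := by
      rw [monomial_eq, Finsupp.prod_fintype _ _ (by simp)]; simp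
    rw [this, coeff_monomial, if_neg, mul_zero]
    rintro rfl
    exact hb (by simp)
  · intro h
    exact absurd (Fintype.mem_piFinset.mpr fun h => by simp) h

/-- translation -/
noncomputable def shift {K : Type*} [CommRing K] [Algebra R K] (ζ : σ → K) :
    MvPolynomial σ R →ₐ[R] MvPolynomial σ K := aeval fun h => X h + C (ζ h)

variable {K : Type*} [CommRing K] [Algebra R K]

lemma coeff_shift_monomial (ζ : σ → K) (a c : σ →₀ ℕ) (x : R) :
    coeff c (shift ζ (monomial a x)) =
      algebraMap R K x * ((mb a c : K) * ∏ h, ζ h ^ (a h - c h)) := by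
  rw [shift, aeval_monomial, IsScalarTower.algebraMap_apply R K (MvPolynomial σ K),
    MvPolynomial.algebraMap_eq, coeff_C_mul, Finsupp.prod_fintype _ _ (by simp)]
  have := coeff_prod_univ (fun h => ((Polynomial.X + Polynomial.C (ζ h)) ^ (a h))) c
  simp only [map_pow, map_add, Polynomial.aeval_X, Polynomial.aeval_C,
    Polynomial.coeff_X_add_C_pow, MvPolynomial.algebraMap_eq] at this
  rw [this, prod_mul_distrib, mb]
  push_cast
  ring

lemma shift_D (ζ : σ → K) (μ : σ →₀ ℕ) (p : MvPolynomial σ R) :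
    shift ζ (D μ p) = D μ (shift ζ p) := by
  induction p using MvPolynomial.induction_on' with
  | monomial a x =>
    ext c
    rw [coeff_D, D_monomial, coeff_shift_monomial, coeff_shift_monomial]
    have h := congrArg (Nat.cast (R := K)) (mb_mul a μ c)
    push_cast at h
    simp only [Finsupp.coe_add, Pi.add_apply, Finsupp.coe_tsub, Pi.sub_apply, map_mul, map_natCast]
    have e : ∀ h, a h - μ h - c h = a h - (c h + μ h) := fun h => by omega
    simp_rw [e]
    linear_combination (algebraMap R K x * ∏ h, ζ h ^ (a h - (c h + μ h))) * h
  | add p q hp hq => rw [map_add, map_add, map_add, map_add, hp, hq]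

end hasse
end UE

set_option linter.all false
namespace UE
open Finset

section uni
open Polynomial
/-- Euler operator -/
noncomputable def eul : Module.End ℚ ℚ[X] := LinearMap.mulLeft ℚ X ∘ₗ derivative

lemma coeff_eul_pow (i : ℕ) (F : ℚ[X]) (d : ℕ) : ((eul ^ i) F).coeff d = (d:ℚ) ^ i * F.coeff d := by
  induction i generalizing F with
  | zero => simp
  | succ i ih =>
    rw [pow_succ, Module.End.mul_apply, ih]
    have : (eul F).coeff d = d * F.coeff d := by
      simp only [eul, LinearMap.comp_apply, LinearMap.mulLeft_apply]
      cases d with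
      | zero => simp
      | succ d => rw [coeff_X_mul, coeff_derivative]; push_cast; ring
    rw [this]; ring

lemma natDegree_eul_pow (i : ℕ) (F : ℚ[X]) : ((eul ^ i) F).natDegree ≤ F.natDegree := by
  rw [natDegree_le_iff_coeff_eq_zero]
  intro d hd
  rw [coeff_eul_pow, coeff_eq_zero_of_natDegree_lt hd, mul_zero]

lemma coeff_prod_top {κ : Type*} (s : Finset κ) (q : κ → ℚ[X]) (d : κ → ℕ)
    (h : ∀ k ∈ s, (q k).natDegree ≤ d k) :
    (∏ k ∈ s, q k).natDegree ≤ ∑ k ∈ s, d k ∧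
    (∏ k ∈ s, q k).coeff (∑ k ∈ s, d k) = ∏ k ∈ s, (q k).coeff (d k) := by
  classical
  induction s using Finset.induction_on with
  | empty => simp
  | insert a s ha ih =>
    obtain ⟨h1, h2⟩ := ih fun k hk => h k (mem_insert_of_mem hk)
    rw [prod_insert ha, sum_insert ha, prod_insert ha]
    exact ⟨natDegree_mul_le_of_le (h a (mem_insert_self _ _)) h1,
      by rw [coeff_mul_add_eq_of_natDegree_le (h a (mem_insert_self _ _)) h1, h2]⟩

lemma det_eul_of_distinct {k : ℕ} (G : Fin k → ℚ[X]) (h0 : ∀ j, G j ≠ 0)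
    (hd : Function.Injective fun j => (G j).natDegree) :
    (Matrix.of fun i j : Fin k => (eul ^ (i:ℕ)) (G j)).det ≠ 0 := by
  intro h
  have h1 := congrArg (fun q : ℚ[X] => q.coeff (∑ j, (G j).natDegree)) h
  simp only [Matrix.det_apply, finset_sum_coeff, coeff_zero] at h1
  have h2 : ∀ π : Equiv.Perm (Fin k),
      (Equiv.Perm.sign π • ∏ j, Matrix.of (fun i j : Fin k => (eul ^ (i:ℕ)) (G j)) (π j) j).coeff
        (∑ j, (G j).natDegree) = Equiv.Perm.sign π • ∏ j,
          Matrix.of (fun i j : Fin k => ((G j).natDegree : ℚ) ^ (i:ℕ) * (G j).leadingCoeff) (π j) j := by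
    intro π
    rw [coeff_smul]
    congr 1
    refine ((coeff_prod_top univ _ (fun j => (G j).natDegree) fun j _ => natDegree_eul_pow _ _).2).trans ?_
    refine prod_congr rfl fun j _ => ?_
    simp only [Matrix.of_apply, coeff_eul_pow]; rfl
  simp_rw [h2] at h1
  rw [← Matrix.det_apply] at h1
  have h3 : (Matrix.of (fun i j : Fin k => ((G j).natDegree : ℚ) ^ (i:ℕ) * (G j).leadingCoeff))
      = (Matrix.vandermonde fun j => ((G j).natDegree : ℚ)).transpose *
        Matrix.diagonal fun j => (G j).leadingCoeff := by
    ext i j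
    simp [Matrix.mul_diagonal, Matrix.vandermonde_apply]
  rw [h3, Matrix.det_mul, Matrix.det_transpose, Matrix.det_diagonal] at h1
  rcases mul_eq_zero.mp h1 with h4 | h4
  · refine Matrix.det_vandermonde_ne_zero_iff.mpr ?_ h4
    intro a b hab
    exact hd (by simpa using hab)
  · obtain ⟨j, _, hj⟩ := Finset.prod_eq_zero_iff.mp h4
    exact h0 j (leadingCoeff_eq_zero.mp hj)

lemma det_eul_ne_zero {k : ℕ} (F : Fin k → ℚ[X]) (hF : LinearIndependent ℚ F) :
    (Matrix.of fun i j : Fin k => (eul ^ (i:ℕ)) (F j)).det ≠ 0 := by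
  classical
  let g : Matrix (Fin k) (Fin k) ℚ → Fin k → ℚ[X] := fun M j => ∑ i, M i j • F i
  let S : Set (Matrix (Fin k) (Fin k) ℚ) := {M | M.det ≠ 0}
  have hS : S.Nonempty := ⟨1, by simp [S]⟩
  obtain ⟨M, hM, hmin⟩ := WellFounded.has_min
    (measure (fun M : Matrix (Fin k) (Fin k) ℚ => ∑ j, (g M j).natDegree)).wf S hS
  have hM' : M.det ≠ 0 := hM
  have hg0 : ∀ N : Matrix (Fin k) (Fin k) ℚ, N.det ≠ 0 → ∀ j, g N j ≠ 0 := by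
    intro N hN j h
    apply hN
    apply Matrix.det_eq_zero_of_column_eq_zero j
    intro i
    exact Fintype.linearIndependent_iff.mp hF (fun i => N i j) h i
  have hinj : Function.Injective fun j => (g M j).natDegree := by
    intro a b hab
    by_contra hne
    have hab : (g M a).natDegree = (g M b).natDegree := hab
    let c : ℚ := (g M a).leadingCoeff / (g M b).leadingCoeff
    have hb0 : (g M b).leadingCoeff ≠ 0 := leadingCoeff_ne_zero.mpr (hg0 M hM' b)
    let N := M.updateCol a (fun i => M i a + (-c) * M i b)
    have hN : N.det ≠ 0 := by
      have := Matrix.det_updateCol_add_smul_self M hne (-c)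
      simp only [smul_eq_mul] at this
      show (M.updateCol a _).det ≠ 0
      rw [this]; exact hM'
    have h1 : g N a = g M a - C c * g M b := by
      simp only [g, N, Matrix.updateCol_self, add_smul, sum_add_distrib, mul_smul,
        neg_smul, sum_neg_distrib]
      rw [← Finset.smul_sum, sub_eq_add_neg, C_mul']
    have h2 : ∀ j, j ≠ a → g N j = g M j := by
      intro j hj
      simp [g, N, Matrix.updateCol_ne hj]
    have h3 : (g N a).natDegree < (g M a).natDegree := by
      rw [h1]
      rw [natDegree_lt_iff_degree_lt (by rw [← h1]; exact hg0 N hN a)]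
      have hc0 : c ≠ 0 := div_ne_zero (leadingCoeff_ne_zero.mpr (hg0 M hM' a)) hb0
      have := degree_sub_lt (p := g M a) (q := C c * g M b) ?_ (hg0 M hM' a) ?_
      · rwa [degree_eq_natDegree (hg0 M hM' a)] at this
      · rw [degree_C_mul hc0, degree_eq_natDegree (hg0 M hM' a),
          degree_eq_natDegree (hg0 M hM' b), hab]
      · rw [leadingCoeff_mul, leadingCoeff_C]; simp [c, hb0]
    apply hmin N hN
    show ∑ j, (g N j).natDegree < ∑ j, (g M j).natDegree
    refine Finset.sum_lt_sum (fun j _ => ?_) ⟨a, mem_univ _, h3⟩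
    by_cases hj : j = a
    · subst hj; exact h3.le
    · rw [h2 j hj]
  have hdet := det_eul_of_distinct (g M) (hg0 M hM') hinj
  have hfac : (Matrix.of fun i j : Fin k => (eul ^ (i:ℕ)) (g M j)) =
      (Matrix.of fun i j : Fin k => (eul ^ (i:ℕ)) (F j)) * M.map C := by
    ext1 i j
    simp only [Matrix.of_apply, Matrix.mul_apply, Matrix.map_apply, g, map_sum, map_smul]
    refine sum_congr rfl fun l _ => ?_
    rw [mul_comm, C_mul']
  rw [hfac, Matrix.det_mul] at hdet
  exact left_ne_zero_of_mul hdet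

end uni
end UE

set_option linter.all false
namespace UE
open Finset MvPolynomial

section wr
variable {σ : Type*} [Fintype σ]

/-- linear weight of an exponent -/
def lam (l : σ → ℕ) (a : σ →₀ ℕ) : ℕ := ∑ h, l h * a h

lemma exists_lam_injOn (S : Finset (σ →₀ ℕ)) : ∃ l : σ → ℕ, Set.InjOn (lam l) S := by
  classical
  let q : (σ →₀ ℕ) × (σ →₀ ℕ) → MvPolynomial σ ℚ :=
    fun ab => ∑ h, C ((ab.1 h : ℚ) - ab.2 h) * X h
  have hq : ∀ ab ∈ S.offDiag, q ab ≠ 0 := by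
    rintro ⟨a, b⟩ hab h0
    rw [mem_offDiag] at hab
    apply hab.2.2
    ext h
    have := congrArg (eval (Pi.single h (1:ℚ))) h0
    simp [q, Pi.single_apply] at this
    have h3 : (a h : ℚ) = b h := by linarith
    exact_mod_cast h3
  have hP : ∏ ab ∈ S.offDiag, q ab ≠ 0 := Finset.prod_ne_zero_iff.mpr hq
  have : ∃ l : σ → ℕ, eval (fun h => (l h : ℚ)) (∏ ab ∈ S.offDiag, q ab) ≠ 0 := by
    by_contra hcon
    push Not at hcon
    apply hP
    refine MvPolynomial.funext_set (s := fun _ => Set.range (Nat.cast : ℕ → ℚ)) 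
      (fun _ => Set.infinite_range_of_injective Nat.cast_injective) ?_
    intro x hx
    choose l hl using fun h => hx h (Set.mem_univ h)
    have := hcon l
    rw [map_zero]
    convert this using 2
    congr 1
    funext h; exact (hl h).symm
  obtain ⟨l, hl⟩ := this
  refine ⟨l, ?_⟩
  intro a ha b hb hab
  by_contra hne
  rw [map_prod] at hl
  apply Finset.prod_ne_zero_iff.mp hl (a, b) (mem_offDiag.mpr ⟨ha, hb, hne⟩)
  have h1 : (lam l a : ℚ) = lam l b := by rw [hab]
  simp only [lam] at h1
  push_cast at h1
  simp only [q, map_sum, map_mul, eval_C, eval_X, sub_mul, sum_sub_distrib]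
  simp_rw [mul_comm]
  linarith

lemma mul_mb (a μ : σ →₀ ℕ) (h : σ) :
    a h * mb a μ = (μ h + 1) * mb a (μ + Finsupp.single h 1) + μ h * mb a μ := by
  classical
  unfold mb
  rw [← Finset.mul_prod_erase univ _ (mem_univ h), ← Finset.mul_prod_erase univ _ (mem_univ h)]
  have : ∏ x ∈ univ.erase h, (a x).choose ((μ + Finsupp.single h 1 : σ →₀ ℕ) x) =
      ∏ x ∈ univ.erase h, (a x).choose (μ x) := by
    refine prod_congr rfl fun x hx => ?_
    have : x ≠ h := ne_of_mem_erase hx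
    simp [Finsupp.single_apply, this.symm]
  rw [this]
  simp only [Finsupp.coe_add, Pi.add_apply, Finsupp.single_eq_same]
  have h2 := Nat.choose_succ_right_eq (a h) (μ h)
  have h3 : a h * (a h).choose (μ h) =
      (μ h + 1) * (a h).choose (μ h + 1) + μ h * (a h).choose (μ h) := by
    rw [mul_comm (μ h + 1), h2]
    by_cases hle : μ h ≤ a h
    · obtain ⟨t, ht⟩ := Nat.exists_eq_add_of_le hle
      have : a h - μ h = t := by omega
      rw [this]; nlinarith
    · rw [Nat.choose_eq_zero_of_lt (by omega)]; simp
  calc _ = (a h * (a h).choose (μ h)) * ∏ x ∈ univ.erase h, (a x).choose (μ x) := by ring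
    _ = _ := by rw [h3]; ring

lemma lam_pow_expand (l : σ → ℕ) (i : ℕ) : ∃ c : (σ →₀ ℕ) →₀ ℚ,
    (∀ μ ∈ c.support, μ.degree ≤ i) ∧
    ∀ a, (lam l a : ℚ) ^ i = c.sum fun μ x => x * (mb a μ : ℚ) := by
  classical
  induction i with
  | zero =>
    refine ⟨Finsupp.single 0 1, ?_, ?_⟩
    · intro μ hμ
      have := Finsupp.support_single_subset hμ
      simp at this; simp [this]
    · intro a; simp [mb]
  | succ i ih =>
    obtain ⟨c, hc, h⟩ := ih
    refine ⟨c.sum fun μ x => ∑ h, (Finsupp.single (μ + Finsupp.single h 1) (x * l h * (μ h + 1))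
      + Finsupp.single μ (x * l h * μ h)), ?_, ?_⟩
    · intro μ hμ
      obtain ⟨ν, hν, hμ⟩ := Finset.mem_biUnion.mp (Finsupp.support_finset_sum hμ)
      obtain ⟨h, _, hμ⟩ := Finset.mem_biUnion.mp (Finsupp.support_finset_sum hμ)
      have hd := hc ν hν
      rcases Finset.mem_union.mp (Finsupp.support_add hμ) with hh | hh
      · have := Finsupp.support_single_subset hh
        rw [mem_singleton] at this
        rw [this, map_add, Finsupp.degree_single]; omega
      · have := Finsupp.support_single_subset hh
        rw [mem_singleton] at this
        rw [this]; omega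
    · intro a
      rw [pow_succ, h, Finsupp.sum_sum_index (by simp) (by intros; ring), Finsupp.sum,
        Finset.sum_mul]
      refine sum_congr rfl fun μ _ => ?_
      beta_reduce
      rw [← Finsupp.sum_finset_sum_index (by simp) (by intros; ring)]
      simp only [lam]
      push_cast
      rw [Finset.mul_sum]
      refine sum_congr rfl fun h _ => ?_
      rw [Finsupp.sum_add_index' (by simp) (by intros; ring), Finsupp.sum_single_index (by simp),
        Finsupp.sum_single_index (by simp)]
      have := congrArg (Nat.cast (R := ℚ)) (mul_mb a μ h)
      push_cast at this
      linear_combination (c μ * l h) * this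

/-- substitution X_h -> X^{l_h} -/
noncomputable def kro (l : σ → ℕ) : MvPolynomial σ ℚ →ₐ[ℚ] Polynomial ℚ :=
  aeval fun h => Polynomial.X ^ l h

lemma kro_monomial (l : σ → ℕ) (a : σ →₀ ℕ) (c : ℚ) :
    kro l (monomial a c) = Polynomial.monomial (lam l a) c := by
  rw [kro, aeval_monomial, Finsupp.prod_fintype _ _ (by simp), ← Polynomial.C_mul_X_pow_eq_monomial]
  simp only [← pow_mul, Finset.prod_pow_eq_pow_sum]
  rfl

lemma kro_injOn (l : σ → ℕ) (S : Finset (σ →₀ ℕ)) (hl : Set.InjOn (lam l) S)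
    (q : MvPolynomial σ ℚ) (hq : q.support ⊆ S) (h0 : kro l q = 0) : q = 0 := by
  classical
  ext a
  by_cases ha : a ∈ q.support
  · have h1 : kro l q = ∑ b ∈ q.support, Polynomial.monomial (lam l b) (q.coeff b) := by
      conv_lhs => rw [← q.support_sum_monomial_coeff]
      rw [map_sum]
      simp [kro_monomial]
    have h2 := congrArg (fun F : Polynomial ℚ => F.coeff (lam l a)) (h1.symm.trans h0)
    simp only [Polynomial.finset_sum_coeff, Polynomial.coeff_monomial, Polynomial.coeff_zero] at h2
    rw [Finset.sum_eq_single a] at h2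
    · simpa using h2
    · intro b hb hba
      rw [if_neg]
      exact fun h => hba (hl (hq hb) (hq ha) h)
    · exact fun h => absurd ha h
  · simpa using ha

theorem gen_wronskian {k : ℕ} (f : Fin k → MvPolynomial σ ℚ) (hf : LinearIndependent ℚ f) :
    ∃ μ : Fin k → (σ →₀ ℕ), (∀ i, (μ i).degree ≤ i) ∧
      (Matrix.of fun i j => D (μ i) (f j)).det ≠ 0 := by
  classical
  let S := univ.biUnion fun j => (f j).support
  obtain ⟨l, hl⟩ := exists_lam_injOn S
  have hind : LinearIndependent ℚ fun j => kro l (f j) := by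
    rw [Fintype.linearIndependent_iff] at hf ⊢
    intro g hg
    apply hf g
    apply kro_injOn l S hl
    · intro a ha
      obtain ⟨j, _, hj⟩ := Finset.mem_biUnion.mp (MvPolynomial.support_sum ha)
      exact Finset.mem_biUnion.mpr ⟨j, mem_univ _, MvPolynomial.support_smul hj⟩
    · rw [map_sum, ← hg]; simp
  have hdet := det_eul_ne_zero _ hind
  choose c hc hexp using lam_pow_expand l
  let Th : ℕ → MvPolynomial σ ℚ → MvPolynomial σ ℚ := fun i q =>
    ∑ μ ∈ (c i).support, monomial μ (c i μ) * D μ q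
  have hTh : ∀ i q, kro l (Th i q) = (eul ^ i) (kro l q) := by
    intro i q
    induction q using MvPolynomial.induction_on' with
    | monomial a x =>
      simp only [Th, D_monomial, monomial_mul, map_sum, kro_monomial]
      ext d
      rw [coeff_eul_pow, Polynomial.finset_sum_coeff, Polynomial.coeff_monomial]
      have : ∀ μ ∈ (c i).support, (Polynomial.monomial (lam l (μ + (a - μ)))
          (c i μ * (x * (mb a μ : ℚ)))).coeff d =
          if lam l a = d then x * (c i μ * (mb a μ : ℚ)) else 0 := by
        intro μ _
        by_cases hle : μ ≤ a
        · rw [add_tsub_cancel_of_le hle, Polynomial.coeff_monomial]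
          split_ifs <;> ring
        · rw [mb_eq_zero hle]; simp
      rw [sum_congr rfl this]
      split_ifs with hd
      · rw [← Finset.mul_sum, ← hd, hexp i a, mul_comm]; rfl
      · simp
    | add p q hp hq =>
      have : Th i (p + q) = Th i p + Th i q := by
        simp [Th, mul_add, sum_add_distrib]
      rw [this, map_add, map_add, map_add, hp, hq]
  have hdet2 : (Matrix.of fun i j : Fin k => Th i (f j)).det ≠ 0 := by
    intro h
    apply hdet
    have := congrArg (kro l) h
    rw [AlgHom.map_det, map_zero] at this
    rw [← this]
    congr 1
    ext1 i j
    simp [hTh]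
  have hrow : (Matrix.of fun i j : Fin k => Th i (f j)).det =
      ∑ r ∈ Fintype.piFinset fun i : Fin k => (c i).support,
        (Matrix.of fun i j : Fin k => monomial (r i) (c i (r i)) * D (r i) (f j)).det := by
    have := (Matrix.detRowAlternating (n := Fin k) (R := MvPolynomial σ ℚ)).toMultilinearMap.map_sum_finset
      (fun i μ => fun j => monomial μ (c i μ) * D μ (f j)) (fun i : Fin k => (c i).support)
    refine Eq.trans ?_ this
    show _ = Matrix.det _
    congr 1
    ext1 i j
    simp [Th]
  rw [hrow] at hdet2
  obtain ⟨r, hr, hne⟩ := Finset.exists_ne_zero_of_sum_ne_zero hdet2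
  refine ⟨r, fun i => hc i _ (Fintype.mem_piFinset.mp hr i), ?_⟩
  intro h0
  apply hne
  have := Matrix.det_mul_column (fun i => monomial (r i) (c i (r i)))
    (Matrix.of fun i j => D (r i) (f j))
  simp only [Matrix.of_apply] at this
  rw [this, h0, mul_zero]

end wr
end UE

set_option linter.all false
namespace UE
open Finset Polynomial

/-- sum of absolute values of coefficients -/
noncomputable def ht (f : ℤ[X]) : ℝ := f.sum fun _ c => |(c : ℝ)|

lemma ht_le_mahler (f : ℤ[X]) :
    ht f ≤ 2 ^ f.natDegree * (f.map (Int.castRingHom ℂ)).mahlerMeasure := by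
  have h1 : ht f = ∑ i ∈ range (f.natDegree + 1), |((f.coeff i : ℤ) : ℝ)| := by
    rw [ht, sum_over_range]; simp
  have h2 : ∑ i ∈ range (f.natDegree + 1), |((f.coeff i : ℤ) : ℝ)| ≤
    ∑ i ∈ range (f.natDegree + 1), (f.natDegree.choose i : ℝ) * (f.map (Int.castRingHom ℂ)).mahlerMeasure := by
    refine sum_le_sum fun i _ => ?_
    have := norm_coeff_le_choose_mul_mahlerMeasure i (f.map (Int.castRingHom ℂ))
    rw [coeff_map, natDegree_map_eq_of_injective (Int.castRingHom ℂ).injective_int] at this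
    simpa using this
  rw [h1]
  refine h2.trans (le_of_eq ?_)
  rw [← Finset.sum_mul]
  congr 1
  exact_mod_cast Nat.sum_range_choose f.natDegree

lemma mahler_le_ht (f : ℤ[X]) : (f.map (Int.castRingHom ℂ)).mahlerMeasure ≤ ht f := by
  refine (mahlerMeasure_le_sum_norm_coeff _).trans (le_of_eq ?_)
  have hd := natDegree_map_eq_of_injective (Int.castRingHom ℂ).injective_int f
  rw [sum_over_range _ (by simp), hd, ht, sum_over_range _ (by simp)]
  refine sum_congr rfl fun i _ => ?_
  simp

lemma one_le_ht {f : ℤ[X]} (h : f ≠ 0) : 1 ≤ ht f := by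
  obtain ⟨a, ha⟩ := Polynomial.support_nonempty.mpr h
  refine le_trans ?_ (Finset.single_le_sum (f := fun a => |((f.coeff a : ℤ) : ℝ)|)
    (fun a _ => abs_nonneg _) ha)
  have := Polynomial.mem_support_iff.mp ha
  exact_mod_cast Int.one_le_abs this

lemma mahler_pow (q : ℂ[X]) (n : ℕ) : (q ^ n).mahlerMeasure = q.mahlerMeasure ^ n := by
  induction n with
  | zero => simp
  | succ a ih => rw [pow_succ, mahlerMeasure_mul, pow_succ, ih]

lemma ht_pow_le {f V : ℤ[X]} (hV : V ≠ 0) {a : ℕ} (h : f ^ a ∣ V) :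
    ht f ^ a ≤ 2 ^ (f.natDegree * a) * ht V := by
  obtain ⟨g, rfl⟩ := h
  have hg : g ≠ 0 := right_ne_zero_of_mul hV
  have hM := mahler_le_ht (f ^ a * g)
  rw [Polynomial.map_mul, Polynomial.map_pow, mahlerMeasure_mul] at hM
  have hp : ((f.map (Int.castRingHom ℂ)) ^ a).mahlerMeasure =
      (f.map (Int.castRingHom ℂ)).mahlerMeasure ^ a := by
    exact mahler_pow _ _
  have h1 : 1 ≤ (g.map (Int.castRingHom ℂ)).mahlerMeasure := one_le_mahlerMeasure_of_ne_zero hg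
  have hf0 : 0 ≤ ht f := Finset.sum_nonneg fun _ _ => abs_nonneg _
  calc ht f ^ a ≤ (2 ^ f.natDegree * (f.map (Int.castRingHom ℂ)).mahlerMeasure) ^ a :=
        pow_le_pow_left₀ hf0 (ht_le_mahler f) a
    _ = 2 ^ (f.natDegree * a) * ((f.map (Int.castRingHom ℂ)) ^ a).mahlerMeasure := by
        rw [mul_pow, ← pow_mul, hp]
    _ ≤ 2 ^ (f.natDegree * a) * (((f.map (Int.castRingHom ℂ)) ^ a).mahlerMeasure *
          (g.map (Int.castRingHom ℂ)).mahlerMeasure) := by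
        gcongr
        exact le_mul_of_one_le_right (mahlerMeasure_nonneg _) h1
    _ ≤ _ := by gcongr

lemma pow_dvd_of_root {K : Type*} [Field K] [CharZero K] {f V : ℤ[X]} (hf : Irreducible f)
    (hd : f.natDegree ≠ 0) {ζ : K} (hζ : aeval ζ f = 0) (a : ℕ)
    (h : (X - C ζ) ^ a ∣ V.map (algebraMap ℤ K)) : f ^ a ∣ V := by
  induction a generalizing V with
  | zero => simp
  | succ a ih =>
    have hprim : f.IsPrimitive := hf.isPrimitive hd
    have hirr : Irreducible (f.map (algebraMap ℤ ℚ)) :=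
      (hprim.irreducible_iff_irreducible_map_fraction_map).mp hf
    have hfζ : aeval ζ (f.map (algebraMap ℤ ℚ)) = 0 := by
      rw [Polynomial.aeval_map_algebraMap]; exact hζ
    have hVζ : aeval ζ V = 0 := by
      have : (X - C ζ) ∣ V.map (algebraMap ℤ K) := (dvd_pow_self _ (by omega)).trans h
      rw [dvd_iff_isRoot, IsRoot, eval_map_algebraMap] at this
      exact this
    have hdvd : f.map (algebraMap ℤ ℚ) ∣ V.map (algebraMap ℤ ℚ) := by
      have h1 := (minpoly.dvd_iff (A := ℚ) (x := ζ)).mpr hfζ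
      have h2 := (minpoly.dvd_iff (A := ℚ) (x := ζ) (p := V.map (algebraMap ℤ ℚ))).mpr (by
        rw [Polynomial.aeval_map_algebraMap]; exact hVζ)
      have hintg : IsIntegral ℚ ζ := by
        refine IsAlgebraic.isIntegral ⟨_, hirr.ne_zero, hfζ⟩
      have h3 : Associated (minpoly ℚ ζ) (f.map (algebraMap ℤ ℚ)) :=
        (minpoly.irreducible hintg).associated_of_dvd hirr h1
      exact h3.symm.dvd.trans h2
    have hfV : f ∣ V := hprim.dvd_of_fraction_map_dvd_fraction_map hdvd
    obtain ⟨V1, rfl⟩ := hfV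
    rw [pow_succ']
    refine mul_dvd_mul_left f (ih ?_)
    -- f is separable
    have hsep : (f.map (algebraMap ℤ K)).Separable := by
      have : (f.map (algebraMap ℤ ℚ)).Separable := hirr.separable
      have := this.map (f := algebraMap ℚ K)
      rwa [Polynomial.map_map, ← IsScalarTower.algebraMap_eq] at this
    have hroot : (X - C ζ) ∣ f.map (algebraMap ℤ K) := by
      rw [dvd_iff_isRoot, IsRoot, eval_map_algebraMap]; exact hζ
    obtain ⟨g, hg⟩ := hroot
    rw [Polynomial.map_mul, hg, pow_succ', mul_assoc] at h
    have h' := (mul_dvd_mul_iff_left (X_sub_C_ne_zero ζ)).mp h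
    have hcop : IsCoprime (X - C ζ) g := by
      rw [hg] at hsep
      exact hsep.isCoprime
    exact (IsCoprime.pow_left hcop).dvd_of_dvd_mul_left h'

section conv
variable {R : Type*} [CommRing R]
/-- one-variable polynomials -/
noncomputable def toU : MvPolynomial (Fin 1) R →ₐ[R] R[X] := MvPolynomial.aeval fun _ => X

lemma toU_coeff (q : MvPolynomial (Fin 1) R) (n : Fin 1 →₀ ℕ) :
    (toU q).coeff (n 0) = q.coeff n := by
  classical
  induction q using MvPolynomial.induction_on' with
  | monomial a x =>
    rw [toU, MvPolynomial.aeval_monomial, Finsupp.prod_fintype _ _ (by simp),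
      MvPolynomial.coeff_monomial]
    simp only [univ_unique, Fin.default_eq_zero, prod_singleton, Polynomial.algebraMap_eq,
      coeff_C_mul, coeff_X_pow]
    have : n 0 = a 0 ↔ a = n := by
      constructor
      · intro h; refine Finsupp.ext fun i => ?_; rw [Subsingleton.elim i 0, h]
      · rintro rfl; rfl
    simp [this]
  | add p q hp hq => rw [map_add, coeff_add, hp, hq, MvPolynomial.coeff_add]

lemma toU_shift {K : Type*} [CommRing K] [Algebra R K] (ζ : K) (q : MvPolynomial (Fin 1) R) :
    toU (shift (fun _ => ζ) q) = ((toU q).map (algebraMap R K)).comp (X + C ζ) := by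
  induction q using MvPolynomial.induction_on with
  | C a => simp [shift, toU]
  | add p q hp hq => simp only [map_add, hp, hq, Polynomial.map_add, add_comp]
  | mul_X p i hp =>
    rw [map_mul, map_mul, map_mul, hp, Polynomial.map_mul, mul_comp]
    congr 1
    simp [shift, toU]

lemma ht_toU (q : MvPolynomial (Fin 1) ℤ) : ht (toU q) = l1 q := by
  classical
  rw [ht, l1_def, Polynomial.sum]
  refine Finset.sum_bij' (fun n _ => Finsupp.single 0 n) (fun a _ => a 0) ?_ ?_ ?_ ?_ ?_
  · intro n hn
    rw [MvPolynomial.mem_support_iff, ← toU_coeff]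
    simpa using hn
  · intro a ha
    rw [Polynomial.mem_support_iff, toU_coeff]
    simpa using ha
  · intro n _; simp
  · intro a _; refine Finsupp.ext fun i => ?_; rw [Subsingleton.elim i 0]; simp
  · intro n _
    rw [← toU_coeff]; simp
end conv

theorem RL1 (Dg : ℕ) (σ : ℝ) (hσ : 0 < σ) : ∃ ω : ℝ, 0 < ω ∧
    ∀ {K : Type*} [Field K] [CharZero K] (ζ : K) (f : ℤ[X]), Irreducible f → f.natDegree ≠ 0 →
      f.natDegree ≤ Dg → aeval ζ f = 0 → ∀ (r B : ℝ) (V : MvPolynomial (Fin 1) ℤ), 0 < r → V ≠ 0 →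
      l1 V ≤ Real.exp B → r ≤ B → B ≤ ω * r * Real.log (ht f) →
      ∃ n, (shift (fun _ => ζ) V).coeff n ≠ 0 ∧ (n 0 : ℝ) < σ * r := by
  have hl2 : 0 < Real.log 2 := Real.log_pos (by norm_num)
  refine ⟨min (σ / 4) (1 / (2 * Dg * Real.log 2 + 1)), by positivity, ?_⟩
  intro K _ _ ζ f hf hd hD hζ r B V hr hV hl hrB hB
  set ω := min (σ / 4) (1 / (2 * Dg * Real.log 2 + 1)) with hω
  have hω0 : 0 < ω := by positivity
  by_contra hcon
  push Not at hcon
  have hV' : toU V ≠ 0 := by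
    intro h
    apply hV; ext n; rw [← toU_coeff, h]; simp
  let a := ⌈σ * r⌉₊
  have hdvd : (X - C ζ) ^ a ∣ (toU V).map (algebraMap ℤ K) := by
    rw [X_sub_C_pow_dvd_iff, ← toU_shift, X_pow_dvd_iff]
    intro d hda
    have := toU_coeff (shift (fun _ => ζ) V) (Finsupp.single 0 d)
    rw [Finsupp.single_eq_same] at this
    rw [this]
    by_contra h
    have := hcon _ h
    rw [Finsupp.single_eq_same] at this
    have h2 := Nat.lt_ceil.mp hda
    linarith
  have h1 := ht_pow_le hV' (pow_dvd_of_root hf hd hζ a hdvd)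
  rw [ht_toU] at h1
  have hht := one_le_ht hf.ne_zero
  have hlog := Real.log_le_log (by positivity) h1
  rw [Real.log_pow, Real.log_mul (by positivity) (by have := one_le_l1 hV; positivity), Real.log_pow] at hlog
  have hlV : Real.log (l1 V) ≤ B := by
    rw [Real.log_le_iff_le_exp (by have := one_le_l1 hV; positivity)]; exact hl
  have ha : σ * r ≤ a := Nat.le_ceil _
  set L := Real.log (ht f)
  have hL1 : 1 ≤ ω * L := by
    by_contra h; push Not at h
    nlinarith
  have hL2 : 2 * Dg * Real.log 2 + 1 ≤ L := by
    have : ω * (2 * Dg * Real.log 2 + 1) ≤ 1 := by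
      have := min_le_right (σ / 4) (1 / (2 * Dg * Real.log 2 + 1))
      rw [← hω, le_div_iff₀ (by positivity)] at this
      exact this
    by_contra h; push Not at h
    nlinarith
  have hL0 : 0 < L := by
    have : 0 ≤ 2 * (Dg:ℝ) * Real.log 2 := by positivity
    linarith
  have hD' : (f.natDegree : ℝ) ≤ Dg := by exact_mod_cast hD
  push_cast at hlog
  have h3 : (a:ℝ) * (L / 2) ≤ B := by
    have : (f.natDegree : ℝ) * Real.log 2 ≤ L / 2 := by nlinarith
    have ha0 : (0:ℝ) ≤ a := by positivity
    nlinarith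
  have h4 : ω ≤ σ / 4 := min_le_left _ _
  have h5 : σ * r * (L / 2) ≤ ω * r * L := by nlinarith
  have h6 : ω * (r * L) ≤ σ / 4 * (r * L) := by
    apply mul_le_mul_of_nonneg_right h4; positivity
  have : 0 < σ * (r * L) := by positivity
  nlinarith

end UE

set_option linter.all false
namespace UE
open MvPolynomial Finset

section ten
variable {R : Type*} [CommRing R] {m : ℕ}

/-- joining exponents -/
noncomputable def jn (b : Fin m →₀ ℕ) (c : Fin 1 →₀ ℕ) : Fin (m + 1) →₀ ℕ := Finsupp.cons (c 0) b
/-- first exponent -/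
noncomputable def hd (a : Fin (m + 1) →₀ ℕ) : Fin 1 →₀ ℕ := Finsupp.single 0 (a 0)

lemma hd_jn (b : Fin m →₀ ℕ) (c : Fin 1 →₀ ℕ) : hd (jn b c) = c := by
  refine Finsupp.ext fun i => ?_
  rw [Subsingleton.elim i 0]; simp [hd, jn]
lemma tail_jn (b : Fin m →₀ ℕ) (c : Fin 1 →₀ ℕ) : Finsupp.tail (jn b c) = b := by
  simp [jn]
lemma jn_eta (a : Fin (m + 1) →₀ ℕ) : jn a.tail (hd a) = a := by
  simp [hd, jn]
lemma jn_zero (b : Fin m →₀ ℕ) (c : Fin 1 →₀ ℕ) : jn b c 0 = c 0 := by simp [jn]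
lemma jn_succ (b : Fin m →₀ ℕ) (c : Fin 1 →₀ ℕ) (i : Fin m) : jn b c i.succ = b i := by simp [jn]

/-- embedding of the last variables -/
noncomputable def e1 : MvPolynomial (Fin m) R →ₐ[R] MvPolynomial (Fin (m + 1)) R := rename Fin.succ
/-- embedding of the first variable -/
noncomputable def e2 : MvPolynomial (Fin 1) R →ₐ[R] MvPolynomial (Fin (m + 1)) R :=
  rename fun _ => 0

lemma e1_monomial (b : Fin m →₀ ℕ) (x : R) : e1 (monomial b x) = monomial (jn b 0) x := by
  rw [e1, rename_monomial]
  refine congrArg (fun z => monomial z x) (Finsupp.ext fun i => ?_)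
  refine Fin.cases ?_ (fun i => ?_) i
  · rw [Finsupp.mapDomain_notin_range]
    · simp [jn]
    · rintro ⟨j, hj⟩; exact Fin.succ_ne_zero j hj
  · rw [Finsupp.mapDomain_apply (Fin.succ_injective m)]; simp [jn]

lemma e2_monomial (c : Fin 1 →₀ ℕ) (x : R) :
    (e2 (monomial c x) : MvPolynomial (Fin (m + 1)) R) = monomial (jn 0 c) x := by
  rw [e2, rename_monomial]
  refine congrArg (fun z => monomial z x) (Finsupp.ext fun i => ?_)
  refine Fin.cases ?_ (fun i => ?_) i
  · have := Finsupp.mapDomain_apply (f := fun _ : Fin 1 => (0 : Fin (m + 1)))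
      (Function.injective_of_subsingleton _) c 0
    simpa [jn] using this
  · rw [Finsupp.mapDomain_notin_range]
    · simp [jn]
    · rintro ⟨j, hj⟩; exact Fin.succ_ne_zero i hj.symm

lemma coeff_ten (u : MvPolynomial (Fin m) R) (v : MvPolynomial (Fin 1) R) (a : Fin (m + 1) →₀ ℕ) :
    coeff a (e1 u * e2 v) = coeff a.tail u * coeff (hd a) v := by
  classical
  induction u using MvPolynomial.induction_on' with
  | monomial b x =>
    induction v using MvPolynomial.induction_on' with
    | monomial c y =>
      rw [e1_monomial, e2_monomial, monomial_mul, coeff_monomial, coeff_monomial, coeff_monomial]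
      have hj : jn b 0 + jn (0 : Fin m →₀ ℕ) c = jn b c := by
        refine Finsupp.ext fun i => ?_
        refine Fin.cases ?_ (fun i => ?_) i
        · simp [jn]
        · simp [jn]
      rw [hj]
      by_cases h : jn b c = a
      · subst h; rw [tail_jn, hd_jn]; simp
      · rw [if_neg h]
        by_cases h1 : b = a.tail
        · by_cases h2 : c = hd a
          · exfalso; apply h; rw [h1, h2, jn_eta]
          · rw [if_neg h2, mul_zero]
        · rw [if_neg h1, zero_mul]
    | add p q hp hq => rw [map_add, mul_add, coeff_add, hp, hq, coeff_add]; ring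
  | add p q hp hq => rw [map_add, add_mul, coeff_add, hp, hq, coeff_add]; ring

lemma mb_jn (a : Fin (m + 1) →₀ ℕ) (μ : Fin m →₀ ℕ) (ν : Fin 1 →₀ ℕ) :
    mb (a + jn μ ν) (jn μ ν) = mb (a.tail + μ) μ * mb (hd a + ν) ν := by
  simp [mb, Fin.prod_univ_succ, jn, hd, Finsupp.tail_apply, mul_comm]

lemma D_ten (u : MvPolynomial (Fin m) R) (v : MvPolynomial (Fin 1) R) (μ : Fin m →₀ ℕ)
    (ν : Fin 1 →₀ ℕ) : D (jn μ ν) (e1 u * e2 v) = e1 (D μ u) * e2 (D ν v) := by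
  ext a
  rw [coeff_D, coeff_ten, coeff_ten, coeff_D, coeff_D, mb_jn]
  have h1 : (a + jn μ ν).tail = a.tail + μ := by
    refine Finsupp.ext fun i => ?_
    simp [jn, Finsupp.tail_apply]
  have h2 : hd (a + jn μ ν) = hd a + ν := by
    refine Finsupp.ext fun i => ?_
    rw [Subsingleton.elim i 0]; simp [hd, jn]
  rw [h1, h2]; push_cast; ring

lemma shift_ten {K : Type*} [CommRing K] [Algebra R K] (ζ : Fin (m + 1) → K)
    (u : MvPolynomial (Fin m) R) (v : MvPolynomial (Fin 1) R) :
    shift ζ (e1 u * e2 v) = e1 (shift (fun i => ζ i.succ) u) * e2 (shift (fun _ => ζ 0) v) := by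
  rw [map_mul]
  congr 1
  · induction u using MvPolynomial.induction_on with
    | C a => simp [shift, e1, MvPolynomial.algebraMap_eq, IsScalarTower.algebraMap_apply R K (MvPolynomial _ K)]
    | add p q hp hq => simp only [map_add, hp, hq]
    | mul_X p i hp => rw [map_mul, map_mul, map_mul, map_mul, hp]; simp [shift, e1]
  · induction v using MvPolynomial.induction_on with
    | C a => simp [shift, e2, MvPolynomial.algebraMap_eq, IsScalarTower.algebraMap_apply R K (MvPolynomial _ K)]
    | add p q hp hq => simp only [map_add, hp, hq]
    | mul_X p i hp => rw [map_mul, map_mul, map_mul, map_mul, hp]; simp [shift, e2]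

lemma D_map {S σ : Type*} [Fintype σ] [CommRing S] (f : R →+* S) (μ : σ →₀ ℕ) (q : MvPolynomial σ R) :
    D μ (map f q) = map f (D μ q) := by
  ext c
  rw [coeff_D, coeff_map, coeff_map, coeff_D]; simp

lemma shift_map {σ K : Type*} [Fintype σ] [Field K] [CharZero K] (ζ : σ → K) (q : MvPolynomial σ ℤ) :
    shift ζ (map (algebraMap ℤ ℚ) q) = shift ζ q := by
  simp only [shift]
  rw [show (MvPolynomial.aeval (R := ℚ) fun h => (X h + C (ζ h) : MvPolynomial σ K)) (map (algebraMap ℤ ℚ) q)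
    = eval₂ (algebraMap ℚ (MvPolynomial σ K)) (fun h => (X h + C (ζ h) : MvPolynomial σ K)) (map (algebraMap ℤ ℚ) q) from rfl,
    eval₂_map]
  rw [MvPolynomial.aeval_def]
  congr 1
  exact RingHom.ext_int _ _

end ten

section slice
variable {σ τ : Type*}
/-- slice of a polynomial -/
noncomputable def slice [DecidableEq σ] (g : (τ →₀ ℕ) → (σ →₀ ℕ)) (g' : (σ →₀ ℕ) → (τ →₀ ℕ))
    (W : MvPolynomial σ ℤ) : MvPolynomial τ ℤ :=
  ∑ a ∈ W.support, if g (g' a) = a then monomial (g' a) (coeff a W) else 0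

variable [DecidableEq σ] {g : (τ →₀ ℕ) → (σ →₀ ℕ)} {g' : (σ →₀ ℕ) → (τ →₀ ℕ)}
lemma coeff_slice (hg : ∀ b, g' (g b) = b) (W : MvPolynomial σ ℤ) (b : τ →₀ ℕ) :
    coeff b (slice g g' W) = coeff (g b) W := by
  classical
  rw [slice, coeff_sum]
  rw [Finset.sum_eq_single (g b)]
  · rw [hg, if_pos rfl]; simp
  · intro a _ ha
    split_ifs with h
    · rw [coeff_monomial, if_neg]
      rintro rfl; exact ha h.symm
    · simp
  · intro h
    rw [MvPolynomial.notMem_support_iff.mp h]; simp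

lemma l1_slice (W : MvPolynomial σ ℤ) : l1 (slice g g' W) ≤ l1 W := by
  rw [slice]
  refine (wnorm_sum_le zabs (fun _ => zero_le_one) _ _).trans ?_
  rw [l1_def]
  refine sum_le_sum fun a _ => ?_
  split_ifs
  · rw [wnorm_monomial]; simp [Finsupp.prod]
  · rw [wnorm_zero]; positivity
end slice

section idx
variable {R σ : Type*} [CommRing R] [Fintype σ]
/-- index at least `s` with weights `w` -/
def idx (w : σ → ℝ) (s : ℝ) (q : MvPolynomial σ R) : Prop :=
  ∀ a, coeff a q ≠ 0 → s ≤ ∑ h, a h * w h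

variable {w : σ → ℝ}
lemma idx_mono {s t : ℝ} {q : MvPolynomial σ R} (h : idx w s q) (hts : t ≤ s) : idx w t q :=
  fun a ha => hts.trans (h a ha)

lemma idx_sum {κ : Type*} {s : ℝ} (S : Finset κ) {f : κ → MvPolynomial σ R}
    (h : ∀ k ∈ S, idx w s (f k)) : idx w s (∑ k ∈ S, f k) := by
  intro a ha
  rw [coeff_sum] at ha
  obtain ⟨k, hk, hk'⟩ := exists_ne_zero_of_sum_ne_zero ha
  exact h k hk a hk'

lemma idx_mul {s t : ℝ} {p q : MvPolynomial σ R} (hp : idx w s p) (hq : idx w t q) :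
    idx w (s + t) (p * q) := by
  classical
  intro a ha
  rw [coeff_mul] at ha
  obtain ⟨x, hx, hx'⟩ := exists_ne_zero_of_sum_ne_zero ha
  rw [HasAntidiagonal.mem_antidiagonal] at hx
  have h1 := hp _ (left_ne_zero_of_mul hx')
  have h2 := hq _ (right_ne_zero_of_mul hx')
  rw [← hx]
  simp only [Finsupp.coe_add, Pi.add_apply, Nat.cast_add, add_mul, sum_add_distrib]
  linarith

lemma idx_prod {κ : Type*} (S : Finset κ) {s : κ → ℝ} {f : κ → MvPolynomial σ R}
    (h : ∀ k ∈ S, idx w (s k) (f k)) : idx w (∑ k ∈ S, s k) (∏ k ∈ S, f k) := by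
  classical
  induction S using Finset.induction_on with
  | empty =>
    intro a ha
    rw [prod_empty, coeff_one] at ha
    have : 0 = a := by by_contra h; simp [h] at ha
    subst this; simp
  | insert k S hk ih =>
    rw [sum_insert hk, prod_insert hk]
    exact idx_mul (h k (mem_insert_self _ _)) (ih fun k hk => h k (mem_insert_of_mem hk))

lemma idx_D {s : ℝ} {q : MvPolynomial σ R} (h : idx w s q) (μ : σ →₀ ℕ) :
    idx w (s - ∑ h, μ h * w h) (D μ q) := by
  intro a ha
  rw [coeff_D] at ha
  have := h _ (right_ne_zero_of_mul ha)
  simp only [Finsupp.coe_add, Pi.add_apply, Nat.cast_add, add_mul, sum_add_distrib] at this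
  linarith

lemma idx_zero (hw : ∀ h, 0 ≤ w h) (q : MvPolynomial σ R) : idx w 0 q :=
  fun a _ => Finset.sum_nonneg fun h _ => mul_nonneg (Nat.cast_nonneg _) (hw h)

lemma idx_det {k : ℕ} {s : Fin k → ℝ} {M : Matrix (Fin k) (Fin k) (MvPolynomial σ R)}
    (h : ∀ i j, idx w (s j) (M i j)) : idx w (∑ j, s j) M.det := by
  rw [Matrix.det_apply']
  refine idx_sum _ fun π _ => ?_
  have h1 : idx w (∑ j, s j) (∏ j, M (π j) j) := idx_prod _ fun j _ => h _ _
  intro a ha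
  refine h1 a ?_
  have e : (((Equiv.Perm.sign π : ℤ) : MvPolynomial σ R)) = C ((Equiv.Perm.sign π : ℤ) : R) := by simp
  rw [e, coeff_C_mul] at ha
  exact right_ne_zero_of_mul ha

/-- degree bounds -/
def bd (r : σ → ℝ) (q : MvPolynomial σ R) : Prop := ∀ a, coeff a q ≠ 0 → ∀ h, (a h : ℝ) ≤ r h

lemma bd_D {r : σ → ℝ} {q : MvPolynomial σ R} (h : bd r q) (μ : σ →₀ ℕ) : bd r (D μ q) := by
  intro a ha i
  rw [coeff_D] at ha
  have := h _ (right_ne_zero_of_mul ha) i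
  simp only [Finsupp.coe_add, Pi.add_apply, Nat.cast_add] at this
  have : (0:ℝ) ≤ μ i := by positivity
  linarith

lemma bd_iff {r : σ → ℝ} {q : MvPolynomial σ R} [DecidableEq σ] :
    bd r q ↔ ∀ h, idx (fun i => if i = h then -1 else 0) (-r h) q := by
  simp only [bd, idx]
  constructor
  · intro H h a ha
    have := H a ha h
    simp; linarith
  · intro H a ha h
    have := H h a ha
    simp at this; linarith

lemma bd_det {k : ℕ} {r : σ → ℝ} {M : Matrix (Fin k) (Fin k) (MvPolynomial σ R)}
    (h : ∀ i j, bd r (M i j)) : bd (fun h => k * r h) M.det := by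
  classical
  rw [bd_iff]
  intro l
  have := idx_det (M := M) (s := fun _ => - r l) (w := fun i => if i = l then -1 else 0)
    (fun i j => bd_iff.mp (h i j) l)
  simpa using this

end idx

section l1
variable {σ : Type*} [Fintype σ]
lemma l1_nonneg (q : MvPolynomial σ ℤ) : 0 ≤ l1 q := wnorm_nonneg _ (fun _ => zero_le_one) _

lemma l1_D {r : σ → ℝ} {q : MvPolynomial σ ℤ} (h : bd r q) (μ : σ →₀ ℕ) :
    l1 (D μ q) ≤ Real.exp (∑ h, r h) * l1 q := by
  classical
  conv_lhs => rw [q.as_sum]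
  rw [map_sum]
  refine (wnorm_sum_le zabs (fun _ => zero_le_one) _ _).trans ?_
  rw [l1_def, mul_sum]
  refine sum_le_sum fun a ha => ?_
  rw [D_monomial, wnorm_monomial]
  simp only [map_mul, zabs_apply, Finsupp.prod, one_pow, prod_const_one, mul_one]
  rw [mul_comm]
  refine mul_le_mul_of_nonneg_right ?_ (abs_nonneg _)
  simp only [Int.cast_natCast, Nat.abs_cast]
  refine (mb_le a μ).trans ?_
  rw [Real.exp_sum]
  refine prod_le_prod (fun _ _ => by positivity) fun i _ => ?_
  have h2 : (2:ℝ) ≤ Real.exp 1 := by have := Real.add_one_le_exp (1:ℝ); linarith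
  calc (2:ℝ) ^ (a i) ≤ (Real.exp 1) ^ (a i) := by gcongr
    _ = Real.exp (a i) := by rw [← Real.exp_nat_mul, mul_one]
    _ ≤ _ := Real.exp_le_exp.mpr (h a (mem_support_iff.mp ha) i)

lemma l1_det {k : ℕ} {E : ℝ} (hE : 0 ≤ E) {M : Matrix (Fin k) (Fin k) (MvPolynomial σ ℤ)}
    (h : ∀ i j, l1 (M i j) ≤ E) : l1 M.det ≤ (k:ℝ) ^ k * E ^ k := by
  rw [Matrix.det_apply']
  refine (wnorm_sum_le zabs (fun _ => zero_le_one) _ _).trans ?_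
  have : ∀ π ∈ (univ : Finset (Equiv.Perm (Fin k))), wnorm zabs (fun _ => 1)
      (((Equiv.Perm.sign π : ℤ) : MvPolynomial σ ℤ) * ∏ j, M (π j) j) ≤ E ^ k := by
    intro π _
    have e : (((Equiv.Perm.sign π : ℤ) : MvPolynomial σ ℤ)) = C ((Equiv.Perm.sign π : ℤ)) := by simp
    rw [e]
    refine (wnorm_C_mul_le zabs (fun _ => zero_le_one) _ _).trans ?_
    have h1 : zabs (Equiv.Perm.sign π : ℤ) = 1 := by
      rcases Int.units_eq_one_or (Equiv.Perm.sign π) with h | h <;> rw [h] <;> simp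
    rw [h1, one_mul]
    refine (wnorm_prod_le zabs (fun _ => zero_le_one) _ _).trans ?_
    refine (prod_le_prod (fun j _ => l1_nonneg _) fun j _ => h (π j) j).trans ?_
    simp
  refine (sum_le_sum this).trans ?_
  simp only [sum_const, card_univ, Fintype.card_perm, Fintype.card_fin, nsmul_eq_mul]
  gcongr
  exact_mod_cast Nat.factorial_le_pow k
end l1

section rank
variable {A B E : Type*} [AddCommGroup A] [AddCommGroup B] [AddCommGroup E] [Module ℚ A] [Module ℚ B]
  [Module ℚ E]
lemma rank_red (β : A →ₗ[ℚ] B →ₗ[ℚ] E) {k : ℕ} (u : Fin k → A) (v : Fin k → B)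
    (h : ¬ LinearIndependent ℚ u) : ∃ k' < k, ∃ (u' : Fin k' → A) (v' : Fin k' → B),
      ∑ i, β (u i) (v i) = ∑ i, β (u' i) (v' i) := by
  rw [Fintype.not_linearIndependent_iff] at h
  obtain ⟨g, hg, j, hj⟩ := h
  obtain _ | k := k
  · exact j.elim0
  refine ⟨k, by omega, fun i => u (j.succAbove i), fun i => v (j.succAbove i) - (g (j.succAbove i) / g j) • v j, ?_⟩
  rw [Fin.sum_univ_succAbove _ j] at hg ⊢
  have hu : u j = - ∑ i, (g (j.succAbove i) / g j) • u (j.succAbove i) := by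
    have h3 : (g j)⁻¹ • (g j • u j) = (g j)⁻¹ • (- ∑ i, g (j.succAbove i) • u (j.succAbove i)) := by
      rw [eq_neg_of_add_eq_zero_left hg]
    rw [smul_smul, inv_mul_cancel₀ hj, one_smul, smul_neg, smul_sum] at h3
    rw [h3]; congr 1; refine sum_congr rfl fun i _ => ?_
    rw [smul_smul]; congr 1; field_simp
  simp only [map_sub, map_smul]
  conv_lhs => rw [hu]
  simp only [map_neg, map_sum, map_smul, LinearMap.neg_apply, LinearMap.sum_apply, LinearMap.smul_apply,
    sum_sub_distrib]
  abel

lemma exists_rank (β : A →ₗ[ℚ] B →ₗ[ℚ] E) {k : ℕ} (u : Fin k → A) (v : Fin k → B) :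
    ∃ k' ≤ k, ∃ (u' : Fin k' → A) (v' : Fin k' → B), LinearIndependent ℚ u' ∧ LinearIndependent ℚ v' ∧
      ∑ i, β (u i) (v i) = ∑ i, β (u' i) (v' i) := by
  induction k using Nat.strong_induction_on with
  | _ k ih =>
  by_cases hu : LinearIndependent ℚ u
  · by_cases hv : LinearIndependent ℚ v
    · exact ⟨k, le_rfl, u, v, hu, hv, rfl⟩
    · obtain ⟨k', hk', v', u', h⟩ := rank_red β.flip v u hv
      obtain ⟨k2, h2, u2, v2, h3, h4, h5⟩ := ih k' hk' u' v'
      refine ⟨k2, by omega, u2, v2, h3, h4, ?_⟩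
      rw [← h5]; simpa using h
  · obtain ⟨k', hk', u', v', h⟩ := rank_red β u v hu
    obtain ⟨k2, h2, u2, v2, h3, h4, h5⟩ := ih k' hk' u' v'
    exact ⟨k2, by omega, u2, v2, h3, h4, h.trans h5⟩
end rank

end UE

set_option linter.all false
namespace UE
open MvPolynomial Finset

/-- tensor map -/
noncomputable def tenL (m : ℕ) : MvPolynomial (Fin m) ℚ →ₗ[ℚ] MvPolynomial (Fin 1) ℚ →ₗ[ℚ]
    MvPolynomial (Fin (m + 1)) ℚ :=
  (LinearMap.mul ℚ (MvPolynomial (Fin (m + 1)) ℚ)).compl₁₂ e1.toLinearMap e2.toLinearMap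

lemma tenL_apply {m : ℕ} (u : MvPolynomial (Fin m) ℚ) (v : MvPolynomial (Fin 1) ℚ) :
    tenL m u v = e1 u * e2 v := rfl

lemma decomp {m n : ℕ} (p : MvPolynomial (Fin (m + 1)) ℤ) (h : ∀ a, coeff a p ≠ 0 → a 0 ≤ n) :
    map (algebraMap ℤ ℚ) p = ∑ i : Fin (n + 1),
      tenL m (map (algebraMap ℤ ℚ) (slice (fun b => jn b (Finsupp.single 0 (i:ℕ))) Finsupp.tail p))
        (monomial (Finsupp.single 0 (i:ℕ)) 1) := by
  classical
  ext a
  rw [coeff_map, coeff_sum]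
  simp only [tenL_apply, coeff_ten, coeff_map]
  simp only [coeff_slice (g' := Finsupp.tail) (g := fun b => jn b (Finsupp.single 0 _)) (fun b => tail_jn _ _),
    coeff_monomial]
  have h1 : ∀ i : ℕ, Finsupp.single 0 i = hd a ↔ i = a 0 := by
    intro i; rw [hd]
    exact (Finsupp.single_injective _).eq_iff
  simp only [h1]
  by_cases ha : a 0 ≤ n
  · rw [Finset.sum_eq_single ⟨a 0, by omega⟩]
    · have : jn a.tail (Finsupp.single 0 (a 0)) = a := jn_eta a
      simp [this]
    · intro b _ hb
      rw [if_neg, mul_zero]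
      intro h; apply hb; ext; exact h
    · simp
  · have : coeff a p = 0 := by by_contra h'; exact ha (h a h')
    rw [this, map_zero, eq_comm]
    refine Finset.sum_eq_zero fun i _ => ?_
    rw [if_neg, mul_zero]
    have := i.2; omega

lemma det_step {m n : ℕ} (p : MvPolynomial (Fin (m + 1)) ℤ) (hp : p ≠ 0)
    (h : ∀ a, coeff a p ≠ 0 → a 0 ≤ n) :
    ∃ k, 1 ≤ k ∧ k ≤ n + 1 ∧ ∃ (μ : Fin k → (Fin m →₀ ℕ)) (ν : Fin k → (Fin 1 →₀ ℕ))
      (U : MvPolynomial (Fin m) ℚ) (V : MvPolynomial (Fin 1) ℚ),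
      (∀ i, (μ i).degree ≤ i) ∧ (∀ i, ν i 0 ≤ i) ∧ U ≠ 0 ∧ V ≠ 0 ∧
      map (algebraMap ℤ ℚ) (Matrix.of fun i j => D (jn (μ i) (ν j)) p).det = e1 U * e2 V := by
  obtain ⟨k, hk, u, v, hu, hv, huv⟩ := exists_rank (tenL m) (k := n + 1)
    (fun i => map (algebraMap ℤ ℚ) (slice (fun b => jn b (Finsupp.single 0 (i:ℕ))) Finsupp.tail p))
    (fun i => monomial (Finsupp.single 0 (i:ℕ)) 1)
  rw [← decomp p h] at huv
  obtain ⟨μ, hμ, hU⟩ := gen_wronskian u hu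
  obtain ⟨ν, hν, hV⟩ := gen_wronskian v hv
  refine ⟨k, ?_, hk, μ, ν, _, _, hμ, fun i => ?_, hU, hV, ?_⟩
  · rcases Nat.eq_zero_or_pos k with rfl | h
    · exfalso
      apply hp
      apply map_injective (algebraMap ℤ ℚ) (algebraMap ℤ ℚ).injective_int
      rw [huv]; simp
    · exact h
  · refine le_trans ?_ (hν i)
    exact Finsupp.le_degree 0 (ν i)
  · have hM : (map (algebraMap ℤ ℚ)).mapMatrix (Matrix.of fun i j => D (jn (μ i) (ν j)) p) =
        (e1.toRingHom.mapMatrix (Matrix.of fun i j => D (μ i) (u j))) *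
        (e2.toRingHom.mapMatrix (Matrix.of fun i j => D (ν i) (v j))).transpose := by
      ext1 i j
      simp only [RingHom.mapMatrix_apply, Matrix.map_apply, Matrix.of_apply, Matrix.mul_apply,
        Matrix.transpose_apply]
      rw [← D_map, huv, map_sum]
      refine sum_congr rfl fun l _ => ?_
      rw [tenL_apply, D_ten]; rfl
    rw [RingHom.map_det, hM, Matrix.det_mul, Matrix.det_transpose, ← RingHom.map_det, ← RingHom.map_det]
    rfl

lemma tsum_bound {k : ℕ} {r0 s : ℝ} (hr : 1 ≤ r0) (hk : (k:ℝ) ≤ 2 * r0) (hs : 0 < s) (hs1 : s ≤ 1) :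
    k * s ^ 2 / 8 ≤ ∑ j : Fin k, max 0 (s - (j:ℝ) / r0) := by
  rw [Fin.sum_univ_eq_sum_range (fun j => max 0 (s - (j:ℝ) / r0)) k]
  let J := min k (⌊s * r0 / 2⌋₊ + 1)
  have hJ : s * k / 4 ≤ (J:ℝ) := by
    simp only [J, Nat.cast_min, le_min_iff]
    constructor
    · have : (0:ℝ) ≤ k := by positivity
      nlinarith
    · have := (Nat.lt_floor_add_one (s * r0 / 2)).le
      push_cast
      nlinarith
  calc k * s ^ 2 / 8 = (s * k / 4) * (s / 2) := by ring
    _ ≤ J * (s / 2) := by gcongr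
    _ = ∑ j ∈ range J, s / 2 := by simp
    _ ≤ ∑ j ∈ range J, max 0 (s - (j:ℝ) / r0) := by
        refine sum_le_sum fun j hj => le_max_of_le_right ?_
        have : j ≤ ⌊s * r0 / 2⌋₊ := by
          have := mem_range.mp hj
          have : j < ⌊s * r0 / 2⌋₊ + 1 := lt_of_lt_of_le this (min_le_right _ _)
          omega
        have h2 : (j:ℝ) ≤ s * r0 / 2 := (Nat.le_floor_iff (by positivity)).mp this
        have : (j:ℝ) / r0 ≤ s / 2 := by rw [div_le_iff₀ (by positivity)]; linarith
        linarith
    _ ≤ _ := by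
        refine sum_le_sum_of_subset_of_nonneg ?_ fun _ _ _ => le_max_left _ _
        exact range_subset_range.mpr (min_le_left _ _)

theorem RL.{u} (m : ℕ) : ∀ (Dg : ℕ) (σ : ℝ), 0 < σ → ∃ ω : ℝ, 0 < ω ∧
    ∀ {K : Type u} [Field K] [CharZero K] (ζ : Fin m → K) (f : Fin m → Polynomial ℤ)
      (r : Fin m → ℝ) (B : ℝ) (p : MvPolynomial (Fin m) ℤ),
      (∀ h, Irreducible (f h) ∧ (f h).natDegree ≠ 0 ∧ (f h).natDegree ≤ Dg ∧
        Polynomial.aeval (ζ h) (f h) = 0 ∧ 1 ≤ r h ∧ r h ≤ B ∧ B ≤ ω * r h * Real.log (ht (f h))) →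
      (∀ h h', h < h' → r h ≤ ω * r h') → p ≠ 0 → bd r p → l1 p ≤ Real.exp B →
      ∃ a, (shift ζ p).coeff a ≠ 0 ∧ ∑ h, a h * (1 / r h) < σ := by
  induction m with
  | zero =>
    intro Dg σ hσ
    refine ⟨1, one_pos, ?_⟩
    intro K _ _ ζ f r B p _ _ hp _ _
    refine ⟨0, ?_, by simpa using hσ⟩
    obtain ⟨c, rfl⟩ := C_surjective (R := ℤ) (Fin 0) p
    have hc : c ≠ 0 := by rintro rfl; simp at hp
    rw [shift, aeval_C, IsScalarTower.algebraMap_apply ℤ K (MvPolynomial _ K), MvPolynomial.algebraMap_eq,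
      coeff_C, if_pos rfl]
    simpa using hc
  | succ m ih =>
    intro Dg σ₀ hσ₀
    obtain ⟨σ, hσ, hσ1, hσ'⟩ : ∃ σ : ℝ, 0 < σ ∧ σ ≤ 1 ∧ σ ≤ σ₀ :=
      ⟨min σ₀ 1, by positivity, min_le_right _ _, min_le_left _ _⟩
    obtain ⟨ω1, hω1, H1⟩ := ih Dg (σ ^ 2 / 64) (by positivity)
    obtain ⟨ω2, hω2, H2⟩ := RL1 Dg (σ ^ 2 / 64) (by positivity)
    obtain ⟨ω, hω, hωa, hωb, hωc, hωd⟩ : ∃ ω : ℝ, 0 < ω ∧ ω ≤ ω1 / (m + 3) ∧ ω ≤ ω2 / (m + 3) ∧ ω ≤ σ / 2 ∧ ω ≤ ω1 :=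
      ⟨min (min (ω1 / (m + 3)) (ω2 / (m + 3))) (min (σ / 2) ω1), by positivity,
        (min_le_left _ _).trans (min_le_left _ _), (min_le_left _ _).trans (min_le_right _ _),
        (min_le_right _ _).trans (min_le_left _ _), (min_le_right _ _).trans (min_le_right _ _)⟩
    refine ⟨ω, hω, ?_⟩
    intro K _ _ ζ f r B p hh hord hp hbd hl
    classical
    by_contra hcon
    push Not at hcon
    have hidx : idx (fun h => 1 / r h) σ (shift ζ p) := fun a ha => hσ'.trans (hcon a ha)
    have hr1 : ∀ h, 1 ≤ r h := fun h => (hh h).2.2.2.2.1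
    have hrp : ∀ h, 0 < r h := fun h => by linarith [hr1 h]
    have hrB : ∀ h, r h ≤ B := fun h => (hh h).2.2.2.2.2.1
    have hB1 : 1 ≤ B := (hr1 0).trans (hrB 0)
    obtain ⟨k, hk1, hkn, μ, ν, U, V, hμ, hν, hU, hV, hW⟩ := det_step (n := ⌊r 0⌋₊) p hp
      (fun a ha => Nat.le_floor (hbd a ha 0))
    set W := (Matrix.of fun i j => D (jn (μ i) (ν j)) p).det with hWdef
    have hk0 : (1:ℝ) ≤ k := by exact_mod_cast hk1
    have hkr : (k:ℝ) ≤ r 0 + 1 := by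
      have h1 : (k:ℝ) ≤ ⌊r 0⌋₊ + 1 := by exact_mod_cast hkn
      have := Nat.floor_le (hrp 0).le
      linarith
    -- size of W
    have hWl : l1 W ≤ Real.exp (k * (m + 3) * B) := by
      have h1 : ∀ i j, l1 ((Matrix.of fun i j => D (jn (μ i) (ν j)) p) i j) ≤ Real.exp ((m + 2) * B) := by
        intro i j
        refine (l1_D hbd _).trans ?_
        calc _ ≤ Real.exp (∑ h, r h) * Real.exp B := by gcongr
          _ ≤ Real.exp ((m + 1) * B) * Real.exp B := by
              gcongr
              refine (sum_le_sum fun h _ => hrB h).trans ?_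
              simp
          _ = _ := by rw [← Real.exp_add]; ring_nf
      refine (l1_det (Real.exp_pos _).le h1).trans ?_
      have hkB : (k:ℝ) ≤ Real.exp B := by
        have := Real.add_one_le_exp B
        linarith [hrB 0]
      calc _ ≤ Real.exp B ^ k * Real.exp ((m + 2) * B) ^ k := by gcongr
        _ = _ := by rw [← Real.exp_nat_mul, ← Real.exp_nat_mul, ← Real.exp_add]; ring_nf
    have hWbd : bd (fun h => k * r h) W := bd_det fun i j => bd_D hbd _
    -- index of W
    have hWidx : idx (fun h => 1 / r h) (k * σ ^ 2 / 32) (shift ζ W) := by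
      have e : shift ζ W = (Matrix.of fun i j => D (jn (μ i) (ν j)) (shift ζ p)).det := by
        rw [hWdef]
        have := RingHom.map_det (shift ζ).toRingHom (Matrix.of fun i j => D (jn (μ i) (ν j)) p)
        refine this.trans ?_
        congr 1
        ext1 i j
        simp only [RingHom.mapMatrix_apply, Matrix.map_apply, Matrix.of_apply]
        exact shift_D _ _ _
      rw [e]
      have hb := tsum_bound (k := k) (r0 := r 0) (s := σ / 2) (hr1 0) (by linarith [hr1 0]) (by positivity) (by linarith)
      refine idx_mono (idx_det (s := fun j : Fin k => max 0 (σ / 2 - (j:ℝ) / r 0)) ?_)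
        (le_trans (le_of_eq (by ring)) hb)
      intro i j
      rcases le_total 0 (σ / 2 - (j:ℝ) / r 0) with h0 | h0
      · rw [max_eq_right h0]
        refine idx_mono (idx_D hidx _) ?_
        rw [Fin.sum_univ_succ]
        simp only [jn_zero, jn_succ]
        have h1 : (ν j 0 : ℝ) * (1 / r 0) ≤ j / r 0 := by
          rw [mul_one_div]
          have : (ν j 0 : ℝ) ≤ j := by exact_mod_cast hν j
          have := hrp 0
          gcongr
        have h2 : ∑ x, (μ i x : ℝ) * (1 / r (Fin.succ x)) ≤ ω := by
          calc _ ≤ ∑ x, (μ i x : ℝ) * (ω / r 0) := by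
                refine sum_le_sum fun x _ => ?_
                refine mul_le_mul_of_nonneg_left ?_ (Nat.cast_nonneg _)
                rw [div_le_div_iff₀ (hrp _) (hrp _)]
                have := hord 0 x.succ (Fin.succ_pos x)
                linarith
            _ = (∑ x, (μ i x : ℝ)) * (ω / r 0) := by rw [sum_mul]
            _ ≤ r 0 * (ω / r 0) := by
                have := hrp 0
                gcongr
                have h3 : ((μ i).degree : ℝ) ≤ i := by exact_mod_cast hμ i
                rw [Finsupp.degree_eq_sum] at h3
                push_cast at h3
                have h4 : ((i:ℕ):ℝ) + 1 ≤ k := by exact_mod_cast i.2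
                linarith
            _ = ω := by field_simp [(hrp 0).ne']
        linarith
      · rw [max_eq_left h0]
        exact idx_zero (fun h => by have := hrp h; positivity) _
    obtain ⟨α, hα⟩ := MvPolynomial.ne_zero_iff.mp hU
    obtain ⟨β, hβ⟩ := MvPolynomial.ne_zero_iff.mp hV
    have hWc : ∀ b c, ((coeff (jn b c) W : ℤ) : ℚ) = coeff b U * coeff c V := by
      intro b c
      have := congrArg (coeff (jn b c)) hW
      rw [coeff_map, coeff_ten, tail_jn, hd_jn] at this
      exact this
    let U0 : MvPolynomial (Fin m) ℤ := slice (fun b => jn b β) Finsupp.tail W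
    let V0 : MvPolynomial (Fin 1) ℤ := slice (fun c => jn α c) hd W
    have hU0c : ∀ b, coeff b U0 = coeff (jn b β) W :=
      fun b => coeff_slice (fun b => tail_jn b β) W b
    have hV0c : ∀ c, coeff c V0 = coeff (jn α c) W :=
      fun b => coeff_slice (fun b => hd_jn α b) W b
    have hU0 : map (algebraMap ℤ ℚ) U0 = C (coeff β V) * U := by
      ext b
      rw [coeff_map, hU0c, coeff_C_mul, mul_comm]; exact hWc b β
    have hV0 : map (algebraMap ℤ ℚ) V0 = C (coeff α U) * V := by
      ext b
      rw [coeff_map, hV0c, coeff_C_mul]; exact hWc α b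
    have hBp : 0 ≤ B := by linarith
    obtain ⟨a, ha, ha'⟩ := H1 (fun h => ζ h.succ) (fun h => f h.succ) (fun h => k * r h.succ)
      (k * (m + 3) * B) U0 (by
        intro h
        obtain ⟨h1, h2, h3, h4, h5, h6, h7⟩ := hh h.succ
        refine ⟨h1, h2, h3, h4, ?_, ?_, ?_⟩
        · nlinarith
        · have : (k:ℝ) * r h.succ ≤ k * B := by gcongr
          have : 0 ≤ (k:ℝ) * (m + 2) * B := by positivity
          nlinarith
        · have h8 : 0 ≤ r h.succ * Real.log (ht (f h.succ)) :=
            mul_nonneg (hrp _).le (Real.log_nonneg (one_le_ht h1.ne_zero))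
          have h9 : ω * (m + 3) ≤ ω1 := by
            rw [le_div_iff₀ (by positivity)] at hωa; exact hωa
          calc (k:ℝ) * (m + 3) * B ≤ k * (m + 3) * (ω * r h.succ * Real.log (ht (f h.succ))) := by gcongr
            _ = k * (ω * (m + 3)) * (r h.succ * Real.log (ht (f h.succ))) := by ring
            _ ≤ k * ω1 * (r h.succ * Real.log (ht (f h.succ))) := by gcongr
            _ = _ := by ring)
      (by
        intro h h' hlt
        have h1 := hord h.succ h'.succ (by simpa using hlt)
        have h2 : ω * r h'.succ ≤ ω1 * r h'.succ := by have := hrp h'.succ; gcongr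
        have : (k:ℝ) * r h.succ ≤ k * (ω1 * r h'.succ) := by gcongr; linarith
        linarith)
      (by
        intro h0
        rw [h0, map_zero, eq_comm, mul_eq_zero] at hU0
        rcases hU0 with h | h
        · rw [C_eq_zero] at h; exact hβ h
        · exact hU h)
      (by
        intro b hb h
        rw [hU0c] at hb
        have := hWbd _ hb h.succ
        rwa [jn_succ] at this)
      ((l1_slice W).trans hWl)
    obtain ⟨n, hn, hn'⟩ : ∃ n, (shift (fun _ => ζ 0) V0).coeff n ≠ 0 ∧ (n 0 : ℝ) < σ ^ 2 / 64 * (k * r 0) := by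
      obtain ⟨h1, h2, h3, h4, h5, h6, h7⟩ := hh 0
      refine H2 (ζ 0) (f 0) h1 h2 h3 h4 (k * r 0) (k * (m + 3) * B) V0 (by positivity) ?_
        ((l1_slice W).trans hWl) ?_ ?_
      · intro h0
        rw [h0, map_zero, eq_comm, mul_eq_zero] at hV0
        rcases hV0 with h | h
        · rw [C_eq_zero] at h; exact hα h
        · exact hV h
      · have : (k:ℝ) * r 0 ≤ k * B := by gcongr
        have : 0 ≤ (k:ℝ) * (m + 2) * B := by positivity
        nlinarith
      · have h8 : 0 ≤ r 0 * Real.log (ht (f 0)) :=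
          mul_nonneg (hrp _).le (Real.log_nonneg (one_le_ht h1.ne_zero))
        have h9 : ω * (m + 3) ≤ ω2 := by
          rw [le_div_iff₀ (by positivity)] at hωb; exact hωb
        calc (k:ℝ) * (m + 3) * B ≤ k * (m + 3) * (ω * r 0 * Real.log (ht (f 0))) := by gcongr
          _ = k * (ω * (m + 3)) * (r 0 * Real.log (ht (f 0))) := by ring
          _ ≤ k * ω2 * (r 0 * Real.log (ht (f 0))) := by gcongr
          _ = _ := by ring
    have hne : coeff (jn a n) (shift ζ W) ≠ 0 := by
      rw [← shift_map, hW, shift_ten, coeff_ten, tail_jn, hd_jn]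
      rw [← shift_map, hU0, map_mul] at ha
      rw [← shift_map, hV0, map_mul] at hn
      refine mul_ne_zero ?_ ?_
      · intro h
        apply ha
        rw [shift, aeval_C, IsScalarTower.algebraMap_apply ℚ K (MvPolynomial _ K),
          MvPolynomial.algebraMap_eq, coeff_C_mul]
        rw [shift] at h
        rw [h, mul_zero]
      · intro h
        apply hn
        rw [shift, aeval_C, IsScalarTower.algebraMap_apply ℚ K (MvPolynomial _ K),
          MvPolynomial.algebraMap_eq, coeff_C_mul]
        rw [shift] at h
        rw [h, mul_zero]
    have hfin := hWidx _ hne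
    rw [Fin.sum_univ_succ] at hfin
    simp only [jn_zero, jn_succ] at hfin
    have h1 : (n 0 : ℝ) * (1 / r 0) < σ ^ 2 / 64 * k := by
      rw [mul_one_div, div_lt_iff₀ (hrp 0)]; linarith
    have h2 : ∑ x : Fin m, (a x : ℝ) * (1 / r x.succ) < σ ^ 2 / 64 * k := by
      have : ∑ x : Fin m, (a x : ℝ) * (1 / r x.succ) = k * ∑ x : Fin m, (a x : ℝ) * (1 / (k * r x.succ)) := by
        rw [mul_sum]
        refine sum_congr rfl fun x _ => ?_
        have := hrp x.succ
        field_simp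
      rw [this, mul_comm]
      gcongr
    linarith
end UE

set_option linter.all false
namespace UE
open Finset

section chern
variable {I : Type*} [Fintype I] [DecidableEq I]

lemma sum_sym (n : ℕ) (i j : I) :
    ∑ b ∈ piAntidiag (univ : Finset I) n, (b i : ℝ) = ∑ b ∈ piAntidiag (univ : Finset I) n, (b j : ℝ) := by
  refine Finset.sum_bij' (fun b _ => b ∘ Equiv.swap i j) (fun b _ => b ∘ Equiv.swap i j) ?_ ?_ ?_ ?_ ?_
  · intro b hb
    rw [mem_piAntidiag] at hb ⊢
    refine ⟨?_, by simp⟩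
    rw [← hb.1]
    exact Equiv.sum_comp (Equiv.swap i j) b
  · intro b hb
    rw [mem_piAntidiag] at hb ⊢
    refine ⟨?_, by simp⟩
    rw [← hb.1]
    exact Equiv.sum_comp (Equiv.swap i j) b
  · intro b _; ext x; simp
  · intro b _; ext x; simp
  · intro b _; simp

lemma sum_mean (n : ℕ) (i : I) :
    ∑ b ∈ piAntidiag (univ : Finset I) n, (b i : ℝ) =
      n * (#(piAntidiag (univ : Finset I) n)) / (Fintype.card I) := by
  have hN : (0:ℝ) < Fintype.card I := by
    have := Fintype.card_pos_iff.mpr ⟨i⟩; exact_mod_cast this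
  rw [eq_div_iff hN.ne']
  have h1 : ∑ j : I, ∑ b ∈ piAntidiag (univ : Finset I) n, (b j : ℝ) =
      (Fintype.card I) * ∑ b ∈ piAntidiag (univ : Finset I) n, (b i : ℝ) := by
    rw [Finset.sum_congr rfl fun j _ => sum_sym n j i]; simp
  rw [Finset.sum_comm] at h1
  have h2 : ∀ b ∈ piAntidiag (univ : Finset I) n, ∑ j, (b j : ℝ) = n := by
    intro b hb
    have := (mem_piAntidiag.mp hb).1
    exact_mod_cast this
  rw [Finset.sum_congr rfl h2] at h1
  simp at h1
  linarith

lemma one_block {n : ℕ} (hn : 1 ≤ n) (i : I) {θ : ℝ} (hθ : |θ| ≤ 1) :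
    ∑ b ∈ piAntidiag (univ : Finset I) n, Real.exp (θ * ((b i : ℝ) / n - 1 / Fintype.card I)) ≤
      #(piAntidiag (univ : Finset I) n) * Real.exp (θ ^ 2) := by
  have hN : (1:ℝ) ≤ Fintype.card I := by
    have := Fintype.card_pos_iff.mpr ⟨i⟩; exact_mod_cast this
  have hn' : (1:ℝ) ≤ n := by exact_mod_cast hn
  have hz : ∀ b ∈ piAntidiag (univ : Finset I) n, |(b i : ℝ) / n - 1 / Fintype.card I| ≤ 1 := by
    intro b hb
    have h1 : b i ≤ n := by
      have := (mem_piAntidiag.mp hb).1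
      rw [← this]; exact single_le_sum (fun _ _ => Nat.zero_le _) (mem_univ i)
    have h1' : (b i : ℝ) ≤ n := by exact_mod_cast h1
    have h2 : (b i : ℝ) / n ≤ 1 := by rw [div_le_one (by linarith)]; exact h1'
    have h3 : 0 ≤ (b i : ℝ) / n := by positivity
    have h4 : 1 / (Fintype.card I : ℝ) ≤ 1 := by rw [div_le_one (by linarith)]; exact hN
    have h5 : 0 ≤ 1 / (Fintype.card I : ℝ) := by positivity
    rw [abs_le]; constructor <;> linarith
  calc _ ≤ ∑ b ∈ piAntidiag (univ : Finset I) n, (1 + θ * ((b i : ℝ) / n - 1 / Fintype.card I) + θ ^ 2) := by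
        refine sum_le_sum fun b hb => ?_
        have h1 := hz b hb
        have h2 : |θ * ((b i : ℝ) / n - 1 / Fintype.card I)| ≤ 1 := by
          rw [abs_mul]; exact mul_le_one₀ hθ (abs_nonneg _) h1
        have h3 := (abs_le.mp (Real.abs_exp_sub_one_sub_id_le h2)).2
        have h4 : (θ * ((b i : ℝ) / n - 1 / Fintype.card I)) ^ 2 ≤ θ ^ 2 := by
          rw [mul_pow]
          have : ((b i : ℝ) / n - 1 / Fintype.card I) ^ 2 ≤ 1 := by
            rw [sq_le_one_iff_abs_le_one]; exact h1
          nlinarith [sq_nonneg θ]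
        linarith
    _ = #(piAntidiag (univ : Finset I) n) * (1 + θ ^ 2) := by
        simp only [sum_add_distrib, sum_const, nsmul_eq_mul, ← mul_sum, sum_sub_distrib, ← sum_div]
        rw [sum_mean]
        field_simp
        ring
    _ ≤ _ := by
        gcongr
        have := Real.add_one_le_exp (θ ^ 2); linarith

variable {m : ℕ}
/-- block exponents -/
def EE (I : Type*) [Fintype I] [DecidableEq I] {m : ℕ} (r : Fin m → ℕ) : Finset (Fin m → I → ℕ) :=
  Fintype.piFinset fun h => piAntidiag univ (r h)

lemma mem_EE {r : Fin m → ℕ} {a : Fin m → I → ℕ} : a ∈ EE I r ↔ ∀ h, ∑ i, a h i = r h := by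
  simp [EE, Fintype.mem_piFinset, mem_piAntidiag]

lemma tail_one {r : Fin m → ℕ} (hr : ∀ h, 1 ≤ r h) (i : I) {ε θ : ℝ} (hθ : |θ| ≤ 1) (hθε : |θ| = ε / 2) :
    (#{a ∈ EE I r | ε * m * |θ| ≤ θ * ∑ h, ((a h i : ℝ) / r h - 1 / Fintype.card I)} : ℝ) ≤
      Real.exp (- (ε ^ 2 * m / 4)) * #(EE I r) := by
  have h1 : ∑ a ∈ EE I r, Real.exp (θ * ∑ h, ((a h i : ℝ) / r h - 1 / Fintype.card I)) ≤
      #(EE I r) * Real.exp (θ ^ 2 * m) := by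
    have e : ∀ a : Fin m → I → ℕ, Real.exp (θ * ∑ h, ((a h i : ℝ) / r h - 1 / Fintype.card I)) =
        ∏ h, Real.exp (θ * ((a h i : ℝ) / r h - 1 / Fintype.card I)) := by
      intro a; rw [mul_sum, Real.exp_sum]
    simp_rw [e]
    rw [EE, ← Finset.prod_univ_sum (fun h => piAntidiag univ (r h))
      (fun h (b : I → ℕ) => Real.exp (θ * ((b i : ℝ) / r h - 1 / Fintype.card I)))]
    refine (prod_le_prod (fun h _ => sum_nonneg fun b _ => (Real.exp_pos _).le)
      fun h _ => one_block (hr h) i hθ).trans ?_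
    rw [prod_mul_distrib, Fintype.card_piFinset]
    simp only [prod_const, card_univ, Fintype.card_fin, Nat.cast_prod]
    rw [← Real.exp_nat_mul, mul_comm (m:ℝ)]
  have h2 : (#{a ∈ EE I r | ε * m * |θ| ≤ θ * ∑ h, ((a h i : ℝ) / r h - 1 / Fintype.card I)} : ℝ) *
      Real.exp (ε * m * |θ|) ≤ ∑ a ∈ EE I r, Real.exp (θ * ∑ h, ((a h i : ℝ) / r h - 1 / Fintype.card I)) := by
    rw [← nsmul_eq_mul, ← sum_const]
    refine (sum_le_sum fun a ha => ?_).trans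
      (sum_le_sum_of_subset_of_nonneg (filter_subset _ _) fun _ _ _ => (Real.exp_pos _).le)
    exact Real.exp_le_exp.mpr (mem_filter.mp ha).2
  have h3 := h2.trans h1
  have hsq : θ ^ 2 = ε ^ 2 / 4 := by rw [← sq_abs, hθε]; ring
  rw [hθε, hsq, ← le_div_iff₀ (Real.exp_pos _)] at h3
  rw [hθε]
  refine h3.trans (le_of_eq ?_)
  rw [mul_div_assoc, ← Real.exp_sub, mul_comm]
  congr 2; ring

/-- bad exponents -/
noncomputable def bad (I : Type*) [Fintype I] [DecidableEq I] {m : ℕ} (r : Fin m → ℕ) (ε : ℝ) :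
    Finset (Fin m → I → ℕ) :=
  {a ∈ EE I r | ∃ i, ε * m < |∑ h, ((a h i : ℝ) / r h - 1 / Fintype.card I)|}

lemma card_bad {r : Fin m → ℕ} (hr : ∀ h, 1 ≤ r h) {ε : ℝ} (hε : 0 < ε) (hε1 : ε ≤ 2) :
    (#(bad I r ε) : ℝ) ≤ 2 * Fintype.card I * Real.exp (- (ε ^ 2 * m / 4)) * #(EE I r) := by
  classical
  have hsub : bad I r ε ⊆ univ.biUnion fun i : I =>
      ({a ∈ EE I r | ε * m * |ε / 2| ≤ (ε / 2) * ∑ h, ((a h i : ℝ) / r h - 1 / Fintype.card I)} ∪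
      {a ∈ EE I r | ε * m * |-(ε / 2)| ≤ (-(ε / 2)) * ∑ h, ((a h i : ℝ) / r h - 1 / Fintype.card I)}) := by
    intro a ha
    obtain ⟨ha1, i, hi⟩ := mem_filter.mp ha
    rw [mem_biUnion]
    refine ⟨i, mem_univ i, ?_⟩
    rw [mem_union, mem_filter, mem_filter, abs_neg, abs_of_pos (by positivity : (0:ℝ) < ε / 2)]
    rcases lt_abs.mp hi with h | h
    · left; refine ⟨ha1, ?_⟩; nlinarith
    · right; refine ⟨ha1, ?_⟩; nlinarith
  have h1 := (card_le_card hsub).trans card_biUnion_le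
  have h2 : ∀ i ∈ (univ : Finset I), (#({a ∈ EE I r | ε * m * |ε / 2| ≤ (ε / 2) * ∑ h, ((a h i : ℝ) / r h - 1 / Fintype.card I)} ∪
      {a ∈ EE I r | ε * m * |-(ε / 2)| ≤ (-(ε / 2)) * ∑ h, ((a h i : ℝ) / r h - 1 / Fintype.card I)}) : ℝ) ≤
      2 * (Real.exp (- (ε ^ 2 * m / 4)) * #(EE I r)) := by
    intro i _
    have h3 := tail_one hr i (ε := ε) (θ := ε / 2) (by rw [abs_of_pos (by positivity)]; linarith)
      (abs_of_pos (by positivity))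
    have h4 := tail_one hr i (ε := ε) (θ := -(ε / 2)) (by rw [abs_neg, abs_of_pos (by positivity)]; linarith)
      (by rw [abs_neg]; exact abs_of_pos (by positivity))
    have h5 : ((#({a ∈ EE I r | ε * m * |ε / 2| ≤ (ε / 2) * ∑ h, ((a h i : ℝ) / r h - 1 / Fintype.card I)} ∪
      {a ∈ EE I r | ε * m * |-(ε / 2)| ≤ (-(ε / 2)) * ∑ h, ((a h i : ℝ) / r h - 1 / Fintype.card I)}) : ℕ) : ℝ) ≤ _ :=
      Nat.cast_le.mpr (card_union_le _ _)
    push_cast at h5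
    linarith
  have h1' : (#(bad I r ε) : ℝ) ≤ _ := Nat.cast_le.mpr h1
  push_cast at h1'
  refine (h1'.trans (sum_le_sum h2)).trans (le_of_eq ?_)
  simp; ring

lemma card_EE_le {r : Fin m → ℕ} : #(EE I r) ≤ (2 ^ Fintype.card I) ^ (∑ h, r h) := by
  rw [EE, Fintype.card_piFinset, ← Finset.prod_pow_eq_pow_sum]
  refine prod_le_prod' fun h _ => ?_
  have : piAntidiag (univ : Finset I) (r h) ⊆ Fintype.piFinset fun _ => range (r h + 1) := by
    intro b hb
    rw [Fintype.mem_piFinset]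
    intro i
    have := (mem_piAntidiag.mp hb).1
    rw [mem_range, ← this]
    exact Nat.lt_succ_of_le (single_le_sum (fun _ _ => Nat.zero_le _) (mem_univ i))
  refine (card_le_card this).trans ?_
  rw [Fintype.card_piFinset]
  simp only [card_range, prod_const, card_univ]
  rw [← pow_mul, mul_comm, pow_mul]
  exact Nat.pow_le_pow_left (Nat.lt_two_pow_self) _

lemma EE_nonempty [Nonempty I] {r : Fin m → ℕ} : (EE I r).Nonempty := by
  obtain ⟨i⟩ := ‹Nonempty I›
  refine ⟨fun h => Pi.single i (r h), ?_⟩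
  rw [mem_EE]; intro h; simp
end chern
end UE

set_option linter.all false
namespace UE
open Finset MvPolynomial

section siegel
attribute [local instance] Matrix.seminormedAddCommGroup
lemma siegel2 {α β : Type*} [Fintype α] [Fintype β] (A : Matrix α β ℤ) {c : ℝ} (hc : 1 ≤ c)
    (hA : ∀ i j, |(A i j : ℝ)| ≤ c) (hab : 2 * Fintype.card α ≤ Fintype.card β)
    (hb : 0 < Fintype.card β) :
    ∃ t : β → ℤ, t ≠ 0 ∧ A.mulVec t = 0 ∧ ∀ j, |(t j : ℝ)| ≤ Fintype.card β * c := by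
  have hb1 : (1:ℝ) ≤ Fintype.card β := by exact_mod_cast hb
  rcases Nat.eq_zero_or_pos (Fintype.card α) with h0 | h0
  · have := Fintype.card_eq_zero_iff.mp h0
    refine ⟨fun _ => 1, ?_, Subsingleton.elim _ _, fun j => ?_⟩
    · intro h
      obtain ⟨b⟩ := Fintype.card_pos_iff.mp hb
      exact one_ne_zero (congrFun h b)
    · simp; nlinarith
  · obtain ⟨t, ht, hAt, hn⟩ := Int.Matrix.exists_ne_zero_int_vec_norm_le A (by omega) h0
    refine ⟨t, ht, hAt, fun j => ?_⟩
    have h1 : |(t j : ℝ)| ≤ ‖t‖ := by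
      have := norm_le_pi_norm t j
      rwa [Int.norm_eq_abs] at this
    refine (h1.trans hn).trans ?_
    have hAn : max 1 ‖A‖ ≤ c := by
      refine max_le hc ?_
      rw [Matrix.norm_le_iff (by linarith)]
      intro i j
      rw [Int.norm_eq_abs]; exact hA i j
    have hab' : 2 * (Fintype.card α : ℝ) ≤ Fintype.card β := by exact_mod_cast hab
    have ha' : (0:ℝ) < Fintype.card α := by exact_mod_cast h0
    have hm1 : 1 ≤ max 1 ‖A‖ := le_max_left _ _
    calc _ ≤ ((Fintype.card β : ℝ) * max 1 ‖A‖) ^ (1:ℝ) := by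
          apply Real.rpow_le_rpow_of_exponent_le
          · nlinarith
          · rw [div_le_one (by linarith)]; linarith
      _ = (Fintype.card β : ℝ) * max 1 ‖A‖ := Real.rpow_one _
      _ ≤ _ := by gcongr
end siegel

section blk
variable {m : ℕ} {I J R S : Type*} [Fintype I] [Fintype J] [CommRing R] [CommRing S] [Algebra R S]
/-- block weights -/
def bw (m : ℕ) (I : Type*) : Fin m × I → (Fin m → ℕ) := fun p => Pi.single p.1 1
/-- block homogeneous -/
def blk (r : Fin m → ℕ) (q : MvPolynomial (Fin m × I) R) : Prop := IsWeightedHomogeneous (bw m I) q r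

lemma weight_bw (a : Fin m × I →₀ ℕ) (h : Fin m) : Finsupp.weight (bw m I) a h = ∑ i, a (h, i) := by
  classical
  rw [Finsupp.weight_apply, Finsupp.sum_fintype _ _ (by simp), Fintype.sum_prod_type]
  simp only [bw, Finset.sum_apply, Pi.smul_apply, Pi.single_apply, smul_eq_mul, mul_ite, mul_one, mul_zero]
  rw [Finset.sum_eq_single h]
  · simp
  · intro b _ hb; simp [hb.symm]
  · simp

lemma blk_iff {r : Fin m → ℕ} {q : MvPolynomial (Fin m × I) R} :
    blk r q ↔ ∀ a, coeff a q ≠ 0 → ∀ h, ∑ i, a (h, i) = r h := by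
  constructor
  · intro H a ha h
    rw [← weight_bw, H ha]
  · intro H a ha
    ext h; rw [weight_bw, H a ha h]

lemma blk_aeval {r : Fin m → ℕ} {q : MvPolynomial (Fin m × I) R} (hq : blk r q)
    {L : Fin m × I → MvPolynomial (Fin m × J) S} (hL : ∀ p, blk (Pi.single p.1 1) (L p)) :
    blk r (aeval L q) := by
  classical
  rw [q.as_sum, map_sum]
  refine IsWeightedHomogeneous.sum _ _ _ fun a ha => ?_
  rw [aeval_monomial, Finsupp.prod_fintype _ _ (by simp),
    IsScalarTower.algebraMap_apply R S (MvPolynomial _ S), MvPolynomial.algebraMap_eq]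
  refine IsWeightedHomogeneous.C_mul ?_ _
  have h1 := IsWeightedHomogeneous.prod (w := bw m J) univ (fun p => L p ^ a p)
    (fun p => a p • Pi.single p.1 1) (fun p _ => (hL p).pow (a p))
  have h2 : ∑ p, a p • (Pi.single p.1 1 : Fin m → ℕ) = r := by
    have := hq (mem_support_iff.mp ha)
    rw [Finsupp.weight_apply, Finsupp.sum_fintype _ _ (by simp)] at this
    exact this
  rw [h2] at h1
  exact h1

lemma blk_lin {h : Fin m} {c : J → S} : blk (Pi.single h 1) (∑ k, C (c k) * X (h, k) : MvPolynomial (Fin m × J) S) := by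
  refine IsWeightedHomogeneous.sum _ _ _ fun k _ => ?_
  exact IsWeightedHomogeneous.C_mul (isWeightedHomogeneous_X S (bw m J) (h, k)) _
end blk

/-- linear substitution in every block -/
noncomputable def lsub {m : ℕ} {I R : Type*} [Fintype I] [CommRing R] (A : Matrix I I R) :
    MvPolynomial (Fin m × I) R →ₐ[R] MvPolynomial (Fin m × I) R :=
  aeval fun p => ∑ k, C (A p.2 k) * X (p.1, k)

section
variable {m : ℕ} {I : Type*} [Fintype I]

lemma l1_aeval {J : Type*} (L : Fin m × I → MvPolynomial J ℤ) {c : ℝ} (hL : ∀ p, l1 (L p) ≤ c)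
    {r : Fin m → ℕ} {q : MvPolynomial (Fin m × I) ℤ} (hq : blk r q) :
    l1 (aeval L q) ≤ c ^ (∑ h, r h) * l1 q := by
  have h1 := wnorm_aeval_le zabs (β := fun _ => 1) (fun _ => zero_le_one) L q
  have h2 := wnorm_mono zabs (β := fun p => wnorm zabs (fun _ => 1) (L p)) (γ := fun _ => c)
    (fun p => wnorm_nonneg zabs (fun _ => zero_le_one) _) hL q
  refine (h1.trans h2).trans (le_of_eq ?_)
  rw [l1_def, wnorm, mul_sum]
  refine sum_congr rfl fun a ha => ?_
  rw [Finsupp.prod_fintype _ _ (fun _ => pow_zero _), prod_pow_eq_pow_sum, Fintype.sum_prod_type,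
    sum_congr rfl fun h _ => blk_iff.mp hq a (mem_support_iff.mp ha) h, mul_comm, zabs_apply]

lemma l1_lsub (A : Matrix I I ℤ) {c : ℝ} (hc : ∀ i, ∑ k, |(A i k : ℝ)| ≤ c) 
    {r : Fin m → ℕ} {q : MvPolynomial (Fin m × I) ℤ} (hq : blk r q) :
    l1 (lsub A q) ≤ c ^ (∑ h, r h) * l1 q := by
  refine l1_aeval _ (fun p => ?_) hq
  refine (wnorm_sum_le zabs (fun _ => zero_le_one) _ _).trans ((sum_le_sum fun k _ => ?_).trans (hc p.2))
  refine (wnorm_C_mul_le zabs (fun _ => zero_le_one) _ _).trans ?_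
  rw [wnorm_X]; simp

variable [DecidableEq I]
/-- exponent from block function -/
noncomputable def fe (a : Fin m → I → ℕ) : Fin m × I →₀ ℕ := Finsupp.equivFunOnFinite.symm fun p => a p.1 p.2
@[simp] lemma fe_apply (a : Fin m → I → ℕ) (p : Fin m × I) : fe a p = a p.1 p.2 := rfl
lemma fe_inj : Function.Injective (fe : (Fin m → I → ℕ) → (Fin m × I →₀ ℕ)) := by
  intro a b h
  ext x i
  exact DFunLike.congr_fun h (x, i)

theorem aux_poly [Nonempty I] {ι : Type*} [Fintype ι] (A : ι → Matrix I I ℤ) {ε : ℝ} (hε : 0 < ε) (hε2 : ε ≤ 2)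
    {m : ℕ} (hm : Fintype.card ι * (2 * Fintype.card I * Real.exp (- (ε ^ 2 * m / 4))) ≤ 1 / 2)
    {c : ℝ} (hc1 : 1 ≤ c) (hc : ∀ v i, ∑ k, |(A v i k : ℝ)| ≤ c) (r : Fin m → ℕ) (hr : ∀ h, 1 ≤ r h) :
    ∃ P : MvPolynomial (Fin m × I) ℤ, P ≠ 0 ∧ blk r P ∧
      l1 P ≤ (4 ^ Fintype.card I * c) ^ (∑ h, r h) ∧
      ∀ v j, coeff j (lsub (A v) P) ≠ 0 → ∀ i, |∑ h, ((j (h, i) : ℝ) / r h - 1 / Fintype.card I)| ≤ ε * m := by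
  classical
  let M : Matrix (ι × bad I r ε) (EE I r) ℤ := fun x a => coeff (fe x.2.1) (lsub (A x.1) (monomial (fe a.1) 1))
  have hblk : ∀ a ∈ EE I r, ∀ x : ℤ, blk r (monomial (fe a) x) := by
    intro a ha x
    rw [blk_iff]
    intro b hb h
    rw [coeff_monomial] at hb
    have : fe a = b := by by_contra h; simp [h] at hb
    rw [← this]
    exact mem_EE.mp ha h
  have hM : ∀ x a, |(M x a : ℝ)| ≤ c ^ (∑ h, r h) := by
    intro x a
    have h1 := coeff_le_wnorm zabs (β := fun _ => 1) (fun _ => zero_le_one) (lsub (A x.1) (monomial (fe a.1) (1:ℤ))) (fe x.2.1)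
    have h2 := l1_lsub (A x.1) (hc x.1) (hblk a.1 a.2 1)
    have h3 : l1 (monomial (fe a.1) (1:ℤ)) = 1 := by
      rw [l1, wnorm_monomial]; simp [Finsupp.prod]
    rw [h3, mul_one] at h2
    refine le_trans ?_ (h1.trans h2)
    simp [Finsupp.prod, M]
  have hE : 0 < #(EE I r) := card_pos.mpr EE_nonempty
  obtain ⟨t, ht, hMt, htb⟩ := siegel2 M (one_le_pow₀ hc1) hM (by
      have h1 := card_bad (I := I) hr hε hε2
      have h2 : (Fintype.card ι : ℝ) * #(bad I r ε) ≤ 1 / 2 * #(EE I r) := by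
        calc _ ≤ (Fintype.card ι : ℝ) * (2 * Fintype.card I * Real.exp (- (ε ^ 2 * m / 4)) * #(EE I r)) := by gcongr
          _ = Fintype.card ι * (2 * Fintype.card I * Real.exp (- (ε ^ 2 * m / 4))) * #(EE I r) := by ring
          _ ≤ _ := by gcongr
      have h3 : (2:ℝ) * (Fintype.card ι * #(bad I r ε)) ≤ #(EE I r) := by linarith
      have h4 : 2 * (Fintype.card ι * #(bad I r ε)) ≤ #(EE I r) := by exact_mod_cast h3
      simpa using h4) (by simpa using hE)
  let P : MvPolynomial (Fin m × I) ℤ := ∑ a : EE I r, monomial (fe a.1) (t a)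
  have hPc : ∀ a : EE I r, coeff (fe a.1) P = t a := by
    intro a
    simp only [P, coeff_sum, coeff_monomial]
    rw [Finset.sum_eq_single a]
    · simp
    · intro b _ hb; rw [if_neg]; intro h; exact hb (Subtype.ext (fe_inj h))
    · simp
  have hPb : blk r P := IsWeightedHomogeneous.sum _ _ _ fun a _ => hblk a.1 a.2 _
  refine ⟨P, ?_, hPb, ?_, ?_⟩
  · intro h
    apply ht; ext a; rw [← hPc, h]; simp
  · have h1 : l1 P ≤ ∑ a : EE I r, |(t a : ℝ)| := by
      refine (wnorm_sum_le zabs (fun _ => zero_le_one) _ _).trans (sum_le_sum fun a _ => ?_)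
      rw [wnorm_monomial]; simp [Finsupp.prod]
    refine h1.trans ((sum_le_sum fun a _ => htb a).trans ?_)
    have h2 : (#(EE I r) : ℝ) ≤ (2 ^ Fintype.card I) ^ (∑ h, r h) := by exact_mod_cast card_EE_le
    simp only [sum_const, card_univ, Fintype.card_coe, nsmul_eq_mul]
    calc _ = (#(EE I r) : ℝ) * #(EE I r) * c ^ (∑ h, r h) := by ring
      _ ≤ (2 ^ Fintype.card I) ^ (∑ h, r h) * (2 ^ Fintype.card I) ^ (∑ h, r h) * c ^ (∑ h, r h) := by gcongr
      _ = _ := by rw [← mul_pow, ← mul_pow, ← mul_pow]; norm_num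
  · intro v j hj i
    by_contra hcon
    push Not at hcon
    have hjb := blk_iff.mp (blk_aeval hPb (L := fun p => ∑ k, C (A v p.2 k) * X (p.1, k)) (fun p => blk_lin)) j hj
    let b : Fin m → I → ℕ := fun h i => j (h, i)
    have hbj : fe b = j := by ext p; rfl
    have hbE : b ∈ EE I r := mem_EE.mpr hjb
    have hbb : b ∈ bad I r ε := by
      rw [bad, mem_filter]; exact ⟨hbE, i, hcon⟩
    apply hj
    have h1 := congrFun hMt (v, ⟨b, hbb⟩)
    simp only [Matrix.mulVec, dotProduct, M, Pi.zero_apply, hbj] at h1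
    simp only [P, map_sum, coeff_sum]
    rw [← h1]
    refine sum_congr rfl fun a _ => ?_
    have : (monomial (fe a.1) (t a) : MvPolynomial (Fin m × I) ℤ) = C (t a) * monomial (fe a.1) 1 := by
      rw [C_mul_monomial, mul_one]
    rw [this, map_mul, lsub, aeval_C, MvPolynomial.algebraMap_eq, coeff_C_mul, mul_comm]
end
end UE

set_option linter.all false
namespace UE
open Finset MvPolynomial

lemma av_nat {K : Type*} [Field K] (v : AbsoluteValue K ℝ) (n : ℕ) : v (n : K) ≤ n := by
  induction n with
  | zero => simp
  | succ n ih =>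
    push_cast
    refine (v.add_le _ _).trans ?_
    rw [map_one]; linarith

lemma av_int {K : Type*} [Field K] (v : AbsoluteValue K ℝ) (n : ℤ) : v (n : K) ≤ |(n : ℝ)| := by
  rcases Int.eq_nat_or_neg n with ⟨k, rfl | rfl⟩
  · simpa using av_nat v k
  · simpa using av_nat v k

section
variable {m : ℕ} {I J K : Type*} [Fintype I] [Field K]

lemma aeval_smul_blk {r : Fin m → ℕ} {P : MvPolynomial (Fin m × I) ℤ} (hP : blk r P) (d : K)
    (Z : Fin m × I → MvPolynomial J K) :
    aeval (fun p => C d * Z p) P = C (d ^ (∑ h, r h)) * aeval Z P := by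
  rw [P.as_sum, map_sum, map_sum, mul_sum]
  refine sum_congr rfl fun a ha => ?_
  rw [aeval_monomial, aeval_monomial, Finsupp.prod_fintype _ _ (by simp), Finsupp.prod_fintype _ _ (by simp)]
  simp only [mul_pow, prod_mul_distrib]
  have : ∏ p : Fin m × I, (C d : MvPolynomial J K) ^ a p = C (d ^ (∑ h, r h)) := by
    rw [prod_pow_eq_pow_sum, Fintype.sum_prod_type,
      sum_congr rfl fun h _ => blk_iff.mp hP a (mem_support_iff.mp ha) h, map_pow]
  rw [this]; ring

lemma lsub_adj [DecidableEq I] {r : Fin m → ℕ} {P : MvPolynomial (Fin m × I) ℤ} (hP : blk r P)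
    (A : Matrix I I ℤ) (Z : Fin m × I → MvPolynomial J K) :
    aeval (fun p : Fin m × I => ∑ k, C ((A p.2 k : ℤ) : K) * Z (p.1, k)) (lsub A.adjugate P) =
      C ((A.det : K) ^ (∑ h, r h)) * aeval Z P := by
  rw [← aeval_smul_blk hP, lsub, ← AlgHom.restrictScalars_apply ℤ, ← AlgHom.comp_apply]
  refine AlgHom.congr_fun (MvPolynomial.algHom_ext ?_) P
  rintro ⟨h, i⟩
  · simp only [AlgHom.comp_apply, aeval_X, map_sum, map_mul, AlgHom.restrictScalars_apply]
    have e : ∀ x : I, aeval (R := ℤ) (fun p : Fin m × I => ∑ k, C ((A p.2 k : ℤ) : K) * Z (p.1, k))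
        (C (A.adjugate i x)) = (C ((A.adjugate i x : ℤ) : K) : MvPolynomial J K) := by
      intro x; simp
    simp only [e, mul_sum]
    rw [sum_comm]
    have h2 : ∀ k, ∑ x, (C ((A.adjugate i x : ℤ) : K) * (C ((A x k : ℤ) : K) * Z (h, k)) : MvPolynomial J K) =
        C (((A.adjugate * A) i k : ℤ) : K) * Z (h, k) := by
      intro k
      rw [Matrix.mul_apply]
      push_cast
      rw [map_sum, sum_mul]
      refine sum_congr rfl fun x _ => ?_
      rw [map_mul]; ring
    simp only [h2, Matrix.adjugate_mul, Matrix.smul_apply, Matrix.one_apply, smul_eq_mul]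
    rw [sum_eq_single i (fun k _ hk => by simp [Ne.symm hk]) (by simp)]
    simp

lemma wnorm_intpoly_le (v : AbsoluteValue K ℝ) {σ : Type*} [Fintype σ] {γ : σ → ℝ} (hγ : ∀ i, 0 ≤ γ i)
    (q : MvPolynomial σ ℤ) {E : ℝ} (hE : ∀ a, coeff a q ≠ 0 → ∏ i, γ i ^ a i ≤ E) :
    wnorm v γ (map (Int.castRingHom K) q) ≤ l1 q * E := by
  rw [wnorm_eq_of_subset v _ q.support (support_map_subset _ _), l1_def, sum_mul]
  refine sum_le_sum fun a ha => ?_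
  rw [coeff_map, Finsupp.prod_fintype _ _ (by simp)]
  exact mul_le_mul (av_int v _) (hE a (mem_support_iff.mp ha)) (prod_nonneg fun i _ => pow_nonneg (hγ i) _)
    (abs_nonneg _)

lemma wnorm_aeval_int_le (v : AbsoluteValue K ℝ) {σ : Type*} [Fintype σ] {β : J → ℝ} (hβ : ∀ i, 0 ≤ β i)
    {γ : σ → ℝ} {Y : σ → MvPolynomial J K} (hY : ∀ i, wnorm v β (Y i) ≤ γ i)
    (q : MvPolynomial σ ℤ) {E : ℝ} (hE : ∀ a, coeff a q ≠ 0 → ∏ i, γ i ^ a i ≤ E) :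
    wnorm v β (aeval Y q) ≤ l1 q * E := by
  have h1 : aeval Y q = aeval Y (map (Int.castRingHom K) q) := by
    rw [aeval_def, aeval_def, eval₂_map]
    congr 1
  rw [h1]
  refine (wnorm_aeval_le v hβ _ _).trans ?_
  refine (wnorm_mono v (fun i => wnorm_nonneg v hβ _) hY _).trans ?_
  exact wnorm_intpoly_le v (fun i => (wnorm_nonneg v hβ _).trans (hY i)) q hE
end

/-- generic point -/
noncomputable def gp {m : ℕ} {I κ K : Type*} [Fintype κ] [DecidableEq I] [CommRing K] (y : Fin m → κ → I → K)
    (l : Fin m → I) (p : Fin m × I) : MvPolynomial (Fin m × Option κ) K :=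
  ∑ k, C (y p.1 k p.2) * X (p.1, some k) + (if p.2 = l p.1 then X (p.1, none) else 0)

lemma coeff_mem {m : ℕ} {I κ K : Type*} [Fintype I] [Fintype κ] [DecidableEq I] [Field K] (O : Subring K)
    (y : Fin m → κ → I → K) (hy : ∀ h k i, y h k i ∈ O) (l : Fin m → I) (P : MvPolynomial (Fin m × I) ℤ)
    (a : Fin m × Option κ →₀ ℕ) : coeff a (aeval (gp y l) P) ∈ O := by
  let y' : Fin m → κ → I → O := fun h k i => ⟨y h k i, hy h k i⟩
  have h1 : aeval (gp y l) P = map O.subtype (aeval (gp y' l) P) := by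
    rw [show (aeval (gp y l) P : MvPolynomial (Fin m × Option κ) K) =
      (aeval (R := ℤ) (gp y l) : _ →ₐ[ℤ] _).toRingHom P from rfl,
      show map O.subtype (aeval (gp y' l) P : MvPolynomial (Fin m × Option κ) O) =
      ((map O.subtype).comp (aeval (R := ℤ) (gp y' l) : _ →ₐ[ℤ] _).toRingHom) P from rfl]
    refine RingHom.congr_fun (MvPolynomial.ringHom_ext ?_ ?_) P
    · intro n; simp
    · intro p
      simp only [AlgHom.toRingHom_eq_coe, RingHom.coe_coe, aeval_X, RingHom.comp_apply, gp, map_add, map_sum,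
        map_mul, map_C, map_X]
      congr 1
      split_ifs <;> simp
  rw [h1, coeff_map]
  exact Subtype.property _

end UE

set_option linter.all false
namespace UE
open Finset MvPolynomial

section
variable {m : ℕ} {I κ K : Type*} [Fintype I] [DecidableEq I] [Fintype κ] [Field K]

lemma gp_comb (A : Matrix I I ℤ) (y : Fin m → κ → I → K) (l : Fin m → I) (h : Fin m) (i : I) :
    (∑ k', C ((A i k' : ℤ) : K) * gp y l (h, k')) =
      ∑ k, C (∑ k', ((A i k' : ℤ) : K) * y h k k') * X (h, some k) + C ((A i (l h) : ℤ) : K) * X (h, none) := by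
  simp only [gp, mul_add, sum_add_distrib, mul_sum]
  congr 1
  · rw [sum_comm]
    refine sum_congr rfl fun k _ => ?_
    rw [map_sum, sum_mul]
    refine sum_congr rfl fun k' _ => ?_
    rw [map_mul]; ring
  · rw [sum_eq_single (l h)]
    · simp
    · intro b _ hb; simp [hb]
    · simp

lemma gp_wnorm (v : AbsoluteValue K ℝ) (A : Matrix I I ℤ) (y : Fin m → κ → I → K) (l : Fin m → I)
    (b : Fin m → κ → ℝ) (hb : ∀ h k, 0 < b h k) (c : I → ℝ) (q : Fin m → ℝ) (hq : ∀ h, 0 < q h) (C1 C2 : ℝ)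
    (hC1 : ∀ i, |c i| ≤ C1) (hC2 : ∀ i k, (Fintype.card κ : ℝ) + |(A i k : ℝ)| ≤ C2)
    (hy : ∀ h k i, v (∑ k', ((A i k' : ℤ) : K) * y h k k') ≤ b h k * Real.exp (c i * q h)) (h : Fin m) (i : I) :
    wnorm v (fun p : Fin m × Option κ => p.2.elim (Real.exp (-(C1 * q p.1))) fun k => (b p.1 k)⁻¹)
      (∑ k', C ((A i k' : ℤ) : K) * gp y l (h, k')) ≤ C2 * Real.exp (c i * q h) := by
  set β : Fin m × Option κ → ℝ := fun p => p.2.elim (Real.exp (-(C1 * q p.1))) fun k => (b p.1 k)⁻¹ with hβd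
  have hβ : ∀ p, 0 ≤ β p := by
    rintro ⟨h, _ | k⟩
    · exact (Real.exp_pos _).le
    · exact (inv_pos.mpr (hb h k)).le
  rw [gp_comb]
  have h1 : wnorm v β (∑ k, C (∑ k', ((A i k' : ℤ) : K) * y h k k') * X (h, some k)) ≤
      Fintype.card κ * Real.exp (c i * q h) := by
    refine (wnorm_sum_le v hβ _ _).trans ?_
    refine (sum_le_card_nsmul _ _ (Real.exp (c i * q h)) fun k _ => ?_).trans ?_
    · refine (wnorm_C_mul_le v hβ _ _).trans ?_
      rw [wnorm_X]
      show _ * (b h k)⁻¹ ≤ _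
      rw [← div_eq_mul_inv, div_le_iff₀ (hb h k), mul_comm]
      exact hy h k i
    · simp
  have h2 : wnorm v β (C ((A i (l h) : ℤ) : K) * X (h, none)) ≤ |(A i (l h) : ℝ)| * Real.exp (c i * q h) := by
    refine (wnorm_C_mul_le v hβ _ _).trans ?_
    rw [wnorm_X]
    refine mul_le_mul (av_int v _) ?_ (hβ _) (abs_nonneg _)
    refine Real.exp_le_exp.mpr ?_
    have := (abs_le.mp (hC1 i)).1
    nlinarith [hq h]
  refine (wnorm_add_le v hβ _ _).trans ((add_le_add h1 h2).trans ?_)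
  rw [← add_mul]
  exact mul_le_mul_of_nonneg_right (hC2 i (l h)) (Real.exp_pos _).le

lemma exp_est {r : Fin m → ℕ} (hr : ∀ h, 1 ≤ r h) (j : Fin m → I → ℕ) (hj : ∀ h, ∑ i, j h i = r h)
    {ε L : ℝ} (hε : 0 < ε) (hL : 0 < L) {N : ℝ}
    (hj2 : ∀ i, |∑ h, ((j h i : ℝ) / r h - 1 / N)| ≤ ε * m)
    (q : Fin m → ℝ) (hq1 : ∀ h, L ≤ r h * q h) (hq2 : ∀ h, r h * q h ≤ (1 + ε) * L) (i : I) :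
    |∑ h, q h * j h i - L * m / N| ≤ 2 * ε * m * L := by
  have hr0 : ∀ h, (0 : ℝ) < r h := fun h => by exact_mod_cast hr h
  have e1 : ∑ h, q h * j h i - L * m / N = ∑ h, (r h * q h - L) * ((j h i : ℝ) / r h) +
      L * ∑ h, ((j h i : ℝ) / r h - 1 / N) := by
    rw [mul_sum, ← sum_add_distrib]
    have : L * m / N = ∑ h : Fin m, L * (1 / N) := by simp; ring
    rw [this, ← sum_sub_distrib]
    refine sum_congr rfl fun h _ => ?_
    have := (hr0 h).ne'
    field_simp; ring
  have e2 : |∑ h, (r h * q h - L) * ((j h i : ℝ) / r h)| ≤ m * (ε * L) := by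
    refine (abs_sum_le_sum_abs _ _).trans ((sum_le_card_nsmul _ _ (ε * L) fun h _ => ?_).trans (by simp))
    have h1 : 0 ≤ r h * q h - L := by linarith [hq1 h]
    have h2 : (j h i : ℝ) / r h ≤ 1 := by
      rw [div_le_one (hr0 h)]
      rw [← hj h]
      exact_mod_cast single_le_sum (f := fun i => j h i) (fun _ _ => Nat.zero_le _) (mem_univ i)
    have h3 : 0 ≤ (j h i : ℝ) / r h := by positivity
    rw [abs_of_nonneg (mul_nonneg h1 h3)]
    nlinarith [hq2 h]
  rw [e1]
  refine (abs_add_le _ _).trans ?_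
  rw [abs_mul, abs_of_pos hL]
  nlinarith [hj2 i, mul_le_mul_of_nonneg_left (hj2 i) hL.le]

lemma place_bound (v : AbsoluteValue K ℝ) (A : Matrix I I ℤ) (hd : (A.det : K) ≠ 0)
    {r : Fin m → ℕ} (hr : ∀ h, 1 ≤ r h) {P : MvPolynomial (Fin m × I) ℤ} (hP : blk r P)
    {ε L : ℝ} (hε : 0 < ε) (hε1 : ε ≤ 1) (hL : 0 < L)
    (hP2 : ∀ j, coeff j (lsub A.adjugate P) ≠ 0 →
      ∀ i, |∑ h, ((j (h, i) : ℝ) / r h - 1 / Fintype.card I)| ≤ ε * m)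
    (y : Fin m → κ → I → K) (l : Fin m → I)
    (b : Fin m → κ → ℝ) (hb : ∀ h k, 0 < b h k) (c : I → ℝ) (q : Fin m → ℝ) (hq : ∀ h, 0 < q h)
    (hq1 : ∀ h, L ≤ r h * q h) (hq2 : ∀ h, r h * q h ≤ (1 + ε) * L) (C1 C2 : ℝ)
    (hC1 : ∀ i, |c i| ≤ C1) (hC2 : ∀ i k, (Fintype.card κ : ℝ) + |(A i k : ℝ)| ≤ C2) (hC20 : 1 ≤ C2)
    (hC2d : 1 ≤ v (A.det : K) * C2)
    (hC2l : l1 (lsub A.adjugate P) ≤ C2 ^ (∑ h, r h)) (hC10 : 0 ≤ C1)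
    (hy : ∀ h k i, v (∑ k', ((A i k' : ℤ) : K) * y h k k') ≤ b h k * Real.exp (c i * q h))
    (a : Fin m × Option κ →₀ ℕ) {σ : ℝ} (ha : ∑ h, (a (h, none) : ℝ) * (1 / r h) < σ) :
    v (coeff a (aeval (gp y l) P)) ≤ (C2 ^ (∑ h, r h)) ^ 3 *
      Real.exp (L * (m / Fintype.card I * ∑ i, c i + 2 * ε * m * Fintype.card I * C1 + 2 * C1 * σ)) *
      ∏ h, ∏ k, b h k ^ a (h, some k) := by
  set β : Fin m × Option κ → ℝ := fun p => p.2.elim (Real.exp (-(C1 * q p.1))) fun k => (b p.1 k)⁻¹ with hβd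
  have hβ : ∀ p, 0 ≤ β p := by
    rintro ⟨h, _ | k⟩
    · exact (Real.exp_pos _).le
    · exact (inv_pos.mpr (hb h k)).le
  set F := (aeval (gp y l) P : MvPolynomial (Fin m × Option κ) K) with hF
  have hbl : blk r (lsub A.adjugate P) := blk_aeval hP (L := fun p => ∑ k, C (A.adjugate p.2 k) * X (p.1, k)) (fun p => blk_lin)
  have h1 := lsub_adj (K := K) hP A (gp y l)
  set R := ∑ h, r h with hR
  set E : ℝ := L * (m / Fintype.card I * ∑ i, c i + 2 * ε * m * Fintype.card I * C1) with hE
  have hr0 : ∀ h, (0 : ℝ) < r h := fun h => by exact_mod_cast hr h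
  have h2 : wnorm v β (aeval (fun p : Fin m × I => ∑ k, C ((A p.2 k : ℤ) : K) * gp y l (p.1, k)) (lsub A.adjugate P))
      ≤ l1 (lsub A.adjugate P) * (C2 ^ R * Real.exp E) := by
    refine wnorm_aeval_int_le v hβ (γ := fun p => C2 * Real.exp (c p.2 * q p.1))
      (fun p => gp_wnorm v A y l b hb c q hq C1 C2 hC1 hC2 hy p.1 p.2) _ ?_
    intro j hj
    have hjs := blk_iff.mp hbl j hj
    simp only [mul_pow, prod_mul_distrib]
    rw [prod_pow_eq_pow_sum, Fintype.sum_prod_type, sum_congr rfl fun h _ => hjs h]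
    refine mul_le_mul_of_nonneg_left ?_ (by positivity)
    simp only [← Real.exp_nat_mul]
    rw [← Real.exp_sum, Fintype.sum_prod_type, sum_comm]
    refine Real.exp_le_exp.mpr ?_
    have e1 : ∀ i, ∑ h, (j (h, i) : ℝ) * (c i * q h) ≤ L * m / Fintype.card I * c i + 2 * ε * m * L * C1 := by
      intro i
      have h3 := exp_est hr (fun h i => j (h, i)) hjs hε hL (hP2 j hj) q hq1 hq2 i
      have h4 : ∑ h, (j (h, i) : ℝ) * (c i * q h) = L * m / Fintype.card I * c i +
        c i * (∑ h, q h * j (h, i) - L * m / Fintype.card I) := by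
        rw [mul_sub, mul_sum]
        have : ∑ h, (j (h, i) : ℝ) * (c i * q h) = ∑ h, c i * (q h * j (h, i)) :=
          sum_congr rfl fun h _ => by ring
        rw [this]; ring
      rw [h4]
      have h5 := (le_abs_self (c i * (∑ h, q h * j (h, i) - L * m / Fintype.card I)))
      rw [abs_mul] at h5
      have h6 := mul_le_mul (hC1 i) h3 (abs_nonneg _) hC10
      linarith
    refine (sum_le_sum fun i _ => e1 i).trans ?_
    rw [sum_add_distrib, ← mul_sum, hE]
    simp only [sum_const, card_univ, nsmul_eq_mul]
    apply le_of_eq; ring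
  rw [h1] at h2
  have h3 : v ((A.det : K) ^ R) * (v (coeff a F) * a.prod fun i k => β i ^ k) ≤
      l1 (lsub A.adjugate P) * (C2 ^ R * Real.exp E) := by
    refine le_trans ?_ h2
    have := coeff_le_wnorm v hβ (C ((A.det : K) ^ R) * F) a
    rwa [coeff_C_mul, map_mul, mul_assoc] at this
  have h4 : (a.prod fun i k => β i ^ k) = Real.exp (-(C1 * ∑ h, q h * a (h, none))) *
      (∏ h, ∏ k, b h k ^ a (h, some k))⁻¹ := by
    rw [Finsupp.prod_fintype _ _ (by simp), Fintype.prod_prod_type]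
    simp only [Fintype.prod_option, prod_mul_distrib]
    congr 1
    · show ∏ h, Real.exp (-(C1 * q h)) ^ a (h, none) = _
      simp only [← Real.exp_nat_mul]
      rw [← Real.exp_sum, mul_sum, ← sum_neg_distrib]
      congr 1
      exact sum_congr rfl fun h _ => by ring
    · rw [← prod_inv_distrib]
      refine prod_congr rfl fun h _ => ?_
      rw [← prod_inv_distrib]
      refine prod_congr rfl fun k _ => ?_
      show (b h k)⁻¹ ^ _ = _
      rw [inv_pow]
  have h5 : C1 * ∑ h, q h * a (h, none) ≤ 2 * C1 * σ * L := by
    have : ∑ h, q h * a (h, none) ≤ 2 * L * ∑ h, (a (h, none) : ℝ) * (1 / r h) := by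
      rw [mul_sum]
      refine sum_le_sum fun h _ => ?_
      have e : q h * a (h, none) = (r h * q h) * (a (h, none) * (1 / r h)) := by
        have := (hr0 h).ne'
        field_simp
      rw [e]
      refine mul_le_mul_of_nonneg_right ?_ (by positivity)
      nlinarith [hq2 h]
    have h6 : ∑ h, q h * a (h, none) ≤ 2 * L * σ := this.trans (by nlinarith)
    nlinarith
  set B := ∏ h, ∏ k, b h k ^ a (h, some k) with hB
  have hB0 : 0 < B := prod_pos fun h _ => prod_pos fun k _ => pow_pos (hb h k) _
  have h6 : 1 ≤ (v (A.det : K)) ^ R * C2 ^ R := by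
    rw [← mul_pow]; exact one_le_pow₀ hC2d
  have hvF := v.nonneg (coeff a F)
  rw [h4, map_pow] at h3
  have h7 : Real.exp (-(2 * C1 * σ * L)) ≤ Real.exp (-(C1 * ∑ h, q h * a (h, none))) :=
    Real.exp_le_exp.mpr (by linarith)
  have hX : (0 : ℝ) < C2 ^ R := by positivity
  calc v (coeff a F) = 1 * v (coeff a F) * 1 := by ring
    _ ≤ ((v (A.det : K)) ^ R * C2 ^ R) * v (coeff a F) *
        (Real.exp (2 * C1 * σ * L) * Real.exp (-(C1 * ∑ h, q h * a (h, none)))) := by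
        refine mul_le_mul (mul_le_mul_of_nonneg_right h6 hvF) ?_ zero_le_one (by positivity)
        rw [← Real.exp_add]
        exact Real.one_le_exp (by linarith)
    _ = (v (A.det : K) ^ R * (v (coeff a F) * (Real.exp (-(C1 * ∑ h, q h * a (h, none))) * B⁻¹))) *
        (C2 ^ R * Real.exp (2 * C1 * σ * L) * B) := by
        field_simp
    _ ≤ (C2 ^ R * (C2 ^ R * Real.exp E)) * (C2 ^ R * Real.exp (2 * C1 * σ * L) * B) := by
        refine mul_le_mul_of_nonneg_right (h3.trans ?_) (by positivity)
        exact mul_le_mul_of_nonneg_right hC2l (by positivity)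
    _ = (C2 ^ R) ^ 3 * (Real.exp E * Real.exp (2 * C1 * σ * L)) * B := by ring
    _ = _ := by
        rw [← Real.exp_add, hE]
        congr 3
        ring

theorem vanish {ι : Type*} [Fintype ι] (av : ι → AbsoluteValue K ℝ) (O : Subring K)
    (pf : ∀ x ∈ O, x ≠ 0 → 1 ≤ ∏ v, av v x) (A : ι → Matrix I I ℤ) (hd : ∀ v, ((A v).det : K) ≠ 0)
    {r : Fin m → ℕ} (hr : ∀ h, 1 ≤ r h) {P : MvPolynomial (Fin m × I) ℤ} (hP : blk r P)
    {ε L : ℝ} (hε : 0 < ε) (hε1 : ε ≤ 1) (hL : 0 < L)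
    (hP2 : ∀ v j, coeff j (lsub (A v).adjugate P) ≠ 0 →
      ∀ i, |∑ h, ((j (h, i) : ℝ) / r h - 1 / Fintype.card I)| ≤ ε * m)
    (y : Fin m → κ → I → K) (hyO : ∀ h k i, y h k i ∈ O) (l : Fin m → I)
    (b : Fin m → ι → κ → ℝ) (hb : ∀ h v k, 0 < b h v k) (hb1 : ∀ h k, ∏ v, b h v k ≤ 1)
    (c : ι → I → ℝ) {δ : ℝ} (hc : ∑ v, ∑ i, c v i ≤ -δ) (q : Fin m → ℝ) (hq : ∀ h, 0 < q h)
    (hq1 : ∀ h, L ≤ r h * q h) (hq2 : ∀ h, r h * q h ≤ (1 + ε) * L) (C1 C2 : ℝ)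
    (hC1 : ∀ v i, |c v i| ≤ C1) (hC2 : ∀ v i k, (Fintype.card κ : ℝ) + |(A v i k : ℝ)| ≤ C2) (hC20 : 1 ≤ C2)
    (hC2d : ∀ v, 1 ≤ av v ((A v).det : K) * C2)
    (hC2l : ∀ v, l1 (lsub (A v).adjugate P) ≤ C2 ^ (∑ h, r h)) (hC10 : 0 ≤ C1)
    (hy : ∀ h v k i, av v (∑ k', ((A v i k' : ℤ) : K) * y h k k') ≤ b h v k * Real.exp (c v i * q h))
    {σ q0 : ℝ} (hq0 : 0 < q0) (hq0' : ∀ h, q0 ≤ q h)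
    (hfin : -(δ * (m / Fintype.card I)) + Fintype.card ι * (2 * ε * m * Fintype.card I * C1 + 2 * C1 * σ +
      6 * Real.log C2 * m / q0) < 0)
    (a : Fin m × Option κ →₀ ℕ) (ha : ∑ h, (a (h, none) : ℝ) * (1 / r h) < σ) :
    coeff a (aeval (gp y l) P) = 0 := by
  by_contra hne
  have h1 := pf _ (coeff_mem O y hyO l P a) hne
  set R := ∑ h, r h with hR
  have h2 : ∏ v, av v (coeff a (aeval (gp y l) P)) ≤
      ∏ v, ((C2 ^ R) ^ 3 *
      Real.exp (L * (m / Fintype.card I * ∑ i, c v i + 2 * ε * m * Fintype.card I * C1 + 2 * C1 * σ)) *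
      ∏ h, ∏ k, b h v k ^ a (h, some k)) :=
    prod_le_prod (fun v _ => (av v).nonneg _) fun v _ => place_bound (av v) (A v) (hd v) hr hP hε hε1 hL (hP2 v) y l
      (fun h k => b h v k) (fun h k => hb h v k) (c v) q hq hq1 hq2 C1 C2 (hC1 v) (hC2 v) hC20 (hC2d v) (hC2l v)
      hC10 (fun h k i => hy h v k i) a ha
  have h3 : ∏ v, ∏ h, ∏ k, b h v k ^ a (h, some k) ≤ 1 := by
    rw [prod_comm]
    refine prod_le_one (fun h _ => prod_nonneg fun v _ => prod_nonneg fun k _ => pow_nonneg (hb h v k).le _) fun h _ => ?_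
    rw [prod_comm]
    refine prod_le_one (fun k _ => prod_nonneg fun v _ => pow_nonneg (hb h v k).le _) fun k _ => ?_
    rw [prod_pow]
    exact pow_le_one₀ (prod_nonneg fun v _ => (hb h v k).le) (hb1 h k)
  have hlog : 0 ≤ Real.log C2 := Real.log_nonneg hC20
  have hRb : (R : ℝ) ≤ 2 * L * m / q0 := by
    rw [hR]; push_cast
    refine (sum_le_card_nsmul _ _ (2 * L / q0) fun h _ => ?_).trans (by simp; apply le_of_eq; ring)
    rw [le_div_iff₀ hq0]
    have : (r h : ℝ) * q0 ≤ r h * q h := mul_le_mul_of_nonneg_left (hq0' h) (Nat.cast_nonneg _)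
    nlinarith [hq2 h]
  rw [prod_mul_distrib, prod_mul_distrib, ← Real.exp_sum, prod_const, card_univ] at h2
  have h4 : (C2 ^ R) ^ 3 = Real.exp (3 * R * Real.log C2) := by
    rw [← pow_mul, ← Real.rpow_natCast, Real.rpow_def_of_pos (by linarith)]
    push_cast; ring_nf
  rw [h4, ← Real.exp_nat_mul, ← Real.exp_add] at h2
  have h5 : ∀ x : ℝ, x < 0 → Real.exp x * ∏ v, ∏ h, ∏ k, b h v k ^ a (h, some k) < 1 := by
    intro x hx
    have := Real.exp_lt_one_iff.mpr hx
    have h6 := mul_le_mul_of_nonneg_left h3 (Real.exp_pos x).le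
    linarith
  refine absurd (h1.trans h2) (not_le.mpr (h5 _ ?_))
  rw [← mul_sum]
  simp only [sum_add_distrib, ← mul_sum, sum_const, card_univ, nsmul_eq_mul]
  have h6 : (Fintype.card ι : ℝ) * (3 * R * Real.log C2) ≤ L * (Fintype.card ι * (6 * Real.log C2 * m / q0)) := by
    have : (Fintype.card ι : ℝ) * (3 * R * Real.log C2) ≤ Fintype.card ι * (3 * (2 * L * m / q0) * Real.log C2) := by
      gcongr
    refine this.trans (le_of_eq ?_)
    ring
  have h7 : (m : ℝ) / Fintype.card I * ∑ v, ∑ i, c v i ≤ m / Fintype.card I * (-δ) :=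
    mul_le_mul_of_nonneg_left hc (by positivity)
  have h8 := mul_neg_of_pos_of_neg hL hfin
  have h9 := mul_le_mul_of_nonneg_left h7 hL.le
  nlinarith
end
end UE

set_option linter.all false
namespace UE
open Finset MvPolynomial

section
variable {m : ℕ} {I κ K : Type*} [Fintype I] [DecidableEq I] [Fintype κ] [Field K]

/-- exponent at the distinguished index -/
noncomputable def lv (l : Fin m → I) (a : Fin m × I →₀ ℕ) : Fin m →₀ ℕ :=
  Finsupp.equivFunOnFinite.symm fun h => a (h, l h)

/-- exponents at the remaining indices -/
noncomputable def oth (l j0 : Fin m → I) (a : Fin m × I →₀ ℕ) : Fin m × I →₀ ℕ :=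
  a.filter fun p => p.2 ≠ l p.1 ∧ p.2 ≠ j0 p.1

/-- the restricted polynomial -/
noncomputable def rp (l j0 : Fin m → I) (P : MvPolynomial (Fin m × I) ℤ) (β : Fin m × I →₀ ℕ) :
    MvPolynomial (Fin m) ℤ :=
  ∑ a ∈ P.support.filter (fun a => oth l j0 a = β), monomial (lv l a) (coeff a P)

lemma lv_oth_inj {l j0 : Fin m → I} (hlj : ∀ h, j0 h ≠ l h) {r : Fin m → ℕ} {a a' : Fin m × I →₀ ℕ}
    (h1 : ∀ h, ∑ i, a (h, i) = r h) (h2 : ∀ h, ∑ i, a' (h, i) = r h) (h3 : lv l a = lv l a')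
    (h4 : oth l j0 a = oth l j0 a') : a = a' := by
  have h5 : ∀ h i, i ≠ j0 h → a (h, i) = a' (h, i) := by
    intro h i hi
    by_cases hil : i = l h
    · subst hil; exact DFunLike.congr_fun h3 h
    · have := DFunLike.congr_fun h4 (h, i)
      rwa [oth, oth, Finsupp.filter_apply_pos _ _ (by exact ⟨hil, hi⟩), Finsupp.filter_apply_pos _ _ (by exact ⟨hil, hi⟩)] at this
  refine Finsupp.ext ?_
  rintro ⟨h, i⟩
  by_cases hi : i = j0 h
  · subst hi
    have := (h1 h).trans (h2 h).symm
    rw [← add_sum_erase _ _ (mem_univ (j0 h)), ← add_sum_erase _ _ (mem_univ (j0 h)),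
      sum_congr rfl fun i hi => h5 h i (ne_of_mem_erase hi)] at this
    omega
  · exact h5 h i hi

lemma rp_ne {l j0 : Fin m → I} (hlj : ∀ h, j0 h ≠ l h) {r : Fin m → ℕ} {P : MvPolynomial (Fin m × I) ℤ}
    (hP : blk r P) {a : Fin m × I →₀ ℕ} (ha : coeff a P ≠ 0) : rp l j0 P (oth l j0 a) ≠ 0 := by
  intro h0
  have h1 : coeff (lv l a) (rp l j0 P (oth l j0 a)) = coeff a P := by
    rw [rp, coeff_sum, sum_eq_single a]
    · simp
    · intro b hb hba
      rw [mem_filter] at hb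
      rw [coeff_monomial, if_neg]
      intro h2
      exact hba (lv_oth_inj hlj (blk_iff.mp hP b (mem_support_iff.mp hb.1)) (blk_iff.mp hP a ha) h2 hb.2)
    · intro h2
      exact (h2 (mem_filter.mpr ⟨mem_support_iff.mpr ha, rfl⟩)).elim
  rw [h0, coeff_zero] at h1
  exact ha h1.symm

lemma rp_bd {l j0 : Fin m → I} {r : Fin m → ℕ} {P : MvPolynomial (Fin m × I) ℤ}
    (hP : blk r P) (β : Fin m × I →₀ ℕ) : bd (fun h => (r h : ℝ)) (rp l j0 P β) := by
  intro n hn h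
  rw [rp, coeff_sum] at hn
  obtain ⟨a, ha, ha'⟩ := exists_ne_zero_of_sum_ne_zero hn
  rw [coeff_monomial] at ha'
  have h1 : lv l a = n := by
    by_contra h; rw [if_neg h] at ha'; exact ha' rfl
  show (n h : ℝ) ≤ r h
  rw [← h1, ← blk_iff.mp hP a (mem_support_iff.mp (mem_filter.mp ha).1) h]
  exact_mod_cast single_le_sum (f := fun i => a (h, i)) (fun _ _ => Nat.zero_le _) (mem_univ (l h))

lemma rp_l1 (l j0 : Fin m → I) (P : MvPolynomial (Fin m × I) ℤ)
    (β : Fin m × I →₀ ℕ) : l1 (rp l j0 P β) ≤ l1 P := by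
  rw [l1, rp]
  refine (wnorm_sum_le zabs (fun _ => zero_le_one) _ _).trans ?_
  rw [l1_def]
  refine (sum_le_sum_of_subset_of_nonneg (filter_subset _ _) fun a _ _ => wnorm_nonneg zabs (fun _ => zero_le_one) _).trans ?_
  refine sum_le_sum fun a _ => ?_
  rw [wnorm_monomial]
  simp

/-- auxiliary free coordinates -/
noncomputable def wz (K : Type*) [Field K] (l j0 : Fin m → I) (p : Fin m × I) : MvPolynomial (Fin m × I) K :=
  if p.2 = l p.1 then 0 else if p.2 = j0 p.1 then 1 else X p

/-- point of the hyperplane plus a free direction -/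
noncomputable def Gp (l j0 : Fin m → I) (M : Fin m → I → K) (p : Fin m × I) :
    MvPolynomial (Fin m) (MvPolynomial (Fin m × I) K) :=
  C (wz K l j0 p) + if p.2 = l p.1 then X p.1 - C (∑ i, C (M p.1 i) * wz K l j0 (p.1, i)) else 0

lemma Gp_monomial {l j0 : Fin m → I} (hlj : ∀ h, j0 h ≠ l h) (M : Fin m → I → K) (a : Fin m × I →₀ ℕ) :
    ∏ p, Gp l j0 M p ^ a p = C (monomial (oth l j0 a) (1 : K)) *
      ∏ h, (X h - C (∑ i, C (M h i) * wz K l j0 (h, i))) ^ lv l a h := by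
  have h1 : (monomial (oth l j0 a) (1 : K)) = ∏ p : Fin m × I, X p ^ oth l j0 a p := by
    rw [monomial_eq, Finsupp.prod_fintype _ _ (by simp), C_1, one_mul]
  have h2 : ∏ h, (X h - C (∑ i, C (M h i) * wz K l j0 (h, i)) : MvPolynomial (Fin m) (MvPolynomial (Fin m × I) K)) ^ lv l a h
    = ∏ p : Fin m × I, if p.2 = l p.1 then
      (X p.1 - C (∑ i, C (M p.1 i) * wz K l j0 (p.1, i))) ^ a p else 1 := by
    rw [Fintype.prod_prod_type]
    refine prod_congr rfl fun h _ => ?_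
    rw [prod_eq_single (l h)]
    · simp [lv]
    · intro i _ hi; simp [hi]
    · simp
  rw [h1, h2, map_prod, ← prod_mul_distrib]
  refine prod_congr rfl fun p _ => ?_
  obtain ⟨h, i⟩ := p
  by_cases h3 : i = l h
  · subst h3
    have : oth l j0 a (h, l h) = 0 := Finsupp.filter_apply_neg _ _ (by simp)
    simp [Gp, this, wz]
  · by_cases h4 : i = j0 h
    · subst h4
      have : oth l j0 a (h, j0 h) = 0 := Finsupp.filter_apply_neg _ _ (by simp)
      simp [Gp, this, wz, h3]
    · have : oth l j0 a (h, i) = a (h, i) := Finsupp.filter_apply_pos _ _ (by exact ⟨h3, h4⟩)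
      simp [Gp, this, wz, h3, h4]

lemma coeff_Gp {l j0 : Fin m → I} (hlj : ∀ h, j0 h ≠ l h) (M : Fin m → I → K) (P : MvPolynomial (Fin m × I) ℤ)
    (β : Fin m × I →₀ ℕ) (hβ : ∀ a, coeff a P ≠ 0 → β.degree ≤ (oth l j0 a).degree) (n : Fin m →₀ ℕ) :
    coeff β (coeff n (aeval (Gp l j0 M) P)) = coeff n (shift (fun h => - M h (j0 h)) (rp l j0 P β)) := by
  have hz : ∀ h, constantCoeff (∑ i, C (M h i) * wz K l j0 (h, i)) = M h (j0 h) := by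
    intro h
    rw [map_sum, sum_eq_single (j0 h)]
    · simp [wz, hlj h]
    · intro i _ hi
      by_cases h2 : i = l h <;> simp [wz, hi, h2]
    · simp
  set f : (Fin m × I →₀ ℕ) → MvPolynomial (Fin m) (MvPolynomial (Fin m × I) K) := fun a =>
    ∏ h, (X h - C (∑ i, C (M h i) * wz K l j0 (h, i))) ^ lv l a h with hf
  have e1 : aeval (Gp l j0 M) P = ∑ a ∈ P.support, C (monomial (oth l j0 a) ((coeff a P : ℤ) : K)) * f a := by
    conv_lhs => rw [P.as_sum, map_sum]
    refine sum_congr rfl fun a _ => ?_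
    rw [aeval_monomial, Finsupp.prod_fintype _ _ (by simp), Gp_monomial hlj, ← mul_assoc]
    congr 1
    have : (monomial (oth l j0 a) ((coeff a P : ℤ) : K)) = C ((coeff a P : ℤ) : K) * monomial (oth l j0 a) (1 : K) := by
      rw [C_mul_monomial, mul_one]
    rw [this, map_mul]
    congr 1
  have e2 : ∀ a, map constantCoeff (f a) = ∏ h, (X h + C (- M h (j0 h))) ^ lv l a h := by
    intro a
    rw [hf, map_prod]
    refine prod_congr rfl fun h _ => ?_
    rw [map_pow, map_sub, map_X, map_C, hz, map_neg, sub_eq_add_neg]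
  rw [e1, coeff_sum, coeff_sum, rp, map_sum, coeff_sum, sum_filter]
  refine sum_congr rfl fun a ha => ?_
  rw [coeff_C_mul, coeff_monomial_mul']
  by_cases h1 : oth l j0 a = β
  · rw [if_pos h1, if_pos h1.le, h1, tsub_self]
    rw [shift, aeval_monomial, Finsupp.prod_fintype _ _ (by simp), ← e2]
    have h3 : (algebraMap ℤ (MvPolynomial (Fin m) K)) (coeff a P) = C ((coeff a P : ℤ) : K) := by simp
    rw [h3, coeff_C_mul, coeff_map]
    rfl
  · rw [if_neg h1, if_neg]
    intro h2
    apply h1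
    have h3 := hβ a (mem_support_iff.mp ha)
    have h4 : β = oth l j0 a + (β - oth l j0 a) := (add_tsub_cancel_of_le h2).symm
    have h5 : (β - oth l j0 a).degree = 0 := by
      have := congrArg Finsupp.degree h4
      rw [map_add] at this
      omega
    rw [Finsupp.degree_eq_zero_iff] at h5
    rw [h5, add_zero] at h4
    exact h4.symm

lemma idx_Gp {l j0 : Fin m → I} (M : Fin m → I → K) (y : Fin m → κ → I → K)
    (s : Fin m → I → κ → K)
    (hs : ∀ h i i', ∑ k, s h i k * y h k i' = (if i' = i then 1 else 0) - if i' = l h then M h i else 0)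
    (P : MvPolynomial (Fin m × I) ℤ) {w : Fin m → ℝ} {σ : ℝ}
    (hF : ∀ a, coeff a (aeval (gp y l) P : MvPolynomial (Fin m × Option κ) K) ≠ 0 → σ ≤ ∑ h, (a (h, none) : ℝ) * w h) :
    idx w σ (aeval (Gp l j0 M) P) := by
  set T : Fin m × Option κ → MvPolynomial (Fin m) (MvPolynomial (Fin m × I) K) := fun p =>
    p.2.elim (X p.1) fun k => C (∑ i, C (s p.1 i k) * wz K l j0 (p.1, i)) with hT
  have h1 : aeval (Gp l j0 M) P = aeval (R := K) T (aeval (gp y l) P) := by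
    rw [← AlgHom.restrictScalars_apply ℤ (aeval (R := K) T), ← AlgHom.comp_apply]
    refine AlgHom.congr_fun (MvPolynomial.algHom_ext ?_) P
    rintro ⟨h, i'⟩
    rw [AlgHom.comp_apply, aeval_X, aeval_X, AlgHom.restrictScalars_apply, gp, map_add, map_sum]
    have h2 : ∀ k, aeval (R := K) T (C (y h k i') * X (h, some k)) =
        C (∑ i, C (y h k i' * s h i k) * wz K l j0 (h, i)) := by
      intro k
      rw [map_mul, aeval_X, ← algebraMap_eq, AlgHom.commutes]
      have : (algebraMap K (MvPolynomial (Fin m) (MvPolynomial (Fin m × I) K))) (y h k i') = C (C (y h k i')) := rfl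
      rw [this, hT]
      show C (C (y h k i')) * C (∑ i, C (s h i k) * wz K l j0 (h, i)) = _
      rw [← map_mul, mul_sum]
      congr 1
      refine sum_congr rfl fun i _ => ?_
      rw [map_mul]; ring
    simp only [h2]
    have h3 : ∑ k, (C (∑ i, C (y h k i' * s h i k) * wz K l j0 (h, i)) : MvPolynomial (Fin m) (MvPolynomial (Fin m × I) K))
      = C (wz K l j0 (h, i')) - if i' = l h then C (∑ i, C (M h i) * wz K l j0 (h, i)) else 0 := by
      rw [← map_sum, sum_comm]
      have h4 : ∀ i, ∑ k, C (y h k i' * s h i k) * wz K l j0 (h, i) =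
         (if i' = i then wz K l j0 (h, i) else 0) - if i' = l h then C (M h i) * wz K l j0 (h, i) else 0 := by
        intro i
        rw [← sum_mul, ← map_sum]
        have : ∑ k, y h k i' * s h i k = ∑ k, s h i k * y h k i' := sum_congr rfl fun k _ => mul_comm _ _
        rw [this, hs]
        split_ifs <;> simp [sub_mul]
      simp only [h4, sum_sub_distrib]
      rw [map_sub]
      congr 1
      · simp
      · split_ifs <;> simp
    rw [h3, Gp]
    by_cases h5 : i' = l h
    · simp only [h5, if_true, aeval_X]
      simp only [hT, Option.elim]
      ring
    · simp [h5]
  rw [h1]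
  set F := (aeval (gp y l) P : MvPolynomial (Fin m × Option κ) K)
  rw [F.as_sum, map_sum]
  refine idx_sum _ fun a ha => ?_
  rw [aeval_monomial, Finsupp.prod_fintype _ _ (by simp), Fintype.prod_prod_type]
  have h2 : ∏ x : Fin m, ∏ y, T (x, y) ^ a (x, y) = C (∏ h, ∏ k, (∑ i, C (s h i k) * wz K l j0 (h, i)) ^ a (h, some k)) *
      monomial (Finsupp.equivFunOnFinite.symm fun h => a (h, none)) 1 := by
    rw [monomial_eq, Finsupp.prod_fintype _ _ (by simp), C_1, one_mul]
    simp only [Fintype.prod_option, prod_mul_distrib, map_prod, map_pow]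
    rw [mul_comm]
    rfl
  rw [h2]
  intro n hn
  have h3 : (algebraMap K (MvPolynomial (Fin m) (MvPolynomial (Fin m × I) K))) (coeff a F) = C (C (coeff a F)) := rfl
  rw [h3, coeff_C_mul, coeff_C_mul, coeff_monomial] at hn
  have h4 : (Finsupp.equivFunOnFinite.symm fun h => a (h, none)) = n := by
    by_contra h; rw [if_neg h] at hn; simp at hn
  rw [← h4]
  exact hF a (mem_support_iff.mp ha)

theorem restr {l j0 : Fin m → I} (hlj : ∀ h, j0 h ≠ l h) (M : Fin m → I → K) (y : Fin m → κ → I → K)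
    (s : Fin m → I → κ → K)
    (hs : ∀ h i i', ∑ k, s h i k * y h k i' = (if i' = i then 1 else 0) - if i' = l h then M h i else 0)
    {P : MvPolynomial (Fin m × I) ℤ} (hP0 : P ≠ 0) {r : Fin m → ℕ} (hP : blk r P) {σ : ℝ}
    (hF : ∀ a, ∑ h, (a (h, none) : ℝ) * (1 / r h) < σ →
      coeff a (aeval (gp y l) P : MvPolynomial (Fin m × Option κ) K) = 0) :
    ∃ p : MvPolynomial (Fin m) ℤ, p ≠ 0 ∧ bd (fun h => (r h : ℝ)) p ∧ l1 p ≤ l1 P ∧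
      ∀ n, coeff n (shift (fun h => - M h (j0 h)) p) ≠ 0 → σ ≤ ∑ h, (n h : ℝ) * (1 / r h) := by
  obtain ⟨a, ha, hmin⟩ := exists_min_image P.support (fun a => (oth l j0 a).degree)
    (MvPolynomial.support_nonempty.mpr hP0)
  refine ⟨rp l j0 P (oth l j0 a), rp_ne hlj hP (mem_support_iff.mp ha), rp_bd hP _, rp_l1 _ _ _ _, ?_⟩
  intro n hn
  rw [← coeff_Gp hlj M P (oth l j0 a) fun b hb => hmin b (mem_support_iff.mpr hb)] at hn
  refine idx_Gp (j0 := j0) M y s hs P (w := fun h => 1 / (r h : ℝ)) (fun b hb => ?_) n ?_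
  · by_contra h
    exact hb (hF b (not_le.mp h))
  · intro h; rw [h] at hn; simp at hn
end
end UE

set_option linter.all false
namespace UE
open Finset

section mp
open Polynomial
variable {K : Type*} [Field K] [CharZero K] [FiniteDimensional ℚ K]

lemma exists_mp (ζ : K) : ∃ f : ℤ[X], Irreducible f ∧ f.natDegree ≠ 0 ∧
    f.natDegree ≤ Module.finrank ℚ K ∧ aeval ζ f = 0 := by
  set g := IsLocalization.integerNormalization (nonZeroDivisors ℤ) (minpoly ℚ ζ) with hg
  have hintg : IsIntegral ℚ ζ := Algebra.IsIntegral.isIntegral ζ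
  have hm0 := minpoly.ne_zero hintg
  obtain ⟨b, hb, hb2⟩ := IsLocalization.integerNormalization_spec (nonZeroDivisors ℤ) (minpoly ℚ ζ)
  have hb0 : b ≠ 0 := nonZeroDivisors.ne_zero hb
  have hg0 : g ≠ 0 := by
    intro h
    rw [← hg, h, Polynomial.map_zero] at hb2
    exact (smul_ne_zero hb0 hm0) hb2.symm
  have hgd : g.natDegree ≤ Module.finrank ℚ K := by
    rw [← natDegree_map_eq_of_injective (algebraMap ℤ ℚ).injective_int g, hb2]
    exact (natDegree_smul_le _ _).trans (minpoly.natDegree_le ζ)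
  have hgz : aeval ζ g = 0 := IsLocalization.integerNormalization_aeval_eq_zero _ _ (minpoly.aeval ℚ ζ)
  obtain ⟨F, hF, hF2⟩ := UniqueFactorizationMonoid.exists_prime_factors g hg0
  obtain ⟨u, hu⟩ := hF2
  have h1 : aeval ζ F.prod = 0 := by
    rw [← hu, map_mul] at hgz
    rcases mul_eq_zero.mp hgz with h | h
    · exact h
    · exact absurd h (u.isUnit.map (aeval ζ)).ne_zero
  rw [map_multiset_prod, Multiset.prod_eq_zero_iff, Multiset.mem_map] at h1
  obtain ⟨f, hf, hf0⟩ := h1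
  have hfp := hF f hf
  refine ⟨f, hfp.irreducible, ?_, ?_, hf0⟩
  · intro h
    obtain ⟨n, rfl⟩ := natDegree_eq_zero.mp h
    simp at hf0
    subst hf0
    exact hfp.ne_zero (by simp)
  · refine (natDegree_le_of_dvd ?_ hg0).trans hgd
    exact (Multiset.dvd_prod hf).trans ⟨_, hu.symm⟩

/-- a chosen primitive integer minimal polynomial -/
noncomputable def mp (ζ : K) : ℤ[X] := (exists_mp ζ).choose
lemma mp_spec (ζ : K) : Irreducible (mp ζ) ∧ (mp ζ).natDegree ≠ 0 ∧
    (mp ζ).natDegree ≤ Module.finrank ℚ K ∧ aeval ζ (mp ζ) = 0 := (exists_mp ζ).choose_spec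

lemma mp_int (ζ : K) : IsIntegral ℤ (((mp ζ).leadingCoeff : K) * ζ) := by
  have := isIntegral_leadingCoeff_smul (mp ζ) ζ (mp_spec ζ).2.2.2
  simpa using this

lemma coeff_le_ht (f : ℤ[X]) (i : ℕ) : |(f.coeff i : ℝ)| ≤ ht f := by
  by_cases h : i ∈ f.support
  · exact single_le_sum (f := fun a => |((f.coeff a : ℤ) : ℝ)|) (fun a _ => abs_nonneg _) h
  · rw [notMem_support_iff.mp h]
    simp [ht, Polynomial.sum, sum_nonneg]

lemma lc_le (v : AbsoluteValue K ℝ) (ζ : K) : v ((mp ζ).leadingCoeff : K) ≤ ht (mp ζ) :=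
  (av_int v _).trans (coeff_le_ht _ _)

lemma lc_mul_le (v : AbsoluteValue K ℝ) (ζ : K) : v (((mp ζ).leadingCoeff : K) * ζ) ≤ ht (mp ζ) := by
  obtain ⟨h1, h2, -, h4⟩ := mp_spec ζ
  set f := mp ζ
  rw [map_mul]
  rcases le_or_gt (v ζ) 1 with h | h
  · refine le_trans ?_ (lc_le v ζ)
    exact mul_le_of_le_one_right (v.nonneg _) h
  · obtain ⟨d, hd⟩ : ∃ d, f.natDegree = d + 1 := ⟨f.natDegree - 1, by omega⟩
    rw [aeval_eq_sum_range, sum_range_succ, hd] at h4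
    have h5 : (f.leadingCoeff : K) * ζ ^ (d + 1) = - ∑ x ∈ range (d + 1), f.coeff x • ζ ^ x := by
      rw [leadingCoeff, hd]
      rw [eq_neg_iff_add_eq_zero, add_comm]
      simpa using h4
    have hz : 0 < v ζ := by linarith
    have h6 : v (f.leadingCoeff : K) * v ζ * v ζ ^ d ≤ ht f * v ζ ^ d := by
      have : v (f.leadingCoeff : K) * v ζ * v ζ ^ d = v ((f.leadingCoeff : K) * ζ ^ (d + 1)) := by
        rw [map_mul, map_pow]; ring
      rw [this, h5, v.map_neg]
      refine (v.sum_le _ _).trans ?_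
      rw [ht, sum_over_range _ (by simp), hd, sum_range_succ _ (d + 1), add_mul, sum_mul]
      refine le_trans ?_ (le_add_of_nonneg_right (by positivity))
      refine sum_le_sum fun x hx => ?_
      rw [zsmul_eq_mul, map_mul, map_pow]
      refine mul_le_mul (av_int v _) ?_ (by positivity) (abs_nonneg _)
      exact pow_le_pow_right₀ h.le (by have := mem_range.mp hx; omega)
    exact le_of_mul_le_mul_right h6 (by positivity)
end mp

section
variable {I κ K : Type*} [Fintype I] [DecidableEq I] [Fintype κ] [DecidableEq κ] [Field K]

/-- the square matrix `[y | e_l]` -/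
def Ym (e : Option κ ≃ I) (y : κ → I → K) (l : I) : Matrix I I K :=
  fun i j => (e.symm j).elim (if i = l then 1 else 0) fun k => y k i

lemma Ym_det (e : Option κ ≃ I) (y : κ → I → K) (hy : LinearIndependent K y) (l : I) (M : I → K)
    (hl : M l = 1) (hM : ∀ k, ∑ i, M i * y k i = 0) : (Ym e y l).det ≠ 0 := by
  have h1 : LinearIndependent K (fun o : Option κ => o.elim (Pi.single l 1 : I → K) y) := by
    rw [linearIndependent_option]
    refine ⟨hy, fun hmem => ?_⟩
    have h2 : ∀ x ∈ Submodule.span K (Set.range y), ∑ i, M i * x i = 0 := by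
      intro x hx
      induction hx using Submodule.span_induction with
      | mem x hx => obtain ⟨k, rfl⟩ := hx; exact hM k
      | zero => simp
      | add a b _ _ ha hb => simp only [Pi.add_apply, mul_add, sum_add_distrib, ha, hb, add_zero]
      | smul c a _ ha =>
        have : ∑ i, M i * (c • a) i = c * ∑ i, M i * a i := by
          rw [mul_sum]; exact sum_congr rfl fun i _ => by simp; ring
        rw [this, ha, mul_zero]
    have h3 := h2 _ hmem
    simp [Pi.single_apply, hl] at h3
  have h2 : LinearIndependent K (Ym e y l).col := by
    have h3 := h1.comp e.symm e.symm.injective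
    convert h3 using 1
    funext j i
    simp only [Matrix.col, Matrix.transpose_apply, Ym, Function.comp]
    rcases e.symm j with _ | k
    · simp [Pi.single_apply]
    · rfl
  rw [Matrix.linearIndependent_cols_iff_isUnit] at h2
  exact ((Matrix.isUnit_iff_isUnit_det _).mp h2).ne_zero

lemma Ym_vec (e : Option κ ≃ I) (y : κ → I → K) (l : I) (M : I → K)
    (hl : M l = 1) (hM : ∀ k, ∑ i, M i * y k i = 0) :
    Matrix.vecMul M (Ym e y l) = Pi.single (e none) 1 := by
  funext j
  rw [Matrix.vecMul, dotProduct]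
  obtain ⟨o, rfl⟩ := e.surjective j
  rcases o with _ | k
  · simp [Ym, hl]
  · rw [Pi.single_eq_of_ne (by simp)]
    simpa [Ym] using hM k

lemma Ym_span (e : Option κ ≃ I) (y : κ → I → K) (hy : LinearIndependent K y) (l : I) (M : I → K)
    (hl : M l = 1) (hM : ∀ k, ∑ i, M i * y k i = 0) :
    ∃ s : I → κ → K, ∀ i i', ∑ k, s i k * y k i' = (if i' = i then 1 else 0) - if i' = l then M i else 0 := by
  have hd := Ym_det e y hy l M hl hM
  have hu : IsUnit (Ym e y l).det := hd.isUnit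
  set Y := Ym e y l with hY
  let x : I → I → K := fun i i' => (if i' = i then 1 else 0) - if i' = l then M i else 0
  refine ⟨fun i k => (Y⁻¹.mulVec (x i)) (e (some k)), fun i i' => ?_⟩
  have h1 : Y.mulVec (Y⁻¹.mulVec (x i)) = x i := by
    rw [Matrix.mulVec_mulVec, Matrix.mul_nonsing_inv _ hu, Matrix.one_mulVec]
  set u := Y⁻¹.mulVec (x i) with hu'
  have h2 : u (e none) = 0 := by
    have h3 : dotProduct (Matrix.vecMul M Y) u = dotProduct M (x i) := by
      rw [← Matrix.dotProduct_mulVec, h1]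
    rw [Ym_vec e y l M hl hM, single_one_dotProduct] at h3
    rw [h3, dotProduct]
    simp [x, mul_sub, sum_sub_distrib, hl]
  have h4 := congrFun h1 i'
  rw [Matrix.mulVec, dotProduct, ← Equiv.sum_comp e, Fintype.sum_option, h2, mul_zero, zero_add] at h4
  show ∑ k, u (e (some k)) * y k i' = x i i'
  rw [← h4]
  refine sum_congr rfl fun k _ => ?_
  rw [mul_comm, hY]
  simp [Ym]

lemma cramer_id (a : Matrix I I K) (ha : a.det ≠ 0) (e : Option κ ≃ I) (y : κ → I → K) (l : I) (M : I → K)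
    (hl : M l = 1) (hM : ∀ k, ∑ i, M i * y k i = 0) (i : I) :
    (Matrix.vecMul M a.adjugate) i * (Ym e y l).det =
      ((a * Ym e y l).updateRow i (Pi.single (e none) 1)).det := by
  set mv := Matrix.vecMul M a.adjugate with hmv
  set Y := Ym e y l
  have h1 : Matrix.vecMul mv (a * Y) = a.det • (Pi.single (e none) 1 : I → K) := by
    rw [hmv, Matrix.vecMul_vecMul, ← Matrix.mul_assoc, Matrix.adjugate_mul, Matrix.smul_mul, Matrix.one_mul,
      Matrix.vecMul_smul, Ym_vec e y l M hl hM]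
  have h2 := Matrix.det_updateRow_sum (a * Y) i mv
  have h3 : (∑ k, mv k • (a * Y) k) = Matrix.vecMul mv (a * Y) := by
    funext j
    simp [Matrix.vecMul, dotProduct, Finset.sum_apply]
  rw [h3, h1, Matrix.det_updateRow_smul, Matrix.det_mul, smul_eq_mul] at h2
  have h4 : a.det * (mv i * Y.det) = a.det * ((a * Y).updateRow i (Pi.single (e none) 1)).det := by
    rw [h2]; ring
  exact mul_left_cancel₀ ha h4

lemma minor_bound (v : AbsoluteValue K ℝ) (e : Option κ ≃ I) (W : Matrix I I K) (b : κ → ℝ) (hb : ∀ k, 0 < b k)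
    (c : I → ℝ) (q : ℝ) (hW : ∀ k i, v (W i (e (some k))) ≤ b k * Real.exp (c i * q)) (i : I) :
    v ((W.updateRow i (Pi.single (e none) 1)).det) ≤
      (Fintype.card I).factorial * ((∏ k, b k) * Real.exp ((∑ i', c i' - c i) * q)) := by
  rw [Matrix.det_apply']
  refine (v.sum_le _ _).trans ?_
  refine (sum_le_card_nsmul _ _ ((∏ k, b k) * Real.exp ((∑ i', c i' - c i) * q)) fun σ _ => ?_).trans ?_
  · rw [map_mul]
    have hs : v (((Equiv.Perm.sign σ : ℤ) : K)) ≤ 1 := by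
      refine (av_int v _).trans ?_
      rcases Int.units_eq_one_or (Equiv.Perm.sign σ) with h | h <;> simp [h]
    have hpos : 0 ≤ (∏ k, b k) * Real.exp ((∑ i', c i' - c i) * q) :=
      mul_nonneg (prod_nonneg fun k _ => (hb k).le) (Real.exp_pos _).le
    refine (mul_le_of_le_one_left (v.nonneg _) hs).trans ?_
    by_cases hσ : σ (e none) = i
    · rw [← Equiv.prod_comp e, Fintype.prod_option, map_mul, hσ, Matrix.updateRow_self, Pi.single_eq_same, map_one,
        one_mul, map_prod]
      refine (prod_le_prod (fun k _ => v.nonneg _) (g := fun k => b k * Real.exp (c (σ (e (some k))) * q)) fun k _ => ?_).trans ?_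
      · rw [Matrix.updateRow_ne]
        · exact hW k _
        · rw [← hσ]
          intro h
          simpa using σ.injective h
      · rw [prod_mul_distrib, ← Real.exp_sum, ← sum_mul]
        refine mul_le_mul_of_nonneg_left (le_of_eq ?_) (prod_nonneg fun k _ => (hb k).le)
        congr 2
        have := Equiv.sum_comp (e.trans σ) c
        rw [Fintype.sum_option] at this
        simp only [Equiv.trans_apply, hσ] at this
        linarith
    · have : ∏ j, W.updateRow i (Pi.single (e none) 1) (σ j) j = 0 := by
        refine prod_eq_zero (mem_univ (σ.symm i)) ?_
        rw [Equiv.apply_symm_apply, Matrix.updateRow_self, Pi.single_eq_of_ne]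
        intro h; apply hσ; rw [← h]; simp
      rw [this, map_zero]; exact hpos
  · rw [card_univ, Fintype.card_perm, nsmul_eq_mul]
end
end UE

set_option linter.all false
namespace UE
open Finset Filter Topology

lemma ev_small {q : ℕ → ℝ} (hq : Tendsto q atTop atTop) (B E : ℝ) (hE : E < 0) :
    ∀ᶠ s in atTop, B * Real.exp (E * q s) < 1 := by
  have h1 : Tendsto (fun s => E * q s) atTop atBot := Tendsto.const_mul_atTop_of_neg hE hq
  have h2 := (Real.tendsto_exp_atBot.comp h1).const_mul B
  rw [mul_zero] at h2
  exact h2.eventually_lt_const zero_lt_one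

section
variable {I κ K ι : Type*} [Fintype I] [DecidableEq I] [Fintype κ] [DecidableEq κ] [Fintype ι] [DecidableEq ι]
  [Field K] [CharZero K] [FiniteDimensional ℚ K]

/-- common denominator -/
noncomputable def dn (T : Finset I) (M : I → K) : K := ∏ j ∈ T, ((mp (-M j)).leadingCoeff : K)

lemma lc_ne (ζ : K) : ((mp ζ).leadingCoeff : K) ≠ 0 := by
  have := (mp_spec ζ).1.ne_zero
  simpa using this

lemma dn_ne (T : Finset I) (M : I → K) : dn T M ≠ 0 := prod_ne_zero_iff.mpr fun j _ => lc_ne _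

lemma dn_mem (O : Subring K) (T : Finset I) (M : I → K) : dn T M ∈ O :=
  prod_mem fun j _ => intCast_mem O _

lemma dn_mul_mem {O : Subring K} (hO : ∀ x : K, IsIntegral ℤ x → x ∈ O) {T : Finset I} (M : I → K) {j : I}
    (hj : j ∈ T) : dn T M * M j ∈ O := by
  rw [dn, ← mul_prod_erase _ _ hj]
  have h1 := hO _ (mp_int (-M j))
  have h2 : ∏ x ∈ T.erase j, ((mp (-M x)).leadingCoeff : K) ∈ O := prod_mem fun j _ => intCast_mem O _
  have : ((mp (-M j)).leadingCoeff : K) * (∏ x ∈ T.erase j, ((mp (-M x)).leadingCoeff : K)) * M j =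
    -((((mp (-M j)).leadingCoeff : K) * -M j) * ∏ x ∈ T.erase j, ((mp (-M x)).leadingCoeff : K)) := by ring
  rw [this]
  exact neg_mem (mul_mem h1 h2)

lemma dn_le (v : AbsoluteValue K ℝ) {T : Finset I} {M : I → K} {H : ℝ} (hH : ∀ j ∈ T, ht (mp (-M j)) ≤ H) :
    v (dn T M) ≤ H ^ T.card := by
  rw [dn, map_prod, ← prod_const]
  exact prod_le_prod (fun _ _ => v.nonneg _) fun j hj => (lc_le v _).trans (hH j hj)

lemma dn_mul_le (v : AbsoluteValue K ℝ) {T : Finset I} {M : I → K} {H : ℝ} (hH : ∀ j ∈ T, ht (mp (-M j)) ≤ H)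
    {j : I} (hj : j ∈ T) : v (dn T M * M j) ≤ H ^ T.card := by
  rw [dn, ← mul_prod_erase _ _ hj, mul_right_comm, map_mul, map_prod]
  have h0 : 1 ≤ ht (mp (-M j)) := one_le_ht (mp_spec _).1.ne_zero
  have h1 : v (((mp (-M j)).leadingCoeff : K) * M j) ≤ H := by
    have := lc_mul_le v (-M j)
    rw [mul_neg, v.map_neg] at this
    exact this.trans (hH j hj)
  have h2 : ∏ x ∈ T.erase j, v ((mp (-M x)).leadingCoeff : K) ≤ ∏ x ∈ T.erase j, H :=
    prod_le_prod (fun _ _ => v.nonneg _) fun x hx => (lc_le v _).trans (hH x (mem_of_mem_erase hx))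
  rw [prod_const] at h2
  have h3 := mul_le_mul h1 h2 (prod_nonneg fun _ _ => v.nonneg _) (by linarith [hH j hj])
  refine h3.trans (le_of_eq ?_)
  rw [← pow_succ', card_erase_of_mem hj]
  congr 1
  have := card_pos.mpr ⟨j, hj⟩
  omega

/-- integer matrix over K -/
def mK (K : Type*) [Field K] (A : Matrix I I ℤ) : Matrix I I K := A.map (Int.cast)

lemma mK_det (A : Matrix I I ℤ) : (mK K A).det = (A.det : K) := by
  rw [mK]
  exact (Int.cast_det A).symm

lemma mK_rel (A : Matrix I I ℤ) (M x : I → K) :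
    (A.det : K) * ∑ i, M i * x i = ∑ i, Matrix.vecMul M (mK K A).adjugate i * ∑ k, (A i k : K) * x k := by
  have h1 : dotProduct (Matrix.vecMul M (mK K A).adjugate) ((mK K A).mulVec x) =
      (mK K A).det * dotProduct M x := by
    rw [Matrix.dotProduct_mulVec, Matrix.vecMul_vecMul, Matrix.adjugate_mul, Matrix.vecMul_smul, Matrix.vecMul_one,
      smul_dotProduct, smul_eq_mul]
  rw [mK_det] at h1
  rw [show ∑ i, M i * x i = dotProduct M x from rfl, ← h1]
  rfl

variable (av : ι → AbsoluteValue K ℝ) (O : Subring K) (hO : ∀ x : K, IsIntegral ℤ x → x ∈ O)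
    (pf : ∀ x ∈ O, x ≠ 0 → 1 ≤ ∏ v, av v x) (A : ι → Matrix I I ℤ) (hd : ∀ v, ((A v).det : K) ≠ 0)

include hO pf hd in
lemma caseA (c : ι → I → ℝ) {q : ℕ → ℝ} (hq : Tendsto q atTop atTop) (y : ℕ → κ → I → K)
    (hyO : ∀ s k i, y s k i ∈ O) (b : ℕ → ι → κ → ℝ) (hb : ∀ s v k, 0 < b s v k) (hb1 : ∀ s k, ∏ v, b s v k ≤ 1)
    (hy : ∀ s v k i, av v (∑ k', ((A v i k' : ℤ) : K) * y s k k') ≤ b s v k * Real.exp (c v i * q s))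
    (M : I → K) (e0 : ι → ℝ) (he0 : ∑ v, e0 v < 0)
    (hM : ∀ v i, Matrix.vecMul M (mK K (A v)).adjugate i ≠ 0 → c v i ≤ e0 v) :
    ∀ᶠ s in atTop, ∀ k, ∑ i, M i * y s k i = 0 := by
  set D := dn univ M
  set mv : ι → I → K := fun v => Matrix.vecMul M (mK K (A v)).adjugate
  set B : ι → ℝ := fun v => (av v ((A v).det : K))⁻¹ * (av v D * ∑ i, av v (mv v i))
  filter_upwards [ev_small hq (∏ v, B v) _ he0, hq.eventually_ge_atTop 0] with s hs hqs k
  by_contra hne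
  have hdv : ∀ v, 0 < av v ((A v).det : K) := fun v => (av v).pos (hd v)
  set z := D * ∑ i, M i * y s k i with hz
  have hz0 : z ≠ 0 := mul_ne_zero (dn_ne _ _) hne
  have hzO : z ∈ O := by
    rw [hz, mul_sum]
    refine sum_mem fun i _ => ?_
    rw [← mul_assoc]
    exact mul_mem (dn_mul_mem hO M (mem_univ i)) (hyO s k i)
  have h1 := pf z hzO hz0
  have h2 : ∀ v, av v z ≤ B v * (b s v k * Real.exp (e0 v * q s)) := by
    intro v
    have h3 : ((A v).det : K) * z = D * ∑ i, mv v i * ∑ k', ((A v i k' : ℤ) : K) * y s k k' := by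
      rw [← mK_rel, hz]; ring
    have h4 : av v ((A v).det : K) * av v z ≤ av v D * ((∑ i, av v (mv v i)) * (b s v k * Real.exp (e0 v * q s))) := by
      rw [← map_mul, h3, map_mul]
      refine mul_le_mul_of_nonneg_left (((av v).sum_le _ _).trans ?_) ((av v).nonneg _)
      rw [sum_mul]
      refine sum_le_sum fun i _ => ?_
      rw [map_mul]
      by_cases h5 : mv v i = 0
      · rw [h5, map_zero, zero_mul, zero_mul]
      · refine mul_le_mul_of_nonneg_left ((hy s v k i).trans ?_) ((av v).nonneg _)
        refine mul_le_mul_of_nonneg_left (Real.exp_le_exp.mpr ?_) (hb s v k).le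
        exact mul_le_mul_of_nonneg_right (hM v i h5) hqs
    have h5 : av v z ≤ (av v ((A v).det : K))⁻¹ * (av v D * ((∑ i, av v (mv v i)) * (b s v k * Real.exp (e0 v * q s)))) := by
      rw [← div_eq_inv_mul, le_div_iff₀ (hdv v), mul_comm]
      exact h4
    refine h5.trans (le_of_eq ?_)
    simp only [B]; ring
  have hB : 0 ≤ ∏ v, B v := prod_nonneg fun v _ => mul_nonneg (inv_nonneg.mpr (hdv v).le)
    (mul_nonneg ((av v).nonneg _) (sum_nonneg fun i _ => (av v).nonneg _))
  clear_value B
  have h3 := h1.trans (prod_le_prod (fun v _ => (av v).nonneg _) fun v _ => h2 v)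
  rw [prod_mul_distrib, prod_mul_distrib, ← Real.exp_sum, ← sum_mul] at h3
  have h4 : (∏ v, B v) * ((∏ v, b s v k) * Real.exp ((∑ v, e0 v) * q s)) ≤ (∏ v, B v) * Real.exp ((∑ v, e0 v) * q s) := by
    refine mul_le_mul_of_nonneg_left ?_ hB
    exact mul_le_of_le_one_left (Real.exp_pos _).le (hb1 s k)
  linarith

include hO pf hd in
lemma caseB (eq : Option κ ≃ I) (c : ι → I → ℝ) {δ q : ℝ} (hq : 0 ≤ q) (y : κ → I → K)
    (hyO : ∀ k i, y k i ∈ O) (hyl : LinearIndependent K y)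
    (b : ι → κ → ℝ) (hb : ∀ v k, 0 < b v k) (hb1 : ∀ k, ∏ v, b v k ≤ 1)
    (hc : ∑ v, ∑ i, c v i ≤ -δ)
    (hy : ∀ v k i, av v (∑ k', ((A v i k' : ℤ) : K) * y k k') ≤ b v k * Real.exp (c v i * q))
    (M : I → K) (l : I) (hl : M l = 1) (hM : ∀ k, ∑ i, M i * y k i = 0) (iv : ι → I)
    (hiv : ∀ v, Matrix.vecMul M (mK K (A v)).adjugate (iv v) ≠ 0) (hiv2 : -(δ / 2) ≤ ∑ v, c v (iv v))
    {C3 H : ℝ} (hC3 : 1 ≤ C3) (hC : ∀ v w i, ∑ j, av w ((mK K (A v)).adjugate j i) ≤ C3) (hH1 : 1 ≤ H)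
    (hH : ∀ j, j ≠ l → ht (mp (-M j)) ≤ H) :
    1 ≤ (C3 * H ^ Fintype.card I) ^ (Fintype.card ι * Fintype.card ι + Fintype.card ι) *
      (((Fintype.card I).factorial : ℝ) ^ Fintype.card ι * Real.exp (-(δ / 2) * q)) := by
  set N := Fintype.card I
  set D := dn (univ.erase l) M
  set mv : ι → I → K := fun v => Matrix.vecMul M (mK K (A v)).adjugate
  have hcard : (univ.erase l).card ≤ N := card_le_univ _
  have hHN : ∀ v : AbsoluteValue K ℝ, ∀ j, v (D * M j) ≤ H ^ N := by
    intro v j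
    refine le_trans ?_ (pow_le_pow_right₀ hH1 hcard)
    by_cases hj : j = l
    · rw [hj, hl, mul_one]
      exact dn_le v fun j hj => hH j (ne_of_mem_erase hj)
    · exact dn_mul_le v (fun j hj => hH j (ne_of_mem_erase hj)) (mem_erase.mpr ⟨hj, mem_univ _⟩)
  have hDO : ∀ j, D * M j ∈ O := by
    intro j
    by_cases hj : j = l
    · rw [hj, hl, mul_one]; exact dn_mem O _ _
    · exact dn_mul_mem hO M (mem_erase.mpr ⟨hj, mem_univ _⟩)
  set X := C3 * H ^ N with hX
  have hHN1 : 1 ≤ H ^ N := one_le_pow₀ hH1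
  have hX1 : 1 ≤ X := one_le_mul_of_one_le_of_one_le hC3 hHN1
  have hadjO : ∀ v i j, (mK K (A v)).adjugate i j ∈ O := by
    intro v i j
    have : (mK K (A v)).adjugate = ((A v).adjugate).map (Int.castRingHom K) :=
      (RingHom.map_adjugate (Int.castRingHom K) (A v)).symm
    rw [this]
    exact intCast_mem O _
  have hDm : ∀ v i, D * mv v i = ∑ j, (D * M j) * (mK K (A v)).adjugate j i := by
    intro v i
    simp only [mv, Matrix.vecMul, dotProduct, mul_sum, mul_assoc]
  -- lower bound
  have hlow : ∀ v, 1 ≤ av v (D * mv v (iv v)) * X ^ Fintype.card ι := by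
    intro v
    have h1 : D * mv v (iv v) ∈ O := by
      rw [hDm]; exact sum_mem fun j _ => mul_mem (hDO j) (hadjO _ _ _)
    have h2 := pf _ h1 (mul_ne_zero (dn_ne _ _) (hiv v))
    rw [← mul_prod_erase _ _ (mem_univ v)] at h2
    refine h2.trans (mul_le_mul_of_nonneg_left ?_ ((av v).nonneg _))
    have h3 : ∀ w, av w (D * mv v (iv v)) ≤ X := by
      intro w
      rw [hDm]
      refine ((av w).sum_le _ _).trans ?_
      have : ∀ j, av w (D * M j * (mK K (A v)).adjugate j (iv v)) ≤ H ^ N * av w ((mK K (A v)).adjugate j (iv v)) := by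
        intro j; rw [map_mul]; exact mul_le_mul_of_nonneg_right (hHN _ j) ((av w).nonneg _)
      refine (sum_le_sum fun j _ => this j).trans ?_
      rw [← mul_sum, hX, mul_comm]
      exact mul_le_mul_of_nonneg_right (hC v w (iv v)) (by positivity)
    refine (prod_le_prod (fun w _ => (av w).nonneg _) fun w _ => h3 w).trans ?_
    rw [prod_const]
    exact pow_le_pow_right₀ hX1 (card_le_univ _)
  have hlow2 : 1 ≤ (∏ v, av v D) * (∏ v, av v (mv v (iv v))) * X ^ (Fintype.card ι * Fintype.card ι) := by
    have h1 : ∏ v : ι, (1 : ℝ) ≤ ∏ v, (av v (D * mv v (iv v)) * X ^ Fintype.card ι) :=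
      prod_le_prod (fun _ _ => zero_le_one) fun v _ => hlow v
    rw [prod_const_one, prod_mul_distrib, prod_const, card_univ, ← pow_mul] at h1
    simpa only [map_mul, prod_mul_distrib] using h1
  have hDle : ∏ v, av v D ≤ X ^ Fintype.card ι := by
    rw [← card_univ (α := ι), ← prod_const]
    refine prod_le_prod (fun v _ => (av v).nonneg _) fun v _ => ?_
    have := hHN (av v) l
    rw [hl, mul_one] at this
    refine this.trans ?_
    rw [hX]; exact le_mul_of_one_le_left (by positivity) hC3
  -- upper bound
  have hYd := Ym_det eq y hyl l M hl hM
  have hYO : (Ym eq y l).det ∈ O := by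
    rw [Matrix.det_apply']
    refine sum_mem fun σ _ => mul_mem (intCast_mem O _) (prod_mem fun j _ => ?_)
    rw [Ym]
    rcases eq.symm j with _ | k
    · simp only [Option.elim]; split_ifs
      · exact one_mem O
      · exact zero_mem O
    · exact hyO _ _
  have hY1 := pf _ hYO hYd
  have hup : ∀ v, av v (mv v (iv v)) * av v (Ym eq y l).det ≤
      N.factorial * ((∏ k, b v k) * Real.exp ((∑ i', c v i' - c v (iv v)) * q)) := by
    intro v
    rw [← map_mul, cramer_id _ (by rw [mK_det]; exact hd v) eq y l M hl hM]
    refine minor_bound (av v) eq _ (b v) (hb v) (c v) q ?_ _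
    intro k i
    have : (mK K (A v) * Ym eq y l) i (eq (some k)) = ∑ k', ((A v i k' : ℤ) : K) * y k k' := by
      rw [Matrix.mul_apply]; simp [Ym, mK]
    rw [this]; exact hy v k i
  have hup2 : ∏ v, av v (mv v (iv v)) ≤ (N.factorial : ℝ) ^ Fintype.card ι * Real.exp (-(δ / 2) * q) := by
    have h1 := prod_le_prod (fun v _ => mul_nonneg ((av v).nonneg _) ((av v).nonneg _)) fun v (_ : v ∈ univ) => hup v
    simp only [prod_mul_distrib, prod_const, card_univ, ← Real.exp_sum, ← sum_mul, sum_sub_distrib] at h1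
    have h2 : ∏ v, ∏ k, b v k ≤ 1 := by
      rw [Finset.prod_comm]
      exact prod_le_one (fun k _ => prod_nonneg fun v _ => (hb v k).le) fun k _ => hb1 k
    have h3 : ∏ v, av v (mv v (iv v)) ≤ (∏ v, av v (mv v (iv v))) * ∏ v, av v (Ym eq y l).det :=
      le_mul_of_one_le_right (prod_nonneg fun v _ => (av v).nonneg _) hY1
    refine (h3.trans h1).trans (mul_le_mul_of_nonneg_left ?_ (by positivity))
    refine (mul_le_of_le_one_left (Real.exp_pos _).le h2).trans (Real.exp_le_exp.mpr ?_)
    exact mul_le_mul_of_nonneg_right (by linarith) hq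
  calc (1 : ℝ) ≤ (∏ v, av v D) * (∏ v, av v (mv v (iv v))) * X ^ (Fintype.card ι * Fintype.card ι) := hlow2
    _ ≤ X ^ Fintype.card ι * ((N.factorial : ℝ) ^ Fintype.card ι * Real.exp (-(δ / 2) * q)) *
        X ^ (Fintype.card ι * Fintype.card ι) := by
      have h0 : 0 ≤ ∏ v, av v (mv v (iv v)) := prod_nonneg fun v _ => (av v).nonneg _
      gcongr
    _ = _ := by rw [pow_add]; ring

include hO pf hd in
theorem step1 (eq : Option κ ≃ I) (c : ι → I → ℝ) {δ : ℝ} (hδ : 0 < δ) (hc : ∑ v, ∑ i, c v i ≤ -δ)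
    {q : ℕ → ℝ} (hq : Tendsto q atTop atTop) (y : ℕ → κ → I → K)
    (hyO : ∀ s k i, y s k i ∈ O) (hyl : ∀ s, LinearIndependent K (y s))
    (b : ℕ → ι → κ → ℝ) (hb : ∀ s v k, 0 < b s v k) (hb1 : ∀ s k, ∏ v, b s v k ≤ 1)
    (hy : ∀ s v k i, av v (∑ k', ((A v i k' : ℤ) : K) * y s k k') ≤ b s v k * Real.exp (c v i * q s))
    (hcon : ∀ M : I → K, M ≠ 0 → ¬ ∃ᶠ s in atTop, ∀ k, ∑ i, M i * y s k i = 0) :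
    ∃ c0 : ℝ, 0 < c0 ∧ ∀ᶠ s in atTop, ∀ (M : I → K) (l : I), M l = 1 → (∀ k, ∑ i, M i * y s k i = 0) →
      ∃ j, j ≠ l ∧ Real.exp (c0 * q s) ≤ ht (mp (-M j)) := by
  classical
  set N := Fintype.card I
  set T := Fintype.card ι * Fintype.card ι + Fintype.card ι with hT
  obtain ⟨C3, hC31, hC3⟩ : ∃ C3 : ℝ, 1 ≤ C3 ∧ ∀ v w i, ∑ j, av w ((mK K (A v)).adjugate j i) ≤ C3 := by
    refine ⟨1 + ∑ v, ∑ w, ∑ i, ∑ j, av w ((mK K (A v)).adjugate j i), ?_, ?_⟩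
    · exact le_add_of_nonneg_right (sum_nonneg fun v _ => sum_nonneg fun w _ => sum_nonneg fun i _ =>
        sum_nonneg fun j _ => (av w).nonneg _)
    · intro v w i
      have h1 := single_le_sum (f := fun v => ∑ w, ∑ i, ∑ j, av w ((mK K (A v)).adjugate j i))
        (fun v _ => sum_nonneg fun w _ => sum_nonneg fun i _ => sum_nonneg fun j _ => (av w).nonneg _) (mem_univ v)
      have h2 := single_le_sum (f := fun w => ∑ i, ∑ j, av w ((mK K (A v)).adjugate j i))
        (fun w _ => sum_nonneg fun i _ => sum_nonneg fun j _ => (av w).nonneg _) (mem_univ w)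
      have h3 := single_le_sum (f := fun i => ∑ j, av w ((mK K (A v)).adjugate j i))
        (fun i _ => sum_nonneg fun j _ => (av w).nonneg _) (mem_univ i)
      linarith
  set c0 := δ / (4 * (N * T + 1)) with hc0
  have hc0p : 0 < c0 := by positivity
  refine ⟨c0, hc0p, ?_⟩
  filter_upwards [ev_small hq (C3 ^ T * (N.factorial : ℝ) ^ Fintype.card ι) (-(δ / 4)) (by linarith),
    hq.eventually_ge_atTop 0] with s hs hqs M l hl hM
  by_contra hno
  push Not at hno
  have hM0 : M ≠ 0 := fun h => by rw [h] at hl; simp at hl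
  have hex : ∀ v, ∃ i, Matrix.vecMul M (mK K (A v)).adjugate i ≠ 0 ∧
      ∀ i', Matrix.vecMul M (mK K (A v)).adjugate i' ≠ 0 → c v i' ≤ c v i := by
    intro v
    have hne : (univ.filter fun i => Matrix.vecMul M (mK K (A v)).adjugate i ≠ 0).Nonempty := by
      by_contra h
      rw [not_nonempty_iff_eq_empty, filter_eq_empty_iff] at h
      have h0 : ∀ i, Matrix.vecMul M (mK K (A v)).adjugate i = 0 := fun i => not_not.mp (h (mem_univ i))
      have h1 := mK_rel (A v) M (Pi.single l 1)
      simp only [h0, zero_mul, sum_const_zero] at h1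
      have h2 : ∑ i, M i * (Pi.single l 1 : I → K) i = 1 := by simp [Pi.single_apply, hl]
      rw [h2, mul_one] at h1
      exact hd v h1
    obtain ⟨i, hi, hmax⟩ := exists_max_image _ (c v) hne
    exact ⟨i, (mem_filter.mp hi).2, fun i' hi' => hmax i' (mem_filter.mpr ⟨mem_univ _, hi'⟩)⟩
  choose iv hiv hivm using hex
  rcases lt_or_ge (∑ v, c v (iv v)) (-(δ / 2)) with h | h
  · refine hcon M hM0 (Eventually.frequently ?_)
    exact caseA av O hO pf A hd c hq y hyO b hb hb1 hy M (fun v => c v (iv v)) (by linarith) hivm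
  · have h1 := caseB av O hO pf A hd eq c hqs (y s) (hyO s) (hyl s) (b s) (hb s) (hb1 s) hc (hy s) M l hl hM iv hiv h
      hC31 hC3 (Real.one_le_exp (by positivity)) (fun j hj => (hno j hj).le)
    have h2 : (C3 * Real.exp (c0 * q s) ^ N) ^ T * ((N.factorial : ℝ) ^ Fintype.card ι * Real.exp (-(δ / 2) * q s)) ≤
        C3 ^ T * (N.factorial : ℝ) ^ Fintype.card ι * Real.exp (-(δ / 4) * q s) := by
      rw [mul_pow, ← pow_mul, ← Real.exp_nat_mul]
      have : C3 ^ T * Real.exp (((N * T : ℕ) : ℝ) * (c0 * q s)) * ((N.factorial : ℝ) ^ Fintype.card ι * Real.exp (-(δ / 2) * q s))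
        = C3 ^ T * (N.factorial : ℝ) ^ Fintype.card ι * Real.exp (((N * T : ℕ) : ℝ) * (c0 * q s) + -(δ / 2) * q s) := by
        rw [Real.exp_add]; ring
      rw [this]
      refine mul_le_mul_of_nonneg_left (Real.exp_le_exp.mpr ?_) (by positivity)
      have h3 : (N * T : ℝ) * c0 ≤ δ / 4 := by
        rw [hc0, ← mul_div_assoc, div_le_iff₀ (by positivity)]
        nlinarith
      have h4 := mul_le_mul_of_nonneg_right h3 hqs
      push_cast
      push_cast at h4
      nlinarith
    linarith
end
end UE

set_option linter.all false
namespace UE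
open Finset Filter Topology

lemma fin_bd {α : Type*} [Finite α] (f : α → ℝ) : ∃ C : ℝ, 1 ≤ C ∧ ∀ x, f x ≤ C := by
  obtain ⟨C, hC⟩ := (Set.finite_range f).bddAbove
  exact ⟨max 1 C, le_max_left _ _, fun x => (hC ⟨x, rfl⟩).trans (le_max_right _ _)⟩

section
variable {I κ K ι : Type*} [Fintype I] [DecidableEq I] [Fintype κ] [DecidableEq κ] [Fintype ι] [DecidableEq ι]
  [Field K]

lemma ex_normal (eq : Option κ ≃ I) (y : κ → I → K) : ∃ (M : I → K) (l : I), M l = 1 ∧ ∀ k, ∑ i, M i * y k i = 0 := by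
  let φ : (I → K) →ₗ[K] (κ → K) := Matrix.mulVecLin (Matrix.of fun k i => y k i)
  have hc : Fintype.card κ + 1 = Fintype.card I := by
    rw [← Fintype.card_congr eq, Fintype.card_option]
  have h1 : LinearMap.ker φ ≠ ⊥ := LinearMap.ker_ne_bot_of_finrank_lt (by simp; omega)
  obtain ⟨M, hM, hM0⟩ := (Submodule.ne_bot_iff _).mp h1
  obtain ⟨l, hl⟩ := Function.ne_iff.mp hM0
  refine ⟨fun i => (M l)⁻¹ * M i, l, inv_mul_cancel₀ hl, fun k => ?_⟩
  have h2 : φ M k = 0 := by rw [LinearMap.mem_ker.mp hM]; rfl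
  have h3 : ∑ i, y k i * M i = 0 := by simpa [φ, Matrix.mulVec, dotProduct] using h2
  calc ∑ i, (M l)⁻¹ * M i * y k i = (M l)⁻¹ * ∑ i, y k i * M i := by
        rw [mul_sum]; exact sum_congr rfl fun i _ => by ring
    _ = 0 := by rw [h3, mul_zero]

lemma ex_m {a b : ℝ} (ha : 0 < a) : ∃ m : ℕ, 1 ≤ m ∧ b * Real.exp (-(a * m)) ≤ 1 / 2 := by
  have h1 := ev_small (q := fun m : ℕ => (m : ℝ)) tendsto_natCast_atTop_atTop (2 * b) (-a) (by linarith)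
  obtain ⟨m, hm, hm1⟩ := (h1.and (eventually_ge_atTop 1)).exists
  refine ⟨m, hm1, ?_⟩
  rw [← neg_mul]
  linarith

variable [CharZero K] [FiniteDimensional ℚ K] (av : ι → AbsoluteValue K ℝ) (O : Subring K)
  (hO : ∀ x : K, IsIntegral ℤ x → x ∈ O)
  (pf : ∀ x ∈ O, x ≠ 0 → 1 ≤ ∏ v, av v x) (A : ι → Matrix I I ℤ) (hd : ∀ v, ((A v).det : K) ≠ 0)
include hO pf hd

set_option maxHeartbeats 1600000 in
theorem thmP (eq : Option κ ≃ I) (c : ι → I → ℝ) {δ : ℝ} (hδ : 0 < δ) (hc : ∑ v, ∑ i, c v i ≤ -δ)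
    {q : ℕ → ℝ} (hq : Tendsto q atTop atTop) (y : ℕ → κ → I → K)
    (hyO : ∀ s k i, y s k i ∈ O) (hyl : ∀ s, LinearIndependent K (y s))
    (b : ℕ → ι → κ → ℝ) (hb : ∀ s v k, 0 < b s v k) (hb1 : ∀ s k, ∏ v, b s v k ≤ 1)
    (hy : ∀ s v k i, av v (∑ k', ((A v i k' : ℤ) : K) * y s k k') ≤ b s v k * Real.exp (c v i * q s)) :
    ∃ M : I → K, M ≠ 0 ∧ ∃ᶠ s in atTop, ∀ k, ∑ i, M i * y s k i = 0 := by
  by_contra hcon0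
  have hcon : ∀ M : I → K, M ≠ 0 → ¬ ∃ᶠ s in atTop, ∀ k, ∑ i, M i * y s k i = 0 :=
    fun M hM h => hcon0 ⟨M, hM, h⟩
  obtain ⟨c0, hc0, hst⟩ := step1 av O hO pf A hd eq c hδ hc hq y hyO hyl b hb hb1 hy hcon
  haveI : Nonempty I := ⟨eq none⟩
  have hιne : Nonempty ι := by
    by_contra h
    rw [not_nonempty_iff] at h
    simp at hc; linarith
  set N := Fintype.card I with hN
  set n := Fintype.card ι with hn
  have hN1 : (1:ℝ) ≤ N := by exact_mod_cast Fintype.card_pos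
  have hn1 : (1:ℝ) ≤ n := by exact_mod_cast Fintype.card_pos
  obtain ⟨C1, hC11, hC1⟩ := fin_bd fun x : ι × I => |c x.1 x.2|
  set ε := min 1 (δ / (8 * n * N ^ 2 * C1)) with hε
  have hεp : 0 < ε := by rw [hε]; positivity
  have hε1 : ε ≤ 1 := min_le_left _ _
  obtain ⟨m, hm1, hm⟩ := ex_m (a := ε ^ 2 / 4) (b := n * (2 * N)) (by positivity)
  have hmp : (1:ℝ) ≤ m := by exact_mod_cast hm1
  set σ := δ * m / (8 * n * N * C1) with hσ
  have hσp : 0 < σ := by rw [hσ]; positivity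
  obtain ⟨ω, hω, hRL⟩ := RL m (Module.finrank ℚ K) σ hσp
  obtain ⟨cA, hcA1, hcA⟩ := fin_bd fun x : ι × I => ∑ k, |((A x.1).adjugate x.2 k : ℝ)|
  obtain ⟨C3, hC31, hC3⟩ := fin_bd fun x : ι × I × I => |(A x.1 x.2.1 x.2.2 : ℝ)|
  obtain ⟨C4, hC41, hC4⟩ := fin_bd fun v : ι => (av v ((A v).det : K))⁻¹
  set C2 := 4 ^ N * cA ^ 2 + Fintype.card κ + C3 + C4 with hC2
  have h4N : (1:ℝ) ≤ 4 ^ N := one_le_pow₀ (by norm_num)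
  have hcA2 : (1:ℝ) ≤ cA ^ 2 := one_le_pow₀ hcA1
  have h4c : (1:ℝ) ≤ 4 ^ N * cA ^ 2 := by nlinarith
  have hκ0 : (0:ℝ) ≤ Fintype.card κ := by positivity
  have hC21 : 1 ≤ C2 := by rw [hC2]; linarith
  have hlog : 0 ≤ Real.log C2 := Real.log_nonneg hC21
  obtain ⟨q0, hq01, hq0a, hq0b⟩ : ∃ q0 : ℝ, 1 ≤ q0 ∧ 24 * N * n * Real.log C2 / δ ≤ q0 ∧
      2 * m * (1 + Real.log C2) / (ω * c0) ≤ q0 :=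
    ⟨max 1 (max (24 * N * n * Real.log C2 / δ) (2 * m * (1 + Real.log C2) / (ω * c0))), le_max_left _ _,
      (le_max_left _ _).trans (le_max_right _ _), (le_max_right _ _).trans (le_max_right _ _)⟩
  have hq0p : 0 < q0 := by linarith
  obtain ⟨t, ht1, ht2⟩ := exists_seq_of_forall_finset_exists
    (fun s => q0 ≤ q s ∧ ∀ (M : I → K) (l : I), M l = 1 → (∀ k, ∑ i, M i * y s k i = 0) →
      ∃ j, j ≠ l ∧ Real.exp (c0 * q s) ≤ ht (mp (-M j))) (fun x y => 2 * q x ≤ ω * q y) (by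
    intro S _
    have h1 : ∀ᶠ s in atTop, ∀ x ∈ S, 2 * q x / ω ≤ q s := by
      rw [Filter.eventually_all_finset]
      exact fun x _ => hq.eventually_ge_atTop _
    obtain ⟨s, hs⟩ := ((hq.eventually_ge_atTop q0).and (hst.and h1)).exists
    refine ⟨s, ⟨hs.1, hs.2.1⟩, fun x hx => ?_⟩
    have := hs.2.2 x hx
    rw [div_le_iff₀ hω] at this
    linarith)
  let sx : Fin m → ℕ := fun h => t (m - 1 - h)
  have hsx1 : ∀ h, q0 ≤ q (sx h) := fun h => (ht1 _).1
  have hsxp : ∀ h, 0 < q (sx h) := fun h => hq0p.trans_le (hsx1 h)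
  have hsx2 : ∀ h h', h < h' → 2 * q (sx h') ≤ ω * q (sx h) := fun h h' hh => ht2 _ _ (by
    have := h'.2; have : h.1 < h'.1 := hh; omega)
  choose M l hMl hMk using fun h => ex_normal eq (y (sx h))
  choose j0 hj0 hjht using fun h => (ht1 (m - 1 - (h : Fin m))).2 (M h) (l h) (hMl h) (hMk h)
  choose sp hsp using fun h => Ym_span eq (y (sx h)) (hyl _) (l h) (M h) (hMl h) (hMk h)
  set L := (∑ h, q (sx h)) / ε + 1 with hL
  have hLp : 0 < L := by
    have : 0 ≤ ∑ h, q (sx h) := sum_nonneg fun h _ => (hsxp h).le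
    rw [hL]; positivity
  have hLq : ∀ h, q (sx h) ≤ ε * L := by
    intro h
    have h1 := single_le_sum (f := fun h => q (sx h)) (fun h _ => (hsxp h).le) (mem_univ h)
    have h2 : ε * L = (∑ h, q (sx h)) + ε := by rw [hL]; field_simp
    rw [h2]; linarith
  clear_value L
  let r : Fin m → ℕ := fun h => ⌈L / q (sx h)⌉₊
  have hr : ∀ h, 1 ≤ r h := fun h => Nat.one_le_iff_ne_zero.mpr (Nat.ceil_pos.mpr (div_pos hLp (hsxp h))).ne'
  have hrq1 : ∀ h, L ≤ r h * q (sx h) := fun h => (div_le_iff₀ (hsxp h)).mp (Nat.le_ceil _)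
  have hrq2 : ∀ h, r h * q (sx h) ≤ (1 + ε) * L := by
    intro h
    have h1 : (r h : ℝ) < L / q (sx h) + 1 := Nat.ceil_lt_add_one (div_pos hLp (hsxp h)).le
    have h2 := mul_le_mul_of_nonneg_right h1.le (hsxp h).le
    rw [add_mul, div_mul_cancel₀ _ (hsxp h).ne'] at h2
    linarith [hLq h]
  obtain ⟨P, hP0, hPb, hPl, hP2⟩ := aux_poly (fun v => (A v).adjugate) hεp (by linarith) (m := m) (by
    have : ε ^ 2 * m / 4 = ε ^ 2 / 4 * m := by ring
    rw [this, ← mul_assoc]; exact hm) hcA1 (fun v i => hcA (v, i)) r hr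
  have hPl' : l1 P ≤ C2 ^ (∑ h, r h) := by
    refine hPl.trans (pow_le_pow_left₀ (by positivity) ?_ _)
    rw [hC2]; nlinarith
  have hF := vanish av O pf A hd hr hPb hεp hε1 hLp hP2 (fun h => y (sx h)) (fun h => hyO _) l (fun h => b (sx h))
    (fun h => hb _) (fun h => hb1 _) c hc (fun h => q (sx h)) hsxp hrq1 hrq2 C1 C2 (fun v i => hC1 (v, i))
    (fun v i k => by have := hC3 (v, i, k); simp only at this; rw [hC2]; linarith) hC21
    (fun v => by
      have h1 : 0 < av v ((A v).det : K) := (av v).pos (hd v)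
      have h2 : (av v ((A v).det : K))⁻¹ ≤ C2 := (hC4 v).trans (by rw [hC2]; linarith)
      calc (1:ℝ) = av v ((A v).det : K) * (av v ((A v).det : K))⁻¹ := (mul_inv_cancel₀ h1.ne').symm
        _ ≤ _ := mul_le_mul_of_nonneg_left h2 h1.le)
    (fun v => by
      refine (l1_lsub _ (fun i => hcA (v, i)) hPb).trans ?_
      refine (mul_le_mul_of_nonneg_left hPl (by positivity)).trans ?_
      rw [← mul_pow]
      refine pow_le_pow_left₀ (by positivity) ?_ _
      rw [hC2]; nlinarith) (by linarith) (fun h => hy _) (σ := σ) hq0p hsx1 (by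
      have e1 : n * (2 * ε * m * N * C1) ≤ δ * m / (4 * N) := by
        have : ε ≤ δ / (8 * n * N ^ 2 * C1) := min_le_right _ _
        calc n * (2 * ε * m * N * C1) ≤ n * (2 * (δ / (8 * n * N ^ 2 * C1)) * m * N * C1) := by gcongr
          _ = δ * m / (4 * N) := by field_simp; norm_num
      have e2 : n * (2 * C1 * σ) = δ * m / (4 * N) := by rw [hσ]; field_simp; norm_num
      have e3 : n * (6 * Real.log C2 * m / q0) ≤ δ * m / (4 * N) := by
        rw [div_le_iff₀ hδ] at hq0a
        rw [← mul_div_assoc, div_le_div_iff₀ hq0p (by positivity)]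
        have := mul_le_mul_of_nonneg_left hq0a (by positivity : (0:ℝ) ≤ m)
        linarith
      have e4 : δ * (m / N) = 4 * (δ * m / (4 * N)) := by field_simp
      have e5 : 0 < δ * m / (4 * N) := by positivity
      rw [e4, mul_add, mul_add]
      linarith)
  replace hjht : ∀ h, Real.exp (c0 * q (sx h)) ≤ ht (mp (-M h (j0 h))) := hjht
  clear_value r sx C2 ε σ
  obtain ⟨p, hp0, hpb, hpl, hpn⟩ := restr hj0 M (fun h => y (sx h)) sp hsp hP0 hPb (σ := σ) hF
  set R := ∑ h, (r h : ℝ) with hR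
  have hrR : ∀ h, (r h : ℝ) ≤ R := fun h => single_le_sum (f := fun h => (r h : ℝ)) (fun _ _ => by positivity) (mem_univ h)
  have hR0 : 0 ≤ R := sum_nonneg fun _ _ => by positivity
  have hR2 : R ≤ m * (2 * L / q0) := by
    refine (sum_le_card_nsmul _ _ (2 * L / q0) fun h _ => ?_).trans (by simp)
    rw [le_div_iff₀ hq0p]
    have h1 : (r h : ℝ) * q0 ≤ r h * q (sx h) := mul_le_mul_of_nonneg_left (hsx1 h) (by positivity)
    have := hrq2 h
    nlinarith
  obtain ⟨a, ha1, ha2⟩ := hRL (fun h => - M h (j0 h)) (fun h => mp (- M h (j0 h))) (fun h => (r h : ℝ))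
    ((1 + Real.log C2) * R) p (fun h => by
      obtain ⟨g1, g2, g3, g4⟩ := mp_spec (- M h (j0 h))
      refine ⟨g1, g2, g3, g4, by exact_mod_cast hr h, ?_, ?_⟩
      · have := hrR h; nlinarith
      · have k1 : c0 * q (sx h) ≤ Real.log (ht (mp (-M h (j0 h)))) := by
          rw [← Real.log_exp (c0 * q (sx h))]
          exact Real.log_le_log (Real.exp_pos _) (hjht h)
        calc (1 + Real.log C2) * R ≤ (1 + Real.log C2) * (m * (2 * L / q0)) := by gcongr
          _ ≤ ω * c0 * L := by
            rw [div_le_iff₀ (by positivity)] at hq0b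
            have : (1 + Real.log C2) * (m * (2 * L / q0)) = (2 * m * (1 + Real.log C2)) * L / q0 := by ring
            rw [this, div_le_iff₀ hq0p]
            have := mul_le_mul_of_nonneg_right hq0b hLp.le
            linarith
          _ ≤ ω * c0 * (r h * q (sx h)) := by gcongr; exact hrq1 h
          _ = ω * r h * (c0 * q (sx h)) := by ring
          _ ≤ _ := by gcongr)
    (fun h h' hh => by
      have k1 := hrq2 h
      have k2 := hrq1 h'
      have k3 := hsx2 h h' hh
      have k4 : (r h : ℝ) * q (sx h) ≤ 2 * (r h' * q (sx h')) := by nlinarith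
      have k5 : (r h : ℝ) * q (sx h) ≤ (ω * r h') * q (sx h) := by
        have := mul_le_mul_of_nonneg_left k3 (by positivity : (0:ℝ) ≤ r h')
        nlinarith
      exact le_of_mul_le_mul_right k5 (hsxp h))
    hp0 hpb (by
      refine (hpl.trans hPl').trans ?_
      rw [← Real.exp_log (show 0 < C2 by linarith), ← Real.exp_nat_mul, Real.exp_log (show 0 < C2 by linarith)]
      refine Real.exp_le_exp.mpr ?_
      push_cast
      rw [← hR]; nlinarith)
  exact absurd (hpn a ha1) (not_le.mpr ha2)
end
end UE

set_option linter.all false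
namespace UE
open Finset Filter Topology

section
variable {K ι : Type*} {n : ℕ} [Fintype ι] [DecidableEq ι] [Field K]

/-- value of the i-th form at v -/
def fo (A : ι → Matrix (Fin n) (Fin n) ℤ) (v : ι) (i : Fin n) (x : Fin n → K) : K := ∑ k, ((A v i k : ℤ) : K) * x k

lemma fo_add (A : ι → Matrix (Fin n) (Fin n) ℤ) (v i) (x y : Fin n → K) : fo A v i (x + y) = fo A v i x + fo A v i y := by
  simp [fo, mul_add, sum_add_distrib]

variable (av : ι → AbsoluteValue K ℝ) (A : ι → Matrix (Fin n) (Fin n) ℤ)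

/-- weighted local norm -/
noncomputable def Nv (t : ι → Fin n → ℝ) (v : ι) (x : Fin n → K) : ℝ := ‖fun i => t v i * av v (fo A v i x)‖

/-- weighted height -/
noncomputable def HH (t : ι → Fin n → ℝ) (x : Fin n → K) : ℝ := ∏ v, Nv av A t v x

lemma Nv_nonneg (t : ι → Fin n → ℝ) (v : ι) (x : Fin n → K) : 0 ≤ Nv av A t v x := norm_nonneg _

lemma HH_nonneg (t : ι → Fin n → ℝ) (x : Fin n → K) : 0 ≤ HH av A t x := prod_nonneg fun _ _ => Nv_nonneg _ _ _ _ _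

lemma le_Nv {t : ι → Fin n → ℝ} (v : ι) (x : Fin n → K) (i : Fin n) :
    t v i * av v (fo A v i x) ≤ Nv av A t v x :=
  (le_abs_self _).trans (norm_le_pi_norm (fun i => t v i * av v (fo A v i x)) i)

lemma Nv_le {t : ι → Fin n → ℝ} (ht : ∀ v i, 0 < t v i) {v : ι} {x : Fin n → K} {r : ℝ} (hr : 0 ≤ r)
    (h : ∀ i, t v i * av v (fo A v i x) ≤ r) : Nv av A t v x ≤ r := by
  refine (pi_norm_le_iff_of_nonneg hr).mpr fun i => ?_
  rw [Real.norm_of_nonneg (mul_nonneg (ht v i).le ((av v).nonneg _))]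
  exact h i

variable {A} (hd : ∀ v, ((A v).det : K) ≠ 0)
include hd

lemma fo_inj {v : ι} {x : Fin n → K} (h : ∀ i, fo A v i x = 0) : x = 0 := by
  have h1 : ((A v).map (fun z : ℤ => (z : K))).mulVec x = 0 := by
    ext i; simpa [Matrix.mulVec, dotProduct, fo] using h i
  refine Matrix.eq_zero_of_mulVec_eq_zero ?_ h1
  have h2 : ((A v).map (fun z : ℤ => (z : K))).det = ((A v).det : K) := by
    have := (Int.castRingHom K).map_det (A v); simpa [RingHom.mapMatrix_apply] using this.symm
  rw [h2]; exact hd v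

lemma Nv_pos {t : ι → Fin n → ℝ} (ht : ∀ v i, 0 < t v i) (v : ι) {x : Fin n → K} (hx : x ≠ 0) : 0 < Nv av A t v x := by
  by_contra h
  refine hx (fo_inj hd (v := v) fun i => ?_)
  by_contra hi
  exact h ((mul_pos (ht v i) ((av v).pos hi)).trans_le (le_Nv av A v x i))

lemma HH_pos {t : ι → Fin n → ℝ} (ht : ∀ v i, 0 < t v i) {x : Fin n → K} (hx : x ≠ 0) : 0 < HH av A t x :=
  prod_pos fun v _ => Nv_pos av hd ht v hx

/-- coordinates are bounded by forms -/
lemma coord_le : ∃ C : ℝ, 1 ≤ C ∧ ∀ (T : ℝ) (t : ι → Fin n → ℝ), 1 ≤ T → (∀ v i, 0 < t v i) → (∀ v i, 1 ≤ T * t v i) →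
    ∀ v (x : Fin n → K) k, av v (x k) ≤ C * T * Nv av A t v x := by
  obtain ⟨C, hC1, hC⟩ := fin_bd fun p : ι × Fin n =>
    ∑ i, av p.1 ((((A p.1).map (fun z : ℤ => (z : K)))⁻¹) p.2 i)
  refine ⟨C, hC1, fun T t hT ht htT v x k => ?_⟩
  set B := (A v).map (fun z : ℤ => (z : K)) with hB
  have hBd : IsUnit B.det := by
    have h2 : B.det = ((A v).det : K) := by
      have := (Int.castRingHom K).map_det (A v); simpa [RingHom.mapMatrix_apply] using this.symm
    rw [h2]; exact (hd v).isUnit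
  have h1 : x k = ∑ i, B⁻¹ k i * fo A v i x := by
    have : B⁻¹.mulVec (B.mulVec x) = x := by
      rw [Matrix.mulVec_mulVec, Matrix.nonsing_inv_mul _ hBd, Matrix.one_mulVec]
    conv_lhs => rw [← this]
    simp [Matrix.mulVec, dotProduct, fo, hB]
  have h3 : ∀ i, av v (fo A v i x) ≤ T * Nv av A t v x := by
    intro i
    have e1 := le_Nv av A (t := t) v x i
    have e2 := (av v).nonneg (fo A v i x)
    calc av v (fo A v i x) = 1 * av v (fo A v i x) := (one_mul _).symm
      _ ≤ T * t v i * av v (fo A v i x) := mul_le_mul_of_nonneg_right (htT v i) e2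
      _ = T * (t v i * av v (fo A v i x)) := by ring
      _ ≤ _ := mul_le_mul_of_nonneg_left e1 (by linarith)
  rw [h1]
  refine ((av v).sum_le _ _).trans ?_
  calc ∑ i, av v (B⁻¹ k i * fo A v i x) ≤ ∑ i, av v (B⁻¹ k i) * (T * Nv av A t v x) := by
        refine sum_le_sum fun i _ => ?_
        rw [map_mul]
        exact mul_le_mul_of_nonneg_left (h3 i) ((av v).nonneg _)
    _ = (∑ i, av v (B⁻¹ k i)) * (T * Nv av A t v x) := by rw [sum_mul]
    _ ≤ C * (T * Nv av A t v x) := by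
        refine mul_le_mul_of_nonneg_right (hC (v, k)) (mul_nonneg (by linarith) (Nv_nonneg _ _ _ _ _))
    _ = _ := by ring

variable (O : Subring K) (pf : ∀ x ∈ O, x ≠ 0 → 1 ≤ ∏ v, av v x)
include pf

/-- lower bound for the height -/
lemma HH_lower : ∃ C : ℝ, 1 ≤ C ∧ ∀ (T : ℝ) (t : ι → Fin n → ℝ), 1 ≤ T → (∀ v i, 0 < t v i) → (∀ v i, 1 ≤ T * t v i) →
    ∀ x : Fin n → K, (∀ i, x i ∈ O) → x ≠ 0 → 1 ≤ (C * T) ^ Fintype.card ι * HH av A t x := by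
  obtain ⟨C, hC1, hC⟩ := coord_le av hd
  refine ⟨C, hC1, fun T t hT ht htT x hxO hx => ?_⟩
  obtain ⟨k, hk⟩ := Function.ne_iff.mp hx
  refine (pf _ (hxO k) hk).trans ?_
  rw [HH, ← card_univ, ← prod_const, ← prod_mul_distrib]
  exact prod_le_prod (fun v _ => (av v).nonneg _) fun v _ => hC T t hT ht htT v x k

/-- greedy successive minima -/
theorem greedy {t : ι → Fin n → ℝ} (ht : ∀ v i, 0 < t v i) :
    ∃ (x : Fin n → Fin n → K) (μ : Fin n → ℝ) (V : ℕ → Submodule K (Fin n → K)),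
      Monotone V ∧ (∀ l ≤ n, Module.finrank K (V l) = l) ∧ (∀ l, V l ≤ Submodule.span K (x '' {j | j.1 < l})) ∧
      (∀ j, x j ∈ V (j.1 + 1)) ∧
      LinearIndependent K x ∧ (∀ j i, x j i ∈ O) ∧ (∀ j, 0 < μ j) ∧ Monotone μ ∧ (∀ j, HH av A t (x j) ≤ 2 * μ j) ∧
      ∀ (j : Fin n) (z : Fin n → K), (∀ i, z i ∈ O) → z ∉ V j.1 → μ j ≤ HH av A t z := by
  classical
  obtain ⟨C, hC1, hC⟩ := HH_lower av hd O pf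
  obtain ⟨T, hT1, hT⟩ := fin_bd fun p : ι × Fin n => (t p.1 p.2)⁻¹
  let S : Submodule K (Fin n → K) → Set ℝ := fun W => {r | ∃ z : Fin n → K, (∀ i, z i ∈ O) ∧ z ∉ W ∧ r = HH av A t z}
  have hCT : 0 < (C * T) ^ Fintype.card ι := by positivity
  have hlow : ∀ W, ∀ r ∈ S W, ((C * T) ^ Fintype.card ι)⁻¹ ≤ r := by
    rintro W r ⟨z, hzO, hzW, rfl⟩
    rw [inv_le_iff_one_le_mul₀' hCT]
    exact hC T t hT1 ht (fun v i => by
      have := hT (v, i)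
      rw [← inv_mul_cancel₀ (ht v i).ne']
      exact mul_le_mul_of_nonneg_right this (ht v i).le) z hzO (fun h => hzW (h ▸ W.zero_mem))
  have hbdd : ∀ W, BddBelow (S W) := fun W => ⟨_, fun r hr => hlow W r hr⟩
  have hSne : ∀ W, W ≠ ⊤ → (S W).Nonempty := by
    intro W hW
    by_contra h
    refine hW (eq_top_iff.mpr ?_)
    rw [← (Pi.basisFun K (Fin n)).span_eq, Submodule.span_le]
    rintro _ ⟨i, rfl⟩
    by_contra hi
    refine h ⟨_, _, ?_, hi, rfl⟩
    intro j
    rw [Pi.basisFun_apply, Pi.single_apply]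
    split_ifs
    · exact O.one_mem
    · exact O.zero_mem
  have hpos : ∀ W, W ≠ ⊤ → 0 < sInf (S W) := fun W hW =>
    (inv_pos.mpr hCT).trans_le (le_csInf (hSne W hW) (hlow W))
  have hpick : ∀ W, ∃ z : Fin n → K, W ≠ ⊤ → (∀ i, z i ∈ O) ∧ z ∉ W ∧ HH av A t z ≤ 2 * sInf (S W) := by
    intro W
    by_cases hW : W = ⊤
    · exact ⟨0, fun h => absurd hW h⟩
    · obtain ⟨r, ⟨z, h1, h2, rfl⟩, h3⟩ := exists_lt_of_csInf_lt (hSne W hW)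
        (show sInf (S W) < 2 * sInf (S W) by linarith [hpos W hW])
      exact ⟨z, fun _ => ⟨h1, h2, h3.le⟩⟩
  choose pick hp using hpick
  obtain ⟨V, hV0, hVs⟩ : ∃ V : ℕ → Submodule K (Fin n → K), V 0 = ⊥ ∧
      ∀ l, V (l + 1) = V l ⊔ Submodule.span K {pick (V l)} :=
    ⟨fun l => Nat.rec ⊥ (fun _ W => W ⊔ Submodule.span K {pick W}) l, rfl, fun _ => rfl⟩
  have hmono : Monotone V := monotone_nat_of_le_succ fun l => by rw [hVs]; exact le_sup_left
  have hfr : ∀ l : ℕ, l ≤ n → Module.finrank K (V l) = l := by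
    intro l
    induction l with
    | zero => intro _; rw [hV0]; simp
    | succ l ih =>
      intro hl
      have h1 := ih (by omega)
      have hne : V l ≠ ⊤ := by
        intro h; rw [h, finrank_top] at h1; simp at h1; omega
      rw [hVs, Submodule.finrank_sup_span_singleton (hp _ hne).2.1, h1]
  have hne : ∀ l < n, V l ≠ ⊤ := by
    intro l hl h
    have h1 := hfr l hl.le
    rw [h, finrank_top] at h1; simp at h1; omega
  let x : Fin n → Fin n → K := fun j => pick (V j.1)
  have hxV : ∀ j, x j ∈ V (j.1 + 1) := fun j => by
    rw [hVs]; exact (le_sup_right : _ ≤ V j.1 ⊔ _) (Submodule.mem_span_singleton_self _)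
  have hspan : ∀ l, l ≤ n → V l ≤ Submodule.span K (x '' {j | j.1 < l}) := by
    intro l
    induction l with
    | zero => intro _; rw [hV0]; exact bot_le
    | succ l ih =>
      intro hl
      rw [hVs, sup_le_iff]
      refine ⟨(ih (by omega)).trans (Submodule.span_mono (Set.image_mono fun j hj => ?_)), ?_⟩
      · simp only [Set.mem_setOf_eq] at hj ⊢; omega
      · rw [Submodule.span_singleton_le_iff_mem]
        exact Submodule.subset_span ⟨⟨l, by omega⟩, by simp, rfl⟩
  have htop : V n = ⊤ := Submodule.eq_top_of_finrank_eq (by rw [hfr n le_rfl]; simp)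
  refine ⟨x, fun j => sInf (S (V j.1)), V, hmono, hfr, ?_, hxV, ?_, fun j => (hp _ (hne j j.2)).1,
    fun j => hpos _ (hne j j.2), ?_, fun j => (hp _ (hne j j.2)).2.2, ?_⟩
  · intro l
    rcases le_or_gt l n with h | h
    · exact hspan l h
    · refine (le_top.trans (htop ▸ hspan n le_rfl)).trans (Submodule.span_mono (Set.image_mono fun j hj => ?_))
      simp only [Set.mem_setOf_eq] at hj ⊢; omega
  · refine linearIndependent_of_top_le_span_of_card_eq_finrank ?_ (by simp)
    rw [← htop]
    exact (hspan n le_rfl).trans (Submodule.span_mono (Set.image_subset_range _ _))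
  · intro j j' hjj
    refine csInf_le_csInf (hbdd _) (hSne _ (hne j' j'.2)) ?_
    rintro r ⟨z, h1, h2, h3⟩
    exact ⟨z, h1, fun h => h2 (hmono hjj h), h3⟩
  · intro j z hzO hz
    exact csInf_le (hbdd _) ⟨z, hzO, hz, rfl⟩
end
end UE

set_option linter.all false
namespace UE
open Finset Filter Topology

section
variable {K : Type*} {n : ℕ} [Field K]

/-- a relation among `j+1` forms on a `j`-dimensional space -/
lemma rel_forms (W : Submodule K (Fin n → K)) (j : ℕ) (hW : Module.finrank K W = j) (L : Fin n → (Fin n → K) →ₗ[K] K)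
    (s : Finset (Fin n)) (hs : j < s.card) :
    ∃ a : Fin n → K, (∃ i ∈ s, a i ≠ 0) ∧ ∀ x ∈ W, ∑ i ∈ s, a i * L i x = 0 := by
  have h1 : ¬ LinearIndependent K (fun i : s => (L i).comp W.subtype) := by
    intro h
    have := h.fintype_card_le_finrank
    rw [Subspace.dual_finrank_eq, hW] at this
    simp at this
    omega
  rw [Fintype.not_linearIndependent_iff] at h1
  obtain ⟨g, hg, i, hi⟩ := h1
  classical
  refine ⟨fun i => if h : i ∈ s then g ⟨i, h⟩ else 0, ⟨i, i.2, by simpa using hi⟩, fun x hx => ?_⟩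
  have h2 := congrArg (fun f : W →ₗ[K] K => f ⟨x, hx⟩) hg
  simp only [LinearMap.sum_apply, LinearMap.smul_apply, LinearMap.comp_apply, Submodule.subtype_apply, smul_eq_mul,
    LinearMap.zero_apply] at h2
  rw [← Finset.sum_coe_sort]
  rw [← h2]
  exact sum_congr rfl fun i _ => by simp

/-- the lemma of Davenport -/
theorem davenport (v : AbsoluteValue K ℝ) (V : ℕ → Submodule K (Fin n → K)) (hV : Monotone V)
    (hfr : ∀ l ≤ n, Module.finrank K (V l) = l) (t : Fin n → ℝ) (ht : ∀ i, 0 < t i) (L : Fin n → (Fin n → K) →ₗ[K] K) :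
    ∃ e : Fin n ≃ Fin n, ∀ (l : Fin n), ∀ x ∈ V (l.1 + 1), ∀ i, ∃ l' ≤ l,
      t i * v (L i x) ≤ (n : ℝ) ^ n * (t (e l') * v (L (e l') x)) := by
  have key : ∀ d : ℕ, d ≤ n → ∃ e : Fin n ≃ Fin n, ∀ l : ℕ, 1 ≤ l → n - d ≤ l → l ≤ n → ∀ x ∈ V l, ∀ i, ∃ l' : Fin n,
      l'.1 < l ∧ t i * v (L i x) ≤ (n : ℝ) ^ d * (t (e l') * v (L (e l') x)) := by
    intro d
    induction d with
    | zero =>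
      intro _
      refine ⟨Equiv.refl _, fun l hl h1 h2 x _ i => ⟨i, by have := i.2; omega, by simp⟩⟩
    | succ d ih =>
      intro hdn
      obtain ⟨e, he⟩ := ih (by omega)
      have hn1 : (1:ℝ) ≤ n := by exact_mod_cast (by omega : 1 ≤ n)
      obtain ⟨j, hj⟩ : ∃ j, j = n - (d + 1) := ⟨_, rfl⟩
      have hjn : j < n := by omega
      let s : Finset (Fin n) := univ.filter fun l => l.1 < j + 1
      have hscard : s.card = j + 1 := by
        have : s = Finset.Iic (⟨j, hjn⟩ : Fin n) := by
          ext l; simp [s, Fin.le_def]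
        rw [this, Fin.card_Iic]
      obtain ⟨a, ⟨i0, hi0s, hi0⟩, ha⟩ := rel_forms (V j) j (hfr j hjn.le) (fun l => L (e l)) s (by omega)
      obtain ⟨p, hps, hpm⟩ := exists_max_image s (fun l => v (a l) / t (e l)) ⟨i0, hi0s⟩
      have hpj : p.1 ≤ j := by have := (mem_filter.mp hps).2; omega
      have hap : a p ≠ 0 := by
        intro h
        have h1 := hpm i0 hi0s
        rw [h, map_zero, zero_div] at h1
        exact absurd h1 (not_le.mpr (div_pos (v.pos hi0) (ht _)))
      -- the form at p is dominated
      have hdom : ∀ x ∈ V j, t (e p) * v (L (e p) x) ≤ ∑ l ∈ s.erase p, t (e l) * v (L (e l) x) := by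
        intro x hx
        have h1 := ha x hx
        rw [← add_sum_erase _ _ hps] at h1
        have h2 : v (a p) * v (L (e p) x) ≤ ∑ l ∈ s.erase p, v (a l) * v (L (e l) x) := by
          rw [← map_mul, eq_neg_of_add_eq_zero_left h1, v.map_neg]
          exact (v.sum_le _ _).trans (sum_le_sum fun l _ => by rw [map_mul])
        have h3 : ∀ l ∈ s.erase p, v (a l) * v (L (e l) x) ≤ v (a p) / t (e p) * (t (e l) * v (L (e l) x)) := by
          intro l hl
          have h4 := hpm l (mem_of_mem_erase hl)
          rw [div_le_iff₀ (ht _)] at h4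
          calc _ ≤ _ := mul_le_mul_of_nonneg_right h4 (v.nonneg _)
            _ = _ := by ring
        have h5 := h2.trans (sum_le_sum h3)
        rw [← mul_sum] at h5
        have h6 : 0 < v (a p) := v.pos hap
        have h7 : v (a p) * v (L (e p) x) = v (a p) / t (e p) * (t (e p) * v (L (e p) x)) := by
          have := (ht (e p)).ne'; field_simp
        rw [h7] at h5
        exact le_of_mul_le_mul_left h5 (div_pos h6 (ht _))
      refine ⟨(Equiv.swap p ⟨j, hjn⟩).trans e, fun l hl h1 h2 x hx i => ?_⟩
      rcases Nat.lt_or_ge j l with h | h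
      · obtain ⟨l', hl', hb⟩ := he l hl (by omega) h2 x hx i
        refine ⟨Equiv.swap p ⟨j, hjn⟩ l', ?_, ?_⟩
        · rw [Equiv.swap_apply_def]; split_ifs <;> omega
        · rw [Equiv.trans_apply, Equiv.swap_apply_self]
          refine hb.trans (mul_le_mul_of_nonneg_right (pow_le_pow_right₀ hn1 (by omega))
            (mul_nonneg (ht _).le (v.nonneg _)))
      · have hlj : l = j := by omega
        subst hlj
        -- any position below `l+1` other than `p` is fine
        have hgood : ∀ l' : Fin n, l'.1 < l + 1 → l' ≠ p → (Equiv.swap p ⟨l, hjn⟩ l').1 < l := by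
          intro l' h1 h2
          rw [Equiv.swap_apply_def]
          rw [if_neg h2]
          split_ifs with h3
          · have : p ≠ ⟨l, hjn⟩ := fun h => h2 (by rw [h, ← ‹l' = ⟨l, hjn⟩›])
            have : p.1 ≠ l := fun h => this (Fin.ext h)
            omega
          · have : l'.1 ≠ l := fun h => ‹¬ l' = ⟨l, hjn⟩› (Fin.ext h)
            omega
        obtain ⟨l', hl', hb⟩ := he (l + 1) (by omega) (by omega) (by omega) x (hV (by omega) hx) i
        by_cases hp : l' = p
        · subst hp
          have h3 := hdom x hx
          have hne : (s.erase l').Nonempty := by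
            rw [← card_pos, card_erase_of_mem hps, hscard]; omega
          obtain ⟨l2, hl2, hm⟩ := exists_max_image (s.erase l') (fun l => t (e l) * v (L (e l) x)) hne
          have h4 : ∑ l ∈ s.erase l', t (e l) * v (L (e l) x) ≤ n * (t (e l2) * v (L (e l2) x)) := by
            refine (sum_le_card_nsmul _ _ _ hm).trans ?_
            rw [nsmul_eq_mul]
            refine mul_le_mul_of_nonneg_right ?_ (mul_nonneg (ht _).le (v.nonneg _))
            exact_mod_cast (card_le_univ _).trans (by simp)
          refine ⟨Equiv.swap l' ⟨l, hjn⟩ l2, hgood l2 (mem_filter.mp (mem_of_mem_erase hl2)).2 (ne_of_mem_erase hl2), ?_⟩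
          rw [Equiv.trans_apply, Equiv.swap_apply_self]
          refine hb.trans ?_
          rw [pow_succ, mul_assoc]
          exact mul_le_mul_of_nonneg_left (h3.trans h4) (by positivity)
        · refine ⟨_, hgood l' hl' hp, ?_⟩
          rw [Equiv.trans_apply, Equiv.swap_apply_self]
          exact hb.trans (mul_le_mul_of_nonneg_right (pow_le_pow_right₀ hn1 (by omega))
            (mul_nonneg (ht _).le (v.nonneg _)))
  obtain ⟨e, he⟩ := key n le_rfl
  refine ⟨e, fun l x hx i => ?_⟩
  obtain ⟨l', h1, h2⟩ := he (l.1 + 1) (by omega) (by omega) (by have := l.2; omega) x hx i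
  exact ⟨l', by rw [Fin.le_def]; omega, h2⟩
end

section
variable {K ι : Type*} {n : ℕ} [Fintype ι] [DecidableEq ι] [Field K]
variable (av : ι → AbsoluteValue K ℝ) {A : ι → Matrix (Fin n) (Fin n) ℤ} (v0 : ι)

/-- modified weights -/
noncomputable def tw (t : ι → Fin n → ℝ) (ρ : Fin n → ℝ) : ι → Fin n → ℝ := fun v i => t v i * if v = v0 then ρ i else 1

lemma tw_pos {t : ι → Fin n → ℝ} (ht : ∀ v i, 0 < t v i) {ρ : Fin n → ℝ} (hρ : ∀ i, 0 < ρ i) (v i) : 0 < tw v0 t ρ v i := by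
  rw [tw]; have := ht v i; have := hρ i; split_ifs <;> simp <;> positivity

lemma prod_tw (t : ι → Fin n → ℝ) (ρ : Fin n → ℝ) : ∏ v, ∏ i, tw v0 t ρ v i = (∏ v, ∏ i, t v i) * ∏ i, ρ i := by
  simp only [tw, prod_mul_distrib]
  congr 1
  rw [Finset.prod_comm]
  simp

/-- the form as a linear map -/
noncomputable def foL (A : ι → Matrix (Fin n) (Fin n) ℤ) (v : ι) (i : Fin n) : (Fin n → K) →ₗ[K] K where
  toFun := fo A v i
  map_add' := fo_add A v i
  map_smul' := fun c x => by simp [fo, mul_sum]; exact sum_congr rfl fun i _ => by ring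

/-- lower bounds for tilted weights -/
theorem tilt (O : Subring K) {t : ι → Fin n → ℝ} (ht : ∀ v i, 0 < t v i) {V : ℕ → Submodule K (Fin n → K)}
    (hVn : ∀ z, z ∈ V n) {μ : Fin n → ℝ}
    (hμV : ∀ (j : Fin n) (z : Fin n → K), (∀ i, z i ∈ O) → z ∉ V j.1 → μ j ≤ HH av A t z)
    {e : Fin n ≃ Fin n} {D : ℝ} (hD : 0 < D) (he : ∀ (l : Fin n), ∀ x ∈ V (l.1 + 1), ∀ i, ∃ l' ≤ l,
      t v0 i * av v0 (fo A v0 i x) ≤ D * (t v0 (e l') * av v0 (fo A v0 (e l') x)))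
    {ρ : Fin n → ℝ} (hρ : ∀ i, 0 < ρ i) (hρa : Antitone ρ) (hρμ : Monotone fun l => ρ l * μ l)
    (l : Fin n) (z : Fin n → K) (hzO : ∀ i, z i ∈ O) (hz : z ∉ V l.1) :
    ρ l * μ l ≤ D * HH av A (tw v0 t fun i => ρ (e.symm i)) z := by
  classical
  -- find the level
  have hex : ∃ j : ℕ, z ∈ V (j + 1) ∧ l.1 ≤ j ∧ j < n ∧ z ∉ V j := by
    by_contra hno
    push Not at hno
    have : ∀ j, l.1 ≤ j → j ≤ n → z ∉ V j := by
      intro j hj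
      induction j, hj using Nat.le_induction with
      | base => exact fun _ => hz
      | succ j hj ih => exact fun h1 h2 => ih (by omega) (hno j h2 hj (by omega))
    exact this n l.2.le le_rfl (hVn z)
  obtain ⟨j, hj1, hlj, hjn, hj2⟩ := hex
  let J : Fin n := ⟨j, hjn⟩
  set t' := tw v0 t fun i => ρ (e.symm i) with ht'
  have h1 : μ J ≤ HH av A t z := hμV J z hzO hj2
  have hpos' : ∀ v i, 0 < t' v i := tw_pos v0 ht fun i => hρ _
  have h2 : ρ J * Nv av A t v0 z ≤ D * Nv av A t' v0 z := by
    rw [mul_comm, ← le_div_iff₀ (hρ J)]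
    refine Nv_le av A ht (div_nonneg (mul_nonneg hD.le (Nv_nonneg _ _ _ _ _)) (hρ J).le) fun i => ?_
    obtain ⟨l', hl', hb⟩ := he J z hj1 i
    rw [le_div_iff₀ (hρ J)]
    have h3 := le_Nv av A (t := t') v0 z (e l')
    have h4 : t' v0 (e l') = t v0 (e l') * ρ l' := by simp [ht', tw]
    rw [h4] at h3
    have h5 : 0 ≤ t v0 (e l') * av v0 (fo A v0 (e l') z) := mul_nonneg (ht _ _).le ((av v0).nonneg _)
    calc t v0 i * av v0 (fo A v0 i z) * ρ J ≤ D * (t v0 (e l') * av v0 (fo A v0 (e l') z)) * ρ J :=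
          mul_le_mul_of_nonneg_right hb (hρ J).le
      _ ≤ D * (t v0 (e l') * av v0 (fo A v0 (e l') z)) * ρ l' :=
          mul_le_mul_of_nonneg_left (hρa hl') (mul_nonneg hD.le h5)
      _ = D * (t v0 (e l') * ρ l' * av v0 (fo A v0 (e l') z)) := by ring
      _ ≤ _ := mul_le_mul_of_nonneg_left h3 hD.le
  have h6 : ∀ v, v ≠ v0 → Nv av A t' v z = Nv av A t v z := by
    intro v hv
    simp [Nv, ht', tw, hv]
  have h7 : ρ J * HH av A t z ≤ D * HH av A t' z := by
    rw [HH, HH, ← mul_prod_erase univ _ (mem_univ v0), ← mul_prod_erase univ _ (mem_univ v0),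
      prod_congr rfl fun v hv => h6 v (ne_of_mem_erase hv), ← mul_assoc, ← mul_assoc]
    exact mul_le_mul_of_nonneg_right h2 (prod_nonneg fun _ _ => Nv_nonneg _ _ _ _ _)
  have h8 : ρ l * μ l ≤ ρ J * μ J := hρμ (show l ≤ J from hlj)
  exact h8.trans ((mul_le_mul_of_nonneg_left h1 (hρ J).le).trans h7)

/-- determinant estimate -/
theorem det_est (hd : ∀ v, ((A v).det : K) ≠ 0) (O : Subring K) (pf : ∀ x ∈ O, x ≠ 0 → 1 ≤ ∏ v, av v x) :
    ∃ C : ℝ, 1 ≤ C ∧ ∀ (t : ι → Fin n → ℝ), (∀ v i, 0 < t v i) → ∀ x : Fin n → Fin n → K, LinearIndependent K x →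
      (∀ j i, x j i ∈ O) → ∏ v, ∏ i, t v i ≤ C * ∏ j, HH av A t (x j) := by
  obtain ⟨C, hC1, hC⟩ := fin_bd fun v => (av v ((A v).det : K))⁻¹
  have hf : (1:ℝ) ≤ (n.factorial : ℝ) := by exact_mod_cast Nat.one_le_iff_ne_zero.mpr n.factorial_ne_zero
  refine ⟨(C * n.factorial) ^ Fintype.card ι, one_le_pow₀ (by nlinarith), fun t ht x hx hxO => ?_⟩
  let X : Matrix (Fin n) (Fin n) K := Matrix.of fun i j => x j i
  have hX0 : X.det ≠ 0 := by
    have h1 : LinearIndependent K (Matrix.transpose X).row := hx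
    have h2 := Matrix.linearIndependent_rows_iff_isUnit.mp h1
    rw [Matrix.isUnit_iff_isUnit_det, Matrix.det_transpose] at h2
    exact h2.ne_zero
  have hXO : X.det ∈ O := by
    rw [Matrix.det_apply]
    refine sum_mem fun σ _ => ?_
    rw [Units.smul_def]
    exact zsmul_mem (prod_mem fun i _ => hxO _ _) _
  have h1 := pf _ hXO hX0
  have h2 : ∀ v, av v X.det * ∏ i, t v i ≤ C * n.factorial * ∏ j, Nv av A t v (x j) := by
    intro v
    set B := (A v).map (fun z : ℤ => (z : K)) with hB
    have hBd : B.det = ((A v).det : K) := by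
      have := (Int.castRingHom K).map_det (A v); simpa [RingHom.mapMatrix_apply] using this.symm
    have h3 : ∀ i j, (B * X) i j = fo A v i (x j) := fun i j => by simp [Matrix.mul_apply, fo, hB, X]
    have h4 : av v (B * X).det * ∏ i, t v i ≤ n.factorial * ∏ j, Nv av A t v (x j) := by
      rw [Matrix.det_apply']
      refine (mul_le_mul_of_nonneg_right ((av v).sum_le _ _) (prod_nonneg fun i _ => (ht v i).le)).trans ?_
      rw [sum_mul]
      refine (sum_le_card_nsmul _ _ (∏ j, Nv av A t v (x j)) fun σ _ => ?_).trans ?_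
      · have hs : av v (((Equiv.Perm.sign σ : ℤ) : K)) ≤ 1 := by
          rcases Int.units_eq_one_or (Equiv.Perm.sign σ) with h | h <;> simp [h]
        rw [map_mul, map_prod, ← Equiv.prod_comp σ (fun i => t v i), mul_assoc, ← prod_mul_distrib]
        calc _ ≤ 1 * ∏ j, av v ((B * X) (σ j) j) * t v (σ j) :=
              mul_le_mul_of_nonneg_right hs (prod_nonneg fun j _ => mul_nonneg ((av v).nonneg _) (ht v _).le)
          _ ≤ _ := by
            rw [one_mul]
            refine prod_le_prod (fun j _ => mul_nonneg ((av v).nonneg _) (ht v _).le) fun j _ => ?_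
            rw [h3, mul_comm]; exact le_Nv av A v _ _
      · simp [Fintype.card_perm]
    rw [Matrix.det_mul, hBd, map_mul] at h4
    have h5 : 0 < av v ((A v).det : K) := (av v).pos (hd v)
    have h6 : (av v ((A v).det : K))⁻¹ ≤ C := hC v
    calc av v X.det * ∏ i, t v i = (av v ((A v).det : K))⁻¹ * (av v ((A v).det : K) * av v X.det * ∏ i, t v i) := by
          field_simp
      _ ≤ C * (n.factorial * ∏ j, Nv av A t v (x j)) :=
          mul_le_mul h6 h4 (mul_nonneg (mul_nonneg ((av v).nonneg _) ((av v).nonneg _))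
            (prod_nonneg fun i _ => (ht v i).le)) (by linarith)
      _ = _ := by ring
  calc ∏ v, ∏ i, t v i ≤ (∏ v, av v X.det) * ∏ v, ∏ i, t v i :=
        le_mul_of_one_le_left (prod_nonneg fun v _ => prod_nonneg fun i _ => (ht v i).le) h1
    _ = ∏ v, (av v X.det * ∏ i, t v i) := by rw [prod_mul_distrib]
    _ ≤ ∏ v, (C * n.factorial * ∏ j, Nv av A t v (x j)) :=
        prod_le_prod (fun v _ => mul_nonneg ((av v).nonneg _) (prod_nonneg fun i _ => (ht v i).le)) fun v _ => h2 v
    _ = _ := by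
        rw [prod_mul_distrib, prod_const, card_univ]
        simp only [HH]
        rw [Finset.prod_comm]
end
end UE

set_option linter.all false
namespace UE
open Finset Filter Topology

lemma prod_trick {n : ℕ} {μ g : Fin n → ℝ} {c B : ℝ} (hc : 1 ≤ c) (hB : 0 ≤ B) (hg : ∀ l, 0 < g l) (hμ : ∀ l, 0 < μ l)
    (h : ∀ l, g l ≤ c * μ l) (hp : ∏ l, μ l ≤ B * ∏ l, g l) (j : Fin n) : μ j ≤ B * c ^ n * g j := by
  have h1 : ∏ l ∈ univ.erase j, g l ≤ c ^ n * ∏ l ∈ univ.erase j, μ l := by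
    have h2 : ∏ l ∈ univ.erase j, g l ≤ ∏ l ∈ univ.erase j, (c * μ l) := prod_le_prod (fun l _ => (hg l).le) fun l _ => h l
    rw [prod_mul_distrib, prod_const] at h2
    refine h2.trans (mul_le_mul_of_nonneg_right (pow_le_pow_right₀ hc ?_) (prod_nonneg fun l _ => (hμ l).le))
    exact (card_le_univ _).trans (by simp)
  have hM : 0 < ∏ l ∈ univ.erase j, μ l := prod_pos fun l _ => hμ l
  rw [← mul_prod_erase univ μ (mem_univ j), ← mul_prod_erase univ g (mem_univ j)] at hp
  have h3 : μ j * ∏ l ∈ univ.erase j, μ l ≤ (B * c ^ n * g j) * ∏ l ∈ univ.erase j, μ l := by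
    refine hp.trans ?_
    have := mul_le_mul_of_nonneg_left h1 (mul_nonneg hB (hg j).le)
    nlinarith
  exact le_of_mul_le_mul_right h3 hM

lemma complete_basis {K : Type*} [Field K] {n : ℕ} {x y : Fin n → Fin n → K} (hx : LinearIndependent K x)
    (hy : LinearIndependent K y) (s : Finset (Fin n)) :
    ∃ z : Fin n → Fin n → K, LinearIndependent K z ∧ (∀ j ∉ s, z j = x j) ∧ ∀ j ∈ s, ∃ l, z j = y l := by
  classical
  induction s using Finset.induction_on with
  | empty => exact ⟨x, hx, by simp, by simp⟩
  | insert a s ha ih =>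
    obtain ⟨z, hz, h1, h2⟩ := ih
    have : ∃ l, y l ∉ Submodule.span K (z '' {i | i ≠ a}) := by
      by_contra hno
      push Not at hno
      have h3 : Submodule.span K (Set.range y) = ⊤ := by
        apply hy.span_eq_top_of_card_eq_finrank'
        simp
      have h4 : z a ∈ Submodule.span K (z '' {i | i ≠ a}) := by
        have : (⊤ : Submodule K (Fin n → K)) ≤ Submodule.span K (z '' {i | i ≠ a}) := by
          rw [← h3, Submodule.span_le]
          rintro _ ⟨l, rfl⟩
          exact hno l
        exact this trivial
      exact hz.notMem_span_image (s := {i | i ≠ a}) (x := a) (by simp) h4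
    obtain ⟨l, hl⟩ := this
    refine ⟨Function.update z a (y l), ?_, ?_, ?_⟩
    · apply LinearIndependent.update hz
      have h3 : y l ∈ Submodule.span K (Set.range z) := by
        rw [hz.span_eq_top_of_card_eq_finrank' (by simp)]; trivial
      obtain ⟨c, hc⟩ := (Finsupp.mem_span_range_iff_exists_finsupp).mp h3
      refine ⟨1, one_mem _, c, ?_, by rw [one_smul, ← hc]; rfl⟩
      rw [mem_nonZeroDivisors_iff_ne_zero]
      intro hca
      apply hl
      rw [← hc]
      refine Submodule.sum_mem _ fun i hi => Submodule.smul_mem _ _ (Submodule.subset_span ⟨i, ?_, rfl⟩)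
      rintro rfl
      simp [hca] at hi
    · intro j hj
      simp only [mem_insert, not_or] at hj
      rw [Function.update_of_ne hj.1, h1 j hj.2]
    · intro j hj
      by_cases hja : j = a
      · subst hja; exact ⟨l, by simp⟩
      · rw [Function.update_of_ne hja]
        exact h2 j ((mem_insert.mp hj).resolve_left hja)

section
variable {K ι : Type*} {n : ℕ} [Fintype ι] [DecidableEq ι] [Field K]

/-- greedy data -/
structure GD (av : ι → AbsoluteValue K ℝ) (A : ι → Matrix (Fin n) (Fin n) ℤ) (O : Subring K) (t : ι → Fin n → ℝ)
    (x : Fin n → Fin n → K) (μ : Fin n → ℝ) (V : ℕ → Submodule K (Fin n → K)) : Prop where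
  mono : Monotone V
  fr : ∀ l ≤ n, Module.finrank K (V l) = l
  li : LinearIndependent K x
  xO : ∀ j i, x j i ∈ O
  pos : ∀ j, 0 < μ j
  μmono : Monotone μ
  hle : ∀ j, HH av A t (x j) ≤ 2 * μ j
  low : ∀ (j : Fin n) (z : Fin n → K), (∀ i, z i ∈ O) → z ∉ V j.1 → μ j ≤ HH av A t z

variable (av : ι → AbsoluteValue K ℝ) {A : ι → Matrix (Fin n) (Fin n) ℤ} (hd : ∀ v, ((A v).det : K) ≠ 0)
  (O : Subring K) (pf : ∀ x ∈ O, x ≠ 0 → 1 ≤ ∏ v, av v x) (v0 : ι)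

include hd pf in
lemma GD_ex {t : ι → Fin n → ℝ} (ht : ∀ v i, 0 < t v i) : ∃ x μ V, GD av A O t x μ V := by
  obtain ⟨x, μ, V, h1, h2, h3, h4, h5, h6, h7, h8, h9, h10⟩ := greedy av hd O pf ht
  exact ⟨x, μ, V, ⟨h1, h2, h5, h6, h7, h8, h9, h10⟩⟩

variable {av O}

lemma GD.top {t x μ V} (h : GD av A O t x μ V) (z) : z ∈ V n := by
  have : V n = ⊤ := Submodule.eq_top_of_finrank_eq (by rw [h.fr n le_rfl]; simp)
  rw [this]; trivial

lemma GD.bot {t x μ V} (h : GD av A O t x μ V) {z} (hz : z ∈ V 0) : z = 0 := by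
  have : V 0 = ⊥ := Submodule.finrank_eq_zero.mp (h.fr 0 (Nat.zero_le _))
  rw [this] at hz; simpa using hz

lemma GD.tilt {t : ι → Fin n → ℝ} {x μ V} (ht : ∀ v i, 0 < t v i) (h : GD av A O t x μ V) (hn : 0 < n) :
    ∃ e : Fin n ≃ Fin n, ∀ (ρ : Fin n → ℝ), (∀ i, 0 < ρ i) → Antitone ρ → Monotone (fun l => ρ l * μ l) →
      ∀ (l : Fin n) (z : Fin n → K), (∀ i, z i ∈ O) → z ∉ V l.1 →
        ρ l * μ l ≤ (n : ℝ) ^ n * HH av A (tw v0 t fun i => ρ (e.symm i)) z := by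
  obtain ⟨e, he⟩ := davenport (av v0) V h.mono h.fr (t v0) (ht v0) (foL A v0)
  refine ⟨e, fun ρ h1 h2 h3 l z hz hzV => ?_⟩
  exact UE.tilt av v0 O ht h.top h.low (D := (n:ℝ) ^ n) (by positivity) he h1 h2 h3 l z hz hzV

include hd pf v0 in
/-- second theorem (upper bound) -/
theorem second (hn : 0 < n) (hM1 : ∃ C : ℝ, 1 ≤ C ∧ ∀ t : ι → Fin n → ℝ, (∀ v i, 0 < t v i) →
      ∃ x : Fin n → K, (∀ i, x i ∈ O) ∧ x ≠ 0 ∧ HH av A t x ^ n ≤ C * ∏ v, ∏ i, t v i) :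
    ∃ C : ℝ, 1 ≤ C ∧ ∀ (t : ι → Fin n → ℝ) x μ V, (∀ v i, 0 < t v i) → GD av A O t x μ V →
      (∏ j, μ j ≤ C * ∏ v, ∏ i, t v i) ∧ ∏ v, ∏ i, t v i ≤ C * ∏ j, μ j := by
  obtain ⟨C, hC1, hC⟩ := hM1
  obtain ⟨Cd, hCd1, hCd⟩ := det_est (n := n) av hd O pf
  have hD : (1:ℝ) ≤ ((n:ℝ) ^ n) ^ n := one_le_pow₀ (one_le_pow₀ (by exact_mod_cast hn))
  have h2n : (1:ℝ) ≤ 2 ^ n := one_le_pow₀ (by norm_num)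
  refine ⟨((n:ℝ) ^ n) ^ n * C + Cd * 2 ^ n, by nlinarith [mul_pos (zero_lt_one.trans_le hCd1) (zero_lt_one.trans_le h2n)],
    fun t x μ V ht h => ?_⟩
  have hP : 0 < ∏ v, ∏ i, t v i := prod_pos fun v _ => prod_pos fun i _ => ht v i
  have hM : 0 < ∏ j, μ j := prod_pos fun j _ => h.pos j
  constructor
  · obtain ⟨e, he⟩ := h.tilt v0 ht hn
    have hρ : ∀ i, 0 < (μ i)⁻¹ := fun i => inv_pos.mpr (h.pos i)
    have he := he (fun l => (μ l)⁻¹) hρ (fun a b hab => by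
        have := h.pos a
        exact inv_anti₀ this (h.μmono hab)) (fun a b _ => by
        simp [inv_mul_cancel₀ (h.pos a).ne', inv_mul_cancel₀ (h.pos b).ne'])
    obtain ⟨z, hzO, hz0, hz⟩ := hC (tw v0 t fun i => (μ (e.symm i))⁻¹) (tw_pos v0 ht fun i => hρ _)
    have h1 := he ⟨0, hn⟩ z hzO (fun hh => hz0 (h.bot hh))
    rw [inv_mul_cancel₀ (h.pos _).ne'] at h1
    have h2 := one_le_pow₀ h1 (n := n)
    rw [mul_pow] at h2
    rw [prod_tw, Equiv.prod_comp e.symm (fun i => (μ i)⁻¹), prod_inv_distrib] at hz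
    have h3 : 1 ≤ ((n:ℝ) ^ n) ^ n * (C * ((∏ v, ∏ i, t v i) * (∏ i, μ i)⁻¹)) :=
      h2.trans (mul_le_mul_of_nonneg_left hz (by positivity))
    have h4 : ∏ j, μ j ≤ ((n:ℝ) ^ n) ^ n * C * ∏ v, ∏ i, t v i := by
      have := mul_le_mul_of_nonneg_left h3 hM.le
      calc _ = (∏ j, μ j) * 1 := (mul_one _).symm
        _ ≤ _ := this
        _ = _ := by field_simp
    have : 0 ≤ Cd * 2 ^ n * ∏ v, ∏ i, t v i := by positivity
    nlinarith
  · have h1 := hCd t ht x h.li h.xO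
    have h2 : ∏ j, HH av A t (x j) ≤ ∏ j, (2 * μ j) := prod_le_prod (fun j _ => HH_nonneg _ _ _ _) fun j _ => h.hle j
    rw [prod_mul_distrib] at h2
    simp only [prod_const, card_univ, Fintype.card_fin] at h2
    have h3 := mul_le_mul_of_nonneg_left h2 (zero_le_one.trans hCd1)
    have : 0 ≤ ((n:ℝ) ^ n) ^ n * C * ∏ j, μ j := by positivity
    nlinarith

end
end UE

set_option linter.all false
namespace UE
open Finset Filter Topology

section
variable {K ι : Type*} {n : ℕ} [Fintype ι] [DecidableEq ι] [Field K]
variable {av : ι → AbsoluteValue K ℝ} {A : ι → Matrix (Fin n) (Fin n) ℤ} (hd : ∀ v, ((A v).det : K) ≠ 0)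
  {O : Subring K} (pf : ∀ x ∈ O, x ≠ 0 → 1 ≤ ∏ v, av v x) (v0 : ι)

lemma exists_notMem {x : Fin n → Fin n → K} (hx : LinearIndependent K x) (W : Submodule K (Fin n → K)) {k : ℕ} (hk : k < n)
    (hW : Module.finrank K W = k) : ∃ j : Fin n, j.1 ≤ k ∧ x j ∉ W := by
  by_contra hno
  push Not at hno
  have h1 : LinearIndependent K (fun j : Fin (k+1) => (⟨x (Fin.castLE hk j), hno _ (by simp; omega)⟩ : W)) := by
    apply LinearIndependent.of_comp W.subtype
    exact hx.comp _ (Fin.castLE_injective hk)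
  have := h1.fintype_card_le_finrank
  rw [hW] at this
  simp at this

lemma span_eq_of {x : Fin n → Fin n → K} (hx : LinearIndependent K x) (W : Submodule K (Fin n → K)) {k : ℕ} (hk : k ≤ n)
    (hW : Module.finrank K W = k) (h : ∀ j : Fin n, j.1 < k → x j ∈ W) : Submodule.span K (x '' {j | j.1 < k}) = W := by
  apply Submodule.eq_of_le_of_finrank_eq
  · rw [Submodule.span_le]; rintro _ ⟨j, hj, rfl⟩; exact h j hj
  · have h1 : x '' {j | j.1 < k} = Set.range (fun j : Fin k => x (Fin.castLE hk j)) := by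
      ext z; constructor
      · rintro ⟨j, hj, rfl⟩; exact ⟨⟨j.1, hj⟩, rfl⟩
      · rintro ⟨j, rfl⟩; exact ⟨_, by simp, rfl⟩
    rw [h1, hW]; exact (finrank_span_eq_card (hx.comp _ (Fin.castLE_injective hk))).trans (by simp)

include hd pf in
theorem geo1 (hn : 0 < n) (hM1 : ∃ C : ℝ, 1 ≤ C ∧ ∀ t : ι → Fin n → ℝ, (∀ v i, 0 < t v i) →
      ∃ x : Fin n → K, (∀ i, x i ∈ O) ∧ x ≠ 0 ∧ HH av A t x ^ n ≤ C * ∏ v, ∏ i, t v i) :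
    ∃ C : ℝ, 1 ≤ C ∧ ∀ (t : ι → Fin n → ℝ) x0 μ V, (∀ v i, 0 < t v i) → GD av A O t x0 μ V →
      ∀ (k : ℕ) (hk1 : 1 ≤ k) (hkn : k < n) (γ : ℝ), C ≤ γ → γ * μ ⟨k - 1, by omega⟩ ≤ μ ⟨k, hkn⟩ →
      ∃ (e : Fin n ≃ Fin n) (x : Fin n → Fin n → K) (b : ι → Fin n → ℝ),
        1 ≤ C * ∏ v, ∏ i, tw v0 t (fun i => (μ (e.symm i))⁻¹) v i ∧
        LinearIndependent K x ∧ (∀ j i, x j i ∈ O) ∧ (∀ v j, 0 < b v j) ∧ (∀ j, ∏ v, b v j ≤ C) ∧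
        (∀ v i j, tw v0 t (fun i => (μ (e.symm i))⁻¹) v i * av v (fo A v i (x j)) ≤ b v j) ∧
        (∀ i j : Fin n, j.1 < k → k ≤ (e.symm i).1 →
          γ * (tw v0 t (fun i => (μ (e.symm i))⁻¹) v0 i * av v0 (fo A v0 i (x j))) ≤ b v0 j) ∧
        ∀ j : Fin n, j.1 < k → x j ∈ V k := by
  classical
  obtain ⟨Cs, hCs1, hCs⟩ := second hd pf v0 hn hM1
  set D : ℝ := (n:ℝ) ^ n with hDdef
  have hD : (1:ℝ) ≤ D := one_le_pow₀ (by exact_mod_cast hn)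
  clear_value D
  set C5 : ℝ := Cs * Cs * (2 * D) ^ n with hC5
  have h2D : 1 ≤ (2 * D) ^ n := one_le_pow₀ (by linarith)
  have hss : 1 ≤ Cs * Cs := by nlinarith
  have hC51 : 1 ≤ C5 := by rw [hC5]; nlinarith
  clear_value C5
  refine ⟨2 * D * C5 + 1 + Cs + 2 * C5, by nlinarith, fun t x0 μ V ht h k hk1 hkn γ hγ hgap => ?_⟩
  have hDC : 1 ≤ D * C5 := by nlinarith
  have hγ1 : 1 ≤ γ := by nlinarith
  have hγ0 : 0 < γ := by linarith
  obtain ⟨e, he⟩ := h.tilt v0 ht hn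
  rw [← hDdef] at he
  have hρ : ∀ i, 0 < (μ i)⁻¹ := fun i => inv_pos.mpr (h.pos i)
  set g : Fin n → ℝ := fun l => if l.1 < k then 1 else γ with hg
  have hg0 : ∀ l, 0 < g l := fun l => by rw [hg]; dsimp only; split_ifs <;> linarith
  have hg1 : ∀ l, 1 ≤ g l := fun l => by rw [hg]; dsimp only; split_ifs <;> linarith
  have hcan : ∀ l, (μ l)⁻¹ * μ l = 1 := fun l => inv_mul_cancel₀ (h.pos l).ne'
  have he1 := he (fun l => (μ l)⁻¹) hρ (fun a b hab => inv_anti₀ (h.pos a) (h.μmono hab)) (fun a b _ => by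
        simp [hcan])
  have hρ2 : ∀ i, 0 < g i * (μ i)⁻¹ := fun i => mul_pos (hg0 i) (hρ i)
  have he2 := he (fun l => g l * (μ l)⁻¹) hρ2 (fun a b hab => by
      have hab' : a.1 ≤ b.1 := hab
      by_cases h1 : b.1 < k
      · have : a.1 < k := by omega
        simp only [hg, h1, this, if_true, one_mul]
        exact inv_anti₀ (h.pos a) (h.μmono hab)
      by_cases h2 : a.1 < k
      · simp only [hg, h1, h2, if_true, if_false, one_mul]
        have h3 : γ * μ a ≤ μ b := by
          have h4 : μ a ≤ μ ⟨k-1, by omega⟩ := h.μmono (Fin.mk_le_mk.mpr (by omega))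
          have h5 : μ ⟨k, hkn⟩ ≤ μ b := h.μmono (Fin.mk_le_mk.mpr (by omega))
          nlinarith
        have ha := h.pos a
        have hb := h.pos b
        rw [← div_eq_mul_inv, div_le_iff₀ hb, inv_mul_eq_div, le_div_iff₀ ha]
        exact h3
      · simp only [hg, h1, h2, if_false]
        exact mul_le_mul_of_nonneg_left (inv_anti₀ (h.pos a) (h.μmono hab)) hγ0.le) (fun a b hab => by
      have hab' : a.1 ≤ b.1 := hab
      simp only [mul_assoc, hcan, mul_one, hg]
      split_ifs <;> first | linarith | omega)
  simp only [mul_assoc, hcan, mul_one] at he2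
  have ht1 := tw_pos v0 ht (ρ := fun i => (μ (e.symm i))⁻¹) (fun i => hρ _)
  have ht2 := tw_pos v0 ht (ρ := fun i => g (e.symm i) * (μ (e.symm i))⁻¹) (fun i => hρ2 _)
  have hP1 := prod_tw v0 t (fun i => (μ (e.symm i))⁻¹)
  have hP2 := prod_tw v0 t (fun i => g (e.symm i) * (μ (e.symm i))⁻¹)
  rw [Equiv.prod_comp e.symm (fun i => (μ i)⁻¹), prod_inv_distrib] at hP1
  rw [Equiv.prod_comp e.symm (fun i => g i * (μ i)⁻¹), prod_mul_distrib, prod_inv_distrib] at hP2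
  obtain ⟨hs1, hs2⟩ := hCs t x0 μ V ht h
  have hM : 0 < ∏ j, μ j := prod_pos fun j _ => h.pos j
  have hP1l : 1 ≤ Cs * ∏ v, ∏ i, tw v0 t (fun i => (μ (e.symm i))⁻¹) v i := by
    rw [hP1, ← mul_assoc, ← div_eq_mul_inv, le_div_iff₀ hM, one_mul]; exact hs1
  have hP1u : ∏ v, ∏ i, tw v0 t (fun i => (μ (e.symm i))⁻¹) v i ≤ Cs := by
    rw [hP1, ← div_eq_mul_inv, div_le_iff₀ hM]; exact hs2
  have hP2u : ∏ v, ∏ i, tw v0 t (fun i => g (e.symm i) * (μ (e.symm i))⁻¹) v i ≤ Cs * ∏ i, g i := by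
    have : ∏ v, ∏ i, tw v0 t (fun i => g (e.symm i) * (μ (e.symm i))⁻¹) v i
      = (∏ v, ∏ i, tw v0 t (fun i => (μ (e.symm i))⁻¹) v i) * ∏ i, g i := by rw [hP1, hP2]; ring
    rw [this]
    exact mul_le_mul_of_nonneg_right hP1u (prod_nonneg fun i _ => (hg0 i).le)
  have hlt12 : ∀ v i, tw v0 t (fun i => (μ (e.symm i))⁻¹) v i ≤ tw v0 t (fun i => g (e.symm i) * (μ (e.symm i))⁻¹) v i := by
    intro v i
    simp only [tw]
    refine mul_le_mul_of_nonneg_left ?_ (ht v i).le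
    split_ifs
    · exact le_mul_of_one_le_left (hρ _).le (hg1 _)
    · exact le_rfl
  have hlt12' : ∀ i, k ≤ (e.symm i).1 → γ * tw v0 t (fun i => (μ (e.symm i))⁻¹) v0 i = tw v0 t (fun i => g (e.symm i) * (μ (e.symm i))⁻¹) v0 i := by
    intro i hi
    have : ¬ (e.symm i).1 < k := by omega
    simp only [tw, if_true, hg, this, if_false]; ring
  set t1 := tw v0 t (fun i => (μ (e.symm i))⁻¹) with ht1d
  set t2 := tw v0 t (fun i => g (e.symm i) * (μ (e.symm i))⁻¹) with ht2d
  obtain ⟨x1, μ1, V1, G1⟩ := GD_ex av hd O pf ht1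
  obtain ⟨x2, μ2, V2, G2⟩ := GD_ex av hd O pf ht2
  have hz0 : ∀ z : Fin n → K, z ≠ 0 → z ∉ V (⟨0, hn⟩ : Fin n).1 := fun z hz hh => hz (h.bot hh)
  have hb1 : ∀ l, (1:ℝ) ≤ 2 * D * μ1 l := fun l => by
    have h1 := he1 ⟨0, hn⟩ (x1 l) (G1.xO l) (hz0 _ (G1.li.ne_zero l))
    rw [hcan] at h1
    have := mul_le_mul_of_nonneg_left (G1.hle l) (zero_le_one.trans hD)
    linarith
  have hb2 : ∀ l, (1:ℝ) ≤ 2 * D * μ2 l := fun l => by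
    have h1 := he2 ⟨0, hn⟩ (x2 l) (G2.xO l) (hz0 _ (G2.li.ne_zero l))
    have h2 := hg1 ⟨0, hn⟩
    have := mul_le_mul_of_nonneg_left (G2.hle l) (zero_le_one.trans hD)
    linarith
  have hgk : g ⟨k, hkn⟩ = γ := by simp [hg]
  have hb2' : ∀ l, g l ≤ 2 * D * μ2 l := fun l => by
    by_cases hl : l.1 < k
    · have : g l = 1 := by simp [hg, hl]
      rw [this]; exact hb2 l
    · have hgl : g l = γ := by simp [hg, hl]
      obtain ⟨j, hjk, hj⟩ := exists_notMem G2.li (V k) hkn (h.fr k hkn.le)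
      have h1 := he2 ⟨k, hkn⟩ (x2 j) (G2.xO j) hj
      rw [hgk] at h1
      have h3 := mul_le_mul_of_nonneg_left (G2.hle j) (zero_le_one.trans hD)
      have h4 : μ2 j ≤ μ2 l := G2.μmono (Fin.le_def.mpr (by omega))
      have h5 := mul_le_mul_of_nonneg_left h4 (zero_le_one.trans hD)
      rw [hgl]; linarith
  have hCs0 : 0 ≤ Cs := by linarith
  have hu1 : ∀ j, μ1 j ≤ C5 := fun j => by
    have := prod_trick (μ := μ1) (g := fun _ => 1) (c := 2 * D) (B := Cs * Cs) (by linarith) (by positivity)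
      (fun _ => one_pos) G1.pos hb1 (by
        simp only [prod_const_one, mul_one]
        exact (hCs t1 x1 μ1 V1 ht1 G1).1.trans (mul_le_mul_of_nonneg_left hP1u hCs0)) j
    rw [hC5]; simpa using this
  have hu2 : ∀ j : Fin n, j.1 < k → μ2 j ≤ C5 := fun j hj => by
    have := prod_trick (μ := μ2) (g := g) (c := 2 * D) (B := Cs * Cs) (by linarith) (by positivity)
      hg0 G2.pos hb2' (by
        rw [mul_assoc]
        exact (hCs t2 x2 μ2 V2 ht2 G2).1.trans (mul_le_mul_of_nonneg_left hP2u hCs0)) j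
    have hgj : g j = 1 := by simp [hg, hj]
    rw [hgj] at this
    rw [hC5]; simpa using this
  have hxV : ∀ j : Fin n, j.1 < k → x2 j ∈ V k := fun j hj => by
    by_contra hno
    have h1 := he2 ⟨k, hkn⟩ (x2 j) (G2.xO j) hno
    rw [hgk] at h1
    have h3 := mul_le_mul_of_nonneg_left ((G2.hle j).trans (mul_le_mul_of_nonneg_left (hu2 j hj) zero_le_two)) (zero_le_one.trans hD)
    nlinarith
  obtain ⟨x, hx, hxa, hxb⟩ := complete_basis G2.li G1.li (univ.filter fun j : Fin n => k ≤ j.1)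
  have hxa' : ∀ j : Fin n, j.1 < k → x j = x2 j := fun j hj => hxa j (by simp; omega)
  have hxb' : ∀ j : Fin n, ¬ j.1 < k → ∃ l, x j = x1 l := fun j hj => hxb j (by simp; omega)
  refine ⟨e, x, fun v j => if j.1 < k then Nv av A t2 v (x j) else Nv av A t1 v (x j), ?_, hx, ?_, ?_, ?_, ?_, ?_, ?_⟩
  · refine hP1l.trans (mul_le_mul_of_nonneg_right (by linarith) (prod_nonneg fun v _ => prod_nonneg fun i _ => (ht1 v i).le))
  · intro j i
    by_cases hj : j.1 < k
    · rw [hxa' j hj]; exact G2.xO j i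
    · obtain ⟨l, hl⟩ := hxb' j hj
      rw [hl]; exact G1.xO l i
  · intro v j
    dsimp only; split_ifs
    · exact Nv_pos av hd ht2 v (hx.ne_zero j)
    · exact Nv_pos av hd ht1 v (hx.ne_zero j)
  · intro j
    by_cases hj : j.1 < k
    · simp only [hj, if_true]
      rw [hxa' j hj]
      have h1 : HH av A t2 (x2 j) ≤ 2 * C5 := (G2.hle j).trans (mul_le_mul_of_nonneg_left (hu2 j hj) zero_le_two)
      rw [HH] at h1; linarith
    · simp only [hj, if_false]
      obtain ⟨l, hl⟩ := hxb' j hj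
      rw [hl]
      have h1 : HH av A t1 (x1 l) ≤ 2 * C5 := (G1.hle l).trans (mul_le_mul_of_nonneg_left (hu1 l) zero_le_two)
      rw [HH] at h1; linarith
  · intro v i j
    dsimp only; split_ifs with hj
    · exact (mul_le_mul_of_nonneg_right (hlt12 v i) ((av v).nonneg _)).trans (le_Nv av A (t := t2) v (x j) i)
    · exact le_Nv av A (t := t1) v (x j) i
  · intro i j hj hi
    simp only [hj, if_true]
    rw [← mul_assoc, hlt12' i hi]
    exact le_Nv av A (t := t2) v0 (x j) i
  · intro j hj
    rw [hxa' j hj]; exact hxV j hj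

include hd pf in
theorem geo (hn : 0 < n) (hM1 : ∃ C : ℝ, 1 ≤ C ∧ ∀ t : ι → Fin n → ℝ, (∀ v i, 0 < t v i) →
      ∃ x : Fin n → K, (∀ i, x i ∈ O) ∧ x ≠ 0 ∧ HH av A t x ^ n ≤ C * ∏ v, ∏ i, t v i) :
    ∃ (C : ℝ) (E : ℕ), 1 ≤ C ∧ ∀ (t : ι → Fin n → ℝ) (T γ : ℝ) (u : Fin n → K), (∀ i, u i ∈ O) → u ≠ 0 → 1 ≤ T →
      (∀ v i, 0 < t v i) → (∀ v i, 1 ≤ T * t v i) → (∀ v i, t v i ≤ T) → C ≤ γ → C * γ ^ (n * n) ≤ ∏ v, ∏ i, t v i →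
      HH av A t u ≤ 1 →
      ∃ (k : ℕ) (e : Fin n ≃ Fin n) (t' : ι → Fin n → ℝ) (b : ι → Fin n → ℝ) (x : Fin n → Fin n → K),
        1 ≤ k ∧ k < n ∧ (∀ v i, 0 < t' v i) ∧ (∀ v i, t' v i ≤ C * T ^ E) ∧ (∀ v i, 1 ≤ C * T ^ E * t' v i) ∧
        1 ≤ C * ∏ v, ∏ i, t' v i ∧
        LinearIndependent K x ∧ (∀ j i, x j i ∈ O) ∧ (∀ v j, 0 < b v j) ∧ (∀ j, ∏ v, b v j ≤ C) ∧
        (∀ v i j, t' v i * av v (fo A v i (x j)) ≤ b v j) ∧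
        (∀ i j : Fin n, j.1 < k → k ≤ (e.symm i).1 → γ * (t' v0 i * av v0 (fo A v0 i (x j))) ≤ b v0 j) ∧
        u ∈ Submodule.span K (x '' {j | j.1 < k}) := by
  classical
  obtain ⟨Cg, hCg1, hCg⟩ := geo1 hd pf v0 hn hM1
  obtain ⟨Cs, hCs1, hCs⟩ := second hd pf v0 hn hM1
  obtain ⟨Cl, hCl1, hCl⟩ := HH_lower (n := n) av hd O pf
  set c := Fintype.card ι with hc
  set B1 : ℝ := 2 * Cl ^ c with hB1
  have hB11 : 1 ≤ B1 := by have := one_le_pow₀ hCl1 (n := c); linarith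
  clear_value B1
  set B2 : ℝ := Cs * B1 ^ n with hB2
  have hB21 : 1 ≤ B2 := by have := one_le_pow₀ hB11 (n := n); nlinarith
  clear_value B2
  refine ⟨Cg + Cs + 1 + B1 + B2, 1 + 2 * n * c, by linarith, fun t T γ u huO hu hT ht htl htu hγ hP hHu => ?_⟩
  obtain ⟨x, μ, V, G⟩ := GD_ex av hd O pf ht
  have hγ1 : 1 ≤ γ := by linarith
  have hs := hCs t x μ V ht G
  have hlow : ∀ j, 1 ≤ B1 * T ^ c * μ j := fun j => by
    have h1 := hCl T t hT ht htl (x j) (G.xO j) (G.li.ne_zero j)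
    refine h1.trans ((mul_le_mul_of_nonneg_left (G.hle j) (by positivity)).trans (le_of_eq ?_))
    rw [hB1, mul_pow]; ring
  have hTc : 1 ≤ T ^ c := one_le_pow₀ hT
  have hup : ∀ j, μ j ≤ B2 * T ^ (2 * n * c) := fun j => by
    have := prod_trick (μ := μ) (g := fun _ => 1) (c := B1 * T ^ c) (B := Cs * T ^ (n * c)) (by nlinarith) (by positivity)
      (fun _ => one_pos) G.pos hlow (by
        simp only [prod_const_one, mul_one]
        refine hs.1.trans (mul_le_mul_of_nonneg_left ?_ (by linarith))
        calc ∏ v, ∏ i, t v i ≤ ∏ v : ι, ∏ i : Fin n, T :=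
              prod_le_prod (fun v _ => prod_nonneg fun i _ => (ht v i).le) fun v _ => prod_le_prod (fun i _ => (ht v i).le) fun i _ => htu v i
          _ = T ^ (n * c) := by simp [hc, pow_mul]) j
    refine this.trans (le_of_eq ?_)
    rw [hB2, mul_pow, ← pow_mul]
    rw [show 2 * n * c = n * c + c * n by ring, pow_add]; ring
  -- choice of k
  have hexk : ∃ k, u ∈ V k := ⟨n, G.top u⟩
  have hk0 := Nat.find_spec hexk
  have hk0n : Nat.find hexk ≤ n := Nat.find_min' hexk (G.top u)
  have hk0min := fun m => Nat.find_min hexk (m := m)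
  set k0 := Nat.find hexk with hk0d
  clear_value k0
  have hk01 : 1 ≤ k0 := by
    by_contra hh
    have : k0 = 0 := by omega
    rw [this] at hk0
    exact hu (G.bot hk0)
  have hμ1 : μ ⟨k0 - 1, by omega⟩ ≤ 1 := (G.low ⟨k0 - 1, by omega⟩ u huO (hk0min (k0 - 1) (by omega))).trans hHu
  have hk : ∃ k, ∃ (h1 : 1 ≤ k) (h2 : k < n), k0 ≤ k ∧ γ * μ ⟨k - 1, by omega⟩ ≤ μ ⟨k, h2⟩ := by
    by_contra hno
    push Not at hno
    have hall : ∀ l, ∀ hl : l < n, μ ⟨l, hl⟩ ≤ γ ^ l := by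
      intro l
      induction l with
      | zero =>
        intro hl
        rw [pow_zero]
        exact (G.μmono (Fin.mk_le_mk.mpr (Nat.zero_le _))).trans hμ1
      | succ l ih =>
        intro hl
        by_cases hlk : k0 ≤ l + 1
        · have h1 := (hno (l+1) (by omega) hl hlk).le
          have h2 := ih (by omega)
          simp only [Nat.add_sub_cancel] at h1
          rw [pow_succ']
          exact h1.trans (mul_le_mul_of_nonneg_left h2 (by linarith))
        · exact ((G.μmono (Fin.mk_le_mk.mpr (by omega))).trans hμ1).trans (one_le_pow₀ hγ1)
    have h3 : ∏ j, μ j ≤ γ ^ (n * n) := by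
      calc ∏ j, μ j ≤ ∏ j : Fin n, γ ^ n := prod_le_prod (fun j _ => (G.pos j).le) fun j _ =>
            (hall j.1 j.2).trans (pow_le_pow_right₀ hγ1 j.2.le)
        _ = _ := by simp [pow_mul]
    have h4 : 0 < γ ^ (n * n) := by positivity
    have h5 := hs.2.trans (mul_le_mul_of_nonneg_left h3 (by linarith))
    nlinarith
  obtain ⟨k, hk1, hkn, hkk, hgap⟩ := hk
  obtain ⟨e, x', b, g1, g2, g3, g4, g5, g6, g7, g8⟩ := hCg t x μ V ht G k hk1 hkn γ (by linarith) hgap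
  have ht1 := tw_pos v0 ht (ρ := fun i => (μ (e.symm i))⁻¹) (fun i => inv_pos.mpr (G.pos _))
  have hn1 : 1 + c ≤ 1 + 2 * n * c := by nlinarith
  refine ⟨k, e, tw v0 t (fun i => (μ (e.symm i))⁻¹), b, x', hk1, hkn, ht1, ?_, ?_, ?_, g2, g3, g4, ?_, g6, g7, ?_⟩
  · intro v i
    have hT1 : T ≤ T ^ (1 + 2 * n * c) := le_self_pow₀ hT (by omega)
    have hTp : 0 < T ^ (1 + 2 * n * c) := by positivity
    simp only [tw]
    split_ifs
    · have h1 : (μ (e.symm i))⁻¹ ≤ B1 * T ^ c := by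
        rw [inv_le_iff_one_le_mul₀ (G.pos _)]; exact hlow _
      calc t v i * (μ (e.symm i))⁻¹ ≤ T * (B1 * T ^ c) := mul_le_mul (htu v i) h1 (inv_pos.mpr (G.pos _)).le (by linarith)
        _ = B1 * T ^ (1 + c) := by ring
        _ ≤ B1 * T ^ (1 + 2 * n * c) := mul_le_mul_of_nonneg_left (pow_le_pow_right₀ hT hn1) (by linarith)
        _ ≤ _ := mul_le_mul_of_nonneg_right (by linarith) hTp.le
    · rw [mul_one]
      refine (htu v i).trans (hT1.trans ?_)
      exact le_mul_of_one_le_left hTp.le (by linarith)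
  · intro v i
    have hTp : 0 < T ^ (2 * n * c) := by positivity
    have hTp1 : 1 ≤ T ^ (2 * n * c) := one_le_pow₀ hT
    have htv := ht v i
    have key : 1 ≤ B2 * T ^ (2 * n * c) * (if v = v0 then (μ (e.symm i))⁻¹ else 1) := by
      split_ifs
      · rw [← div_eq_mul_inv, le_div_iff₀ (G.pos _), one_mul]; exact hup _
      · nlinarith
    have hif : 0 < (if v = v0 then (μ (e.symm i))⁻¹ else 1) := by
      split_ifs
      · exact inv_pos.mpr (G.pos _)
      · exact one_pos
    simp only [tw]
    have h1 : 1 ≤ (T * t v i) * (B2 * T ^ (2 * n * c) * (if v = v0 then (μ (e.symm i))⁻¹ else 1)) :=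
      one_le_mul_of_one_le_of_one_le (htl v i) key
    refine h1.trans ?_
    rw [pow_add, pow_one]
    have : 0 < T * t v i * (T ^ (2 * n * c) * (if v = v0 then (μ (e.symm i))⁻¹ else 1)) := by positivity
    calc _ = B2 * (T * t v i * (T ^ (2 * n * c) * (if v = v0 then (μ (e.symm i))⁻¹ else 1))) := by ring
      _ ≤ (Cg + Cs + 1 + B1 + B2) * (T * t v i * (T ^ (2 * n * c) * (if v = v0 then (μ (e.symm i))⁻¹ else 1))) :=
        mul_le_mul_of_nonneg_right (by linarith) this.le
      _ = _ := by ring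
  · exact g1.trans (mul_le_mul_of_nonneg_right (by linarith) (prod_nonneg fun v _ => prod_nonneg fun i _ => (ht1 v i).le))
  · intro j; exact (g5 j).trans (by linarith)
  · rw [span_eq_of g2 (V k) hkn.le (G.fr k hkn.le) g8]
    exact G.mono hkk hk0

end
end UE

set_option linter.all false
namespace UE
open Finset Filter Topology

section
variable {R : Type*} [CommRing R] {p n : ℕ}

lemma sum_emb {M : Type*} [AddCommMonoid M] (F : (Fin p → Fin n) → M) (hF : ∀ f, ¬ Function.Injective f → F f = 0) :
    ∑ I : Fin p ↪o Fin n, ∑ σ : Equiv.Perm (Fin p), F (I ∘ σ) = ∑ f, F f := by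
  rw [← Finset.sum_product', univ_product_univ]
  refine Finset.sum_of_injOn (fun x : (Fin p ↪o Fin n) × Equiv.Perm (Fin p) => (x.1 ∘ x.2 : Fin p → Fin n)) ?_ (by simp) ?_ (by simp)
  · rintro ⟨I, σ⟩ _ ⟨J, τ⟩ _ h
    simp only at h
    have h1 : Set.range I = Set.range J := by
      have := congrArg Set.range h
      rwa [EquivLike.range_comp, EquivLike.range_comp] at this
    have h2 : (I : Fin p → Fin n) = J := (StrictMono.range_inj I.strictMono J.strictMono).mp h1
    have h3 : I = J := DFunLike.coe_injective h2
    subst h3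
    congr 1
    refine Equiv.ext fun a => ?_
    have := congrFun h a
    simpa using this
  · intro f _ hf
    by_contra hne
    have hinj : Function.Injective f := by by_contra h; exact hne (hF f h)
    refine hf ⟨(OrderEmbedding.ofStrictMono (f ∘ Tuple.sort f)
      ((Tuple.monotone_sort f).strictMono_of_injective (hinj.comp (Tuple.sort f).injective)), (Tuple.sort f).symm), by simp, ?_⟩
    ext a; simp

theorem cauchy_binet (A : Matrix (Fin p) (Fin n) R) (B : Matrix (Fin n) (Fin p) R) :
    (A * B).det = ∑ I : Fin p ↪o Fin n, (A.submatrix id I).det * (B.submatrix I id).det := by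
  have h1 : (A * B).det = ∑ f : Fin p → Fin n, (∏ i, A i (f i)) * (B.submatrix f id).det := by
    have h2 : (A * B).det = Matrix.detRowAlternating (fun i => ∑ k : Fin n, A i k • B k) := by
      rw [Matrix.det]
      congr 1
      ext i j
      simp [Matrix.mul_apply]
    rw [h2]
    have h3 := MultilinearMap.map_sum (Matrix.detRowAlternating (R := R) (n := Fin p)).toMultilinearMap
      (fun (i : Fin p) (k : Fin n) => A i k • B k)
    refine h3.trans (sum_congr rfl fun f _ => ?_)
    have h4 := MultilinearMap.map_smul_univ (Matrix.detRowAlternating (R := R) (n := Fin p)).toMultilinearMap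
      (fun i => A i (f i)) (fun i => B (f i))
    exact h4
  rw [h1, ← sum_emb]
  · refine sum_congr rfl fun I _ => ?_
    have h5 : ∀ σ : Equiv.Perm (Fin p), (B.submatrix (I ∘ σ) id).det = (Equiv.Perm.sign σ : R) * (B.submatrix I id).det := by
      intro σ
      rw [← Matrix.det_permute]; rfl
    simp only [h5]
    rw [← Matrix.det_transpose (A.submatrix id I), Matrix.det_apply' (A.submatrix id I).transpose, sum_mul]
    refine sum_congr rfl fun σ _ => ?_
    simp; ring
  · intro f hf
    rw [Function.Injective] at hf
    push Not at hf
    obtain ⟨a, b, hab, hne⟩ := hf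
    rw [Matrix.det_zero_of_row_eq hne, mul_zero]
    ext j; simp [hab]

/-- compound matrix -/
noncomputable def cpd (p : ℕ) (M : Matrix (Fin n) (Fin n) R) : Matrix (Fin p ↪o Fin n) (Fin p ↪o Fin n) R :=
  Matrix.of fun I J => (M.submatrix I J).det

lemma cpd_mul (M N : Matrix (Fin n) (Fin n) R) : cpd p (M * N) = cpd p M * cpd p N := by
  ext I J
  simp only [cpd, Matrix.of_apply, Matrix.mul_apply]
  rw [show (M * N).submatrix I J = (M.submatrix I id) * (N.submatrix id J) by ext; simp [Matrix.mul_apply], cauchy_binet]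
  rfl

lemma cpd_one : cpd p (1 : Matrix (Fin n) (Fin n) R) = 1 := by
  ext I J
  simp only [cpd, Matrix.of_apply]
  by_cases h : I = J
  · subst h
    rw [Matrix.submatrix_one _ I.injective]; simp
  · rw [Matrix.one_apply_ne h]
    have h1 : ∃ a, I a ∉ Set.range J := by
      by_contra hno
      push Not at hno
      apply h
      apply DFunLike.coe_injective
      rw [← StrictMono.range_inj I.strictMono J.strictMono]
      apply Set.eq_of_subset_of_ncard_le
      · rintro _ ⟨a, rfl⟩; exact hno a
      · rw [← Set.image_univ, ← Set.image_univ, Set.ncard_image_of_injective _ I.injective, Set.ncard_image_of_injective _ J.injective]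
      · exact Set.toFinite _
    obtain ⟨a, ha⟩ := h1
    apply Matrix.det_eq_zero_of_row_eq_zero a
    intro j
    rw [Matrix.submatrix_apply, Matrix.one_apply_ne]
    intro hh; exact ha ⟨j, hh.symm⟩

lemma cpd_map (A : Matrix (Fin n) (Fin n) ℤ) : cpd p (A.map (fun z : ℤ => (z : R))) = (cpd p A).map (fun z : ℤ => (z : R)) := by
  ext I J
  simp only [cpd, Matrix.of_apply, Matrix.map_apply]
  have := (Int.castRingHom R).map_det (A.submatrix I J)
  simp only [RingHom.mapMatrix_apply, eq_intCast] at this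
  rw [this]; rfl

lemma cpd_isUnit {M : Matrix (Fin n) (Fin n) R} (h : IsUnit M.det) : IsUnit (cpd p M).det := by
  have h1 : cpd p M * cpd p M⁻¹ = 1 := by rw [← cpd_mul, Matrix.mul_nonsing_inv _ h, cpd_one]
  exact Matrix.isUnit_det_of_right_inverse h1

lemma cpd_det_ne {K : Type*} [Field K] {A : Matrix (Fin n) (Fin n) ℤ} (h : (A.det : K) ≠ 0) : ((cpd p A).det : K) ≠ 0 := by
  have h2 : ∀ {m : Type} [Fintype m] [DecidableEq m] (B : Matrix m m ℤ), (B.det : K) = (B.map (fun z : ℤ => (z : K))).det := by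
    intro m _ _ B
    have := (Int.castRingHom K).map_det B; simpa [RingHom.mapMatrix_apply] using this
  rw [h2, ← cpd_map]
  rw [h2] at h
  exact (cpd_isUnit h.isUnit).ne_zero

lemma count_emb (hn : 0 < n) : ∃ r : ℝ, 0 ≤ r ∧ ∀ m : Fin n → ℝ, ∑ I : Fin p ↪o Fin n, ∑ a, m (I a) = r * ∑ i, m i := by
  classical
  let w : Fin n → ℝ := fun i => ∑ f : Fin p → Fin n, if Function.Injective f then ∑ a, (if f a = i then (1:ℝ) else 0) else 0
  have hw : ∀ i j, w i = w j := by
    intro i j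
    refine Fintype.sum_equiv (Equiv.arrowCongr (Equiv.refl _) (Equiv.swap i j)) _ _ fun f => ?_
    have h1 : Function.Injective ((Equiv.arrowCongr (Equiv.refl (Fin p)) (Equiv.swap i j)) f) ↔ Function.Injective f := by
      have : (Equiv.arrowCongr (Equiv.refl (Fin p)) (Equiv.swap i j)) f = (Equiv.swap i j) ∘ f := by ext; simp
      rw [this, Function.Injective.of_comp_iff (Equiv.swap i j).injective]
    simp only [h1]
    split_ifs
    · refine sum_congr rfl fun a _ => ?_
      have : (Equiv.arrowCongr (Equiv.refl (Fin p)) (Equiv.swap i j)) f a = (Equiv.swap i j) (f a) := by simp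
      rw [this]
      congr 1
      rw [Equiv.swap_apply_eq_iff, Equiv.swap_apply_right]
    · rfl
  have hw0 : ∀ i, 0 ≤ w i := fun i => sum_nonneg fun f _ => by
    split_ifs
    · exact sum_nonneg fun a _ => by split_ifs <;> norm_num
    · exact le_rfl
  have hfac : (0:ℝ) < (p.factorial : ℝ) := by exact_mod_cast p.factorial_pos
  refine ⟨w ⟨0, hn⟩ / p.factorial, div_nonneg (hw0 _) hfac.le, fun m => ?_⟩
  have h1 := sum_emb (p := p) (n := n) (fun f => if Function.Injective f then ∑ a, m (f a) else 0) (fun f hf => by simp [hf])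
  have h2 : ∀ (I : Fin p ↪o Fin n) (σ : Equiv.Perm (Fin p)), (if Function.Injective (I ∘ σ) then ∑ a, m ((I ∘ σ) a) else 0) = ∑ a, m (I a) := by
    intro I σ
    rw [if_pos (I.injective.comp σ.injective)]
    exact Equiv.sum_comp σ fun a => m (I a)
  simp only [h2, sum_const, card_univ, Fintype.card_perm, Fintype.card_fin, nsmul_eq_mul, ← mul_sum] at h1
  have h3 : (∑ f : Fin p → Fin n, if Function.Injective f then ∑ a, m (f a) else 0) = ∑ i, m i * w i := by
    simp only [w, mul_sum]
    rw [Finset.sum_comm]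
    refine sum_congr rfl fun f _ => ?_
    split_ifs
    · simp only [mul_sum]
      rw [Finset.sum_comm]
      refine sum_congr rfl fun a _ => ?_
      simp
    · simp
  rw [h3] at h1
  have h4 : ∑ i, m i * w i = w ⟨0, hn⟩ * ∑ i, m i := by
    rw [mul_sum]; exact sum_congr rfl fun i _ => by rw [hw i ⟨0, hn⟩]; ring
  rw [h4] at h1
  rw [div_mul_eq_mul_div, ← h1]; field_simp

lemma det_bound {K : Type*} [Field K] (v : AbsoluteValue K ℝ) (N : Matrix (Fin p) (Fin p) K) (B r : Fin p → ℝ)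
    (h : ∀ a b, v (N a b) ≤ B b * r a) : v N.det ≤ p.factorial * ((∏ b, B b) * ∏ a, r a) := by
  rw [Matrix.det_apply']
  refine (v.sum_le _ _).trans ?_
  have : ∀ σ : Equiv.Perm (Fin p), v ((Equiv.Perm.sign σ : ℤ) * ∏ i, N (σ i) i) ≤ (∏ b, B b) * ∏ a, r a := by
    intro σ
    have hs : v ((Equiv.Perm.sign σ : ℤ) : K) = 1 := by
      rcases Int.units_eq_one_or (Equiv.Perm.sign σ) with h | h <;> simp [h]
    rw [map_mul, hs, one_mul, map_prod, ← Equiv.prod_comp σ r, ← prod_mul_distrib]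
    exact prod_le_prod (fun _ _ => v.nonneg _) fun i _ => h _ _
  refine (sum_le_sum fun σ _ => this σ).trans ?_
  simp [Fintype.card_perm]

/-- if M kills all but one column of the compound, it kills all u -/
lemma kill {K : Type*} [Field K] {k p : ℕ} (hnk : n = k + (p + 1)) (M : (Fin (p+1) ↪o Fin n) → K)
    {x : Fin n → Fin n → K} (hx : LinearIndependent K x) {u : Fin n → K} (hu : u ∈ Submodule.span K (x '' {j | j.1 < k}))
    (hM : ∀ J : Fin (p+1) ↪o Fin n, (∃ b, (J b).1 < k) → ∑ I, M I * ((Matrix.of fun i j => x j i).submatrix I J).det = 0)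
    (W : Matrix (Fin n) (Fin (p+1)) K) (hW : ∀ i, W i 0 = u i) : ∑ I, M I * (W.submatrix I id).det = 0 := by
  set X : Matrix (Fin n) (Fin n) K := Matrix.of fun i j => x j i with hXd
  have hXu : IsUnit X.det := by
    have h1 : LinearIndependent K (Matrix.transpose X).row := hx
    have h2 := Matrix.linearIndependent_rows_iff_isUnit.mp h1
    rwa [Matrix.isUnit_iff_isUnit_det, Matrix.det_transpose] at h2
  obtain ⟨a, ha0, hau⟩ : ∃ a : Fin n → K, (∀ j, ¬ j.1 < k → a j = 0) ∧ X.mulVec a = u := by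
    rw [Finsupp.mem_span_image_iff_linearCombination] at hu
    obtain ⟨l, hl, hlu⟩ := hu
    refine ⟨l, fun j hj => ?_, ?_⟩
    · by_contra hne
      exact hj (hl (Finsupp.mem_support_iff.mpr hne))
    · rw [← hlu, Finsupp.linearCombination_apply, Finsupp.sum_fintype _ _ (by simp)]
      ext i
      simp [Matrix.mulVec, dotProduct, hXd, mul_comm]
  set B : Matrix (Fin n) (Fin (p+1)) K := X⁻¹ * W with hB
  have hWB : W = X * B := by rw [hB, ← Matrix.mul_assoc, Matrix.mul_nonsing_inv _ hXu, Matrix.one_mul]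
  have hB0 : ∀ i, B i 0 = a i := by
    intro i
    have h1 : (fun i => B i 0) = X⁻¹.mulVec u := by
      ext i; simp [hB, Matrix.mul_apply, Matrix.mulVec, dotProduct, hW]
    have h2 := congrFun h1 i
    rw [← hau, Matrix.mulVec_mulVec, Matrix.nonsing_inv_mul _ hXu, Matrix.one_mulVec] at h2
    exact h2
  have h1 : ∀ I : Fin (p+1) ↪o Fin n, (W.submatrix I id).det = ∑ J : Fin (p+1) ↪o Fin n, (X.submatrix I J).det * (B.submatrix J id).det := by
    intro I
    rw [hWB, show (X * B).submatrix I id = (X.submatrix I id) * B by ext; simp [Matrix.mul_apply], cauchy_binet]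
    rfl
  simp only [h1, mul_sum]
  rw [Finset.sum_comm]
  refine sum_eq_zero fun J _ => ?_
  by_cases hJ : ∃ b, (J b).1 < k
  · have := hM J hJ
    simp only [← mul_assoc, ← sum_mul]
    rw [this, zero_mul]
  · push Not at hJ
    have : (B.submatrix J id).det = 0 := by
      apply Matrix.det_eq_zero_of_column_eq_zero 0
      intro i
      simp only [Matrix.submatrix_apply, id]
      rw [hB0, ha0 _ (by have := hJ i; omega)]
    simp [this]

/-- nonzero linear form from M -/
lemma ex_form {K : Type*} [Field K] {p : ℕ} {M : (Fin (p+1) ↪o Fin n) → K} (hM : M ≠ 0) :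
    ∃ ℓ : Fin n → K, ℓ ≠ 0 ∧ ∀ u : Fin n → K, (∀ W : Matrix (Fin n) (Fin (p+1)) K, (∀ i, W i 0 = u i) →
      ∑ I, M I * (W.submatrix I id).det = 0) → ∑ i, ℓ i * u i = 0 := by
  obtain ⟨I0, hI0⟩ := Function.ne_iff.mp hM
  let E : Matrix (Fin n) (Fin (p+1)) K := (1 : Matrix (Fin n) (Fin n) K).submatrix id I0
  let L : (Fin n → K) →ₗ[K] K :=
    { toFun := fun u => ∑ I, M I * Matrix.cramer (E.submatrix I id) (fun a => u (I a)) 0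
      map_add' := fun u w => by
        rw [← sum_add_distrib]
        refine sum_congr rfl fun I _ => ?_
        rw [← mul_add, ← Pi.add_apply, ← map_add]; rfl
      map_smul' := fun c u => by
        rw [RingHom.id_apply, smul_eq_mul, mul_sum]
        refine sum_congr rfl fun I _ => ?_
        have : Matrix.cramer (E.submatrix I id) (fun a => (c • u) (I a)) = c • Matrix.cramer (E.submatrix I id) (fun a => u (I a)) := by
          rw [← map_smul]; rfl
        rw [this, Pi.smul_apply, smul_eq_mul]; ring }
  have hL : ∀ u, L u = ∑ i, L (Pi.single i 1) * u i := by
    intro u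
    conv_lhs => rw [← Finset.univ_sum_single u]
    rw [map_sum]
    refine sum_congr rfl fun i _ => ?_
    have : (Pi.single i (u i) : Fin n → K) = u i • Pi.single i 1 := by
      rw [← Pi.single_smul]; simp
    rw [this, map_smul, smul_eq_mul, mul_comm]
  have hLd : ∀ u, L u = ∑ I, M I * ((E.updateCol 0 u).submatrix I id).det := by
    intro u
    refine sum_congr rfl fun I _ => ?_
    rw [Matrix.cramer_apply]
    congr 2
  refine ⟨fun i => L (Pi.single i 1), ?_, fun u hu => ?_⟩
  · intro h0
    have h1 : L (Pi.single (I0 0) 1) = 0 := congrFun h0 (I0 0)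
    rw [hLd] at h1
    have h2 : E.updateCol 0 (Pi.single (I0 0) 1) = E := by
      ext i b
      rw [Matrix.updateCol_apply]
      split_ifs with hb
      · subst hb
        simp [E, Matrix.one_apply, Pi.single_apply]
      · rfl
    rw [h2] at h1
    have h3 : ∀ I : Fin (p+1) ↪o Fin n, (E.submatrix I id).det = (1 : Matrix (Fin (p+1) ↪o Fin n) (Fin (p+1) ↪o Fin n) K) I I0 := by
      intro I
      rw [← cpd_one]; rfl
    simp only [h3, Matrix.one_apply] at h1
    rw [Finset.sum_eq_single I0 (fun I _ hI => by simp [hI]) (by simp)] at h1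
    simp at h1
    exact hI0 h1
  · rw [← hL, hLd]
    exact hu _ fun i => by simp

end
end UE

set_option linter.all false
namespace UE
open Finset Filter Topology

lemma freq_pig {α σ : Type*} [Finite α] {l : Filter σ} {P : α → σ → Prop} (h : ∃ᶠ s in l, ∃ a, P a s) : ∃ a, ∃ᶠ s in l, P a s := by
  by_contra hno
  push Not at hno
  have := eventually_all.mpr hno
  exact h (this.mono fun s hs hh => by obtain ⟨a, ha⟩ := hh; exact hs a ha)

section
variable {K ι : Type*} {n : ℕ} [Fintype ι] [DecidableEq ι] [Field K] [CharZero K] [FiniteDimensional ℚ K]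
variable {av : ι → AbsoluteValue K ℝ} {A : ι → Matrix (Fin n) (Fin n) ℤ} (hd : ∀ v, ((A v).det : K) ≠ 0)
  {O : Subring K} (hO : ∀ x, IsIntegral ℤ x → x ∈ O) (pf : ∀ x ∈ O, x ≠ 0 → 1 ≤ ∏ v, av v x) (v0 : ι)

/-- data from geo at one place s -/
structure GeoD (av : ι → AbsoluteValue K ℝ) (A : ι → Matrix (Fin n) (Fin n) ℤ) (O : Subring K) (v0 : ι)
    (C B γ : ℝ) (u : Fin n → K) (k : ℕ) (e : Fin n ≃ Fin n) (t' : ι → Fin n → ℝ) (b : ι → Fin n → ℝ) (x : Fin n → Fin n → K) : Prop where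
  tpos : ∀ v i, 0 < t' v i
  tlog : ∀ v i, |Real.log (t' v i)| ≤ B
  tprod : 1 ≤ C * ∏ v, ∏ i, t' v i
  li : LinearIndependent K x
  xO : ∀ j i, x j i ∈ O
  bpos : ∀ v j, 0 < b v j
  bprod : ∀ j, ∏ v, b v j ≤ C
  bd : ∀ v i j, t' v i * av v (fo A v i (x j)) ≤ b v j
  gap : ∀ i j : Fin n, j.1 < k → k ≤ (e.symm i).1 → γ * (t' v0 i * av v0 (fo A v0 i (x j))) ≤ b v0 j
  umem : u ∈ Submodule.span K (x '' {j | j.1 < k})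

include hd pf v0 in
lemma su_step1 (hn : 0 < n) (hM1 : ∃ C : ℝ, 1 ≤ C ∧ ∀ t : ι → Fin n → ℝ, (∀ v i, 0 < t v i) →
      ∃ x : Fin n → K, (∀ i, x i ∈ O) ∧ x ≠ 0 ∧ HH av A t x ^ n ≤ C * ∏ v, ∏ i, t v i)
    {q : ℕ → ℝ} (hq : Tendsto q atTop atTop) (u : ℕ → Fin n → K) (huO : ∀ s i, u s i ∈ O) (hu0 : ∀ s, u s ≠ 0)
    (t : ℕ → ι → Fin n → ℝ) (ht : ∀ s v i, 0 < t s v i) (C0 : ℝ) (htl : ∀ s v i, |Real.log (t s v i)| ≤ C0 * q s)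
    (hH : ∀ s, HH av A (t s) (u s) ≤ 1) (hP : ∀ s, Real.exp (q s) ≤ ∏ v, ∏ i, t s v i) :
    ∃ (C Λ η : ℝ) (k : ℕ) (e : Fin n ≃ Fin n), 1 ≤ C ∧ 0 ≤ Λ ∧ 0 < η ∧ 1 ≤ k ∧ k < n ∧
      ∃ᶠ s in atTop, ∃ t' b x, GeoD av A O v0 C (Λ * q s) (Real.exp (η * q s)) (u s) k e t' b x := by
  obtain ⟨C, E, hC1, hC⟩ := geo hd pf v0 hn hM1
  have hnR : (0:ℝ) < n := by exact_mod_cast hn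
  set η : ℝ := 1 / (2 * (n * n)) with hη
  have hη0 : 0 < η := by positivity
  set C1 := max C0 0 with hC1d
  have hC10 : 0 ≤ C1 := le_max_right _ _
  have hlogC : 0 ≤ Real.log C := Real.log_nonneg hC1
  have hC0 : 0 < C := by linarith
  have hev : ∀ᶠ s in atTop, ∃ p : Fin n × (Fin n ≃ Fin n), 1 ≤ p.1.1 ∧ ∃ t' b x,
      GeoD av A O v0 C ((Real.log C + E * C1) * q s) (Real.exp (η * q s)) (u s) p.1.1 p.2 t' b x := by
    filter_upwards [hq.eventually_ge_atTop 1, hq.eventually_ge_atTop (Real.log C / η), hq.eventually_ge_atTop (2 * Real.log C)] with s h1 h2 h3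
    have hlt : ∀ v i, |Real.log (t s v i)| ≤ C1 * q s := fun v i =>
      (htl s v i).trans (mul_le_mul_of_nonneg_right (le_max_left _ _) (by linarith))
    have hT : (1:ℝ) ≤ Real.exp (C1 * q s) := Real.one_le_exp (by positivity)
    obtain ⟨k, e, t', b, x, g1, g2, g3, g4, g5, g6, g7, g8, g9, g10, g11, g12, g13⟩ :=
      hC (t s) (Real.exp (C1 * q s)) (Real.exp (η * q s)) (u s) (huO s) (hu0 s) hT (ht s)
        (fun v i => by
          rw [← Real.exp_log (ht s v i), ← Real.exp_add]
          apply Real.one_le_exp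
          have := (abs_le.mp (hlt v i)).1; linarith)
        (fun v i => by
          rw [← Real.log_le_iff_le_exp (ht s v i)]
          exact (abs_le.mp (hlt v i)).2)
        (by
          rw [← Real.log_le_iff_le_exp hC0]
          rw [div_le_iff₀ hη0] at h2; linarith)
        (by
          refine le_trans ?_ (hP s)
          rw [← Real.exp_nat_mul]
          nth_rw 1 [← Real.exp_log hC0]
          rw [← Real.exp_add, Real.exp_le_exp]
          have : ((n * n : ℕ) : ℝ) * (η * q s) = q s / 2 := by
            rw [hη]; push_cast; field_simp
          rw [this]; linarith)
        (hH s)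
    refine ⟨(⟨k, g2⟩, e), g1, t', b, x, ⟨g3, fun v i => ?_, g6, g7, g8, g9, g10, g11, g12, g13⟩⟩
    have hb1 : Real.log (t' v i) ≤ Real.log C + E * (C1 * q s) := by
      have := Real.log_le_log (g3 v i) (g4 v i)
      rwa [Real.log_mul hC0.ne' (by positivity), Real.log_pow, Real.log_exp] at this
    have hb2 : 0 ≤ Real.log C + E * (C1 * q s) + Real.log (t' v i) := by
      have := Real.log_le_log one_pos (g5 v i)
      rwa [Real.log_one, Real.log_mul (by positivity) (g3 v i).ne', Real.log_mul hC0.ne' (by positivity), Real.log_pow, Real.log_exp] at this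
    have hb3 : Real.log C + E * (C1 * q s) ≤ (Real.log C + E * C1) * q s := by nlinarith
    rw [abs_le]; constructor <;> linarith
  obtain ⟨p, hp⟩ := freq_pig hev.frequently
  have hp1 : 1 ≤ p.1.1 := by
    obtain ⟨s, hs⟩ := hp.exists; exact hs.1
  exact ⟨C, Real.log C + E * C1, η, p.1.1, p.2, hC1, by positivity, hη0, hp1, p.1.2, hp.mono fun s hs => hs.2⟩

end
end UE

set_option linter.all false
namespace UE
open Finset Filter Topology

section
variable {K ι : Type*} {n : ℕ} [Fintype ι] [DecidableEq ι] [Field K] [CharZero K] [FiniteDimensional ℚ K]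
variable {av : ι → AbsoluteValue K ℝ} {A : ι → Matrix (Fin n) (Fin n) ℤ} (hd : ∀ v, ((A v).det : K) ≠ 0)
  {O : Subring K} (hO : ∀ x, IsIntegral ℤ x → x ∈ O) (pf : ∀ x ∈ O, x ≠ 0 → 1 ≤ ∏ v, av v x) (v0 : ι)

lemma ex_emb (p : ℕ) (s : Finset (Fin n)) (hs : s.card = p) : ∃ I : Fin p ↪o Fin n, ∀ a, I a ∈ s :=
  ⟨s.orderEmbOfFin hs, fun a => orderEmbOfFin_mem s hs a⟩

lemma emb_unique {p : ℕ} {s : Finset (Fin n)} (hs : s.card = p) {I J : Fin p ↪o Fin n} (hI : ∀ a, I a ∈ s) (hJ : ∀ a, J a ∈ s) : I = J := by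
  rw [orderEmbOfFin_unique' hs hI, orderEmbOfFin_unique' hs hJ]

lemma cpd_form (v : ι) (x : Fin n → Fin n → K) {p : ℕ} (I J : Fin p ↪o Fin n) :
    ∑ I', ((cpd p (A v) I I' : ℤ) : K) * ((Matrix.of fun i j => x j i).submatrix I' J).det
      = (Matrix.of fun a b => fo A v (I a) (x (J b))).det := by
  have h1 := congrFun (congrFun (cpd_mul (p := p) ((A v).map (fun z : ℤ => (z : K))) (Matrix.of fun i j => x j i)) I) J
  rw [cpd_map, Matrix.mul_apply] at h1
  simp only [Matrix.map_apply] at h1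
  refine Eq.trans ?_ (h1.symm.trans ?_)
  · rfl
  · simp only [cpd, Matrix.of_apply]
    congr 1

/-- bound of the compound forms -/
lemma cpd_bd {C B γ : ℝ} (hγ : 0 < γ) {u : Fin n → K} {k : ℕ} {e : Fin n ≃ Fin n} {t' b : ι → Fin n → ℝ} {x : Fin n → Fin n → K}
    (G : GeoD av A O v0 C B γ u k e t' b x) {p : ℕ} (Is : Fin p ↪o Fin n) (hIs : ∀ a, k ≤ (e.symm (Is a)).1)
    (I J : Fin p ↪o Fin n) (hJ : ∃ a, (J a).1 < k) (v : ι) :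
    av v (Matrix.of fun a b => fo A v (I a) (x (J b))).det ≤
      p.factorial * (((∏ a, b v (J a)) * if v = v0 ∧ I = Is then γ⁻¹ else 1) * ∏ a, (t' v (I a))⁻¹) := by
  obtain ⟨a0, ha0⟩ := hJ
  have h1 : (∏ a, b v (J a)) * (if v = v0 ∧ I = Is then γ⁻¹ else 1) =
      ∏ a, (b v (J a) * if a = a0 then (if v = v0 ∧ I = Is then γ⁻¹ else 1) else 1) := by
    rw [prod_mul_distrib]; simp
  rw [h1]
  apply det_bound
  intro a c
  rw [Matrix.of_apply, ← div_eq_mul_inv, le_div_iff₀ (G.tpos _ _), mul_comm]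
  by_cases h2 : c = a0
  · subst h2
    by_cases h3 : v = v0 ∧ I = Is
    · rw [if_pos rfl, if_pos h3]
      obtain ⟨rfl, rfl⟩ := h3
      rw [← div_eq_mul_inv, le_div_iff₀ hγ, mul_comm]
      exact G.gap _ _ ha0 (hIs a)
    · rw [if_pos rfl, if_neg h3, mul_one]; exact G.bd _ _ _
  · rw [if_neg h2, mul_one]; exact G.bd _ _ _

set_option maxHeartbeats 1000000 in
include hd hO pf in
lemma su_step2 (hn : 0 < n) {q : ℕ → ℝ} (hq : Tendsto q atTop atTop) (u : ℕ → Fin n → K)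
    (C Λ η : ℝ) (k : ℕ) (e : Fin n ≃ Fin n) (hC1 : 1 ≤ C) (hΛ : 0 ≤ Λ) (hη : 0 < η) (hk1 : 1 ≤ k) (hkn : k < n)
    (hfr : ∃ᶠ s in atTop, ∃ t' b x, GeoD av A O v0 C (Λ * q s) (Real.exp (η * q s)) (u s) k e t' b x) :
    ∃ ℓ : Fin n → K, ℓ ≠ 0 ∧ ∃ᶠ s in atTop, ∑ i, ℓ i * u s i = 0 := by
  classical
  obtain ⟨p', hp'⟩ : ∃ p', n = k + (p' + 1) := ⟨n - k - 1, by omega⟩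
  set p := p' + 1 with hp
  obtain ⟨r, hr0, hr⟩ := count_emb (p := p) hn
  set c := Fintype.card ι with hc
  set N := Fintype.card (Fin p ↪o Fin n) with hN
  set ε : ℝ := η / (2 * (r * (1 + c * n) + c * N + 1)) with hε
  have hden : 0 < 2 * (r * (1 + c * n) + c * N + 1) := by positivity
  have hε0 : 0 < ε := by positivity
  have hCp : 0 < C := by linarith
  have hfac : (1:ℝ) ≤ p.factorial := by exact_mod_cast p.factorial_pos
  have hpos : 0 < (p.factorial : ℝ) * C ^ p := by positivity
  -- discretise
  have hfr2 : ∃ᶠ s in atTop, ∃ m : ι → Fin n → Set.Icc (-(⌈Λ / ε⌉ + 1)) (⌈Λ / ε⌉ + 1),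
      ((p.factorial : ℝ) * C ^ p ≤ Real.exp (ε * q s) ∧ 1 ≤ q s ∧ ∃ t' b x, GeoD av A O v0 C (Λ * q s) (Real.exp (η * q s)) (u s) k e t' b x ∧
        ∀ v i, ε * (((m v i : ℤ)) : ℝ) * q s ≤ Real.log (t' v i) ∧ Real.log (t' v i) ≤ ε * (((m v i : ℤ) : ℝ) + 1) * q s) := by
    refine (hfr.and_eventually ((hq.eventually_ge_atTop 1).and (hq.eventually_ge_atTop (Real.log (p.factorial * C ^ p) / ε)))).mono ?_
    rintro s ⟨⟨t', b, x, G⟩, h1, h2⟩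
    have hq0 : 0 < q s := by linarith
    have hεq : 0 < ε * q s := by positivity
    have hfl : ∀ v i, |Real.log (t' v i) / (ε * q s)| ≤ Λ / ε := by
      intro v i
      rw [abs_div, abs_of_pos hεq, div_le_div_iff₀ hεq hε0]
      have := mul_le_mul_of_nonneg_right (G.tlog v i) hε0.le
      linarith
    refine ⟨fun v i => ⟨⌊Real.log (t' v i) / (ε * q s)⌋, ?_, ?_⟩, ?_, h1, t', b, x, G, fun v i => ⟨?_, ?_⟩⟩
    · have h3 := (abs_le.mp (hfl v i)).1
      rw [Int.le_floor]
      push_cast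
      have := Int.le_ceil (Λ / ε)
      linarith
    · have h3 := (abs_le.mp (hfl v i)).2
      have h4 : ⌊Real.log (t' v i) / (ε * q s)⌋ ≤ ⌈Λ / ε⌉ := by
        have := Int.floor_le_floor h3
        exact this.trans (Int.floor_le_ceil _)
      omega
    · rw [← Real.log_le_iff_le_exp hpos]
      rw [div_le_iff₀ hε0] at h2; linarith
    · have := Int.floor_le (Real.log (t' v i) / (ε * q s))
      rw [le_div_iff₀ hεq] at this
      dsimp only; linarith
    · have := (Int.lt_floor_add_one (Real.log (t' v i) / (ε * q s))).le
      rw [div_le_iff₀ hεq] at this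
      dsimp only; linarith
  obtain ⟨m0, hm0⟩ := freq_pig hfr2
  obtain ⟨m, hm⟩ : ∃ m : ι → Fin n → ℝ, ∀ v i, m v i = ((m0 v i : ℤ) : ℝ) := ⟨_, fun _ _ => rfl⟩
  simp only [← hm] at hm0
  clear hm hfr2 hfr
  obtain ⟨φ, hφ, hφP⟩ := extraction_of_frequently_atTop hm0
  choose hε1 hq1 t' b x G hm1 hm2 using hφP
  have hqφ : Tendsto (fun s => q (φ s)) atTop atTop := hq.comp hφ.tendsto_atTop
  -- index sets
  have hs1 : (univ.filter fun i : Fin n => k ≤ i.1).card = p := by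
    have : (univ.filter fun i : Fin n => i.1 < k).card = k := by rw [Fin.card_filter_val_lt]; omega
    have h2 := card_filter_add_card_filter_not (s := (univ : Finset (Fin n))) (fun i : Fin n => i.1 < k)
    simp only [not_lt, card_univ, Fintype.card_fin] at h2
    omega
  have hs2 : (univ.filter fun i : Fin n => k ≤ (e.symm i).1).card = p := by
    rw [← hs1]
    refine card_bij (fun i _ => e.symm i) (by simp) (by simp) ?_
    intro j hj
    exact ⟨e j, by simpa using hj, by simp⟩
  obtain ⟨J0, hJ0⟩ := ex_emb p _ hs1
  obtain ⟨Is, hIs⟩ := ex_emb p _ hs2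
  have hJne : ∀ J : Fin p ↪o Fin n, J ≠ J0 → ∃ a, (J a).1 < k := by
    intro J hJ
    by_contra hno
    push Not at hno
    exact hJ (emb_unique hs1 (fun a => by simpa using hno a) hJ0)
  have hIs' : ∀ a, k ≤ (e.symm (Is a)).1 := fun a => by simpa using hIs a
  -- weights
  let w : ι → (Fin p ↪o Fin n) → ℝ := fun v I => -(ε * ∑ a, m v (I a)) + ε + if v = v0 ∧ I = Is then -η else 0
  have hsumw : ∑ v, ∑ I, w v I ≤ -(η / 2) := by
    have h1 : ∑ v, ∑ I : Fin p ↪o Fin n, w v I = -(ε * (r * ∑ v, ∑ i, m v i)) + c * N * ε - η := by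
      have h2 : ∀ v, ∑ I : Fin p ↪o Fin n, w v I = -(ε * (r * ∑ i, m v i)) + N * ε + if v = v0 then -η else 0 := by
        intro v
        simp only [w, sum_add_distrib]
        congr 1
        · congr 1
          · rw [sum_neg_distrib, ← mul_sum, hr]
          · simp [hN]
        · by_cases hv : v = v0 <;> simp [hv]
      simp only [h2, sum_add_distrib]
      simp [sum_neg_distrib, ← mul_sum, hc]; ring
    have h3 : -(ε * ∑ v, ∑ i, m v i) ≤ ε * (1 + c * n) := by
      have hq0 : 0 < q (φ 0) := by linarith [hq1 0]
      have h4 : Real.log (∏ v, ∏ i, t' 0 v i) ≤ ∑ v : ι, ∑ i : Fin n, ε * (m v i + 1) * q (φ 0) := by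
        rw [Real.log_prod (fun v _ => (prod_pos fun i _ => (G 0).tpos v i).ne')]
        refine sum_le_sum fun v _ => ?_
        rw [Real.log_prod (fun i _ => ((G 0).tpos v i).ne')]
        exact sum_le_sum fun i _ => hm2 0 v i
      have h5 : ∑ v : ι, ∑ i : Fin n, ε * (m v i + 1) * q (φ 0) = (ε * (∑ v, ∑ i, m v i) + ε * (c * n)) * q (φ 0) := by
        have h50 : ∀ v i, ε * (m v i + 1) * q (φ 0) = ε * q (φ 0) * m v i + ε * q (φ 0) := fun v i => by ring
        simp only [h50, sum_add_distrib, ← mul_sum, sum_const, card_univ, nsmul_eq_mul, Fintype.card_fin, ← hc]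
        ring
      have hPp : 0 < ∏ v, ∏ i, t' 0 v i := prod_pos fun v _ => prod_pos fun i _ => (G 0).tpos v i
      have h6 : 0 ≤ Real.log C + Real.log (∏ v, ∏ i, t' 0 v i) := by
        rw [← Real.log_mul hCp.ne' hPp.ne']
        exact Real.log_nonneg (G 0).tprod
      have h7 : Real.log C ≤ ε * q (φ 0) := by
        rw [Real.log_le_iff_le_exp hCp]
        refine le_trans ?_ (hε1 0)
        have : C ≤ C ^ p := le_self_pow₀ hC1 (by omega)
        nlinarith
      rw [h5] at h4
      by_contra hno
      push Not at hno
      nlinarith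
    rw [h1]
    have h8 : ε * (r * (1 + c * n) + c * N) ≤ η / 2 := by
      have : ε * (2 * (r * (1 + c * n) + c * N + 1)) = η := by rw [hε]; field_simp
      nlinarith
    have h9 := mul_le_mul_of_nonneg_left h3 hr0
    nlinarith
  -- points
  have hXu : ∀ s, IsUnit ((Matrix.of fun i j => x s j i : Matrix (Fin n) (Fin n) K)).det := by
    intro s
    have h1 : LinearIndependent K (Matrix.transpose (Matrix.of fun i j => x s j i : Matrix (Fin n) (Fin n) K)).row := (G s).li
    have h2 := Matrix.linearIndependent_rows_iff_isUnit.mp h1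
    rwa [Matrix.isUnit_iff_isUnit_det, Matrix.det_transpose] at h2
  have hprodb : ∀ s (J : Fin p ↪o Fin n), ∏ v, ((C ^ p)⁻¹ * ∏ a, b s v (J a)) ≤ 1 := by
    intro s J
    rw [prod_mul_distrib, Finset.prod_comm, prod_const, card_univ]
    have h1 : ∏ a, ∏ v, b s v (J a) ≤ C ^ p := by
      calc ∏ a, ∏ v, b s v (J a) ≤ ∏ a : Fin p, C := prod_le_prod (fun a _ => prod_nonneg fun v _ => ((G s).bpos _ _).le) fun a _ => (G s).bprod _
        _ = _ := by simp
    have h2 : ((C ^ p)⁻¹) ^ Fintype.card ι ≤ (C ^ p)⁻¹ :=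
      pow_le_of_le_one (by positivity) (inv_le_one_of_one_le₀ (one_le_pow₀ hC1)) (Fintype.card_pos_iff.mpr ⟨v0⟩).ne'
    calc _ ≤ (C ^ p)⁻¹ * C ^ p := mul_le_mul h2 h1 (prod_nonneg fun a _ => prod_nonneg fun v _ => ((G s).bpos _ _).le) (by positivity)
      _ = 1 := inv_mul_cancel₀ (by positivity)
  obtain ⟨M, hM0, hM⟩ := thmP av O hO pf (fun v => cpd p (A v)) (fun v => cpd_det_ne (hd v)) (Equiv.optionSubtypeNe J0) w
    (half_pos hη) hsumw hqφ (fun s J I => ((Matrix.of fun i j => x s j i).submatrix I J.1).det)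
    (fun s J I => by
      rw [Matrix.det_apply']
      refine sum_mem fun σ _ => mul_mem (intCast_mem _ _) (prod_mem fun a _ => ?_)
      exact (G s).xO _ _)
    (fun s => by
      have h1 := cpd_isUnit (p := p) (hXu s)
      rw [← Matrix.isUnit_iff_isUnit_det, ← Matrix.linearIndependent_cols_iff_isUnit] at h1
      exact h1.comp (Subtype.val : {J // J ≠ J0} → _) Subtype.val_injective)
    (fun s v J => (C ^ p)⁻¹ * ∏ a, b s v (J.1 a))
    (fun s v J => mul_pos (by positivity) (prod_pos fun a _ => (G s).bpos _ _))
    (fun s J => hprodb s J.1)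
    (fun s v J I => by
      rw [cpd_form]
      refine (cpd_bd v0 (Real.exp_pos _) (G s) Is hIs' I J.1 (hJne J.1 J.2) v).trans ?_
      have hb0 : 0 < ∏ a, b s v (J.1 a) := prod_pos fun a _ => (G s).bpos _ _
      have h1 : ∏ a, (t' s v (I a))⁻¹ ≤ Real.exp (-(ε * ∑ a, m v (I a)) * q (φ s)) := by
        have : -(ε * ∑ a, m v (I a)) * q (φ s) = ∑ a, -(ε * m v (I a) * q (φ s)) := by
          rw [sum_neg_distrib, ← sum_mul, ← mul_sum]; ring
        rw [this, Real.exp_sum]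
        refine prod_le_prod (fun a _ => (inv_pos.mpr ((G s).tpos _ _)).le) fun a _ => ?_
        rw [Real.exp_neg]
        refine inv_anti₀ (Real.exp_pos _) ?_
        rw [← Real.le_log_iff_exp_le ((G s).tpos _ _)]
        exact hm1 s v (I a)
      have h2 : (if v = v0 ∧ I = Is then (Real.exp (η * q (φ s)))⁻¹ else 1) = Real.exp ((if v = v0 ∧ I = Is then -η else 0) * q (φ s)) := by
        split_ifs
        · rw [neg_mul, Real.exp_neg]
        · simp
      rw [h2]
      have h3 : Real.exp (w v I * q (φ s)) = Real.exp (ε * q (φ s)) * (Real.exp ((if v = v0 ∧ I = Is then -η else 0) * q (φ s)) * Real.exp (-(ε * ∑ a, m v (I a)) * q (φ s))) := by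
        rw [← Real.exp_add, ← Real.exp_add]; congr 1; simp only [w]; ring
      rw [h3]
      set R := Real.exp ((if v = v0 ∧ I = Is then -η else 0) * q (φ s)) with hR
      have hR0 : 0 < R := Real.exp_pos _
      clear_value R
      set Z := Real.exp (-(ε * ∑ a, m v (I a)) * q (φ s)) with hZ
      have hZ0 : 0 < Z := Real.exp_pos _
      clear_value Z
      calc (p.factorial : ℝ) * (((∏ a, b s v (J.1 a)) * R) * ∏ a, (t' s v (I a))⁻¹)
          ≤ (p.factorial : ℝ) * (((∏ a, b s v (J.1 a)) * R) * Z) := by gcongr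
        _ = (p.factorial * C ^ p) * ((C ^ p)⁻¹ * (∏ a, b s v (J.1 a)) * (R * Z)) := by
          have hcc : C ^ p * (C ^ p)⁻¹ = 1 := mul_inv_cancel₀ (by positivity)
          linear_combination (-((p.factorial : ℝ) * (∏ a, b s v (J.1 a)) * R * Z)) * hcc
        _ ≤ Real.exp (ε * q (φ s)) * ((C ^ p)⁻¹ * (∏ a, b s v (J.1 a)) * (R * Z)) :=
          mul_le_mul_of_nonneg_right (hε1 s) (by positivity)
        _ = _ := by ring)
  obtain ⟨ℓ, hℓ0, hℓ⟩ := ex_form hM0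
  refine ⟨ℓ, hℓ0, ?_⟩
  refine hφ.tendsto_atTop.frequently (hM.mono fun s hs => ?_)
  refine hℓ _ fun W hW => kill hp' M (G s).li (G s).umem (fun J hJ => ?_) W hW
  refine hs ⟨J, ?_⟩
  rintro rfl
  obtain ⟨a, ha⟩ := hJ
  have := hJ0 a
  simp at this; omega

include hd hO pf v0 in
/-- the subspace theorem, special form -/
theorem subspace_thm (hn : 0 < n) (hM1 : ∃ C : ℝ, 1 ≤ C ∧ ∀ t : ι → Fin n → ℝ, (∀ v i, 0 < t v i) →
      ∃ x : Fin n → K, (∀ i, x i ∈ O) ∧ x ≠ 0 ∧ HH av A t x ^ n ≤ C * ∏ v, ∏ i, t v i)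
    {q : ℕ → ℝ} (hq : Tendsto q atTop atTop) (u : ℕ → Fin n → K) (huO : ∀ s i, u s i ∈ O) (hu0 : ∀ s, u s ≠ 0)
    (t : ℕ → ι → Fin n → ℝ) (ht : ∀ s v i, 0 < t s v i) (C0 : ℝ) (htl : ∀ s v i, |Real.log (t s v i)| ≤ C0 * q s)
    (hH : ∀ s, HH av A (t s) (u s) ≤ 1) (hP : ∀ s, Real.exp (q s) ≤ ∏ v, ∏ i, t s v i) :
    ∃ ℓ : Fin n → K, ℓ ≠ 0 ∧ ∃ᶠ s in atTop, ∑ i, ℓ i * u s i = 0 := by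
  obtain ⟨C, Λ, η, k, e, h1, h2, h3, h4, h5, h6⟩ := su_step1 hd pf v0 hn hM1 hq u huO hu0 t ht C0 htl hH hP
  exact su_step2 hd hO pf v0 hn hq u C Λ η k e h1 h2 h3 h4 h5 h6

end
end UE

set_option linter.all false
namespace UE
open Finset Filter Topology

section
variable {K ι : Type*} {n : ℕ} [Fintype ι] [DecidableEq ι] [Field K]

/-- dropping the index d -/
def dropA (d : ι → Fin (n+1)) (v : ι) : Matrix (Fin n) (Fin n) ℤ :=
  Matrix.of fun i k => if (d v).succAbove i = 0 then -1 else if (d v).succAbove i = k.succ then 1 else 0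

lemma fo_dropA (d : ι → Fin (n+1)) (v : ι) (i : Fin n) (u : Fin (n+1) → K) (hu : ∑ i, u i = 0) :
    fo (dropA d) v i (fun k => u k.succ) = u ((d v).succAbove i) := by
  rw [Fin.sum_univ_succ] at hu
  simp only [fo, dropA, Matrix.of_apply]
  by_cases h : (d v).succAbove i = 0
  · simp only [h, if_true]
    rw [eq_neg_of_add_eq_zero_left hu]
    simp
  · obtain ⟨k, hk⟩ := Fin.exists_succ_eq.mpr h
    simp only [h, if_false, ← hk]
    simp

lemma dropA_det (d : ι → Fin (n+1)) (v : ι) : (((dropA d v).det : ℤ) : K) ≠ 0 := by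
  have h2 : (((dropA d v).det : ℤ) : K) = ((dropA d v).map (fun z : ℤ => (z : K))).det := by
    have := (Int.castRingHom K).map_det (dropA d v); simpa [RingHom.mapMatrix_apply] using this
  rw [h2]
  intro h0
  obtain ⟨x, hx0, hx⟩ := Matrix.exists_mulVec_eq_zero_iff.mpr h0
  apply hx0
  let u : Fin (n+1) → K := Fin.cons (-∑ k, x k) x
  have hu : ∑ i, u i = 0 := by rw [Fin.sum_univ_succ]; simp [u]
  have hz : ∀ i, u ((d v).succAbove i) = 0 := by
    intro i
    rw [← fo_dropA d v i u hu]
    have := congrFun hx i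
    simpa [Matrix.mulVec, dotProduct, fo, u] using this
  have hd0 : u (d v) = 0 := by
    rw [Fin.sum_univ_succAbove _ (d v)] at hu
    simpa [hz] using hu
  ext k
  have : u k.succ = 0 := by
    by_cases h : k.succ = d v
    · rw [h]; exact hd0
    · obtain ⟨i, hi⟩ := Fin.exists_succAbove_eq h
      rw [← hi]; exact hz i
  simpa [u] using this

variable [CharZero K] [FiniteDimensional ℚ K]
variable {av : ι → AbsoluteValue K ℝ}
  {O : Subring K} (hO : ∀ x, IsIntegral ℤ x → x ∈ O) (pf : ∀ x ∈ O, x ≠ 0 → 1 ≤ ∏ v, av v x) (v0 : ι)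

omit [CharZero K] [FiniteDimensional ℚ K] [DecidableEq ι] in
include pf in
lemma unit_prod {x : K} (hx : x ∈ O) (hx' : x⁻¹ ∈ O) (h0 : x ≠ 0) : ∏ v, av v x = 1 := by
  apply le_antisymm _ (pf x hx h0)
  have h1 := pf _ hx' (inv_ne_zero h0)
  simp only [map_inv₀, prod_inv_distrib] at h1
  have h2 : 0 < ∏ v, av v x := prod_pos fun v _ => (av v).pos h0
  rwa [one_le_inv₀ h2] at h1

include hO pf v0 in
theorem unit_abs (hn : 0 < n) (hM1 : ∀ A : ι → Matrix (Fin n) (Fin n) ℤ, (∀ v, ((A v).det : K) ≠ 0) →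
      ∃ C : ℝ, 1 ≤ C ∧ ∀ t : ι → Fin n → ℝ, (∀ v i, 0 < t v i) →
      ∃ x : Fin n → K, (∀ i, x i ∈ O) ∧ x ≠ 0 ∧ HH av A t x ^ n ≤ C * ∏ v, ∏ i, t v i)
    (hfin : ∀ B : ℝ, {x | x ∈ O ∧ ∀ v, av v x ≤ B}.Finite)
    (u : ℕ → Fin (n+1) → K) (huO : ∀ s i, u s i ∈ O) (huO' : ∀ s i, (u s i)⁻¹ ∈ O) (hu0 : ∀ s i, u s i ≠ 0)
    (hu1 : ∀ s, u s 0 = 1) (hsum : ∀ s, ∑ i, u s i = 0) (hcof : ∀ a, ∀ᶠ s in atTop, u s ≠ a) :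
    ∃ ℓ : Fin n → K, ℓ ≠ 0 ∧ ∃ᶠ s in atTop, ∑ i, ℓ i * u s i.succ = 0 := by
  classical
  -- largest index
  have hmax : ∀ s, ∃ d : ι → Fin (n+1), ∀ v i, av v (u s i) ≤ av v (u s (d v)) := by
    intro s
    have : ∀ v, ∃ d, ∀ i, av v (u s i) ≤ av v (u s d) := fun v => Finite.exists_max fun i => av v (u s i)
    choose d hd using this
    exact ⟨d, hd⟩
  obtain ⟨d, hd⟩ := freq_pig (P := fun (d : ι → Fin (n+1)) s => ∀ v i, av v (u s i) ≤ av v (u s (d v)))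
    (Eventually.frequently (Eventually.of_forall hmax) (f := atTop))
  obtain ⟨φ, hφ, hdφ⟩ := extraction_of_frequently_atTop hd
  suffices h : ∃ ℓ : Fin n → K, ℓ ≠ 0 ∧ ∃ᶠ s in atTop, ∑ i, ℓ i * u (φ s) i.succ = 0 by
    obtain ⟨ℓ, h0, h1⟩ := h
    exact ⟨ℓ, h0, hφ.tendsto_atTop.frequently h1⟩
  obtain ⟨Q, hQ⟩ : ∃ Q : ℕ → ℝ, ∀ s, Q s = ∏ v, av v (u (φ s) (d v)) := ⟨_, fun _ => rfl⟩
  have hm1 : ∀ s v, 1 ≤ av v (u (φ s) (d v)) := fun s v => by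
    have := hdφ s v 0; rwa [hu1, map_one] at this
  have hmQ : ∀ s v, av v (u (φ s) (d v)) ≤ Q s := fun s v => by
    rw [hQ, ← mul_prod_erase univ _ (mem_univ v)]
    refine le_mul_of_one_le_right (zero_le_one.trans (hm1 s v)) ?_
    exact le_trans (by simp) (prod_le_prod (s := univ.erase v) (f := fun _ => (1:ℝ)) (fun _ _ => zero_le_one) fun w _ => hm1 s w)
  have hup : ∀ s v i, av v (u (φ s) i) ≤ Q s := fun s v i => (hdφ s v i).trans (hmQ s v)
  have hQ1 : ∀ s, 1 ≤ Q s := fun s => (hm1 s v0).trans (hmQ s v0)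
  have hQ0 : ∀ s, 0 < Q s := fun s => by linarith [hQ1 s]
  have hlo : ∀ s v i, 1 ≤ Q s * av v (u (φ s) i) := fun s v i => by
    have h1 := unit_prod pf (huO (φ s) i) (huO' (φ s) i) (hu0 (φ s) i)
    rw [← h1, ← mul_prod_erase univ _ (mem_univ v), mul_comm]
    refine mul_le_mul_of_nonneg_right ?_ ((av v).nonneg _)
    rw [hQ, ← mul_prod_erase univ _ (mem_univ v)]
    refine le_trans (prod_le_prod (fun w _ => (av w).nonneg _) fun w _ => hdφ s w i) ?_
    exact le_mul_of_one_le_left (prod_nonneg fun w _ => (av w).nonneg _) (hm1 s v)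
  have hQt : Tendsto Q atTop atTop := by
    rw [tendsto_atTop]
    intro B
    have hF : {a : Fin (n+1) → K | ∀ i, a i ∈ {x | x ∈ O ∧ ∀ v, av v x ≤ B}}.Finite := by
      have := Set.Finite.pi' (fun _ : Fin (n+1) => hfin B); exact this
    have h1 : ∀ᶠ s in atTop, ∀ a ∈ {a : Fin (n+1) → K | ∀ i, a i ∈ {x | x ∈ O ∧ ∀ v, av v x ≤ B}}, u (φ s) ≠ a := by
      rw [Filter.eventually_all_finite hF]
      intro a _
      exact hφ.tendsto_atTop.eventually (hcof a)
    filter_upwards [h1] with s hs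
    by_contra hno
    push Not at hno
    exact hs (u (φ s)) (fun i => ⟨huO _ _, fun v => (hup s v i).trans hno.le⟩) rfl
  have hdet : ∀ v, ((dropA d v).det : K) ≠ 0 := fun v => dropA_det d v
  have htpos : ∀ s v (i : Fin n), 0 < (av v (u (φ s) ((d v).succAbove i)))⁻¹ := fun s v i => inv_pos.mpr ((av v).pos (hu0 _ _))
  refine subspace_thm hdet hO pf v0 hn (hM1 (dropA d) hdet) (Real.tendsto_log_atTop.comp hQt)
    (fun s k => u (φ s) k.succ) (fun s k => huO _ _) (fun s h => hu0 (φ s) (Fin.succ ⟨0, hn⟩) (congrFun h ⟨0, hn⟩))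
    (fun s v i => (av v (u (φ s) ((d v).succAbove i)))⁻¹) htpos 1 ?_ ?_ ?_
  · intro s v i
    have hpos := (av v).pos (hu0 (φ s) ((d v).succAbove i))
    rw [Real.log_inv, abs_neg, one_mul, Function.comp, abs_le]
    constructor
    · have := Real.log_nonneg (hlo s v ((d v).succAbove i))
      rw [Real.log_mul (hQ0 s).ne' hpos.ne'] at this; linarith
    · exact Real.log_le_log hpos (hup s v _)
  · intro s
    refine prod_le_one (fun v _ => Nv_nonneg _ _ _ _ _) fun v _ => ?_
    refine Nv_le av _ (htpos s) zero_le_one fun i => ?_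
    rw [fo_dropA d v i (u (φ s)) (hsum _)]
    exact (inv_mul_cancel₀ ((av v).pos (hu0 _ _)).ne').le
  · intro s
    rw [Function.comp, Real.exp_log (hQ0 s), hQ]
    have h1 : ∀ v, ∏ i : Fin n, (av v (u (φ s) ((d v).succAbove i)))⁻¹ = av v (u (φ s) (d v)) * (∏ i, av v (u (φ s) i))⁻¹ := by
      intro v
      rw [Fin.prod_univ_succAbove _ (d v), prod_inv_distrib]
      have := ((av v).pos (hu0 (φ s) (d v))).ne'
      rw [mul_inv, ← mul_assoc, mul_inv_cancel₀ this, one_mul]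
    simp only [h1, prod_mul_distrib, prod_inv_distrib]
    rw [Finset.prod_comm (f := fun v i => av v (u (φ s) i))]
    simp only [unit_prod pf (huO (φ s) _) (huO' (φ s) _) (hu0 (φ s) _)]
    simp
end
end UE

set_option linter.all false
namespace UE
open Finset Filter Topology NumberField IsDedekindDomain

section
variable {K : Type*} {n : ℕ} [Field K] [NumberField K]

/-- integral version of the forms -/
noncomputable def Lo (B : Matrix (Fin n) (Fin n) ℤ) (i : Fin n) (x : Fin n → 𝓞 K) : 𝓞 K := ∑ k, ((B i k : ℤ) : 𝓞 K) * x k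

lemma Lo_sub (B : Matrix (Fin n) (Fin n) ℤ) (i : Fin n) (x y : Fin n → 𝓞 K) : Lo B i (x - y) = Lo B i x - Lo B i y := by
  simp [Lo, mul_sub, sum_sub_distrib]

lemma floor_cell {a b r : ℝ} (hr : 0 < r) (ha : 0 ≤ a) (hb : 0 ≤ b) (h : ⌊a / r⌋₊ = ⌊b / r⌋₊) : |a - b| ≤ r := by
  have h1 := Nat.floor_le (div_nonneg ha hr.le)
  have h2 := Nat.floor_le (div_nonneg hb hr.le)
  have h3 := Nat.lt_floor_add_one (a / r)
  have h4 := Nat.lt_floor_add_one (b / r)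
  rw [h] at h1 h3
  have h5 : |a / r - b / r| ≤ 1 := by rw [abs_le]; constructor <;> linarith
  rwa [← sub_div, abs_div, abs_of_pos hr, div_le_one hr] at h5

/-- pigeonhole -/
theorem pigeon (S : Finset (HeightOneSpectrum (𝓞 K))) (A : InfinitePlace K ⊕ S → Matrix (Fin n) (Fin n) ℤ) :
    ∃ c : ℝ, 1 ≤ c ∧ ∀ (e : S → Fin n → ℕ) (r : InfinitePlace K → Fin n → ℝ), (∀ w i, 0 < r w i) →
      c * ∏ v, ∏ i, ((Ideal.absNorm v.1.asIdeal : ℝ) ^ e v i) < ∏ w, ∏ i, r w i ^ w.mult →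
      ∃ x : Fin n → 𝓞 K, x ≠ 0 ∧ (∀ (w : InfinitePlace K) i, w (Lo (A (.inl w)) i x : 𝓞 K) ≤ 2 * r w i) ∧
        ∀ v i, Lo (A (.inr v)) i x ∈ v.1.asIdeal ^ e v i := by
  classical
  obtain ⟨I, hI, ω, hcard⟩ : ∃ (I : Type) (_ : Fintype I) (ω : Module.Basis I ℤ (𝓞 K)), Fintype.card I = Module.finrank ℚ K := by
    refine ⟨Fin (Module.finrank ℤ (𝓞 K)), inferInstance, Module.finBasis ℤ (𝓞 K), ?_⟩
    rw [Fintype.card_fin, RingOfIntegers.rank]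
  -- points
  let X : (Fin n → I → ℕ) → Fin n → 𝓞 K := fun z j => ∑ k, (z j k : 𝓞 K) * ω k
  have hXinj : Function.Injective X := by
    intro z z' h
    funext j k
    have h1 := congrFun h j
    have h2 : ∑ k, ((z j k : ℤ) - (z' j k : ℤ)) • ω k = 0 := by
      simp only [sub_smul, sum_sub_distrib, sub_eq_zero, zsmul_eq_mul, Int.cast_natCast]
      exact h1
    have h3 := (Fintype.linearIndependent_iff.mp ω.linearIndependent) _ h2 k
    omega
  -- bound at infinity
  obtain ⟨c1, hc1, hc1b⟩ := fin_bd (fun p : InfinitePlace K × Fin n =>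
    ∑ j, ∑ k, |((A (.inl p.1) p.2 j : ℤ) : ℝ)| * p.1 (ω k : 𝓞 K))
  have hbd : ∀ (T : ℕ) (z : Fin n → I → ℕ), (∀ j k, z j k < T) → ∀ (w : InfinitePlace K) i,
      ‖w.embedding (Lo (A (.inl w)) i (X z) : 𝓞 K)‖ ≤ c1 * T := by
    intro T z hz w i
    have h0 : w.embedding (Lo (A (.inl w)) i (X z) : 𝓞 K) = ∑ j, ∑ k, ((A (.inl w) i j : ℤ) : ℂ) * ((z j k : ℂ) * w.embedding (ω k : 𝓞 K)) := by
      simp [Lo, X, mul_sum]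
    rw [h0]
    refine (norm_sum_le _ _).trans ?_
    refine (sum_le_sum fun j _ => norm_sum_le _ _).trans ?_
    have h1 := hc1b (w, i)
    refine le_trans ?_ (mul_le_mul_of_nonneg_right h1 (Nat.cast_nonneg T))
    rw [sum_mul]
    refine sum_le_sum fun j _ => ?_
    rw [sum_mul]
    refine sum_le_sum fun k _ => ?_
    rw [norm_mul, norm_mul, InfinitePlace.norm_embedding_eq, Complex.norm_intCast, Complex.norm_natCast]
    have h2 : (z j k : ℝ) ≤ T := by exact_mod_cast (hz j k).le
    have h3 : 0 ≤ |((A (.inl w) i j : ℤ) : ℝ)| * w (ω k : 𝓞 K) := mul_nonneg (abs_nonneg _) (w.1.nonneg _)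
    calc _ = (|((A (.inl w) i j : ℤ) : ℝ)| * w (ω k : 𝓞 K)) * z j k := by ring
      _ ≤ _ := mul_le_mul_of_nonneg_left h2 h3
  refine ⟨(4 * c1) ^ (n * Module.finrank ℚ K), one_le_pow₀ (by linarith), fun e r hr hlt => ?_⟩
  obtain ⟨R, hR1, hR⟩ := fin_bd (fun p : InfinitePlace K × Fin n => r p.1 p.2)
  obtain ⟨T, hT⟩ := exists_nat_gt R
  have hT0 : (0:ℝ) < T := by linarith
  let M : InfinitePlace K → Fin n → ℕ := fun w i => ⌊2 * c1 * T / r w i⌋₊ + 1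
  have hM : ∀ w i, (M w i : ℝ) ≤ 4 * c1 * T / r w i := by
    intro w i
    have h1 : (1:ℝ) ≤ 2 * c1 * T / r w i := by
      rw [one_le_div (hr w i)]
      have := hR (w, i)
      simp only at this
      nlinarith
    have h2 := Nat.floor_le (zero_le_one.trans h1)
    have h3 : 4 * c1 * T / r w i = 2 * (2 * c1 * T / r w i) := by ring
    simp only [M]; push_cast; linarith
  let part : ℕ → ℂ → ℝ := fun k z => if k = 0 then z.re else z.im
  have hpart : ∀ k z, |part k z| ≤ ‖z‖ := fun k z => by
    simp only [part]; split_ifs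
    · exact Complex.abs_re_le_norm z
    · exact Complex.abs_im_le_norm z
  have hpos : ∀ (z : Fin n → I → Fin T) (w : InfinitePlace K) i k,
      0 ≤ part k (w.embedding (Lo (A (.inl w)) i (X fun j k => z j k) : 𝓞 K)) + c1 * T ∧
      part k (w.embedding (Lo (A (.inl w)) i (X fun j k => z j k) : 𝓞 K)) + c1 * T ≤ 2 * c1 * T := by
    intro z w i k
    have h1 := (hpart k _).trans (hbd T (fun j k => z j k) (fun j k => (z j k).2) w i)
    rw [abs_le] at h1
    constructor <;> linarith
  let F : (Fin n → I → Fin T) → ((w : InfinitePlace K) → (i : Fin n) → Fin w.mult → Fin (M w i)) ×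
      ((v : S) → (i : Fin n) → (𝓞 K ⧸ (v.1.asIdeal ^ e v i))) := fun z =>
    (fun w i k => ⟨⌊(part k (w.embedding (Lo (A (.inl w)) i (X fun j k => z j k) : 𝓞 K)) + c1 * T) / r w i⌋₊, by
      refine Nat.lt_succ_of_le (Nat.floor_le_floor ?_)
      exact div_le_div_of_nonneg_right (hpos z w i k).2 (hr w i).le⟩,
     fun v i => Ideal.Quotient.mk _ (Lo (A (.inr v)) i (X fun j k => z j k)))
  have hfinq : ∀ (v : S) i, Finite (𝓞 K ⧸ (v.1.asIdeal ^ e v i)) := fun v i =>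
    Ideal.finiteQuotientOfFreeOfNeBot _ (pow_ne_zero _ v.1.ne_bot)
  have hnotinj : ¬ Function.Injective F := by
    intro hinj
    have h1 := Nat.card_le_card_of_injective F hinj
    have h2 : (Nat.card (Fin n → I → Fin T) : ℝ) = (T:ℝ) ^ (n * Module.finrank ℚ K) := by
      rw [Nat.card_eq_fintype_card]
      simp [hcard, pow_mul, mul_comm n]
    have h3 : (Nat.card (((w : InfinitePlace K) → (i : Fin n) → Fin w.mult → Fin (M w i)) ×
      ((v : S) → (i : Fin n) → (𝓞 K ⧸ (v.1.asIdeal ^ e v i)))) : ℝ) = (∏ w, ∏ i, (M w i : ℝ) ^ w.mult) *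
        ∏ v, ∏ i, ((Ideal.absNorm v.1.asIdeal : ℝ) ^ e v i) := by
      rw [Nat.card_prod, Nat.card_pi, Nat.card_pi]
      push_cast
      congr 1
      · refine prod_congr rfl fun w _ => ?_
        rw [Nat.card_eq_fintype_card]; simp
      · refine prod_congr rfl fun v _ => ?_
        rw [Nat.card_pi]
        push_cast
        refine prod_congr rfl fun i _ => ?_
        have : Nat.card (𝓞 K ⧸ v.1.asIdeal ^ e v i) = Ideal.absNorm (v.1.asIdeal ^ e v i) := by
          rw [Ideal.absNorm_apply]; rfl
        rw [this, map_pow]; push_cast; rfl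
    have h4 : (∏ w : InfinitePlace K, ∏ i : Fin n, (M w i : ℝ) ^ w.mult) ≤ (4 * c1 * T) ^ (n * Module.finrank ℚ K) / ∏ w, ∏ i, r w i ^ w.mult := by
      have : ∏ w : InfinitePlace K, ∏ i : Fin n, (4 * c1 * T / r w i) ^ w.mult = (4 * c1 * T) ^ (n * Module.finrank ℚ K) / ∏ w, ∏ i, r w i ^ w.mult := by
        simp only [div_pow, prod_div_distrib]
        congr 1
        simp only [prod_const, card_univ, Fintype.card_fin, ← pow_mul]
        rw [prod_pow_eq_pow_sum, ← sum_mul, InfinitePlace.sum_mult_eq, mul_comm (Module.finrank ℚ K)]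
      rw [← this]
      exact prod_le_prod (fun w _ => prod_nonneg fun i _ => by positivity) fun w _ =>
        prod_le_prod (fun i _ => by positivity) fun i _ => pow_le_pow_left₀ (Nat.cast_nonneg _) (hM w i) _
    have h5 : (T:ℝ) ^ (n * Module.finrank ℚ K) ≤ ((4 * c1 * T) ^ (n * Module.finrank ℚ K) / ∏ w, ∏ i, r w i ^ w.mult) *
        ∏ v : S, ∏ i, ((Ideal.absNorm v.1.asIdeal : ℝ) ^ e v i) := by
      rw [← h2]
      refine le_trans (Nat.cast_le.mpr h1) ?_
      rw [h3]
      exact mul_le_mul_of_nonneg_right h4 (prod_nonneg fun v _ => prod_nonneg fun i _ => by positivity)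
    have hrp : 0 < ∏ w, ∏ i, r w i ^ w.mult := prod_pos fun w _ => prod_pos fun i _ => pow_pos (hr w i) _
    rw [div_mul_eq_mul_div, le_div_iff₀ hrp, mul_pow (4 * c1)] at h5
    have hTp : (0:ℝ) < (T:ℝ) ^ (n * Module.finrank ℚ K) := by positivity
    have h6 : (T:ℝ) ^ (n * Module.finrank ℚ K) * ((4 * c1) ^ (n * Module.finrank ℚ K) * ∏ v : S, ∏ i, ((Ideal.absNorm v.1.asIdeal : ℝ) ^ e v i)) < (T:ℝ) ^ (n * Module.finrank ℚ K) * ∏ w, ∏ i, r w i ^ w.mult :=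
      mul_lt_mul_of_pos_left hlt hTp
    linarith
  simp only [Function.Injective, not_forall] at hnotinj
  obtain ⟨z, z', hF, hne⟩ := hnotinj
  refine ⟨X (fun j k => z j k) - X (fun j k => z' j k), ?_, ?_, ?_⟩
  · rw [sub_ne_zero]
    intro h
    apply hne
    have := hXinj h
    funext j k
    exact Fin.ext (congrFun (congrFun this j) k)
  · intro w i
    have h1 : ∀ k : Fin w.mult, |part k (w.embedding (Lo (A (.inl w)) i (X fun j k => z j k) : 𝓞 K)) -
        part k (w.embedding (Lo (A (.inl w)) i (X fun j k => z' j k) : 𝓞 K))| ≤ r w i := by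
      intro k
      have h2 := congrFun (congrFun (congrFun (congrArg Prod.fst hF) w) i) k
      simp only [F, Fin.mk.injEq] at h2
      have := floor_cell (hr w i) (hpos z w i k).1 (hpos z' w i k).1 h2
      rwa [add_sub_add_right_eq_sub] at this
    rw [Lo_sub, ← InfinitePlace.norm_embedding_eq]
    refine (Complex.norm_le_abs_re_add_abs_im _).trans ?_
    have hre : |(w.embedding ((Lo (A (.inl w)) i (X fun j k => z j k) - Lo (A (.inl w)) i (X fun j k => z' j k) : 𝓞 K) : K)).re| ≤ r w i := by
      have := h1 ⟨0, w.mult_pos⟩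
      simpa [part] using this
    have him : |(w.embedding ((Lo (A (.inl w)) i (X fun j k => z j k) - Lo (A (.inl w)) i (X fun j k => z' j k) : 𝓞 K) : K)).im| ≤ r w i := by
      by_cases hw : w.IsReal
      · have h3 := InfinitePlace.isReal_iff.mp hw
        have h4 : ∀ y : K, (w.embedding y).im = 0 := fun y => by
          have := RingHom.congr_fun h3 y
          rw [ComplexEmbedding.conjugate_coe_eq] at this
          exact Complex.conj_eq_iff_im.mp this
        rw [h4, abs_zero]; exact (hr w i).le
      · have := h1 ⟨1, by rw [InfinitePlace.mult, if_neg hw]; norm_num⟩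
        simpa [part] using this
    linarith
  · intro v i
    have h2 := congrFun (congrFun (congrArg Prod.snd hF) v) i
    simp only [F] at h2
    rw [Lo_sub]
    exact Ideal.Quotient.eq.mp h2
end
end UE

set_option linter.all false
namespace UE
open Finset Filter Topology NumberField IsDedekindDomain

section
variable {K : Type*} {n : ℕ} [Field K]

/-- square root of an absolute value -/
noncomputable def sqA (a : AbsoluteValue K ℝ) : AbsoluteValue K ℝ where
  toFun x := √(a x)
  map_mul' x y := by rw [map_mul, Real.sqrt_mul (a.nonneg x)]
  nonneg' x := Real.sqrt_nonneg _
  eq_zero' x := by rw [Real.sqrt_eq_zero (a.nonneg x)]; exact a.eq_zero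
  add_le' x y := by
    refine (Real.sqrt_le_sqrt (a.add_le x y)).trans ?_
    rw [Real.sqrt_le_left (by positivity), add_sq, Real.sq_sqrt (a.nonneg x), Real.sq_sqrt (a.nonneg y)]
    have : 0 ≤ √(a x) * √(a y) := by positivity
    linarith

lemma sqA_sq (a : AbsoluteValue K ℝ) (x : K) : sqA a x ^ 2 = a x := Real.sq_sqrt (a.nonneg x)

variable [NumberField K]

/-- normalised finite absolute value -/
noncomputable def fa (v : HeightOneSpectrum (𝓞 K)) : AbsoluteValue K ℝ := (FinitePlace.mk v).1

lemma fa_le_one (v : HeightOneSpectrum (𝓞 K)) (x : K) : fa v x ≤ 1 ↔ v.valuation K x ≤ 1 := by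
  have : fa v x = ‖FinitePlace.embedding v x‖ := rfl
  rw [this, FinitePlace.norm_embedding']
  have h := WithZeroMulInt.toNNReal_strictMono (HeightOneSpectrum.one_lt_absNorm_nnreal v)
  rw [← h.le_iff_le (a := v.valuation K x), map_one]
  norm_cast

lemma fa_int (v : HeightOneSpectrum (𝓞 K)) (x : 𝓞 K) : fa v (x : K) ≤ 1 := FinitePlace.norm_le_one K v x

lemma fa_lt (v : HeightOneSpectrum (𝓞 K)) (x : 𝓞 K) (h : x ∈ v.asIdeal) : fa v (x : K) < 1 := (FinitePlace.norm_lt_one_iff_mem K v x).mpr h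

lemma fa_one (v : HeightOneSpectrum (𝓞 K)) (x : 𝓞 K) (h : x ∉ v.asIdeal) : fa v (x : K) = 1 := (FinitePlace.norm_eq_one_iff_notMem K v x).mpr h

lemma fa_pow (v : HeightOneSpectrum (𝓞 K)) (x : 𝓞 K) (e : ℕ) (h : x ∈ v.asIdeal ^ e) :
    fa v (x : K) * (Ideal.absNorm v.asIdeal : ℝ) ^ e ≤ 1 := by
  have h0 : fa v (x : K) = ‖FinitePlace.embedding v (algebraMap (𝓞 K) K x)‖ := rfl
  rw [h0, FinitePlace.norm_embedding_int]
  have hm := WithZeroMulInt.toNNReal_strictMono (HeightOneSpectrum.one_lt_absNorm_nnreal v)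
  have h1 := hm.monotone ((v.intValuation_le_pow_iff_mem x e).mpr h)
  have hpos : (0:ℝ) < Ideal.absNorm v.asIdeal := by exact_mod_cast (zero_lt_one.trans (HeightOneSpectrum.one_lt_absNorm v))
  have h2 : ((WithZeroMulInt.toNNReal (HeightOneSpectrum.absNorm_ne_zero v) (WithZero.exp (-(e:ℤ))) : NNReal) : ℝ) = ((Ideal.absNorm v.asIdeal : ℝ) ^ e)⁻¹ := by
    rw [WithZeroMulInt.toNNReal_neg_apply _ WithZero.exp_ne_zero]
    have h9 : Multiplicative.toAdd (WithZero.unzero (WithZero.exp_ne_zero (a := -(e:ℤ)))) = -(e:ℤ) := rfl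
    rw [h9]; simp
  have h3 : ((WithZeroMulInt.toNNReal (HeightOneSpectrum.absNorm_ne_zero v) (v.intValuation x) : NNReal) : ℝ) ≤ ((Ideal.absNorm v.asIdeal : ℝ) ^ e)⁻¹ := by
    rw [← h2]; exact_mod_cast h1
  calc _ ≤ ((Ideal.absNorm v.asIdeal : ℝ) ^ e)⁻¹ * (Ideal.absNorm v.asIdeal : ℝ) ^ e := mul_le_mul_of_nonneg_right h3 (by positivity)
    _ = 1 := inv_mul_cancel₀ (by positivity)

/-- S-integers -/
noncomputable def OS (S : Finset (HeightOneSpectrum (𝓞 K))) : Subring K where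
  carrier := {x | ∀ v ∉ S, v.valuation K x ≤ 1}
  mul_mem' {a b} ha hb v hv := by rw [map_mul]; exact mul_le_one' (ha v hv) (hb v hv)
  one_mem' v _ := by rw [map_one]
  add_mem' {a b} ha hb v hv := (Valuation.map_add_le _ (ha v hv) (hb v hv))
  zero_mem' v _ := by rw [map_zero]; exact zero_le_one
  neg_mem' {a} ha v hv := by rw [Valuation.map_neg]; exact ha v hv

open Classical in
/-- the absolute values -/
noncomputable def avS (S : Finset (HeightOneSpectrum (𝓞 K))) : InfinitePlace K ⊕ S → AbsoluteValue K ℝ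
  | .inl w => if w.IsReal then sqA w.1 else w.1
  | .inr v => sqA (fa v.1)

lemma avS_inl (S : Finset (HeightOneSpectrum (𝓞 K))) (w : InfinitePlace K) (x : K) : avS S (.inl w) x ^ 2 = w x ^ w.mult := by
  by_cases h : w.IsReal
  · simp only [avS, if_pos h, sqA_sq, InfinitePlace.mult, pow_one]; rfl
  · simp only [avS, if_neg h, InfinitePlace.mult]; rfl

lemma avS_inr (S : Finset (HeightOneSpectrum (𝓞 K))) (v : S) (x : K) : avS S (.inr v) x ^ 2 = fa v.1 x := sqA_sq _ _

lemma OS_int (S : Finset (HeightOneSpectrum (𝓞 K))) (x : K) (hx : IsIntegral ℤ x) : x ∈ OS S := by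
  intro v _
  exact v.valuation_le_one (⟨x, hx⟩ : 𝓞 K)

lemma pfS (S : Finset (HeightOneSpectrum (𝓞 K))) (x : K) (hx : x ∈ OS S) (h0 : x ≠ 0) : 1 ≤ ∏ v, avS S v x := by
  classical
  have h1 := prod_abs_eq_one h0
  rw [← finprod_comp_equiv FinitePlace.equivHeightOneSpectrum.symm] at h1
  have hfin : (Function.mulSupport fun v => FinitePlace.equivHeightOneSpectrum.symm v x).Finite := by
    have := (FinitePlace.hasFiniteMulSupport h0)
    refine Set.Finite.subset (Set.Finite.preimage FinitePlace.equivHeightOneSpectrum.symm.injective.injOn this) ?_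
    intro v hv; exact hv
  have h2 : ∏ᶠ v, FinitePlace.equivHeightOneSpectrum.symm v x ≤ ∏ v : S, fa v.1 x := by
    rw [finprod_eq_prod_of_mulSupport_subset (s := hfin.toFinset ∪ S) _ (by intro v hv; simp; left; exact hv)]
    rw [← prod_sdiff (subset_union_right : S ⊆ hfin.toFinset ∪ S), ← Finset.prod_coe_sort S]
    have h3 : ∏ v ∈ (hfin.toFinset ∪ S) \ S, FinitePlace.equivHeightOneSpectrum.symm v x ≤ 1 := by
      refine prod_le_one (fun v _ => (fa v).nonneg x) fun v hv => ?_
      exact (fa_le_one v x).mpr (hx v (mem_sdiff.mp hv).2)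
    have h4 : (0:ℝ) ≤ ∏ v : S, FinitePlace.equivHeightOneSpectrum.symm v.1 x := prod_nonneg fun v _ => (fa v.1).nonneg x
    exact mul_le_of_le_one_left h4 h3
  have h5 : (∏ v, avS S v x) ^ 2 = (∏ w : InfinitePlace K, w x ^ w.mult) * ∏ v : S, fa v.1 x := by
    rw [← prod_pow, Fintype.prod_sum_type]
    simp only [avS_inl, avS_inr]
  have h6 : 1 ≤ (∏ v, avS S v x) ^ 2 := by
    rw [h5, ← h1]
    exact mul_le_mul_of_nonneg_left h2 (prod_nonneg fun w _ => pow_nonneg (w.1.nonneg _) _)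
  exact (one_le_sq_iff₀ (prod_nonneg fun v _ => (avS S v).nonneg _)).mp h6

variable (S : Finset (HeightOneSpectrum (𝓞 K))) (m : 𝓞 K) (hm0 : m ≠ 0) (hmS : ∀ v, v ∈ S ↔ m ∈ v.asIdeal)

include hmS in
lemma m_inv : ((m : K)⁻¹) ∈ OS S := by
  intro v hv
  rw [← fa_le_one, map_inv₀, fa_one v m (fun h => hv ((hmS v).mpr h)), inv_one]

include hmS hm0 in
lemma m_small (B : ℝ) : ∃ E : ℕ, ∀ v : S, B * avS S (.inr v) m ^ E ≤ 1 := by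
  have h : ∀ v : S, avS S (.inr v) m < 1 := fun v => by
    have := fa_lt v.1 m ((hmS v.1).mp v.2)
    rw [← avS_inr S v] at this
    exact (sq_lt_one_iff₀ ((avS S _).nonneg _)).mp this
  have h2 : ∀ᶠ E : ℕ in atTop, ∀ v : S, B * avS S (.inr v) m ^ E ≤ 1 := by
    rw [eventually_all]
    intro v
    have := (tendsto_pow_atTop_nhds_zero_of_lt_one ((avS S (.inr v)).nonneg _) (h v)).const_mul B
    rw [mul_zero] at this
    exact this.eventually_le_const zero_lt_one
  exact h2.exists

include hmS hm0 in
lemma hfinS (B : ℝ) : {x | x ∈ OS S ∧ ∀ v, avS S v x ≤ B}.Finite := by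
  wlog hB : 1 ≤ B generalizing B
  · exact (this 1 le_rfl).subset fun x hx => ⟨hx.1, fun v => (hx.2 v).trans (not_le.mp hB).le⟩
  have hmK : (m : K) ≠ 0 := RingOfIntegers.coe_ne_zero_iff.mpr hm0
  obtain ⟨E, hE⟩ := m_small S m hm0 hmS B
  obtain ⟨D, hD1, hD⟩ := fin_bd (fun w : InfinitePlace K => w ((m : K) ^ E) * B ^ 2)
  refine Set.Finite.of_finite_image (f := fun x => (m : K) ^ E * x) ((Embeddings.finite_of_norm_le K ℂ D).subset ?_)
    (mul_right_injective₀ (pow_ne_zero E hmK)).injOn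
  rintro _ ⟨x, ⟨hxO, hx⟩, rfl⟩
  constructor
  · obtain ⟨y, hy⟩ := HeightOneSpectrum.mem_integers_of_valuation_le_one (R := 𝓞 K) K ((m : K) ^ E * x) (fun v => by
      rw [← fa_le_one]
      by_cases hv : v ∈ S
      · have h1 := hE ⟨v, hv⟩
        rw [← avS_inr S ⟨v, hv⟩]
        rw [sq_le_one_iff₀ ((avS S _).nonneg _), map_mul, map_pow, mul_comm]
        exact (mul_le_mul_of_nonneg_right (hx _) (by positivity)).trans h1
      · rw [map_mul, map_pow, fa_one v m (fun h => hv ((hmS v).mpr h)), one_pow, one_mul, fa_le_one]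
        exact hxO v hv)
    simp only [← hy]
    exact RingOfIntegers.isIntegral_coe y
  · intro φ
    have h1 := hD (InfinitePlace.mk φ)
    rw [map_mul, norm_mul]
    refine le_trans ?_ h1
    rw [InfinitePlace.apply]
    refine mul_le_mul_of_nonneg_left ?_ (norm_nonneg _)
    rw [← InfinitePlace.apply]
    have h2 := avS_inl S (InfinitePlace.mk φ) x
    have h3 : avS S (.inl (InfinitePlace.mk φ)) x ^ 2 ≤ B ^ 2 := pow_le_pow_left₀ ((avS S _).nonneg _) (hx _) 2
    rw [h2] at h3
    by_contra hc
    push Not at hc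
    have h4 : 1 ≤ (InfinitePlace.mk φ) x := by nlinarith
    have h5 := le_self_pow₀ h4 (InfinitePlace.mk φ).mult_pos.ne'
    linarith

set_option maxHeartbeats 1000000 in
include hmS hm0 in
lemma hM1S (hn : 0 < n) (A : InfinitePlace K ⊕ S → Matrix (Fin n) (Fin n) ℤ) :
      ∃ C : ℝ, 1 ≤ C ∧ ∀ t : InfinitePlace K ⊕ S → Fin n → ℝ, (∀ v i, 0 < t v i) →
      ∃ x : Fin n → K, (∀ i, x i ∈ OS S) ∧ x ≠ 0 ∧ HH (avS S) A t x ^ n ≤ C * ∏ v, ∏ i, t v i := by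
  classical
  obtain ⟨c, hc1, hc⟩ := pigeon S A
  have hmK : (m : K) ≠ 0 := RingOfIntegers.coe_ne_zero_iff.mpr hm0
  let b : S → ℝ := fun v => √(Ideal.absNorm v.1.asIdeal : ℝ)
  have hb2 : ∀ v, b v ^ 2 = (Ideal.absNorm v.1.asIdeal : ℝ) := fun v => Real.sq_sqrt (Nat.cast_nonneg _)
  have hb1 : ∀ v, 1 < b v := fun v => by
    rw [← one_lt_sq_iff₀ (Real.sqrt_nonneg _), hb2]; exact_mod_cast HeightOneSpectrum.one_lt_absNorm v.1
  have hb0 : ∀ v, 0 < b v := fun v => by linarith [hb1 v]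
  clear_value b
  have hbp : 1 ≤ ∏ v, b v := le_trans (by simp) (prod_le_prod (s := univ) (f := fun _ => (1:ℝ)) (fun _ _ => zero_le_one) fun v _ => (hb1 v).le)
  set W := Fintype.card (InfinitePlace K) with hW
  have hWpos : 0 < W := Fintype.card_pos
  refine ⟨2 ^ (W * n) * (∏ v, b v) ^ n * (2 * c), ?_, fun t ht => ?_⟩
  · have h1 : (1:ℝ) ≤ 2 ^ (W * n) := one_le_pow₀ one_le_two
    have h2 : 1 ≤ (∏ v, b v) ^ n := one_le_pow₀ hbp
    have h3 := one_le_mul_of_one_le_of_one_le h1 h2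
    exact one_le_mul_of_one_le_of_one_le h3 (by linarith)
  obtain ⟨B, hB1, hB⟩ := fin_bd (fun p : S × Fin n => (t (.inr p.1) p.2)⁻¹)
  obtain ⟨E, hE⟩ := m_small S m hm0 hmS B
  have hmp : ∀ v, 0 < avS S v m := fun v => (avS S v).pos hmK
  obtain ⟨t', ht'⟩ : ∃ t' : InfinitePlace K ⊕ S → Fin n → ℝ, ∀ v i, t' v i = t v i * (avS S v m ^ E)⁻¹ := ⟨_, fun _ _ => rfl⟩
  have ht'0 : ∀ v i, 0 < t' v i := fun v i => by rw [ht']; exact mul_pos (ht v i) (inv_pos.mpr (pow_pos (hmp v) E))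
  have ht'1 : ∀ (v : S) i, 1 ≤ t' (.inr v) i := fun v i => by
    have h1 := hB (v, i)
    have h2 := hE v
    have h3 := pow_pos (hmp (.inr v)) E
    have h4 := ht (.inr v) i
    rw [ht', ← div_eq_mul_inv, one_le_div h3]
    simp only at h1
    have h5 : (t (.inr v) i)⁻¹ * avS S (.inr v) m ^ E ≤ 1 := (mul_le_mul_of_nonneg_right h1 h3.le).trans h2
    rwa [inv_mul_le_iff₀ h4, mul_one] at h5
  have hPP : ∏ v, ∏ i, t' v i = ∏ v, ∏ i, t v i := by
    simp only [ht', prod_mul_distrib]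
    have := unit_prod (pfS S) (OS_int S m m.isIntegral_coe) (m_inv S m hmS) hmK
    simp only [prod_const, prod_inv_distrib, prod_pow, this, one_pow, inv_one, mul_one]
  have hex : ∀ (v : S) i, ∃ e : ℕ, b v ^ e ≤ t' (.inr v) i ∧ t' (.inr v) i < b v ^ (e+1) := fun v i =>
    exists_nat_pow_near (ht'1 v i) (hb1 v)
  choose e he1 he2 using hex
  set P := ∏ v, ∏ i, t v i with hP
  have hP0 : 0 < P := prod_pos fun v _ => prod_pos fun i _ => ht v i
  obtain ⟨R, hR0, hR⟩ : ∃ R : ℝ, 0 < R ∧ R ^ (W * n) = 2 * c * P :=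
    ⟨(2 * c * P) ^ (((W * n : ℕ) : ℝ)⁻¹), Real.rpow_pos_of_pos (by positivity) _, Real.rpow_inv_natCast_pow (by positivity) (by positivity)⟩
  obtain ⟨r, hr0, hr⟩ : ∃ r : InfinitePlace K → Fin n → ℝ, (∀ w i, 0 < r w i) ∧ ∀ w i, r w i ^ w.mult = (R / t' (.inl w) i) ^ 2 := by
    have : ∀ (w : InfinitePlace K) i, ∃ r : ℝ, 0 < r ∧ r ^ w.mult = (R / t' (.inl w) i) ^ 2 := fun w i => by
      have := div_pos hR0 (ht'0 (.inl w) i)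
      by_cases h : w.IsReal
      · exact ⟨(R / t' (.inl w) i) ^ 2, by positivity, by simp [InfinitePlace.mult, h]⟩
      · exact ⟨(R / t' (.inl w) i), by positivity, by simp [InfinitePlace.mult, h]⟩
    choose r hr using this
    exact ⟨r, fun w i => (hr w i).1, fun w i => (hr w i).2⟩
  obtain ⟨x, hx0, hxi, hxf⟩ := hc e r hr0 (by
    have h1 : ∏ v : S, ∏ i, ((Ideal.absNorm v.1.asIdeal : ℝ) ^ e v i) ≤ (∏ v : S, ∏ i, t' (.inr v) i) ^ 2 := by
      simp only [← prod_pow]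
      refine prod_le_prod (fun v _ => prod_nonneg fun i _ => by positivity) fun v _ =>
        prod_le_prod (fun i _ => by positivity) fun i _ => ?_
      rw [← hb2, ← pow_mul, mul_comm, pow_mul]
      exact pow_le_pow_left₀ (pow_nonneg (hb0 v).le _) (he1 v i) 2
    have h2 : ∏ w, ∏ i, r w i ^ w.mult = (2 * c * P) ^ 2 / (∏ w : InfinitePlace K, ∏ i, t' (.inl w) i) ^ 2 := by
      simp only [hr, div_pow, prod_div_distrib, prod_pow, prod_const, card_univ, Fintype.card_fin]
      rw [← hW, ← hR]; ring
    have h3 : P = (∏ w : InfinitePlace K, ∏ i, t' (.inl w) i) * ∏ v : S, ∏ i, t' (.inr v) i := by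
      rw [← hPP, Fintype.prod_sum_type]
    have h4 : 0 < ∏ w : InfinitePlace K, ∏ i, t' (.inl w) i := prod_pos fun v _ => prod_pos fun i _ => ht'0 _ i
    have h5 : 0 < ∏ v : S, ∏ i, t' (.inr v) i := prod_pos fun v _ => prod_pos fun i _ => ht'0 _ i
    rw [h2, h3]
    refine lt_of_le_of_lt (mul_le_mul_of_nonneg_left h1 (by linarith)) ?_
    rw [lt_div_iff₀ (by positivity)]
    have h6 : 0 < (∏ v : S, ∏ i, t' (.inr v) i) ^ 2 * (∏ w : InfinitePlace K, ∏ i, t' (.inl w) i) ^ 2 := by positivity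
    nlinarith)
  have hfo : ∀ v i, t v i * avS S v (fo A v i (fun k => ((m:K) ^ E)⁻¹ * (x k : K))) = t' v i * avS S v ((Lo (A v) i x : 𝓞 K) : K) := by
    intro v i
    have : fo A v i (fun k => ((m:K) ^ E)⁻¹ * (x k : K)) = ((m:K) ^ E)⁻¹ * ((Lo (A v) i x : 𝓞 K) : K) := by
      simp only [fo, Lo, map_sum, map_mul, map_intCast, mul_sum]
      refine sum_congr rfl fun k _ => by ring
    rw [this, map_mul, map_inv₀, map_pow, ht', mul_assoc]
  refine ⟨fun k => ((m:K) ^ E)⁻¹ * (x k : K), fun k => ?_, ?_, ?_⟩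
  · refine (OS S).mul_mem ?_ (OS_int S _ (x k).isIntegral_coe)
    rw [← inv_pow]; exact (OS S).pow_mem (m_inv S m hmS) E
  · intro h
    apply hx0
    funext k
    have h1 := congrFun h k
    simp only [Pi.zero_apply, mul_eq_zero, inv_eq_zero] at h1
    exact RingOfIntegers.coe_eq_zero_iff.mp (h1.resolve_left (pow_ne_zero E hmK))
  · have hinl : ∀ w, Nv (avS S) A t (.inl w) (fun k => ((m:K) ^ E)⁻¹ * (x k : K)) ≤ 2 * R := fun w => by
      refine Nv_le _ _ ht (by positivity) fun i => ?_
      rw [hfo]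
      have h1 : avS S (.inl w) ((Lo (A (.inl w)) i x : 𝓞 K) : K) ^ 2 ≤ (2 * R / t' (.inl w) i) ^ 2 := by
        rw [avS_inl]
        refine (pow_le_pow_left₀ (w.1.nonneg _) (hxi w i) _).trans ?_
        rw [mul_pow, hr, mul_div_assoc, mul_pow]
        refine mul_le_mul_of_nonneg_right ?_ (by positivity)
        refine pow_le_pow_right₀ one_le_two ?_
        rw [InfinitePlace.mult]; split_ifs <;> norm_num
      have h2 := (sq_le_sq₀ ((avS S _).nonneg _) (div_nonneg (by positivity) (ht'0 _ _).le)).mp h1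
      rwa [le_div_iff₀ (ht'0 _ _), mul_comm] at h2
    have hinr : ∀ v, Nv (avS S) A t (.inr v) (fun k => ((m:K) ^ E)⁻¹ * (x k : K)) ≤ b v := fun v => by
      refine Nv_le _ _ ht (hb0 v).le fun i => ?_
      rw [hfo]
      have h1 := fa_pow v.1 _ _ (hxf v i)
      rw [← avS_inr S, ← hb2, ← pow_mul, mul_comm 2, pow_mul, ← mul_pow, sq_le_one_iff₀ (mul_nonneg ((avS S _).nonneg _) (pow_nonneg (hb0 v).le _))] at h1
      have h2 := he2 v i
      rw [pow_succ] at h2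
      calc _ ≤ (b v ^ e v i * b v) * avS S (.inr v) ((Lo (A (.inr v)) i x : 𝓞 K) : K) := mul_le_mul_of_nonneg_right h2.le ((avS S _).nonneg _)
        _ = b v * (avS S (.inr v) ((Lo (A (.inr v)) i x : 𝓞 K) : K) * b v ^ e v i) := by ring
        _ ≤ b v * 1 := mul_le_mul_of_nonneg_left h1 (hb0 v).le
        _ = _ := mul_one _
    have hH : HH (avS S) A t (fun k => ((m:K) ^ E)⁻¹ * (x k : K)) ≤ (2 * R) ^ W * ∏ v, b v := by
      rw [HH, Fintype.prod_sum_type]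
      refine mul_le_mul ?_ (prod_le_prod (fun _ _ => Nv_nonneg _ _ _ _ _) fun v _ => hinr v) (prod_nonneg fun _ _ => Nv_nonneg _ _ _ _ _) (by positivity)
      refine (prod_le_prod (fun _ _ => Nv_nonneg _ _ _ _ _) fun w _ => hinl w).trans ?_
      rw [prod_const, card_univ]
    refine (pow_le_pow_left₀ (HH_nonneg _ _ _ _) hH n).trans (le_of_eq ?_)
    rw [mul_pow, ← pow_mul, mul_pow, hR]; ring

/-- unit equations over number fields -/
theorem unit_nf (Γ : Subgroup Kˣ) (hΓ : Γ.FG) (hn : 0 < n) (u : ℕ → Fin (n+1) → Kˣ) (hu : ∀ s i, u s i ∈ Γ)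
    (hu1 : ∀ s, u s 0 = 1) (hsum : ∀ s, ∑ i, (u s i : K) = 0) (hcof : ∀ a, ∀ᶠ s in atTop, u s ≠ a) :
    ∃ ℓ : Fin n → K, ℓ ≠ 0 ∧ ∃ᶠ s in atTop, ∑ i, ℓ i * (u s i.succ : K) = 0 := by
  classical
  obtain ⟨F, hF⟩ := hΓ
  have hnd : ∀ g : Kˣ, ∃ a b : 𝓞 K, a ≠ 0 ∧ b ≠ 0 ∧ (g : K) = a / b := by
    intro g
    obtain ⟨a, b, hb, h⟩ := IsFractionRing.div_surjective (𝓞 K) (g : K)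
    refine ⟨a, b, ?_, nonZeroDivisors.ne_zero hb, h.symm⟩
    rintro rfl
    rw [map_zero, zero_div] at h
    exact g.ne_zero h.symm
  choose num den hnum hden hg using hnd
  let m : 𝓞 K := ∏ g ∈ F, num g * den g
  have hm0 : m ≠ 0 := prod_ne_zero_iff.mpr fun g _ => mul_ne_zero (hnum g) (hden g)
  have hfinS : {v : HeightOneSpectrum (𝓞 K) | m ∈ v.asIdeal}.Finite := by
    have := Ideal.finite_factors (I := Ideal.span {m}) (by simpa using hm0)
    simpa only [Ideal.dvd_span_singleton] using this
  let S := hfinS.toFinset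
  have hmS : ∀ v, v ∈ S ↔ m ∈ v.asIdeal := fun v => by simp [S]
  have hgen : ∀ g ∈ Γ, ∀ v ∉ S, fa v (g : K) = 1 := by
    intro g hg'
    rw [← hF] at hg'
    induction hg' using Subgroup.closure_induction with
    | mem g h =>
      intro v hv
      rw [hmS] at hv
      have hd : num g * den g ∣ m := dvd_prod_of_mem _ h
      have h1 : num g ∉ v.asIdeal := fun h => hv (Ideal.mem_of_dvd _ hd (Ideal.mul_mem_right _ _ h))
      have h2 : den g ∉ v.asIdeal := fun h => hv (Ideal.mem_of_dvd _ hd (Ideal.mul_mem_left _ _ h))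
      rw [hg, map_div₀, fa_one v _ h1, fa_one v _ h2, div_one]
    | one => intro v _; simp
    | mul a b _ _ iha ihb => intro v hv; rw [Units.val_mul, map_mul, iha v hv, ihb v hv, mul_one]
    | inv a _ iha => intro v hv; rw [Units.val_inv_eq_inv_val, map_inv₀, iha v hv, inv_one]
  have hO : ∀ g ∈ Γ, (g : K) ∈ OS S := fun g h v hv => (fa_le_one v _).mp (hgen g h v hv).le
  refine unit_abs (av := avS S) (OS_int S) (pfS S) (.inl (Classical.arbitrary _)) hn (fun A _ => hM1S S m hm0 hmS hn A) (UE.hfinS S m hm0 hmS)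
    (fun s i => (u s i : K)) (fun s i => hO _ (hu s i)) (fun s i => ?_) (fun s i => (u s i).ne_zero) (fun s => by rw [hu1]; rfl) hsum ?_
  · rw [← Units.val_inv_eq_inv_val]; exact hO _ (Γ.inv_mem (hu s i))
  · intro a
    by_cases h : ∃ s, (fun i => (u s i : K)) = a
    · obtain ⟨s0, rfl⟩ := h
      filter_upwards [hcof (u s0)] with s hs h
      exact hs (funext fun i => Units.ext (congrFun h i))
    · exact Eventually.of_forall fun s hs => h ⟨s, hs⟩
end
end UE

set_option linter.all false
namespace UE
open Finset Filter Topology NumberField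

/-- pairs with constant ratio, over number fields -/
theorem pair_nf {K : Type*} [Field K] [NumberField K] (n : ℕ) : ∀ (Γ : Subgroup Kˣ) (hΓ : Γ.FG) (hn : 0 < n)
    (u : ℕ → Fin n → Kˣ) (hu : ∀ s i, u s i ∈ Γ) (hsum : ∀ s, ∑ i, (u s i : K) = 0),
    ∃ i j, i ≠ j ∧ ∃ c : Kˣ, ∃ᶠ s in atTop, u s i = c * u s j := by
  classical
  induction n using Nat.strong_induction_on with
  | _ n ih =>
  intro Γ hΓ hn u hu hsum
  obtain ⟨k, rfl⟩ : ∃ k, n = k + 1 := ⟨n - 1, by omega⟩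
  rcases Nat.eq_zero_or_pos k with rfl | hk
  · exact absurd (by simpa using hsum 0) (u 0 0).ne_zero
  by_cases hcof : ∀ a, ∀ᶠ s in atTop, (fun i => u s i / u s 0) ≠ a
  · obtain ⟨ℓ, hℓ, hf⟩ := unit_nf Γ hΓ hk (fun s i => u s i / u s 0) (fun s i => Γ.div_mem (hu s i) (hu s 0)) (fun s => div_self' _)
      (fun s => by
        simp only [Units.val_div_eq_div_val, ← sum_div, hsum, zero_div]) hcof
    obtain ⟨φ, hφ, hφs⟩ := extraction_of_frequently_atTop hf
    let T := {i : Fin k // ℓ i ≠ 0}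
    let e := (Fintype.equivFin T).symm
    have hTk : Fintype.card T < k + 1 := by
      have := Fintype.card_subtype_le (fun i : Fin k => ℓ i ≠ 0)
      rw [Fintype.card_fin] at this
      exact Nat.lt_succ_of_le this
    have hT0 : 0 < Fintype.card T := by
      obtain ⟨i, hi⟩ := Function.ne_iff.mp hℓ
      exact Fintype.card_pos_iff.mpr ⟨⟨i, hi⟩⟩
    let g : T → Kˣ := fun i => Units.mk0 (ℓ i.1) i.2
    have hΓ' : (Γ ⊔ Subgroup.closure (Set.range g)).FG := by
      refine Subgroup.FG.sup hΓ ?_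
      exact (Subgroup.fg_iff _).mpr ⟨_, rfl, Set.finite_range g⟩
    obtain ⟨i, j, hij, c, hc⟩ := ih _ hTk (Γ ⊔ Subgroup.closure (Set.range g)) hΓ' hT0 (fun s i => g (e i) * u (φ s) (e i).1.succ)
      (fun s i => Subgroup.mul_mem _ (Subgroup.mem_sup_right (Subgroup.subset_closure ⟨_, rfl⟩)) (Subgroup.mem_sup_left (hu _ _))) (fun s => by
        have h1 := hφs s
        simp only [Units.val_div_eq_div_val, mul_div_assoc', ← sum_div] at h1
        have h2 : ∑ i, ℓ i * (u (φ s) i.succ : K) = 0 := by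
          rcases div_eq_zero_iff.mp h1 with h | h
          · exact h
          · exact absurd h (u (φ s) 0).ne_zero
        rw [e.sum_comp (fun i : T => ((g i * u (φ s) i.1.succ : Kˣ) : K))]
        refine Eq.trans ?_ h2
        rw [← Finset.sum_filter_of_ne (s := univ) (p := fun i => ℓ i ≠ 0) (fun i _ h => left_ne_zero_of_mul h)]
        rw [Finset.sum_subtype (p := fun i => ℓ i ≠ 0) (Finset.univ.filter fun i => ℓ i ≠ 0) (by simp) (fun i => ℓ i * (u (φ s) i.succ : K))]
        rfl)
    refine ⟨(e i).1.succ, (e j).1.succ, fun h => hij (e.injective (Subtype.ext (Fin.succ_injective _ h))), (g (e i))⁻¹ * c * g (e j), ?_⟩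
    refine hφ.tendsto_atTop.frequently (hc.mono fun s hs => ?_)
    rw [mul_assoc, mul_assoc, ← hs, inv_mul_cancel_left]
  · push Not at hcof
    obtain ⟨a, ha⟩ := hcof
    refine ⟨Fin.last k, 0, by simp [Fin.ext_iff]; omega, a (Fin.last k), ?_⟩
    refine Frequently.mono (p := fun s => (fun i => u s i / u s 0) = a) ?_ fun s hs => ?_
    · exact ha
    · rw [← congrFun hs (Fin.last k)]; simp
end UE

set_option linter.all false
namespace UE
open Finset Filter Topology NumberField

theorem spec_alg (A : Type*) [CommRing A] [IsDomain A] [Algebra ℚ A] [Algebra.FiniteType ℚ A] :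
    ∃ D : ℕ, ∀ r : A, r ≠ 0 → ∃ Q : Ideal A, Q.IsMaximal ∧ r ∉ Q ∧ Module.Finite ℚ (A ⧸ Q) ∧ Module.finrank ℚ (A ⧸ Q) ≤ D := by
  classical
  obtain ⟨s, g, hg, hgf⟩ := exists_finite_inj_algHom_of_fg ℚ A
  letI : Algebra (MvPolynomial (Fin s) ℚ) A := g.toRingHom.toAlgebra
  haveI : Module.Finite (MvPolynomial (Fin s) ℚ) A := hgf
  obtain ⟨S, hS⟩ := Module.Finite.fg_top (R := MvPolynomial (Fin s) ℚ) (M := A)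
  have hmap : ∀ b, algebraMap (MvPolynomial (Fin s) ℚ) A b = g b := fun b => rfl
  haveI : Algebra.IsIntegral (MvPolynomial (Fin s) ℚ) A := Algebra.IsIntegral.of_finite _ _
  refine ⟨S.card, fun r hr => ?_⟩
  have h1 := Ideal.comap_ne_bot_of_integral_mem hr (Ideal.mem_span_singleton_self r) (Algebra.IsIntegral.isIntegral (R := MvPolynomial (Fin s) ℚ) r)
  obtain ⟨b, hb, hb0⟩ := Submodule.exists_mem_ne_zero_of_ne_bot h1
  obtain ⟨N, hN⟩ : ∃ N : Fin s → ℚ, MvPolynomial.eval N b ≠ 0 := by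
    by_contra! h
    exact hb0 (MvPolynomial.funext fun x => by simpa using h x)
  have hsurj : Function.Surjective (MvPolynomial.eval N) := fun q => ⟨MvPolynomial.C q, by simp⟩
  have hPm : (RingHom.ker (MvPolynomial.eval N)).IsMaximal := RingHom.ker_isMaximal_of_surjective _ hsurj
  obtain ⟨Q, hQm, hQ⟩ := Ideal.exists_ideal_over_maximal_of_isIntegral (S := A) (RingHom.ker (MvPolynomial.eval N)) (by
    rw [(RingHom.injective_iff_ker_eq_bot _).mp (show Function.Injective (algebraMap (MvPolynomial (Fin s) ℚ) A) from hg)]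
    exact bot_le)
  have hmem : ∀ p, MvPolynomial.eval N p = 0 ↔ g p ∈ Q := fun p => by
    rw [← RingHom.mem_ker, ← hQ, Ideal.mem_comap, hmap]
  have hspan : Submodule.span ℚ ((S.image (Ideal.Quotient.mk Q) : Finset (A ⧸ Q)) : Set (A ⧸ Q)) = ⊤ := by
    rw [eq_top_iff]
    rintro x -
    obtain ⟨a, rfl⟩ := Ideal.Quotient.mk_surjective x
    have ha : a ∈ Submodule.span (MvPolynomial (Fin s) ℚ) (S : Set A) := hS ▸ Submodule.mem_top
    induction ha using Submodule.span_induction with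
    | mem x hx => exact Submodule.subset_span (by simpa using ⟨x, hx, rfl⟩)
    | zero => simp
    | add x y _ _ hx hy => rw [map_add]; exact Submodule.add_mem _ hx hy
    | smul c x _ hx =>
      have : Ideal.Quotient.mk Q (c • x) = (MvPolynomial.eval N c) • Ideal.Quotient.mk Q x := by
        have h3 : g c - algebraMap ℚ A (MvPolynomial.eval N c) ∈ Q := by
          have := (hmem (c - MvPolynomial.C (MvPolynomial.eval N c))).mp (by simp)
          rw [map_sub] at this
          convert this using 2
          exact (g.commutes _).symm
        rw [Algebra.smul_def, hmap, Algebra.smul_def, map_mul]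
        congr 1
        exact Ideal.Quotient.eq.mpr h3
      rw [this]
      exact Submodule.smul_mem _ _ hx
  refine ⟨Q, hQm, fun h => hN ((hmem b).mpr ?_), ⟨⟨_, hspan⟩⟩, ?_⟩
  · obtain ⟨a, ha⟩ := Ideal.mem_span_singleton.mp (Ideal.mem_comap.mp hb)
    rw [← hmap, ha]
    exact Q.mul_mem_right _ h
  · have := finrank_span_finset_le_card (R := ℚ) (S.image (Ideal.Quotient.mk Q))
    rw [Set.finrank, hspan, finrank_top] at this
    exact this.trans Finset.card_image_le

theorem nf_of (L : Type*) [Field L] [CharZero L] [i1 : Module ℚ L] [h : Module.Finite ℚ L] : NumberField L := by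
  obtain rfl : i1 = DivisionRing.toRatAlgebra.toModule := Subsingleton.elim _ _
  exact { to_charZero := inferInstance, to_finiteDimensional := h }

theorem tors_bd (L : Type*) [Field L] [CharZero L] [i1 : Module ℚ L] [Module.Finite ℚ L] (D : ℕ) (hD : Module.finrank ℚ L ≤ D)
    (x : L) (m : ℕ) (hm : 0 < m) (hx : x ^ m = 1) : x ^ (2 * D).factorial = 1 := by
  obtain rfl : i1 = DivisionRing.toRatAlgebra.toModule := Subsingleton.elim _ _
  have hq : 0 < orderOf x := orderOf_pos_iff.mpr (isOfFinOrder_iff_pow_eq_one.mpr ⟨m, hm, hx⟩)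
  have h1 : (orderOf x).totient ≤ D := by
    rw [← Polynomial.natDegree_cyclotomic (orderOf x) ℚ, Polynomial.cyclotomic_eq_minpoly_rat (IsPrimitiveRoot.orderOf x) hq]
    exact (minpoly.natDegree_le x).trans hD
  refine orderOf_dvd_iff_pow_eq_one.mp ((Nat.dvd_iff_prime_pow_dvd_dvd _ _).mpr fun p k hp hk => ?_)
  rcases k with _ | k
  · simp
  have h2 : (p ^ (k+1)).totient ≤ D := (Nat.le_of_dvd (Nat.totient_pos.mpr hq) (Nat.totient_dvd_of_dvd hk)).trans h1
  rw [Nat.totient_prime_pow_succ hp] at h2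
  refine Nat.dvd_factorial (pow_pos hp.pos _) ?_
  have h3 : p ≤ 2 * (p - 1) := by have := hp.two_le; omega
  calc p ^ (k+1) = p ^ k * p := pow_succ _ _
    _ ≤ p ^ k * (2 * (p - 1)) := Nat.mul_le_mul_left _ h3
    _ = 2 * (p ^ k * (p - 1)) := by ring
    _ ≤ _ := Nat.mul_le_mul_left _ h2

universe uu
theorem specialize {G : Type uu} [Field G] [CharZero G] (Γ : Subgroup Gˣ) (hΓ : Γ.FG) (F : Finset Γ)
    (hF : ∀ γ ∈ F, ∀ m : ℕ, 0 < m → γ ^ m ≠ 1) :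
    ∃ (L : Type uu) (_ : Field L) (_ : NumberField L) (θ : Γ →* Lˣ),
      (∀ (n : ℕ) (u : Fin n → Γ), ∑ i, ((u i : Gˣ) : G) = 0 → ∑ i, (θ (u i) : L) = 0) ∧
      ∀ γ ∈ F, ∀ m : ℕ, 0 < m → θ γ ^ m ≠ 1 := by
  classical
  obtain ⟨S, hS⟩ := hΓ
  let B : Set G := ((fun x : Gˣ => (x : G)) '' S) ∪ ((fun x : Gˣ => ((x⁻¹ : Gˣ) : G)) '' S)
  have hB : B.Finite := (S.finite_toSet.image _).union (S.finite_toSet.image _)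
  let A := Algebra.adjoin ℚ B
  have hΓA : ∀ γ ∈ Γ, (γ : G) ∈ A := by
    intro γ hγ
    rw [← hS] at hγ
    have : (γ : G) ∈ A ∧ ((γ⁻¹ : Gˣ) : G) ∈ A := by
      induction hγ using Subgroup.closure_induction with
      | mem x hx => exact ⟨Algebra.subset_adjoin (Or.inl ⟨x, hx, rfl⟩), Algebra.subset_adjoin (Or.inr ⟨x, hx, rfl⟩)⟩
      | one => simp [A.one_mem]
      | mul x y _ _ hx hy =>
        rw [mul_inv, Units.val_mul, Units.val_mul]
        exact ⟨A.mul_mem hx.1 hy.1, A.mul_mem hx.2 hy.2⟩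
      | inv x _ hx => rw [inv_inv]; exact ⟨hx.2, hx.1⟩
    exact this.1
  haveI : Algebra.FiniteType ℚ A := (Subalgebra.fg_iff_finiteType _).mp (Subalgebra.fg_def.mpr ⟨B, hB, rfl⟩)
  obtain ⟨D, hD⟩ := spec_alg A
  let ι : Γ →* A := 
    { toFun := fun γ => ⟨((γ : Gˣ) : G), hΓA _ γ.2⟩
      map_one' := by ext; simp
      map_mul' := fun x y => by ext; simp }
  have hιv : ∀ γ, ((ι γ : A) : G) = ((γ : Gˣ) : G) := fun γ => rfl
  obtain ⟨Q, hQm, hr, hfin, hfr⟩ := hD (∏ γ ∈ F, (ι γ ^ (2 * D).factorial - 1)) (by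
    rw [Finset.prod_ne_zero_iff]
    intro γ hγ h
    refine hF γ hγ _ (Nat.factorial_pos (2 * D)) ?_
    rw [sub_eq_zero, ← map_pow] at h
    have h2 := congrArg (fun a : A => (a : G)) h
    simp only [hιv] at h2
    ext
    simpa using h2)
  letI : Field (A ⧸ Q) := Ideal.Quotient.field Q
  haveI : CharZero (A ⧸ Q) := algebraRat.charZero _
  have hθ : ∀ γ, (((Units.map ((Ideal.Quotient.mk Q) : A →* A ⧸ Q)).comp ι.toHomUnits γ : (A ⧸ Q)ˣ) : A ⧸ Q) = Ideal.Quotient.mk Q (ι γ) := fun γ => rfl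
  refine ⟨A ⧸ Q, inferInstance, ?_, (Units.map ((Ideal.Quotient.mk Q) : A →* A ⧸ Q)).comp ι.toHomUnits, ?_, ?_⟩
  · exact @nf_of (A ⧸ Q) _ _ _ hfin
  · intro n u hu
    simp only [hθ]
    rw [← map_sum]
    convert map_zero (Ideal.Quotient.mk Q)
    ext
    simpa [hιv] using hu
  · intro γ hγ m hm h
    apply hr
    rw [← Ideal.Quotient.eq_zero_iff_mem, map_prod]
    refine Finset.prod_eq_zero hγ ?_
    rw [map_sub, map_pow, map_one, sub_eq_zero]
    have h2 := congrArg (fun a : (A ⧸ Q)ˣ => (a : A ⧸ Q)) h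
    simp only [Units.val_pow_eq_pow_val, hθ, Units.val_one] at h2
    exact @tors_bd (A ⧸ Q) _ _ _ hfin D hfr _ m hm h2
end UE

set_option linter.all false
namespace UE
open Finset Filter Topology NumberField

theorem finrank_drop {M : Type*} [AddCommGroup M] [Module.Finite ℤ M] (A B : Submodule ℤ M) (hAB : A ≤ B)
    (γ : M) (hγ : γ ∈ B) (h : ∀ a : ℤ, a ≠ 0 → a • γ ∉ A) : Module.finrank ℤ A < Module.finrank ℤ B := by
  haveI : Module.Finite ℤ B := Module.Finite.of_fg (IsNoetherian.noetherian B)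
  have h1 := Submodule.finrank_quotient_add_finrank (A.comap B.subtype)
  rw [(Submodule.comapSubtypeEquivOfLe hAB).finrank_eq] at h1
  have h2 : Module.finrank ℤ (B ⧸ A.comap B.subtype) ≠ 0 := by
    intro h0
    obtain ⟨a, ha, hx⟩ := Module.finrank_eq_zero_iff.mp h0 (Submodule.Quotient.mk ⟨γ, hγ⟩)
    rw [← Submodule.Quotient.mk_smul, Submodule.Quotient.mk_eq_zero] at hx
    exact h a ha hx
  omega

theorem pair_aux {G : Type*} [Field G] [CharZero G] (Γ : Subgroup Gˣ) (hΓ : Γ.FG) {n : ℕ} (hn : 0 < n) (N : ℕ) :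
    ∀ (u : ℕ → Fin n → Γ) (hsum : ∀ s, ∑ i, ((u s i : Gˣ) : G) = 0)
    (H : Fin n → Fin n → Submodule ℤ (Additive Γ))
    (hH : ∀ i j s s', Additive.ofMul (u s i / u s j) - Additive.ofMul (u s' i / u s' j) ∈ H i j)
    (hN : ∑ p : Fin n × Fin n, Module.finrank ℤ (H p.1 p.2) = N),
    ∃ i j, i ≠ j ∧ ∃ c : Γ, ∃ᶠ s in atTop, u s i = c * u s j := by
  classical
  haveI : Group.FG Γ := (Group.fg_iff_subgroup_fg Γ).mpr hΓ
  haveI : Module.Finite ℤ (Additive Γ) := Module.Finite.iff_addGroup_fg.mpr inferInstance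
  induction N using Nat.strong_induction_on with
  | _ N ih =>
  intro u hsum H hH hN
  by_cases h0 : ∃ i j, i ≠ j ∧ Module.finrank ℤ (H i j) = 0
  · obtain ⟨i, j, hij, h0⟩ := h0
    haveI : Module.Finite ℤ (H i j) := Module.Finite.of_fg (IsNoetherian.noetherian _)
    haveI : Finite (H i j) := Module.finite_of_fg_torsion _ (fun {x} => by
      obtain ⟨a, ha, hx⟩ := Module.finrank_eq_zero_iff.mp h0 x
      exact ⟨⟨a, mem_nonZeroDivisors_of_ne_zero ha⟩, hx⟩)
    obtain ⟨a, ha⟩ := freq_pig (α := H i j) (l := (atTop : Filter ℕ))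
      (P := fun a s => Additive.ofMul (u s i / u s j) - Additive.ofMul (u 0 i / u 0 j) = a)
      (Filter.Eventually.frequently (Filter.Eventually.of_forall fun s => ⟨⟨_, hH i j s 0⟩, rfl⟩))
    refine ⟨i, j, hij, Additive.toMul (a : Additive Γ) * (u 0 i / u 0 j), ha.mono fun s hs => ?_⟩
    rw [← hs, toMul_sub, toMul_ofMul, toMul_ofMul, div_mul_cancel, div_mul_cancel]
  · push Not at h0
    have hγ : ∀ p : {p : Fin n × Fin n // p.1 ≠ p.2}, ∃ γ ∈ H p.1.1 p.1.2, ∀ a : ℤ, a ≠ 0 → a • γ ≠ 0 := by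
      intro p
      have h1 := h0 _ _ p.2
      rw [Ne, Module.finrank_eq_zero_iff] at h1
      push Not at h1
      obtain ⟨x, hx⟩ := h1
      exact ⟨x, x.2, fun a ha h => hx a ha (Subtype.ext (by simpa using h))⟩
    choose γ hγH hγ using hγ
    obtain ⟨L, _, _, θ, hθs, hθ⟩ := specialize Γ hΓ (univ.image fun p => Additive.toMul (γ p)) (by
      intro g hg m hm h
      obtain ⟨p, -, rfl⟩ := Finset.mem_image.mp hg
      refine hγ p m (by omega) ?_
      rw [natCast_zsmul]
      exact h)
    obtain ⟨i, j, hij, c, hc⟩ := pair_nf n θ.range ((Group.fg_iff_subgroup_fg _).mp inferInstance) hn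
      (fun s i => θ (u s i)) (fun s i => ⟨_, rfl⟩) (fun s => hθs n (u s) (hsum s))
    obtain ⟨φ, hφ, hφs⟩ := extraction_of_frequently_atTop hc
    let K : Submodule ℤ (Additive Γ) := LinearMap.ker (AddMonoidHom.toIntLinearMap (MonoidHom.toAdditive θ))
    have hK : ∀ x : Γ, Additive.ofMul x ∈ K ↔ θ x = 1 := fun x => Iff.rfl
    clear_value K
    have hlt : Module.finrank ℤ (H i j ⊓ K : Submodule ℤ (Additive Γ)) < Module.finrank ℤ (H i j) := by
      refine finrank_drop _ _ inf_le_left (γ ⟨(i, j), hij⟩) (hγH ⟨(i, j), hij⟩) fun a ha h => ?_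
      have h3 := (hK (Additive.toMul (γ ⟨(i, j), hij⟩) ^ a)).mp h.2
      rw [map_zpow] at h3
      have h4 : θ (Additive.toMul (γ ⟨(i, j), hij⟩)) ^ a.natAbs = 1 := by
        rcases Int.natAbs_eq a with h5 | h5
        · rw [h5, zpow_natCast] at h3; exact h3
        · rw [h5, zpow_neg, zpow_natCast, inv_eq_one] at h3; exact h3
      exact hθ _ (Finset.mem_image_of_mem _ (Finset.mem_univ _)) _ (Int.natAbs_pos.mpr ha) h4
    let H' : Fin n → Fin n → Submodule ℤ (Additive Γ) := fun a b => if (a, b) = (i, j) then H i j ⊓ K else H a b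
    have hH1 : H' i j = H i j ⊓ K := if_pos rfl
    have hH2 : ∀ a b, (a, b) ≠ (i, j) → H' a b = H a b := fun a b h => if_neg h
    clear_value H'
    have hle : ∀ p : Fin n × Fin n, Module.finrank ℤ (H' p.1 p.2) ≤ Module.finrank ℤ (H p.1 p.2) := by
      rintro ⟨a, b⟩
      by_cases h : (a, b) = (i, j)
      · obtain ⟨rfl, rfl⟩ := Prod.mk.inj h
        rw [hH1]
        exact hlt.le
      · rw [hH2 a b h]
    obtain ⟨i', j', hij', c', hc'⟩ := ih _ (by
      rw [← hN]
      refine Finset.sum_lt_sum (fun p _ => hle p) ⟨(i, j), Finset.mem_univ _, ?_⟩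
      rw [hH1]
      exact hlt) (fun s => u (φ s)) (fun s => hsum _) H' (by
      intro a b s s'
      by_cases h : (a, b) = (i, j)
      · obtain ⟨rfl, rfl⟩ := Prod.mk.inj h
        rw [hH1]
        refine ⟨hH _ _ _ _, (hK _).mpr ?_⟩
        have e : ∀ s, θ (u (φ s) a / u (φ s) b) = c := fun s => by rw [map_div, hφs s, mul_div_cancel_right]
        exact (map_div θ _ _).trans ((congrArg₂ _ (e s) (e s')).trans (div_self' c))
      · rw [hH2 a b h]; exact hH _ _ _ _) rfl
    exact ⟨i', j', hij', c', hφ.tendsto_atTop.frequently hc'⟩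

theorem pair_G {G : Type*} [Field G] [CharZero G] (Γ : Subgroup Gˣ) (hΓ : Γ.FG) {n : ℕ} (hn : 0 < n)
    (u : ℕ → Fin n → Γ) (hsum : ∀ s, ∑ i, ((u s i : Gˣ) : G) = 0) :
    ∃ i j, i ≠ j ∧ ∃ c : Γ, ∃ᶠ s in atTop, u s i = c * u s j :=
  pair_aux Γ hΓ hn _ u hsum (fun _ _ => ⊤) (fun _ _ _ _ => Submodule.mem_top) rfl
end UE

set_option linter.all false
namespace UE
open Finset Filter Topology NumberField

theorem bc_aux {G : Type*} [Field G] [CharZero G] {ι : Type*} [Fintype ι] [DecidableEq ι] [DecidableEq G] (Γ : Subgroup Gˣ) (hΓ : Γ.FG) (N : ℕ) :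
    ∀ (c : ι → G) (hN : (univ.filter fun i => c i ≠ 0).card = N) (u : ℕ → ι → Γ)
    (hsum : ∀ s, ∑ i, c i * ((u s i : Gˣ) : G) = 0),
    ∃ φ : ℕ → ℕ, StrictMono φ ∧ ∀ s s' (f : Γ → G), ∑ i, c i * (((u (φ s) i : Gˣ) : G) * f (u (φ s') i / u (φ s) i)) = 0 := by
  classical
  induction N using Nat.strong_induction_on with
  | _ N ih =>
  intro c hN u hsum
  by_cases hc0 : ∀ i, c i = 0
  · exact ⟨id, strictMono_id, fun s s' f => by simp [hc0]⟩
  push Not at hc0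
  let T := {i : ι // c i ≠ 0}
  let e := (Fintype.equivFin T).symm
  have hT0 : 0 < Fintype.card T := by
    obtain ⟨i, hi⟩ := hc0
    exact Fintype.card_pos_iff.mpr ⟨⟨i, hi⟩⟩
  let g : T → Gˣ := fun i => Units.mk0 (c i.1) i.2
  have hΓ' : (Γ ⊔ Subgroup.closure (Set.range g)).FG := by
    refine Subgroup.FG.sup hΓ ?_
    exact (Subgroup.fg_iff _).mpr ⟨_, rfl, Set.finite_range g⟩
  obtain ⟨k, l, hkl, d, hd⟩ := pair_G (Γ ⊔ Subgroup.closure (Set.range g)) hΓ' hT0 (fun s i => ⟨g (e i) * u s (e i).1,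
    Subgroup.mul_mem _ (Subgroup.mem_sup_right (Subgroup.subset_closure ⟨_, rfl⟩)) (Subgroup.mem_sup_left (u s (e i).1).2)⟩) (fun s => by
      show ∑ i, ((g (e i) * u s (e i).1 : Gˣ) : G) = 0
      rw [e.sum_comp (fun i : T => ((g i * u s i.1 : Gˣ) : G))]
      refine Eq.trans ?_ (hsum s)
      rw [← Finset.sum_filter_of_ne (s := univ) (p := fun i => c i ≠ 0) (fun i _ h => left_ne_zero_of_mul h)]
      rw [Finset.sum_subtype (p := fun i => c i ≠ 0) (Finset.univ.filter fun i => c i ≠ 0) (by simp) (fun i => c i * ((u s i : Gˣ) : G))]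
      rfl)
  obtain ⟨φ, hφ, hφs⟩ := extraction_of_frequently_atTop hd
  obtain ⟨i, hi⟩ : ∃ i, i = (e k).1 := ⟨_, rfl⟩
  obtain ⟨j, hj⟩ : ∃ j, j = (e l).1 := ⟨_, rfl⟩
  have hij : i ≠ j := fun h => hkl (e.injective (Subtype.ext (hi ▸ hj ▸ h)))
  have hci : c i ≠ 0 := hi ▸ (e k).2
  have hcj : c j ≠ 0 := hj ▸ (e l).2
  have hq : ∀ s, u (φ s) i / u (φ s) j = u (φ 0) i / u (φ 0) j := by
    have : ∀ s, ((u (φ s) i : Gˣ)) / u (φ s) j = (g (e k))⁻¹ * d * g (e l) := by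
      intro s
      have h1 := congrArg Subtype.val (hφs s)
      simp only [Subgroup.coe_mul] at h1
      rw [← hi, ← hj] at h1
      rw [div_eq_iff_eq_mul, mul_assoc, mul_assoc, ← h1, inv_mul_cancel_left]
    intro s
    apply Subtype.ext
    rw [Subgroup.coe_div, Subgroup.coe_div, this, this]
  obtain ⟨b, hb⟩ : ∃ b, b = u (φ 0) i / u (φ 0) j := ⟨_, rfl⟩
  simp only [← hb, div_eq_iff_eq_mul] at hq
  let c' : ι → G := fun k => c k - (if k = i then c i else 0) + (if k = j then c i * ((b : Gˣ) : G) else 0)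
  have hmerge : ∀ w : ι → G, w i = ((b : Gˣ) : G) * w j → ∑ k, c' k * w k = ∑ k, c k * w k := by
    intro w hw
    simp only [c', sub_mul, add_mul, Finset.sum_add_distrib, Finset.sum_sub_distrib, ite_mul, zero_mul, Finset.sum_ite_eq', Finset.mem_univ, if_true]
    rw [hw]; ring
  obtain ⟨φ', hφ', hr⟩ := ih _ (by
    rw [← hN]
    refine Finset.card_lt_card (Finset.ssubset_iff_of_subset ?_ |>.mpr ⟨i, ?_, ?_⟩)
    · intro k hk
      simp only [Finset.mem_filter, Finset.mem_univ, true_and] at hk ⊢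
      intro h
      apply hk
      have h1 : k ≠ i := fun h' => hci (h' ▸ h)
      have h2 : k ≠ j := fun h' => hcj (h' ▸ h)
      simp [c', h, h1, h2]
    · simpa using hci
    · simp [c', hij]) c' rfl (fun s => u (φ s)) (fun s => by
      rw [hmerge (fun i => ((u (φ s) i : Gˣ) : G)) (by rw [hq]; simp)]; exact hsum _)
  refine ⟨φ ∘ φ', hφ.comp hφ', fun s s' f => ?_⟩
  rw [← hr s s' f, ← hmerge]
  · rfl
  · simp only [Function.comp]
    rw [hq (φ' s), hq (φ' s'), mul_div_mul_left_eq_div]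
    simp [mul_assoc]

theorem bc {G : Type*} [Field G] [CharZero G] {ι : Type*} [Fintype ι] (Γ : Subgroup Gˣ) (hΓ : Γ.FG)
    (c : ι → G) (u : ℕ → ι → Γ) (hsum : ∀ s, ∑ i, c i * ((u s i : Gˣ) : G) = 0) :
    ∃ φ : ℕ → ℕ, StrictMono φ ∧ ∀ s s' (f : Γ → G), ∑ i, c i * (((u (φ s) i : Gˣ) : G) * f (u (φ s') i / u (φ s) i)) = 0 := by
  classical
  exact bc_aux Γ hΓ _ c rfl u hsum
end UE

set_option linter.all false
namespace UE
open Finset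

def Bad {G : Type*} [Field G] (u v : G) : Prop := u + v = 0 ∨ u ^ 2 + u * v + v ^ 2 = 0

def L2 {G : Type*} [Field G] (x1 x2 : G) (a1 a2 n : ℕ) : G :=
  (if n = 0 then 1 else 0) - (if n = a1 then x1 else 0) - (if n = a2 then x2 else 0) + (if n = a1 + a2 then x1 * x2 else 0)

def L3 {G : Type*} [Field G] (x1 x2 x3 : G) (a1 a2 a3 n : ℕ) : G :=
  (if n = 0 then 1 else 0) - (if n = a1 then x1 else 0) - (if n = a2 then x2 else 0) - (if n = a3 then x3 else 0)
   + (if n = a1 + a2 then x1 * x2 else 0) + (if n = a1 + a3 then x1 * x3 else 0) + (if n = a2 + a3 then x2 * x3 else 0)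
   - (if n = a1 + a2 + a3 then x1 * x2 * x3 else 0)

theorem coeff_L2 {G : Type*} [Field G] (x1 x2 : G) (a1 a2 n : ℕ) :
    (((1 - Polynomial.C x1 * Polynomial.X ^ a1) * (1 - Polynomial.C x2 * Polynomial.X ^ a2)).coeff n : G) = L2 x1 x2 a1 a2 n := by
  have : (1 - Polynomial.C x1 * Polynomial.X ^ a1) * (1 - Polynomial.C x2 * Polynomial.X ^ a2) =
     Polynomial.C 1 * Polynomial.X ^ 0 - Polynomial.C x1 * Polynomial.X ^ a1 - Polynomial.C x2 * Polynomial.X ^ a2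
      + Polynomial.C (x1 * x2) * Polynomial.X ^ (a1 + a2) := by
    simp only [map_mul, map_one]; ring
  rw [this]
  simp only [Polynomial.coeff_add, Polynomial.coeff_sub, Polynomial.coeff_C_mul_X_pow, L2]

theorem coeff_L3 {G : Type*} [Field G] (x1 x2 x3 : G) (a1 a2 a3 n : ℕ) :
    (((1 - Polynomial.C x1 * Polynomial.X ^ a1) * (1 - Polynomial.C x2 * Polynomial.X ^ a2) * (1 - Polynomial.C x3 * Polynomial.X ^ a3)).coeff n : G)
      = L3 x1 x2 x3 a1 a2 a3 n := by
  have : (1 - Polynomial.C x1 * Polynomial.X ^ a1) * (1 - Polynomial.C x2 * Polynomial.X ^ a2) * (1 - Polynomial.C x3 * Polynomial.X ^ a3) =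
     Polynomial.C 1 * Polynomial.X ^ 0 - Polynomial.C x1 * Polynomial.X ^ a1 - Polynomial.C x2 * Polynomial.X ^ a2 - Polynomial.C x3 * Polynomial.X ^ a3
      + Polynomial.C (x1 * x2) * Polynomial.X ^ (a1 + a2) + Polynomial.C (x1 * x3) * Polynomial.X ^ (a1 + a3)
      + Polynomial.C (x2 * x3) * Polynomial.X ^ (a2 + a3) - Polynomial.C (x1 * x2 * x3) * Polynomial.X ^ (a1 + a2 + a3) := by
    simp only [map_mul, map_one]; ring
  rw [this]
  simp only [Polynomial.coeff_add, Polynomial.coeff_sub, Polynomial.coeff_C_mul_X_pow, L3]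

theorem deg2 {G : Type*} [Field G] {x1 x2 y1 y2 : G} {a1 a2 b1 b2 : ℕ} (hx1 : x1 ≠ 0) (hx2 : x2 ≠ 0)
    (ha1 : 0 < a1) (ha2 : 0 < a2) (hb1 : 0 < b1) (hb2 : 0 < b2) (E : ∀ n, L2 x1 x2 a1 a2 n = L2 y1 y2 b1 b2 n) : a1 + a2 ≤ b1 + b2 := by
  by_contra! h
  have := E (a1 + a2)
  simp (disch := omega) only [L2, if_pos, if_neg, if_true] at this
  exact mul_ne_zero hx1 hx2 (by linear_combination this)

theorem deg3 {G : Type*} [Field G] {x1 x2 x3 y1 y2 y3 : G} {a1 a2 a3 b1 b2 b3 : ℕ} (hx1 : x1 ≠ 0) (hx2 : x2 ≠ 0) (hx3 : x3 ≠ 0)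
    (ha1 : 0 < a1) (ha2 : 0 < a2) (ha3 : 0 < a3) (hb1 : 0 < b1) (hb2 : 0 < b2) (hb3 : 0 < b3)
    (E : ∀ n, L3 x1 x2 x3 a1 a2 a3 n = L3 y1 y2 y3 b1 b2 b3 n) : a1 + a2 + a3 ≤ b1 + b2 + b3 := by
  by_contra! h
  have := E (a1 + a2 + a3)
  simp (disch := omega) only [L3, if_pos, if_neg, if_true] at this
  exact mul_ne_zero (mul_ne_zero hx1 hx2) hx3 (by linear_combination -this)

def Con2 {G : Type*} [Field G] (x1 x2 y1 y2 : G) (a1 a2 b1 b2 : ℕ) : Prop :=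
  (Bad x1 x2 ∨ Bad y1 y2) ∨ (x1 = y1 ∧ a1 = b1) ∨ (x2 = y1 ∧ a2 = b1)

theorem case2 {G : Type*} [Field G] {x1 x2 y1 y2 : G} {a1 a2 b1 b2 : ℕ} (hx1 : x1 ≠ 0) (hx2 : x2 ≠ 0) (hy1 : y1 ≠ 0) (hy2 : y2 ≠ 0)
    (ha1 : 0 < a1) (ha : a1 ≤ a2) (hb1 : 0 < b1) (hb : b1 ≤ b2) (E : ∀ n, L2 x1 x2 a1 a2 n = L2 y1 y2 b1 b2 n) : Con2 x1 x2 y1 y2 a1 a2 b1 b2 := by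
  have hd : a1 + a2 = b1 + b2 := le_antisymm (deg2 hx1 hx2 ha1 (by omega) hb1 (by omega) E)
    (deg2 hy1 hy2 hb1 (by omega) ha1 (by omega) fun n => (E n).symm)
  rcases lt_trichotomy a1 b1 with h | h | h
  · have e1 := E a1
    rcases ha.eq_or_lt with h2 | h2
    · omega
    · simp (disch := omega) only [L2, if_pos, if_neg, if_true] at e1
      exact absurd (by linear_combination -e1) hx1
  · have e1 := E a1
    rcases ha.eq_or_lt with h2 | h2
    · have e2 := E (a1 + a1)
      simp (disch := omega) only [L2, if_pos, if_neg, if_true] at e1 e2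
      have : (x1 - y1) * (x2 - y1) = 0 := by linear_combination y1 * e1 + e2
      rcases mul_eq_zero.mp this with h3 | h3
      · exact Or.inr (Or.inl ⟨sub_eq_zero.mp h3, h⟩)
      · exact Or.inr (Or.inr ⟨sub_eq_zero.mp h3, by omega⟩)
    · simp (disch := omega) only [L2, if_pos, if_neg, if_true] at e1
      exact Or.inr (Or.inl ⟨by linear_combination -e1, h⟩)
  · have e1 := E b1
    rcases hb.eq_or_lt with h2 | h2
    · omega
    · simp (disch := omega) only [L2, if_pos, if_neg, if_true] at e1
      exact absurd (by linear_combination e1) hy1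

/-- case where the multiplicity of the minimal exponent is two on the left, one on the right -/
theorem case21 {G : Type*} [Field G] {x1 x2 x3 y1 y2 y3 : G} {e a b c : ℕ}
    (hx1 : x1 ≠ 0) (hx2 : x2 ≠ 0) (hx3 : x3 ≠ 0) (hy1 : y1 ≠ 0) (hy2 : y2 ≠ 0) (hy3 : y3 ≠ 0) (he : 0 < e)
    (ha : e < a) (hb : e < b) (hbc : b ≤ c) (hd : a + e = b + c)
    (E : ∀ n, L3 x1 x2 x3 e e a n = L3 y1 y2 y3 e b c n) : Bad x1 x2 ∨ Bad y2 y3 := by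
  have e1 := E e
  have e2 := E b
  have etop := E (a + e + e)
  simp (disch := omega) only [L3, if_pos, if_neg, if_true] at e1 etop
  have hs : x1 + x2 = y1 := by linear_combination -e1
  have ht : x1 * x2 * x3 = y1 * y2 * y3 := by linear_combination -etop
  have hp : x1 * x2 ≠ 0 := mul_ne_zero hx1 hx2
  rcases hbc.eq_or_lt with h | h
  · subst h
    by_cases h2 : b = 2 * e
    · have e3 := E (3 * e)
      have e4 := E (4 * e)
      simp (disch := omega) only [L3, if_pos, if_neg, if_true] at e2 e3 e4
      have f3 : x3 = (x1 + x2) * (x1 * x2) := by linear_combination -e3 + (y2+y3) * hs - (x1+x2) * e2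
      have f4 : (x1 + x2) * x3 = y2 * y3 := by linear_combination e4
      have hps : x1 * x2 = (x1 + x2) ^ 2 := by
        have : (x1 * x2) * (x1 + x2) * (x1 * x2 - (x1 + x2) ^ 2) = 0 := by
          have h5 : x1 * x2 * x3 = (x1 + x2) * ((x1 + x2) * x3) := by rw [f4, hs, ht]; ring
          rw [f3] at h5; linear_combination h5
        rcases mul_eq_zero.mp this with h6 | h6
        · exact absurd h6 (mul_ne_zero hp (hs ▸ hy1))
        · exact sub_eq_zero.mp h6
      left; right
      linear_combination -hps
    · simp (disch := omega) only [L3, if_pos, if_neg, if_true] at e2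
      right; left; linear_combination e2
  · by_cases h2 : b = 2 * e
    · by_cases h3 : c = 3 * e
      · have e3 := E (3 * e)
        have e4 := E (4 * e)
        have e5 := E (5 * e)
        simp (disch := omega) only [L3, if_pos, if_neg, if_true] at e2 e3 e4 e5
        have g2 : y2 = -(x1 * x2) := by linear_combination e2
        have g3 : y3 = (x1 + x2) * y2 := by linear_combination e3 - y2 * hs
        have g4 : x3 = -((x1 + x2) * y3) := by linear_combination -e4 + y3 * hs
        have g5 : (x1 + x2) * x3 = y2 * y3 := by linear_combination e5
        rw [g4, g3, g2] at g5
        have : (x1 * x2) * (x1 + x2) * (x1 * x2 - (x1 + x2) ^ 2) = 0 := by linear_combination -g5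
        rcases mul_eq_zero.mp this with h6 | h6
        · exact absurd h6 (mul_ne_zero hp (hs ▸ hy1))
        · left; right; linear_combination -h6
      · have e3 := E c
        simp (disch := omega) only [L3, if_pos, if_neg, if_true] at e3
        exact absurd (by linear_combination e3) hy3
    · simp (disch := omega) only [L3, if_pos, if_neg, if_true] at e2
      exact absurd (by linear_combination e2) hy2

theorem case3 {G : Type*} [Field G] {x1 x2 x3 y1 y2 y3 : G} {a1 a2 a3 b1 b2 b3 : ℕ}
    (hx1 : x1 ≠ 0) (hx2 : x2 ≠ 0) (hx3 : x3 ≠ 0) (hy1 : y1 ≠ 0) (hy2 : y2 ≠ 0) (hy3 : y3 ≠ 0)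
    (ha1 : 0 < a1) (ha : a1 ≤ a2) (ha' : a2 ≤ a3) (hb1 : 0 < b1) (hb : b1 ≤ b2) (hb' : b2 ≤ b3)
    (E : ∀ n, L3 x1 x2 x3 a1 a2 a3 n = L3 y1 y2 y3 b1 b2 b3 n) :
    (Bad x1 x2 ∨ Bad x2 x3 ∨ Bad y1 y2 ∨ Bad y2 y3) ∨ (x1 = y1 ∧ a1 = b1) ∨ (x2 = y1 ∧ a2 = b1) ∨ (x3 = y1 ∧ a3 = b1) ∨ (x3 = y3 ∧ a3 = b3) := by
  have hd : a1 + a2 + a3 = b1 + b2 + b3 := le_antisymm (deg3 hx1 hx2 hx3 ha1 (by omega) (by omega) hb1 (by omega) (by omega) E)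
    (deg3 hy1 hy2 hy3 hb1 (by omega) (by omega) ha1 (by omega) (by omega) fun n => (E n).symm)
  rcases lt_trichotomy a1 b1 with h | h | h
  · have e1 := E a1
    rcases ha.eq_or_lt with h2 | h2
    · simp (disch := omega) only [L3, if_pos, if_neg, if_true] at e1
      exact Or.inl (Or.inl (Or.inl (by linear_combination -e1)))
    · simp (disch := omega) only [L3, if_pos, if_neg, if_true] at e1
      exact absurd (by linear_combination -e1) hx1
  · subst h
    rcases ha.eq_or_lt with h2 | h2
    · subst h2
      rcases hb.eq_or_lt with h3 | h3
      · subst h3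
        obtain rfl : a3 = b3 := by omega
        have e1 := E a1
        rcases ha'.eq_or_lt with h4 | h4
        · subst h4
          have e2 := E (2 * a1)
          have e3 := E (3 * a1)
          simp (disch := omega) only [L3, if_pos, if_neg, if_true] at e1 e2 e3
          have : (x1 - y1) * ((x2 - y1) * (x3 - y1)) = 0 := by linear_combination -y1 ^ 2 * e1 - y1 * e2 - e3
          rcases mul_eq_zero.mp this with h5 | h5
          · exact Or.inr (Or.inl ⟨sub_eq_zero.mp h5, rfl⟩)
          · rcases mul_eq_zero.mp h5 with h5 | h5
            · exact Or.inr (Or.inr (Or.inl ⟨sub_eq_zero.mp h5, rfl⟩))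
            · exact Or.inr (Or.inr (Or.inr (Or.inl ⟨sub_eq_zero.mp h5, rfl⟩)))
        · by_cases h5 : a3 = 2 * a1
          · have e3 := E (3 * a1)
            simp (disch := omega) only [L3, if_pos, if_neg, if_true] at e1 e3
            have : (x1 + x2) * (x3 - y3) = 0 := by linear_combination e3 + y3 * e1
            rcases mul_eq_zero.mp this with h6 | h6
            · exact Or.inl (Or.inl (Or.inl h6))
            · exact Or.inr (Or.inr (Or.inr (Or.inr ⟨sub_eq_zero.mp h6, rfl⟩)))
          · have e2 := E (2 * a1)
            simp (disch := omega) only [L3, if_pos, if_neg, if_true] at e1 e2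
            have : (x1 - y1) * (x2 - y1) = 0 := by linear_combination y1 * e1 + e2
            rcases mul_eq_zero.mp this with h6 | h6
            · exact Or.inr (Or.inl ⟨sub_eq_zero.mp h6, rfl⟩)
            · exact Or.inr (Or.inr (Or.inl ⟨sub_eq_zero.mp h6, rfl⟩))
      · have := case21 hx1 hx2 hx3 hy1 hy2 hy3 ha1 (by omega) h3 hb' (by omega) E
        tauto
    · rcases hb.eq_or_lt with h3 | h3
      · subst h3
        have := case21 hy1 hy2 hy3 hx1 hx2 hx3 ha1 (by omega) h2 ha' (by omega) (fun n => (E n).symm)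
        tauto
      · have e1 := E a1
        simp (disch := omega) only [L3, if_pos, if_neg, if_true] at e1
        exact Or.inr (Or.inl ⟨by linear_combination -e1, rfl⟩)
  · have e1 := E b1
    rcases hb.eq_or_lt with h2 | h2
    · simp (disch := omega) only [L3, if_pos, if_neg, if_true] at e1
      exact Or.inl (Or.inr (Or.inr (Or.inl (Or.inl (by linear_combination e1)))))
    · simp (disch := omega) only [L3, if_pos, if_neg, if_true] at e1
      exact absurd (by linear_combination e1) hy1
end UE

set_option linter.all false
namespace UE
open Finset

noncomputable def fac {G : Type*} [Field G] (p : G × ℕ) : Polynomial G := 1 - Polynomial.C p.1 * Polynomial.X ^ p.2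

def HasBad {G : Type*} [Field G] {n : ℕ} (p : Fin n → G × ℕ) : Prop := ∃ i j, i ≠ j ∧ Bad (p i).1 (p j).1

def Common (G : Type*) [Field G] (n : ℕ) : Prop := ∀ p q : Fin n → G × ℕ, (∀ i, (p i).1 ≠ 0 ∧ 0 < (p i).2) → (∀ i, (q i).1 ≠ 0 ∧ 0 < (q i).2) →
  ∏ i, fac (p i) = ∏ i, fac (q i) → HasBad p ∨ HasBad q ∨ ∃ i j, p i = q j

def SameM (G : Type*) [Field G] (n : ℕ) : Prop := ∀ p q : Fin n → G × ℕ, (∀ i, (p i).1 ≠ 0 ∧ 0 < (p i).2) → (∀ i, (q i).1 ≠ 0 ∧ 0 < (q i).2) →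
  ∏ i, fac (p i) = ∏ i, fac (q i) → HasBad p ∨ HasBad q ∨ ∃ π : Equiv.Perm (Fin n), ∀ k, q k = p (π k)

theorem fac_ne {G : Type*} [Field G] (p : G × ℕ) (h : 0 < p.2) : fac p ≠ 0 := by
  intro h0
  have := congrArg (fun f => Polynomial.coeff f 0) h0
  simp [fac, Polynomial.coeff_X_pow, h.ne] at this

theorem same_succ {G : Type*} [Field G] {n : ℕ} (hc : Common G (n+1)) (hs : SameM G n) : SameM G (n+1) := by
  intro p q hp hq h
  rcases hc p q hp hq h with h1 | h1 | ⟨i, j, hij⟩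
  · exact Or.inl h1
  · exact Or.inr (Or.inl h1)
  have h2 := h
  rw [Fin.prod_univ_succAbove _ i, Fin.prod_univ_succAbove _ j, hij] at h2
  have h3 := mul_left_cancel₀ (fac_ne _ (hq j).2) h2
  rcases hs (fun k => p (i.succAbove k)) (fun k => q (j.succAbove k)) (fun _ => hp _) (fun _ => hq _) h3 with ⟨a, b, hab, hB⟩ | ⟨a, b, hab, hB⟩ | ⟨π, h4⟩
  · exact Or.inl ⟨_, _, fun h => hab (Fin.succAbove_right_injective h), hB⟩
  · exact Or.inr (Or.inl ⟨_, _, fun h => hab (Fin.succAbove_right_injective h), hB⟩)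
  · refine Or.inr (Or.inr ⟨(finSuccEquiv' j).trans (π.optionCongr.trans (finSuccEquiv' i).symm), fun k => ?_⟩)
    rcases Fin.eq_self_or_eq_succAbove j k with rfl | ⟨k, rfl⟩
    · simp [hij]
    · simpa using h4 k

theorem common1 (G : Type*) [Field G] : Common G 1 := by
  intro p q hp hq h
  refine Or.inr (Or.inr ⟨0, 0, ?_⟩)
  simp only [Fin.prod_univ_one] at h
  have h1 : Polynomial.C (p 0).1 * Polynomial.X ^ (p 0).2 = Polynomial.C (q 0).1 * Polynomial.X ^ (q 0).2 := by
    simp only [fac] at h; linear_combination -h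
  have h2 := congrArg (fun f => Polynomial.coeff f (p 0).2) h1
  simp only [Polynomial.coeff_C_mul_X_pow, if_true] at h2
  by_cases h3 : (p 0).2 = (q 0).2
  · rw [if_pos h3] at h2; exact Prod.ext h2 h3
  · rw [if_neg h3] at h2; exact absurd h2 (hp 0).1

theorem common2 (G : Type*) [Field G] : Common G 2 := by
  intro p q hp hq h
  obtain ⟨σ, hσ⟩ : ∃ σ, σ = Tuple.sort (fun i => (p i).2) := ⟨_, rfl⟩
  obtain ⟨τ, hτ⟩ : ∃ σ, σ = Tuple.sort (fun i => (q i).2) := ⟨_, rfl⟩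
  have hσm : Monotone ((fun i => (p i).2) ∘ σ) := hσ ▸ Tuple.monotone_sort _
  have hτm : Monotone ((fun i => (q i).2) ∘ τ) := hτ ▸ Tuple.monotone_sort _
  rw [← Equiv.prod_comp σ (fun i => fac (p i)), ← Equiv.prod_comp τ (fun i => fac (q i)), Fin.prod_univ_two, Fin.prod_univ_two] at h
  have E := fun n => congrArg (fun f => Polynomial.coeff f n) h
  simp only [fac, coeff_L2] at E
  have := case2 (hp (σ 0)).1 (hp (σ 1)).1 (hq (τ 0)).1 (hq (τ 1)).1 (hp (σ 0)).2 (hσm (by decide : (0 : Fin 2) ≤ 1))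
    (hq (τ 0)).2 (hτm (by decide : (0 : Fin 2) ≤ 1)) E
  have ne : ∀ (σ : Equiv.Perm (Fin 2)), σ 0 ≠ σ 1 := fun σ => by simp
  rcases this with (h | h) | h | h
  · exact Or.inl ⟨_, _, ne σ, h⟩
  · exact Or.inr (Or.inl ⟨_, _, ne τ, h⟩)
  · exact Or.inr (Or.inr ⟨_, _, Prod.ext h.1 h.2⟩)
  · exact Or.inr (Or.inr ⟨_, _, Prod.ext h.1 h.2⟩)

theorem common3 (G : Type*) [Field G] : Common G 3 := by
  intro p q hp hq h
  obtain ⟨σ, hσ⟩ : ∃ σ, σ = Tuple.sort (fun i => (p i).2) := ⟨_, rfl⟩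
  obtain ⟨τ, hτ⟩ : ∃ σ, σ = Tuple.sort (fun i => (q i).2) := ⟨_, rfl⟩
  have hσm : Monotone ((fun i => (p i).2) ∘ σ) := hσ ▸ Tuple.monotone_sort _
  have hτm : Monotone ((fun i => (q i).2) ∘ τ) := hτ ▸ Tuple.monotone_sort _
  rw [← Equiv.prod_comp σ (fun i => fac (p i)), ← Equiv.prod_comp τ (fun i => fac (q i)), Fin.prod_univ_three, Fin.prod_univ_three] at h
  have E := fun n => congrArg (fun f => Polynomial.coeff f n) h
  simp only [fac, coeff_L3] at E
  have := case3 (hp (σ 0)).1 (hp (σ 1)).1 (hp (σ 2)).1 (hq (τ 0)).1 (hq (τ 1)).1 (hq (τ 2)).1 (hp (σ 0)).2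
    (hσm (by decide : (0 : Fin 3) ≤ 1)) (hσm (by decide : (1 : Fin 3) ≤ 2))
    (hq (τ 0)).2 (hτm (by decide : (0 : Fin 3) ≤ 1)) (hτm (by decide : (1 : Fin 3) ≤ 2)) E
  have ne : ∀ (σ : Equiv.Perm (Fin 3)) (i j : Fin 3), i ≠ j → σ i ≠ σ j := fun σ i j h => σ.injective.ne h
  rcases this with (h | h | h | h) | h | h | h | h
  · exact Or.inl ⟨_, _, ne σ 0 1 (by decide), h⟩
  · exact Or.inl ⟨_, _, ne σ 1 2 (by decide), h⟩
  · exact Or.inr (Or.inl ⟨_, _, ne τ 0 1 (by decide), h⟩)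
  · exact Or.inr (Or.inl ⟨_, _, ne τ 1 2 (by decide), h⟩)
  all_goals exact Or.inr (Or.inr ⟨_, _, Prod.ext h.1 h.2⟩)

theorem same3 (G : Type*) [Field G] : SameM G 3 :=
  same_succ (common3 G) (same_succ (common2 G) (same_succ (common1 G) (fun p q _ _ _ => Or.inr (Or.inr ⟨1, fun k => k.elim0⟩))))
end UE

set_option linter.all false
namespace UE
open Finset Filter

theorem exists_functional {M : Type*} [AddCommGroup M] [Module.Finite ℤ M] {ι : Type*} [Fintype ι] (v : ι → M)
    (hv : ∀ i, v i ∉ Submodule.torsion ℤ M) : ∃ ψ : M →ₗ[ℤ] ℤ, ∀ i, ψ (v i) ≠ 0 := by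
  classical
  let b := Module.finBasis ℤ (M ⧸ Submodule.torsion ℤ M)
  let P : M →ₗ[ℤ] Polynomial ℤ := (Polynomial.ofFn _).comp (b.equivFun.toLinearMap.comp (Submodule.torsion ℤ M).mkQ)
  have hP : ∀ i, P (v i) ≠ 0 := by
    intro i h
    have h1 : b.equivFun ((Submodule.torsion ℤ M).mkQ (v i)) = 0 := by
      refine Polynomial.injective_ofFn _ ?_
      rw [map_zero]; exact h
    rw [LinearEquiv.map_eq_zero_iff] at h1
    exact hv i ((Submodule.Quotient.mk_eq_zero _).mp h1)
  obtain ⟨N, hN⟩ : ∃ N : ℤ, (∏ i, P (v i)).eval N ≠ 0 := by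
    by_contra! h
    exact (Finset.prod_ne_zero_iff.mpr fun i _ => hP i) (Polynomial.funext fun x => by simpa using h x)
  refine ⟨(Polynomial.leval N).comp P, fun i => ?_⟩
  rw [Polynomial.eval_prod, Finset.prod_ne_zero_iff] at hN
  exact hN i (mem_univ _)

theorem flip_one {G : Type*} [Field G] (x : Gˣ) (a : ℤ) (ha : a ≠ 0) :
    ∃ (ε : ℤ) (m : ℕ) (κ : G), (ε = 1 ∨ ε = -1) ∧ κ ≠ 0 ∧ ∀ T : Gˣ,
      (T : G) ^ m * (((x * T ^ a : Gˣ) : G) - 1) = κ * (fac (((x ^ ε : Gˣ) : G), a.natAbs)).eval (T : G) := by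
  rcases lt_or_gt_of_ne ha with h | h
  · obtain ⟨k, rfl⟩ := Int.exists_eq_neg_ofNat h.le
    refine ⟨-1, k, x, Or.inr rfl, x.ne_zero, fun T => ?_⟩
    have := x.ne_zero
    have := T.ne_zero
    simp [fac]
    field_simp
  · obtain ⟨k, rfl⟩ := Int.eq_ofNat_of_zero_le h.le
    refine ⟨1, 0, -1, Or.inl rfl, by simp, fun T => ?_⟩
    simp [fac]

theorem poly_eq {G : Type*} [Field G] [Infinite G] (P Q : Polynomial G) (hP : P.coeff 0 = 1) (hQ : Q.coeff 0 = 1) (m m' : ℕ) (κ κ' : G)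
    (hκ : κ ≠ 0) (hκ' : κ' ≠ 0) (h : ∀ T : Gˣ, (T : G) ^ m * (κ * P.eval (T : G)) = (T : G) ^ m' * (κ' * Q.eval (T : G))) : P = Q := by
  have h1 : Polynomial.X ^ (m + 1) * (Polynomial.C κ * P) = Polynomial.X ^ (m' + 1) * (Polynomial.C κ' * Q) := by
    refine Polynomial.funext fun r => ?_
    by_cases hr : r = 0
    · simp [hr]
    · have := h (Units.mk0 r hr)
      simp only [Units.val_mk0] at this
      simp only [Polynomial.eval_mul, Polynomial.eval_pow, Polynomial.eval_X, Polynomial.eval_C, pow_succ']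
      rw [mul_assoc, this, mul_assoc]
  have hmm : m = m' := by
    rcases lt_trichotomy m m' with h2 | h2 | h2
    · have := congrArg (fun f => Polynomial.coeff f (m + 1)) h1
      simp only [Polynomial.coeff_X_pow_mul'] at this
      rw [if_pos le_rfl, if_neg (by omega)] at this
      simp [hP, hκ] at this
    · exact h2
    · have := congrArg (fun f => Polynomial.coeff f (m' + 1)) h1
      simp only [Polynomial.coeff_X_pow_mul'] at this
      rw [if_pos le_rfl, if_neg (by omega)] at this
      simp [hQ] at this
      exact absurd this.symm hκ'
  subst hmm
  have h2 := mul_left_cancel₀ (pow_ne_zero _ Polynomial.X_ne_zero) h1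
  have h3 := congrArg (fun f => Polynomial.coeff f 0) h2
  simp only [Polynomial.coeff_C_mul, hP, hQ, mul_one] at h3
  rw [h3] at h2
  exact mul_left_cancel₀ (by simpa using hκ') h2

def Rt {G : Type*} [Field G] (w : Gˣ) : Prop := (w : G) = -1 ∨ IsPrimitiveRoot (w : G) 3

theorem Rt_inv {G : Type*} [Field G] {w : Gˣ} (h : Rt w⁻¹) : Rt w := by
  rcases h with h | h
  · left
    have : w⁻¹ = -1 := Units.ext (by simpa using h)
    rw [← inv_inv w, this]; simp
  · right
    have := h.inv
    simpa using this

theorem Bad_Rt {G : Type*} [Field G] [CharZero G] {u v : Gˣ} (h : Bad (u : G) (v : G)) : Rt (u / v) := by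
  have hv := v.ne_zero
  rcases h with h | h
  · left
    rw [Units.val_div_eq_div_val, div_eq_iff hv]; linear_combination h
  · right
    have h1 : ((u : G) / v) ^ 2 + (u : G) / v + 1 = 0 := by field_simp; linear_combination h
    rw [Units.val_div_eq_div_val]
    obtain ⟨w, hw⟩ : ∃ w, w = (u : G) / v := ⟨_, rfl⟩
    rw [← hw] at h1 ⊢
    haveI : Fact (Nat.Prime 3) := ⟨Nat.prime_three⟩
    have h3 : orderOf w = 3 := orderOf_eq_prime (by linear_combination (w - 1) * h1) (by
      rintro rfl
      norm_num at h1)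
    rw [← h3]; exact IsPrimitiveRoot.orderOf w

theorem Bad_conv {G : Type*} [Field G] [CharZero G] {u v : Gˣ} {ε δ : ℤ} (hε : ε = 1 ∨ ε = -1) (hδ : δ = 1 ∨ δ = -1)
    (h : Bad ((u ^ ε : Gˣ) : G) ((v ^ δ : Gˣ) : G)) : Rt (u * v) ∨ Rt (u / v) := by
  have := Bad_Rt h
  rcases hε with rfl | rfl <;> rcases hδ with rfl | rfl
  · right; simpa using this
  · left; simpa using this
  · left; refine Rt_inv ?_; convert this using 1; rw [zpow_neg_one, zpow_one, mul_inv, div_eq_mul_inv]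
  · right; refine Rt_inv ?_; convert this using 1; rw [zpow_neg_one, zpow_neg_one, inv_div_inv, inv_div]

def Concl {G : Type*} [Field G] (x y : Fin 3 → Gˣ) : Prop :=
        (∃ (η : Fin 3 → ℤ) (π : Equiv.Perm (Fin 3)),
          (∀ i, η i = 1 ∨ η i = -1) ∧ ∀ i, y i = x (π i) ^ η (π i)) ∨
        (∃ i j : Fin 3, i < j ∧ ((Rt (x i * x j) ∨ Rt (x i / x j)) ∨ (Rt (y i * y j) ∨ Rt (y i / y j))))

theorem Bad_symm {G : Type*} [Field G] {u v : G} (h : Bad u v) : Bad v u := by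
  rcases h with h | h
  · left; linear_combination h
  · right; linear_combination h

theorem concl_of {G : Type*} [Field G] [CharZero G] (x y : Fin 3 → Gˣ) (a b : Fin 3 → ℤ) (ha : ∀ i, a i ≠ 0) (hb : ∀ i, b i ≠ 0)
    (h : ∀ T : Gˣ, ∏ i, (((x i * T ^ a i : Gˣ) : G) - 1) = ∏ i, (((y i * T ^ b i : Gˣ) : G) - 1)) : Concl x y := by
  choose ε m κ hε hκ hx using fun i => flip_one (x i) (a i) (ha i)
  choose δ m' κ' hδ hκ' hy using fun i => flip_one (y i) (b i) (hb i)
  have hc : ∀ (p : Fin 3 → G × ℕ), (∀ i, 0 < (p i).2) → (∏ i, fac (p i)).coeff 0 = 1 := by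
    intro p hp
    rw [Polynomial.coeff_zero_eq_eval_zero, Polynomial.eval_prod]
    refine Finset.prod_eq_one fun i _ => ?_
    simp [fac, (hp i).ne']
  have hPQ := poly_eq (∏ i, fac (((x i ^ ε i : Gˣ) : G), (a i).natAbs)) (∏ i, fac (((y i ^ δ i : Gˣ) : G), (b i).natAbs))
    (hc _ fun i => Int.natAbs_pos.mpr (ha i)) (hc _ fun i => Int.natAbs_pos.mpr (hb i)) (∑ i, m' i) (∑ i, m i) (∏ i, κ i) (∏ i, κ' i)
    (Finset.prod_ne_zero_iff.mpr fun i _ => hκ i) (Finset.prod_ne_zero_iff.mpr fun i _ => hκ' i) (fun T => by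
      rw [Polynomial.eval_prod, Polynomial.eval_prod, ← Finset.prod_mul_distrib, ← Finset.prod_mul_distrib]
      simp only [← hx, ← hy]
      rw [Finset.prod_mul_distrib, Finset.prod_mul_distrib, h T, Finset.prod_pow_eq_pow_sum, Finset.prod_pow_eq_pow_sum]
      ring)
  rcases same3 G _ _ (fun i => ⟨(x i ^ ε i).ne_zero, Int.natAbs_pos.mpr (ha i)⟩) (fun i => ⟨(y i ^ δ i).ne_zero, Int.natAbs_pos.mpr (hb i)⟩) hPQ
    with ⟨i, j, hij, hB⟩ | ⟨i, j, hij, hB⟩ | ⟨π, hπ⟩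
  · right
    rcases lt_or_gt_of_ne hij with h1 | h1
    · exact ⟨i, j, h1, Or.inl (Bad_conv (hε i) (hε j) hB)⟩
    · exact ⟨j, i, h1, Or.inl (Bad_conv (hε j) (hε i) (Bad_symm hB))⟩
  · right
    rcases lt_or_gt_of_ne hij with h1 | h1
    · exact ⟨i, j, h1, Or.inr (Bad_conv (hδ i) (hδ j) hB)⟩
    · exact ⟨j, i, h1, Or.inr (Bad_conv (hδ j) (hδ i) (Bad_symm hB))⟩
  · left
    refine ⟨fun i => ε i * δ (π.symm i), π, fun i => ?_, fun i => ?_⟩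
    · rcases hε i with h1 | h1 <;> rcases hδ (π.symm i) with h2 | h2 <;> simp [h1, h2]
    · have h1 : y i ^ δ i = x (π i) ^ ε (π i) := Units.ext (congrArg Prod.fst (hπ i))
      show y i = x (π i) ^ (ε (π i) * δ (π.symm (π i)))
      rw [Equiv.symm_apply_apply, zpow_mul, ← h1, ← zpow_mul]
      rcases hδ i with h2 | h2 <;> simp [h2]
end UE

set_option linter.all false
namespace UE
open Finset Filter

theorem expand3 {G : Type*} [Field G] (z : Fin 3 → G) :
    ∏ i, (z i - 1) = ∑ I : Finset (Fin 3), (-1 : G) ^ (univ \ I).card * ∏ i ∈ I, z i := by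
  simp only [sub_eq_add_neg]
  rw [Finset.prod_add, Finset.powerset_univ]
  refine Finset.sum_congr rfl fun I _ => ?_
  rw [Finset.prod_const, mul_comm]

/-- a sequence of solutions leaving every finite set satisfies the conclusion infinitely often -/
theorem seq_concl {G : Type*} [Field G] [CharZero G] (Γ : Subgroup Gˣ) (hΓ : Γ.FG) (x y : ℕ → Fin 3 → Γ)
    (hx : ∀ γ i, ∀ᶠ s in atTop, x s i ≠ γ) (hy : ∀ γ i, ∀ᶠ s in atTop, y s i ≠ γ)
    (heq : ∀ s, ∏ i, (((x s i : Gˣ) : G) - 1) = ∏ i, (((y s i : Gˣ) : G) - 1)) :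
    ∃ s, Concl (fun i => (x s i : Gˣ)) (fun i => (y s i : Gˣ)) := by
  classical
  haveI : Group.FG Γ := (Group.fg_iff_subgroup_fg Γ).mpr hΓ
  haveI : Module.Finite ℤ (Additive Γ) := Module.Finite.iff_addGroup_fg.mpr inferInstance
  obtain ⟨φ, hφ, hr⟩ := bc Γ hΓ (ι := Finset (Fin 3) ⊕ Finset (Fin 3))
    (Sum.elim (fun I => (-1 : G) ^ (univ \ I).card) (fun I => - (-1 : G) ^ (univ \ I).card))
    (fun s => Sum.elim (fun I => ∏ i ∈ I, x s i) (fun I => ∏ i ∈ I, y s i)) (fun s => by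
      have h := heq s
      rw [expand3, expand3] at h
      rw [Fintype.sum_sum_type]
      simp only [Sum.elim_inl, Sum.elim_inr, Subgroup.val_finset_prod, Units.coe_prod, neg_mul, Finset.sum_neg_distrib]
      rw [h, add_neg_cancel])
  have key : ∀ s s' (χ : Γ →* Gˣ), ∏ i, (((x (φ s) i * χ (x (φ s') i / x (φ s) i) : Gˣ) : G) - 1)
      = ∏ i, (((y (φ s) i * χ (y (φ s') i / y (φ s) i) : Gˣ) : G) - 1) := by
    intro s s' χ
    have h := hr s s' (fun γ => (χ γ : G))
    rw [Fintype.sum_sum_type] at h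
    simp only [Sum.elim_inl, Sum.elim_inr, neg_mul, Finset.sum_neg_distrib, ← Finset.prod_div_distrib, map_prod, Subgroup.val_finset_prod,
      Units.coe_prod, ← Finset.prod_mul_distrib] at h
    rw [expand3, expand3]
    simp only [Units.val_mul]
    exact eq_of_sub_eq_zero (by rw [sub_eq_add_neg]; exact h)
  have htf : Finite (Submodule.torsion ℤ (Additive Γ)) := by
    haveI : Module.Finite ℤ (Submodule.torsion ℤ (Additive Γ)) := Module.Finite.of_fg (IsNoetherian.noetherian _)
    exact Module.finite_of_fg_torsion _ (Submodule.torsion_isTorsion)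
  have hev : ∀ (z : ℕ → Fin 3 → Γ), (∀ γ i, ∀ᶠ s in atTop, z s i ≠ γ) → ∀ i, ∀ᶠ s in atTop,
      Additive.ofMul (z (φ s) i / z (φ 0) i) ∉ Submodule.torsion ℤ (Additive Γ) := by
    intro z hz i
    have h1 : ∀ᶠ s in atTop, ∀ t : Submodule.torsion ℤ (Additive Γ), z (φ s) i ≠ Additive.toMul (t : Additive Γ) * z (φ 0) i :=
      Filter.eventually_all.mpr fun t => hφ.tendsto_atTop.eventually (hz _ i)
    refine h1.mono fun s hs hm => hs ⟨_, hm⟩ ?_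
    simp
  obtain ⟨s', h1, h2⟩ := ((Filter.eventually_all.mpr (hev x hx)).and (Filter.eventually_all.mpr (hev y hy))).exists
  obtain ⟨ψ, hψ⟩ := exists_functional (Sum.elim (fun i : Fin 3 => Additive.ofMul (x (φ s') i / x (φ 0) i))
    (fun i : Fin 3 => Additive.ofMul (y (φ s') i / y (φ 0) i))) (by
      rintro (i | i)
      · exact h1 i
      · exact h2 i)
  refine ⟨φ 0, concl_of _ _ (fun i => ψ (Additive.ofMul (x (φ s') i / x (φ 0) i))) (fun i => ψ (Additive.ofMul (y (φ s') i / y (φ 0) i)))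
    (fun i => hψ (Sum.inl i)) (fun i => hψ (Sum.inr i)) fun T => ?_⟩
  let χ : Γ →* Gˣ :=
    { toFun := fun γ => T ^ ψ (Additive.ofMul γ)
      map_one' := by simp
      map_mul' := fun a b => by rw [ofMul_mul, map_add, zpow_add] }
  exact key 0 s' χ
end UE

theorem unit_equation_products_of_three
    (G : Type*) [Field G] [CharZero G] (Γ : Subgroup Gˣ) (hΓ : Γ.FG) :
    ∃ S : Finset Gˣ, ↑S ⊆ (Γ : Set Gˣ) ∧ 1 ∈ S ∧
      ∀ x y : Fin 3 → Gˣ, (∀ i, x i ∈ Γ) → (∀ i, y i ∈ Γ) →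
        (∏ i, ((x i : G) - 1)) = (∏ i, ((y i : G) - 1)) →
        ((∃ i, x i ∈ S) ∨ (∃ i, y i ∈ S)) ∨
        (∃ (η : Fin 3 → ℤ) (π : Equiv.Perm (Fin 3)),
          (∀ i, η i = 1 ∨ η i = -1) ∧ ∀ i, y i = x (π i) ^ η (π i)) ∨
        (∃ i j : Fin 3, i < j ∧
          (((x i * x j : Gˣ) : G) = -1 ∨ IsPrimitiveRoot ((x i * x j : Gˣ) : G) 3 ∨
           ((x i / x j : Gˣ) : G) = -1 ∨ IsPrimitiveRoot ((x i / x j : Gˣ) : G) 3 ∨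
           ((y i * y j : Gˣ) : G) = -1 ∨ IsPrimitiveRoot ((y i * y j : Gˣ) : G) 3 ∨
           ((y i / y j : Gˣ) : G) = -1 ∨ IsPrimitiveRoot ((y i / y j : Gˣ) : G) 3)) := by
  classical
  by_contra hno
  have hC : ∀ S : Finset Gˣ, ↑S ⊆ (Γ : Set Gˣ) → 1 ∈ S → ∃ x y : Fin 3 → Γ,
      (∏ i, (((x i : Gˣ) : G) - 1)) = (∏ i, (((y i : Gˣ) : G) - 1)) ∧ (∀ i, (x i : Gˣ) ∉ S) ∧ (∀ i, (y i : Gˣ) ∉ S) ∧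
      ¬ UE.Concl (fun i => (x i : Gˣ)) (fun i => (y i : Gˣ)) := by
    intro S hS h1
    by_contra hn
    refine hno ⟨S, hS, h1, fun x y hx hy hxy => ?_⟩
    by_contra hbad
    refine hn ⟨fun i => ⟨x i, hx i⟩, fun i => ⟨y i, hy i⟩, hxy, fun i h => hbad (Or.inl (Or.inl ⟨i, h⟩)),
      fun i h => hbad (Or.inl (Or.inr ⟨i, h⟩)), fun hc => hbad (Or.inr ?_)⟩
    rcases hc with hc | ⟨i, j, hij, hc⟩
    · exact Or.inl hc
    · refine Or.inr ⟨i, j, hij, ?_⟩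
      simp only [UE.Rt] at hc
      tauto
  haveI : Group.FG Γ := (Group.fg_iff_subgroup_fg Γ).mpr hΓ
  haveI : Module.Finite ℤ (Additive Γ) := Module.Finite.iff_addGroup_fg.mpr inferInstance
  haveI : Countable Γ := by
    obtain ⟨n, f, hf⟩ := Module.Finite.exists_fin' ℤ (Additive Γ)
    exact (hf.countable : Countable (Additive Γ))
  obtain ⟨e, he⟩ := exists_surjective_nat Γ
  choose x y hxy hx hy hcon using fun s : ℕ => hC (insert 1 ((Finset.range s).image fun k => (e k : Gˣ))) (by
    intro g hg
    rcases Finset.mem_insert.mp (Finset.mem_coe.mp hg) with rfl | hg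
    · exact Γ.one_mem
    · obtain ⟨k, -, rfl⟩ := Finset.mem_image.mp hg
      exact (e k).2) (Finset.mem_insert_self _ _)
  have hmem : ∀ k s, k < s → (e k : Gˣ) ∈ insert (1 : Gˣ) ((Finset.range s).image fun k => (e k : Gˣ)) := fun k s h =>
    Finset.mem_insert_of_mem (Finset.mem_image_of_mem _ (Finset.mem_range.mpr h))
  obtain ⟨s, hs⟩ := UE.seq_concl Γ hΓ x y
    (fun γ i => by
      obtain ⟨k, rfl⟩ := he γ
      filter_upwards [Filter.eventually_gt_atTop k] with s hs h
      exact hx s i (h ▸ hmem k s hs))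
    (fun γ i => by
      obtain ⟨k, rfl⟩ := he γ
      filter_upwards [Filter.eventually_gt_atTop k] with s hs h
      exact hy s i (h ▸ hmem k s hs)) hxy
  exact hcon s hs
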